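/- For every simple (non-weak) pseudoline arrangement of n pseudolines in ℝ² there exist a numbering L₁, …, Lₙ of its pseudolines, a homeomorphism h : ℝ² → ℝ², and sets C₁, …, Cₙ with h(Lᵢ) = Cᵢ for every i, where each Cᵢ is an unbounded simple polygonal curve (a finite union of line segments and two closed rays) contained in the boundary of some closed convex subset of ℝ² with nonempty interior, such that Cᵢ has exactly i − 1 bend points for every i; in particular, the total number of bend points over all the chains equals n(n − 1)/2, the number of crossings of the arrangement. -/

import Mathlib

open Set

/-- The Euclidean plane. -/
abbrev Plane := EuclideanSpace ℝ (Fin 2)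

/-- A straight line in the plane. -/
def IsLine (S : Set Plane) : Prop :=
  ∃ a u : Plane, u ≠ 0 ∧ S = {p | ∃ t : ℝ, p = a + t • u}

/-- A pseudoline: image of a straight line under a self-homeomorphism of the plane. -/
def IsPseudoline (L : Set Plane) : Prop :=
  ∃ (h : Plane ≃ₜ Plane) (ℓ : Set Plane), IsLine ℓ ∧ L = h '' ℓ

/-- Two curves cross at `p`: `p` lies on both, and each of them meets every
connected component of the complement of the other. -/
def CrossAt (L M : Set Plane) (p : Plane) : Prop :=
  p ∈ L ∩ M ∧
  (∀ x ∈ Mᶜ, (L ∩ connectedComponentIn Mᶜ x).Nonempty) ∧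
  (∀ x ∈ Lᶜ, (M ∩ connectedComponentIn Lᶜ x).Nonempty)

/-- A weak pseudoline arrangement: pairwise distinct pseudolines, any two of which
intersect in at most one point, and cross wherever they intersect. -/
def IsWeakArrangement {n : ℕ} (L : Fin n → Set Plane) : Prop :=
  Function.Injective L ∧
  (∀ i, IsPseudoline (L i)) ∧
  (∀ i j, i ≠ j → (L i ∩ L j).Subsingleton) ∧
  (∀ i j, i ≠ j → ∀ p ∈ L i ∩ L j, CrossAt (L i) (L j) p)

/-- A (non-weak) pseudoline arrangement: a weak arrangement in which any two
pseudolines intersect (in exactly one point, where they cross). -/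
def IsArrangement {n : ℕ} (L : Fin n → Set Plane) : Prop :=
  IsWeakArrangement L ∧ ∀ i j, i ≠ j → (L i ∩ L j).Nonempty

/-- Simplicity: no point lies on three distinct pseudolines of the family. -/
def IsSimple {n : ℕ} (L : Fin n → Set Plane) : Prop :=
  ∀ (p : Plane) (i j k : Fin n),
    p ∈ L i → p ∈ L j → p ∈ L k → i = j ∨ i = k ∨ j = k

/-- Outerplanarity: every intersection point of two pseudolines of the family lies
in the closure of some unbounded connected component of the complement of the union. -/
def IsOuterplanar {n : ℕ} (L : Fin n → Set Plane) : Prop :=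
  ∀ i j, i ≠ j → ∀ p ∈ L i ∩ L j,
    ∃ x ∈ (⋃ k, L k)ᶜ,
      ¬ Bornology.IsBounded (connectedComponentIn (⋃ k, L k)ᶜ x) ∧
      p ∈ closure (connectedComponentIn (⋃ k, L k)ᶜ x)

/-- A closed ray in the plane. -/
def IsRay (R : Set Plane) : Prop :=
  ∃ a u : Plane, u ≠ 0 ∧ R = {p | ∃ t : ℝ, 0 ≤ t ∧ p = a + t • u}

/-- A closed line segment in the plane. -/
def IsSegment (S : Set Plane) : Prop :=
  ∃ a b : Plane, S = segment ℝ a b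

/-- A convex curve: one contained in the boundary of a closed convex set with
nonempty interior. -/
def InConvexBoundary (C : Set Plane) : Prop :=
  ∃ K : Set Plane, IsClosed K ∧ Convex ℝ K ∧ (interior K).Nonempty ∧ C ⊆ frontier K

/-- A bend point of a set `C`: a point of `C` no neighborhood of which meets `C`
in a subset of a straight line. -/
def IsBendPoint (C : Set Plane) (p : Plane) : Prop :=
  p ∈ C ∧ ∀ U ∈ nhds p, ¬ ∃ ℓ : Set Plane, IsLine ℓ ∧ C ∩ U ⊆ ℓ

section P1
open Set Complex Metric Filter Topology

/-- continuous logarithm of (z-p)/(z-q) on X -/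
def HasLog (X : Set ℂ) (p q : ℂ) : Prop :=
  ∃ g : ℂ → ℂ, ContinuousOn g X ∧ ∀ z ∈ X, exp (g z) * (z - q) = z - p

lemma HasLog.refl (X : Set ℂ) (p : ℂ) : HasLog X p p :=
  ⟨fun _ => 0, continuousOn_const, by simp⟩

lemma HasLog.symm {X : Set ℂ} {p q : ℂ} (h : HasLog X p q) : HasLog X q p := by
  obtain ⟨g, hg, h⟩ := h
  refine ⟨fun z => - g z, hg.neg, fun z hz => ?_⟩
  rw [← h z hz, ← mul_assoc, ← Complex.exp_add]; simp

lemma HasLog.trans {X : Set ℂ} {p q r : ℂ} (h : HasLog X p q) (h' : HasLog X q r) :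
    HasLog X p r := by
  obtain ⟨g, hg, h⟩ := h
  obtain ⟨g', hg', h'⟩ := h'
  refine ⟨fun z => g z + g' z, hg.add hg', fun z hz => ?_⟩
  rw [← h z hz, ← h' z hz, Complex.exp_add, mul_assoc]

lemma HasLog.mono {X Y : Set ℂ} {p q : ℂ} (h : HasLog X p q) (hY : Y ⊆ X) : HasLog Y p q := by
  obtain ⟨g, hg, h⟩ := h
  exact ⟨g, hg.mono hY, fun z hz => h z (hY hz)⟩

lemma HasLog.of_near {X : Set ℂ} {p q : ℂ} (h : ∀ z ∈ X, ‖q - p‖ < ‖z - q‖) : HasLog X p q := by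
  have hne : ∀ z ∈ X, z - q ≠ 0 := fun z hz h0 => by
    have := h z hz; rw [h0, norm_zero] at this; exact absurd this (not_lt.2 (norm_nonneg _))
  have hs : ∀ z ∈ X, 1 + (q - p) / (z - q) ∈ slitPlane := fun z hz => by
    apply mem_slitPlane_of_norm_lt_one
    rw [norm_div, div_lt_one (norm_pos_iff.2 (hne z hz))]; exact h z hz
  refine ⟨fun z => log (1 + (q - p) / (z - q)), ?_, fun z hz => ?_⟩
  · refine ContinuousOn.clog ?_ hs
    exact continuousOn_const.add (continuousOn_const.div (by fun_prop) hne)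
  · rw [Complex.exp_log (slitPlane_ne_zero (hs z hz))]
    have := hne z hz
    field_simp
    ring

lemma hasLog_of_mem_component {X : Set ℂ} (hX : IsClosed X) {p q : ℂ}
    (hp : p ∈ Xᶜ) (hq : q ∈ connectedComponentIn Xᶜ p) : HasLog X p q := by
  refine (isPreconnected_connectedComponentIn (F := Xᶜ) (x := p)).induction₂ (HasLog X) ?_ ?_ ?_
    (mem_connectedComponentIn hp) hq
  · intro x hx
    have hx' : x ∈ Xᶜ := connectedComponentIn_subset _ _ hx
    obtain ⟨ε, hε, hb⟩ := Metric.isOpen_iff.1 hX.isOpen_compl x hx'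
    refine nhdsWithin_le_nhds ?_
    filter_upwards [ball_mem_nhds x (half_pos hε)] with y hy
    apply HasLog.of_near
    intro z hz
    have h1 : ε ≤ dist z x := by
      by_contra hcon
      exact hb (mem_ball.2 (not_le.1 hcon)) hz
    rw [mem_ball] at hy
    rw [← dist_eq_norm, ← dist_eq_norm]
    linarith [dist_triangle z y x]
  · intro x y z _ _ _ h h'; exact h.trans h'
  · intro x y _ _ h; exact h.symm

/-- components of an open set have frontier in the complement -/
lemma frontier_component_subset {X : Set ℂ} (hX : IsClosed X) (p : ℂ) :
    frontier (connectedComponentIn Xᶜ p) ⊆ X := by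
  intro z hz
  by_contra hzX
  have ho := (hX.isOpen_compl.connectedComponentIn (x := p))
  have ho' := (hX.isOpen_compl.connectedComponentIn (x := z))
  obtain ⟨w, hw, hw'⟩ := mem_closure_iff.1 hz.1 _ ho' (mem_connectedComponentIn hzX)
  have h1 := connectedComponentIn_eq hw
  have h2 := connectedComponentIn_eq hw'
  have : z ∈ connectedComponentIn Xᶜ p := by
    have h3 := mem_connectedComponentIn (x := z) (F := Xᶜ) hzX
    rwa [h1, ← h2] at h3
  rw [ho.frontier_eq] at hz
  exact hz.2 this

lemma isPreconnected_compl_closedBall_complex (R : ℝ) (hR : 0 < R) (c : ℂ) :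
    IsPreconnected (closedBall c R)ᶜ := by
  have : (closedBall c R)ᶜ = (fun w => c + exp w) '' {w : ℂ | Real.log R < w.re} := by
    ext z
    simp only [mem_compl_iff, mem_closedBall, not_le, mem_image, mem_ofPred_eq]
    constructor
    · intro h
      have h0 : z - c ≠ 0 := by
        rw [dist_eq_norm] at h; exact norm_pos_iff.1 (hR.trans h)
      refine ⟨log (z - c), ?_, by rw [exp_log h0]; ring⟩
      rw [log_re]; exact Real.log_lt_log hR (by rwa [dist_eq_norm] at h)
    · rintro ⟨w, hw, rfl⟩
      rw [dist_eq_norm, add_sub_cancel_left, norm_exp]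
      rwa [← Real.log_lt_iff_lt_exp hR]
  rw [this]
  refine IsPreconnected.image ?_ _ (by fun_prop)
  exact (convex_halfSpace_re_gt _).isPreconnected

/-- two points with unbounded components in the complement of a bounded set share the component -/
lemma component_eq_of_unbounded {X : Set ℂ} (hX : Bornology.IsBounded X) {p q : ℂ}
    (hp : ¬ Bornology.IsBounded (connectedComponentIn Xᶜ p))
    (hq : ¬ Bornology.IsBounded (connectedComponentIn Xᶜ q)) :
    connectedComponentIn Xᶜ p = connectedComponentIn Xᶜ q := by
  obtain ⟨R, hR⟩ := hX.subset_closedBall 0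
  have hR' : X ⊆ closedBall 0 (max R 1) := hR.trans (closedBall_subset_closedBall (le_max_left _ _))
  have key : ∀ p, ¬ Bornology.IsBounded (connectedComponentIn Xᶜ p) →
      (closedBall (0:ℂ) (max R 1))ᶜ ⊆ connectedComponentIn Xᶜ p := by
    intro p hp
    have : ∃ w ∈ connectedComponentIn Xᶜ p, w ∉ closedBall (0:ℂ) (max R 1) := by
      by_contra hcon
      push Not at hcon
      exact hp (isBounded_closedBall.subset hcon)
    obtain ⟨w, hw, hw'⟩ := this
    rw [connectedComponentIn_eq hw]
    exact (isPreconnected_compl_closedBall_complex _ (by positivity) 0).subset_connectedComponentIn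
      hw' (compl_subset_compl.2 hR')
  have hw : ∃ w : ℂ, w ∈ (closedBall (0:ℂ) (max R 1))ᶜ := by
    refine ⟨((max R 1 + 1 : ℝ) : ℂ), ?_⟩
    have h0 : (0:ℝ) ≤ max R 1 + 1 := by positivity
    simp only [mem_compl_iff, mem_closedBall, dist_zero_right, Complex.norm_real, Real.norm_eq_abs,
      abs_of_nonneg h0]
    linarith
  obtain ⟨w, hw⟩ := hw
  rw [connectedComponentIn_eq (key p hp hw), connectedComponentIn_eq (key q hq hw)]

/-- continuous function with exp = 1 on preconnected set is constant -/
lemma const_of_exp_eq_one {T : Type*} [TopologicalSpace T] {s : Set T} (hs : IsPreconnected s)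
    {k : T → ℂ} (hk : ContinuousOn k s) (h1 : ∀ t ∈ s, exp (k t) = 1) {a b : T} (ha : a ∈ s)
    (hb : b ∈ s) : k a = k b := by
  have hre : ∀ t ∈ s, ∃ n : ℤ, k t = n * (2 * Real.pi * I) := fun t ht => exp_eq_one_iff.1 (h1 t ht)
  let f : T → ℝ := fun t => (k t).im / (2 * Real.pi)
  have hf : ContinuousOn f s := (Complex.continuous_im.comp_continuousOn hk).div_const _
  have hpi := Real.pi_pos
  have hfn : ∀ t ∈ s, ∀ n : ℤ, k t = n * (2 * Real.pi * I) → f t = n := by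
    intro t _ n hn
    simp only [f, hn]
    simp
  obtain ⟨n, hn⟩ := hre a ha
  obtain ⟨m, hm⟩ := hre b hb
  have hnm : n = m := by
    have hord := (hs.image f hf).ordConnected
    by_contra hne
    have main : ∀ n m : ℤ, n < m → (n:ℝ) ∈ f '' s → (m:ℝ) ∈ f '' s → False := by
      intro n m hlt hn hm
      have hle : (n:ℝ) + 1 ≤ m := by exact_mod_cast hlt
      have : (n:ℝ) + 1/2 ∈ f '' s := hord.out hn hm ⟨by linarith, by linarith⟩
      obtain ⟨t, ht, hft⟩ := this
      obtain ⟨l, hl⟩ := hre t ht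
      rw [hfn t ht l hl] at hft
      have h2 : (2 * l : ℝ) = 2 * n + 1 := by linarith
      have h3 : 2 * l = 2 * n + 1 := by exact_mod_cast h2
      omega
    have h1 : (n:ℝ) ∈ f '' s := ⟨a, ha, hfn a ha n hn⟩
    have h2 : (m:ℝ) ∈ f '' s := ⟨b, hb, hfn b hb m hm⟩
    rcases lt_or_gt_of_ne hne with h | h
    · exact main n m h h1 h2
    · exact main m n h h2 h1
  rw [hn, hm, hnm]

lemma no_log_circle (p : ℂ) (R : ℝ) (hR : 0 < R) (l : ℂ → ℂ) (hl : ContinuousOn l (sphere p R))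
    (h : ∀ z ∈ sphere p R, exp (l z) = z - p) : False := by
  have hmem : ∀ θ : ℝ, p + R * exp (θ * I) ∈ sphere p R := by
    intro θ
    simp [dist_eq_norm, Complex.norm_exp_ofReal_mul_I, abs_of_pos hR]
  let k : ℝ → ℂ := fun θ => l (p + R * exp (θ * I)) - θ * I - Real.log R
  have hk : Continuous k := by
    have : Continuous fun θ : ℝ => l (p + R * exp (θ * I)) :=
      hl.comp_continuous (by fun_prop) hmem
    exact (this.sub (by fun_prop)).sub continuous_const
  have h1 : ∀ θ ∈ (univ : Set ℝ), exp (k θ) = 1 := by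
    intro θ _
    simp only [k]
    rw [Complex.exp_sub, Complex.exp_sub, h _ (hmem θ), ← Complex.ofReal_exp, Real.exp_log hR]
    have := Complex.exp_ne_zero (θ * I)
    have h2 : (R:ℂ) ≠ 0 := by exact_mod_cast hR.ne'
    field_simp
    ring
  have := const_of_exp_eq_one isPreconnected_univ hk.continuousOn h1 (mem_univ 0)
    (mem_univ (2 * Real.pi))
  simp only [k] at this
  have e1 : exp (((2 * Real.pi : ℝ) : ℂ) * I) = 1 := by
    push_cast; exact Complex.exp_two_pi_mul_I
  rw [e1] at this
  have h3 := Real.pi_pos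
  have := congrArg Complex.im this
  simp at this
  linarith

lemma isSimplyConnected_univ_complex : IsSimplyConnected (univ : Set ℂ) := by
  have : ContractibleSpace (univ : Set ℂ) :=
    (Homeomorph.Set.univ ℂ).contractibleSpace
  exact SimplyConnectedSpace.ofContractible _

/-- Eilenberg, the converse direction. -/
lemma mem_component_of_hasLog_aux {X : Set ℂ} (hX : IsCompact X) {p q : ℂ} (hp : p ∈ Xᶜ)
    (hq : q ∈ Xᶜ) (hl : HasLog X p q) (hb : Bornology.IsBounded (connectedComponentIn Xᶜ p)) :
    q ∈ connectedComponentIn Xᶜ p := by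
  by_contra hqn
  classical
  obtain ⟨g, hg, hgX⟩ := hl
  set U := connectedComponentIn Xᶜ p with hU
  have hUo : IsOpen U := hX.isClosed.isOpen_compl.connectedComponentIn
  have hfr : frontier U ⊆ X := frontier_component_subset hX.isClosed p
  obtain ⟨G, hG⟩ := ContinuousMap.exists_restrict_eq hX.isClosed
    (⟨X.domRestrict g, continuousOn_iff_continuous_domRestrict.1 hg⟩ : C(X, ℂ))
  have hGX : ∀ z ∈ X, G z = g z := fun z hz => by
    have := DFunLike.congr_fun hG ⟨z, hz⟩
    exact this
  let H : ℂ → ℂ := fun z => if z ∈ U then exp (G z) * (z - q) else z - p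
  have hHc : Continuous H := by
    refine Continuous.if ?_ (by fun_prop) (by fun_prop)
    intro z hz
    have hz' : z ∈ X := hfr hz
    rw [hGX z hz', hgX z hz']
  have hH0 : ∀ z, H z ≠ 0 := by
    intro z
    simp only [H]
    split_ifs with hz
    · refine mul_ne_zero (exp_ne_zero _) (sub_ne_zero.2 ?_)
      rintro rfl; exact hqn hz
    · refine sub_ne_zero.2 ?_
      rintro rfl; exact hz (mem_connectedComponentIn hp)
  obtain ⟨l, hlc, hle⟩ := exists_continuousOn_eqOn_exp_comp isSimplyConnected_univ_complex
    isOpen_univ hHc.continuousOn (by rintro ⟨z, _, hz⟩; exact hH0 z hz)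
  obtain ⟨R, hR⟩ := hb.subset_ball p
  have hRp : 0 < R := by
    have := hR (mem_connectedComponentIn hp)
    exact pos_of_mem_ball this
  refine no_log_circle p R hRp l (hlc.mono (subset_univ _)) ?_
  intro z hz
  have := hle (mem_univ z)
  simp only [Function.comp] at this
  rw [this]
  simp only [H]
  rw [if_neg]
  intro hzU
  have := hR hzU
  rw [mem_ball] at this
  rw [mem_sphere] at hz
  linarith

lemma mem_component_of_hasLog {X : Set ℂ} (hX : IsCompact X) {p q : ℂ} (hp : p ∈ Xᶜ)
    (hq : q ∈ Xᶜ) (hl : HasLog X p q) : q ∈ connectedComponentIn Xᶜ p := by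
  by_cases hb : Bornology.IsBounded (connectedComponentIn Xᶜ p)
  · exact mem_component_of_hasLog_aux hX hp hq hl hb
  by_cases hb' : Bornology.IsBounded (connectedComponentIn Xᶜ q)
  · have := mem_component_of_hasLog_aux hX hq hp hl.symm hb'
    rw [← connectedComponentIn_eq this]
    exact mem_connectedComponentIn hq
  · rw [component_eq_of_unbounded hX.isBounded hb hb']
    exact mem_connectedComponentIn hq

lemma HasLog.union {X Y : Set ℂ} (hX : IsClosed X) (hY : IsClosed Y)
    (hXY : IsPreconnected (X ∩ Y)) {p q : ℂ} (hq : q ∉ X) (h1 : HasLog X p q)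
    (h2 : HasLog Y p q) : HasLog (X ∪ Y) p q := by
  classical
  obtain ⟨g, hg, hgX⟩ := h1
  obtain ⟨g', hg', hgY⟩ := h2
  have hk : ∀ z ∈ X ∩ Y, exp (g z - g' z) = 1 := by
    intro z hz
    have h0 : z - q ≠ 0 := sub_ne_zero.2 (by rintro rfl; exact hq hz.1)
    rw [Complex.exp_sub, div_eq_one_iff_eq (exp_ne_zero _)]
    exact mul_right_cancel₀ h0 ((hgX z hz.1).trans (hgY z hz.2).symm)
  obtain ⟨c, hc1, hc⟩ : ∃ c, exp c = 1 ∧ ∀ z ∈ X ∩ Y, g z = g' z + c := by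
    rcases (X ∩ Y).eq_empty_or_nonempty with he | ⟨a, ha⟩
    · exact ⟨0, exp_zero, by simp [he]⟩
    · refine ⟨g a - g' a, hk a ha, fun z hz => ?_⟩
      have := const_of_exp_eq_one hXY ((hg.mono inter_subset_left).sub (hg'.mono inter_subset_right))
        hk hz ha
      simp only [Pi.sub_apply] at this
      rw [← this]; ring
  let f : ℂ → ℂ := fun z => if z ∈ X then g z else g' z + c
  have hfX : EqOn f g X := fun z hz => by simp [f, hz]
  have hfY : EqOn f (fun z => g' z + c) Y := fun z hz => by
    simp only [f]; split_ifs with h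
    · exact hc z ⟨h, hz⟩
    · rfl
  refine ⟨f, ContinuousOn.union_of_isClosed (hg.congr hfX)
    ((hg'.add continuousOn_const).congr hfY) hX hY, ?_⟩
  rintro z (hz | hz)
  · rw [hfX hz, hgX z hz]
  · rw [hfY hz]; simp only []; rw [Complex.exp_add, hc1, mul_one, hgY z hz]

/-- Janiszewski's theorem. -/
theorem janiszewski {X Y : Set ℂ} (hX : IsCompact X) (hY : IsCompact Y)
    (hXY : IsPreconnected (X ∩ Y)) {p q : ℂ} (hp : p ∉ X) (hp' : p ∉ Y)
    (h1 : q ∈ connectedComponentIn Xᶜ p) (h2 : q ∈ connectedComponentIn Yᶜ p) :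
    q ∈ connectedComponentIn (X ∪ Y)ᶜ p := by
  have hqX : q ∉ X := connectedComponentIn_subset _ _ h1
  have hqY : q ∉ Y := connectedComponentIn_subset _ _ h2
  refine mem_component_of_hasLog (hX.union hY) ?_ ?_ ?_
  · simp [hp, hp']
  · simp [hqX, hqY]
  · exact HasLog.union hX.isClosed hY.isClosed hXY hqX
      (hasLog_of_mem_component hX.isClosed hp h1) (hasLog_of_mem_component hY.isClosed hp' h2)

lemma continuousOn_invFunOn_of_compact {A B : Type*} [TopologicalSpace A] [TopologicalSpace B]
    [T2Space B] [Nonempty A] {K : Set A} (hK : IsCompact K) {f : A → B} (hc : ContinuousOn f K)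
    (hi : InjOn f K) : ContinuousOn (Function.invFunOn f K) (f '' K) := by
  rw [continuousOn_iff_isClosed]
  intro t ht
  refine ⟨f '' (K ∩ t), ((hK.inter_right ht).image_of_continuousOn
    (hc.mono inter_subset_left)).isClosed, ?_⟩
  ext z
  constructor
  · rintro ⟨h1, h2⟩
    refine ⟨⟨_, ⟨Function.invFunOn_mem h2, h1⟩, Function.invFunOn_eq h2⟩, h2⟩
  · rintro ⟨⟨x, ⟨hx, hxt⟩, rfl⟩, h2⟩
    refine ⟨?_, h2⟩
    have : Function.invFunOn f K (f x) = x :=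
      hi (Function.invFunOn_mem h2) hx (Function.invFunOn_eq h2)
    rw [mem_preimage, this]; exact hxt

/-- An arc does not separate the plane. -/
theorem arc_not_separate {α : ℝ → ℂ} {a b : ℝ} (hab : a ≤ b) (hc : ContinuousOn α (Icc a b))
    (hi : InjOn α (Icc a b)) {p q : ℂ} (hp : p ∉ α '' Icc a b) (hq : q ∉ α '' Icc a b) :
    q ∈ connectedComponentIn (α '' Icc a b)ᶜ p := by
  refine mem_component_of_hasLog (isCompact_Icc.image_of_continuousOn hc) hp hq ?_
  -- pull back
  let β : ℝ → ℂ := fun t => α (projIcc a b hab t)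
  have hβ : Continuous β := by
    exact hc.comp_continuous (continuous_subtype_val.comp continuous_projIcc) (fun t => (projIcc a b hab t).2)
  have hmem : ∀ t, β t ∈ α '' Icc a b := fun t => mem_image_of_mem _ (projIcc a b hab t).2
  have hp0 : ∀ t, β t - p ≠ 0 := fun t => sub_ne_zero.2 (fun h => hp (h ▸ hmem t))
  have hq0 : ∀ t, β t - q ≠ 0 := fun t => sub_ne_zero.2 (fun h => hq (h ▸ hmem t))
  have hsc : IsSimplyConnected (univ : Set ℝ) := by
    have : ContractibleSpace (univ : Set ℝ) := (Homeomorph.Set.univ ℝ).contractibleSpace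
    exact SimplyConnectedSpace.ofContractible _
  obtain ⟨l, hlc, hle⟩ := exists_continuousOn_eqOn_exp_comp hsc isOpen_univ
    (g := fun t => (β t - p) / (β t - q))
    ((Continuous.div (by fun_prop) (by fun_prop) hq0).continuousOn)
    (by rintro ⟨z, _, hz⟩; exact (div_ne_zero (hp0 z) (hq0 z)) hz)
  rw [continuousOn_univ] at hlc
  -- inverse continuous on the compact image
  have hinv := continuousOn_invFunOn_of_compact isCompact_Icc hc hi
  refine ⟨fun z => l (Function.invFunOn α (Icc a b) z), hlc.comp_continuousOn hinv, ?_⟩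
  intro z hz
  have h1 : Function.invFunOn α (Icc a b) z ∈ Icc a b := Function.invFunOn_mem hz
  have h2 : α (Function.invFunOn α (Icc a b) z) = z := Function.invFunOn_eq hz
  have h3 := hle (mem_univ (Function.invFunOn α (Icc a b) z))
  simp only [Function.comp, β, projIcc_of_mem hab h1, h2] at h3
  rw [h3, div_mul_cancel₀]
  exact sub_ne_zero.2 (fun h => hq (h ▸ hz))

end P1

section P2
open Set Complex Metric Filter Topology MeasureTheory
open scoped ENNReal

lemma det_restrict_smulRight (c : ℂ) :
    ((ContinuousLinearMap.toSpanSingleton ℂ c).restrictScalars ℝ : ℂ →L[ℝ] ℂ).det = ‖c‖ ^ 2 := by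
  have h : (((ContinuousLinearMap.toSpanSingleton ℂ c).restrictScalars ℝ : ℂ →L[ℝ] ℂ) :
      ℂ →ₗ[ℝ] ℂ) = Algebra.lmul ℝ ℂ c := by
    ext z
    all_goals simp [mul_comm]
  rw [ContinuousLinearMap.det, h, ← Algebra.norm_apply, Algebra.norm_complex_apply, normSq_eq_norm_sq]

lemma lintegral_inv_top (c R : ℝ) (hc : 0 < c) (hR : 0 < R) :
    ∫⁻ r in Ioo 0 R, ENNReal.ofReal (c / r) = ⊤ := by
  by_contra hne
  have hI : IntegrableOn (fun r => c / r) (Ioo 0 R) := by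
    refine ⟨by fun_prop, ?_⟩
    rw [hasFiniteIntegral_iff_ofReal]
    · exact lt_top_iff_ne_top.2 hne
    · filter_upwards [ae_restrict_mem measurableSet_Ioo] with r hr
      exact div_nonneg hc.le hr.1.le
  have h2 : IntegrableOn (fun r : ℝ => r⁻¹) (Ioo 0 R) := by
    have : IntegrableOn (fun r => c⁻¹ * (c / r)) (Ioo 0 R) := hI.const_mul c⁻¹
    refine this.congr_fun (fun r hr => ?_) measurableSet_Ioo
    have := hr.1.ne'
    field_simp
  have h3 : IntervalIntegrable (fun r : ℝ => r⁻¹) volume 0 R := by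
    rw [intervalIntegrable_iff_integrableOn_Ioo_of_le hR.le]; exact h2
  rw [intervalIntegrable_inv_iff] at h3
  rcases h3 with h3 | h3
  · exact hR.ne h3
  · exact h3 (by simp [hR.le])

/-- The point of the circle. -/
noncomputable def cpt (p : ℂ) (r θ : ℝ) : ℂ := p + r * (Real.cos θ + Real.sin θ * I)

lemma exists_cpt (p z : ℂ) (r : ℝ) (hr : 0 < r) (hz : z ∈ sphere p r) :
    ∃ θ ∈ Ioc (-Real.pi) Real.pi, z = cpt p r θ := by
  refine ⟨arg (z - p), arg_mem_Ioc _, ?_⟩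
  have h := norm_mul_cos_add_sin_mul_I (z - p)
  rw [mem_sphere, dist_eq_norm] at hz
  rw [hz] at h
  rw [cpt]; push_cast; rw [h]; ring

lemma cpt_mem (p : ℂ) (r : ℝ) (hr : 0 ≤ r) (θ : ℝ) : cpt p r θ ∈ sphere p r := by
  have : (Real.cos θ + Real.sin θ * I : ℂ) = exp (θ * I) := by
    rw [Complex.exp_mul_I]; push_cast; rfl
  rw [cpt, this]
  simp [Complex.norm_exp_ofReal_mul_I, abs_of_nonneg hr]

lemma hasDerivAt_cpt (p : ℂ) (r θ : ℝ) :
    HasDerivAt (cpt p r) (r * (-Real.sin θ + Real.cos θ * I)) θ := by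
  have h1 : HasDerivAt (fun θ : ℝ => ((Real.cos θ : ℝ) : ℂ)) ((-Real.sin θ : ℝ) : ℂ) θ :=
    (Real.hasDerivAt_cos θ).ofReal_comp
  have h2 : HasDerivAt (fun θ : ℝ => ((Real.sin θ : ℝ) : ℂ)) ((Real.cos θ : ℝ) : ℂ) θ :=
    (Real.hasDerivAt_sin θ).ofReal_comp
  have := ((h1.add (h2.mul_const I)).const_mul (r : ℂ)).const_add p
  convert! this using 1
  push_cast; ring

lemma norm_cpt_deriv (r θ : ℝ) (hr : 0 ≤ r) :
    ‖(r * (-Real.sin θ + Real.cos θ * I) : ℂ)‖ = r := by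
  have : (-Real.sin θ + Real.cos θ * I : ℂ) = I * exp (θ * I) := by
    rw [Complex.exp_mul_I]; push_cast; ring_nf; rw [I_sq]; ring
  rw [this]
  simp [Complex.norm_exp_ofReal_mul_I, abs_of_nonneg hr]

lemma area_holo {F : ℂ → ℂ} {G : Set ℂ} (hG : IsOpen G) (hF : DifferentiableOn ℂ F G)
    (hi : InjOn F G) :
    ∫⁻ z in G, ENNReal.ofReal (‖deriv F z‖ ^ 2) = volume (F '' G) := by
  rw [← lintegral_abs_det_fderiv_eq_addHaar_image volume hG.measurableSet
    (f' := fun z => (ContinuousLinearMap.toSpanSingleton ℂ (deriv F z)).restrictScalars ℝ) ?_ hi]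
  · refine lintegral_congr fun z => ?_
    rw [det_restrict_smulRight, abs_of_nonneg (by positivity)]
  · intro z hz
    have := (hF.differentiableAt (hG.mem_nhds hz)).hasDerivAt.hasFDerivAt
    exact (this.restrictScalars ℝ).hasFDerivWithinAt

lemma length_aux {F : ℂ → ℂ} {G : Set ℂ} (hG : IsOpen G) (hF : DifferentiableOn ℂ F G)
    (hi : InjOn F G) (hfin : volume (F '' G) ≠ ⊤) (p : ℂ) {δ R : ℝ} (hδ : 0 < δ) (hR : 0 < R) :
    ∃ r ∈ Ioo 0 R, ∫⁻ θ in Ioo (-Real.pi) Real.pi,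
      ENNReal.ofReal r * G.indicator (fun z => ENNReal.ofReal ‖deriv F z‖) (cpt p r θ)
        ≤ ENNReal.ofReal δ := by
  by_contra hcon
  push Not at hcon
  have hpi := Real.pi_pos
  set H : ℂ → ℝ≥0∞ := G.indicator (fun z => ENNReal.ofReal (‖deriv F z‖ ^ 2)) with hH
  have hHm : Measurable H := by
    refine Measurable.indicator ?_ hG.measurableSet
    exact ENNReal.measurable_ofReal.comp ((measurable_deriv F).norm.pow_const 2)
  have hHint : ∫⁻ z, H z = volume (F '' G) := by
    rw [hH, lintegral_indicator hG.measurableSet, area_holo hG hF hi]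
  have hHint' : ∫⁻ z, H (p + z) = volume (F '' G) := by
    rw [← hHint, lintegral_add_left_eq_self H p]
  rw [← Complex.lintegral_comp_polarCoord_symm] at hHint'
  have hcp : ∀ q : ℝ × ℝ, p + Complex.polarCoord.symm q = cpt p q.1 q.2 := by
    intro q; rw [Complex.polarCoord_symm_apply, cpt]
  simp only [hcp] at hHint'
  have hcm : Measurable fun q : ℝ × ℝ => cpt p q.1 q.2 := by
    unfold cpt; fun_prop
  have htar : polarCoord.target = Ioi (0:ℝ) ×ˢ Ioo (-Real.pi) Real.pi := rfl
  rw [htar, Measure.volume_eq_prod, ← Measure.prod_restrict, lintegral_prod] at hHint'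
  swap
  · refine Measurable.aemeasurable ?_
    exact Measurable.mul (ENNReal.measurable_ofReal.comp measurable_fst) (hHm.comp hcm)
  have key : ∀ r ∈ Ioo 0 R, ENNReal.ofReal ((δ ^ 2 / (2 * Real.pi)) / r) ≤
      ∫⁻ θ in Ioo (-Real.pi) Real.pi, ENNReal.ofReal r • H (cpt p r θ) := by
    intro r hr
    have h1 := hcon r hr
    obtain ⟨A, hA⟩ : ∃ A, A = ∫⁻ θ in Ioo (-Real.pi) Real.pi, ENNReal.ofReal r • H (cpt p r θ) :=
      ⟨_, rfl⟩
    rw [← hA]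
    have hr0 := hr.1
    have hpt : ∀ θ, ENNReal.ofReal r * G.indicator (fun z => ENNReal.ofReal ‖deriv F z‖) (cpt p r θ)
        ≤ ENNReal.ofReal (δ / (4 * Real.pi)) +
          ENNReal.ofReal (r * Real.pi / δ) * (ENNReal.ofReal r • H (cpt p r θ)) := by
      intro θ
      by_cases hθ : cpt p r θ ∈ G
      · simp only [hH, indicator_of_mem hθ, smul_eq_mul]
        rw [← ENNReal.ofReal_mul hr0.le, ← ENNReal.ofReal_mul hr0.le,
          ← ENNReal.ofReal_mul (by positivity), ← ENNReal.ofReal_add (by positivity) (by positivity)]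
        refine ENNReal.ofReal_le_ofReal ?_
        set D := ‖deriv F (cpt p r θ)‖
        have : 0 ≤ (δ / (4 * Real.pi)) * (2 * Real.pi * r * D / δ - 1) ^ 2 := by positivity
        have e : (δ / (4 * Real.pi)) * (2 * Real.pi * r * D / δ - 1) ^ 2 =
          δ / (4 * Real.pi) + r * Real.pi / δ * (r * D ^ 2) - r * D := by
          field_simp; ring
        linarith
      · simp [hθ]
    have h2 : ENNReal.ofReal δ ≤ ENNReal.ofReal (δ / 2) + ENNReal.ofReal (r * Real.pi / δ) * A := by
      refine h1.le.trans ((lintegral_mono hpt).trans ?_)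
      rw [lintegral_add_left (by fun_prop)]
      gcongr
      · rw [lintegral_const]
        simp only [MeasurableSet.univ, Measure.restrict_apply, univ_inter, Real.volume_Ioo]
        rw [← ENNReal.ofReal_mul (by positivity)]
        refine ENNReal.ofReal_le_ofReal ?_
        field_simp; linarith
      · rw [hA, lintegral_const_mul]
        have hcm' : Measurable fun θ : ℝ => cpt p r θ := by unfold cpt; fun_prop
        exact Measurable.mul measurable_const (hHm.comp hcm')
    by_cases hAt : A = ⊤
    · rw [hAt]; exact le_top
    clear hA
    lift A to NNReal using hAt
    rw [← ENNReal.ofReal_coe_nnreal, ← ENNReal.ofReal_mul (by positivity),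
      ← ENNReal.ofReal_add (by positivity) (by positivity),
      ENNReal.ofReal_le_ofReal_iff (by positivity)] at h2
    rw [← ENNReal.ofReal_coe_nnreal]
    refine ENNReal.ofReal_le_ofReal ?_
    rw [div_div, div_le_iff₀ (by positivity)]
    have h3 : δ / 2 ≤ r * Real.pi / δ * A := by linarith
    rw [div_mul_eq_mul_div, le_div_iff₀ hδ] at h3
    nlinarith
  refine hfin (top_le_iff.1 ?_)
  rw [← hHint', ← lintegral_inv_top (δ ^ 2 / (2 * Real.pi)) R (by positivity) hR]
  refine (setLIntegral_mono' measurableSet_Ioo key).trans ?_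
  exact lintegral_mono_set Ioo_subset_Ioi_self

lemma volume_proj_le {F : ℂ → ℂ} {G : Set ℂ} (hG : IsOpen G) (hF : DifferentiableOn ℂ F G)
    (p : ℂ) {r : ℝ} (hr : 0 < r) (L : ℂ →L[ℝ] ℝ) (hL : ∀ z, |L z| ≤ ‖z‖) :
    volume (L '' (F '' (sphere p r ∩ G))) ≤ ∫⁻ θ in Ioo (-Real.pi) Real.pi,
      ENNReal.ofReal r * G.indicator (fun z => ENNReal.ofReal ‖deriv F z‖) (cpt p r θ) := by
  set s : Set ℝ := {θ | θ ∈ Ioo (-Real.pi) Real.pi ∧ cpt p r θ ∈ G} with hs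
  have hcc : Continuous (cpt p r) := by unfold cpt; fun_prop
  have hso : IsOpen s := isOpen_Ioo.inter (hG.preimage hcc)
  set g : ℝ → ℝ := fun θ => L (F (cpt p r θ)) with hg
  have hder : ∀ θ ∈ s, HasDerivAt g
      (L (deriv F (cpt p r θ) * (r * (-Real.sin θ + Real.cos θ * I)))) θ := by
    intro θ hθ
    have h1 := (hF.differentiableAt (hG.mem_nhds hθ.2)).hasDerivAt
    have h2 := h1.comp θ (hasDerivAt_cpt p r θ)
    exact L.hasFDerivAt.comp_hasDerivAt θ h2
  have hsub : L '' (F '' (sphere p r ∩ G)) ⊆ g '' s ∪ {g Real.pi} := by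
    rintro _ ⟨_, ⟨z, ⟨hz, hzG⟩, rfl⟩, rfl⟩
    obtain ⟨θ, hθ, rfl⟩ := exists_cpt p z r hr hz
    rcases hθ.2.lt_or_eq with h | h
    · exact Or.inl ⟨θ, ⟨⟨hθ.1, h⟩, hzG⟩, rfl⟩
    · right; rw [h]; rfl
  calc volume (L '' (F '' (sphere p r ∩ G))) ≤ volume (g '' s ∪ {g Real.pi}) := measure_mono hsub
    _ ≤ volume (g '' s) + volume {g Real.pi} := measure_union_le _ _
    _ = volume (g '' s) := by simp
    _ ≤ ∫⁻ θ in s, ENNReal.ofReal |(ContinuousLinearMap.toSpanSingleton ℝ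
        (L (deriv F (cpt p r θ) * (r * (-Real.sin θ + Real.cos θ * I)))) : ℝ →L[ℝ] ℝ).det| := by
        refine addHaar_image_le_lintegral_abs_det_fderiv volume hso.measurableSet ?_
        intro θ hθ
        exact (hder θ hθ).hasFDerivAt.hasFDerivWithinAt
    _ ≤ ∫⁻ θ in s, ENNReal.ofReal r * G.indicator (fun z => ENNReal.ofReal ‖deriv F z‖) (cpt p r θ) := by
        refine setLIntegral_mono' hso.measurableSet ?_
        intro θ hθ
        rw [indicator_of_mem hθ.2, ← ENNReal.ofReal_mul hr.le]
        refine ENNReal.ofReal_le_ofReal ?_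
        have hdet : ∀ c : ℝ, (ContinuousLinearMap.toSpanSingleton ℝ c : ℝ →L[ℝ] ℝ).det = c := by
          intro c; rw [ContinuousLinearMap.det, LinearMap.det_ring]; simp
        rw [hdet]
        refine (hL _).trans ?_
        rw [norm_mul, norm_cpt_deriv _ _ hr.le, mul_comm]
    _ ≤ _ := lintegral_mono_set (fun θ hθ => hθ.1)

/-- Length-area principle. -/
theorem length_area {F : ℂ → ℂ} {G : Set ℂ} (hG : IsOpen G) (hF : DifferentiableOn ℂ F G)
    (hi : InjOn F G) (hfin : Bornology.IsBounded (F '' G)) (p : ℂ) {δ R : ℝ} (hδ : 0 < δ)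
    (hR : 0 < R) : ∃ r ∈ Ioo 0 R,
      volume (re '' (F '' (sphere p r ∩ G))) ≤ ENNReal.ofReal δ ∧
      volume (im '' (F '' (sphere p r ∩ G))) ≤ ENNReal.ofReal δ := by
  obtain ⟨r, hr, h⟩ := length_aux hG hF hi hfin.measure_lt_top.ne p hδ hR
  exact ⟨r, hr, (volume_proj_le hG hF p hr.1 reCLM (fun z => abs_re_le_norm z)).trans h,
    (volume_proj_le hG hF p hr.1 imCLM (fun z => abs_im_le_norm z)).trans h⟩

lemma sub_le_of_volume {S : Set ℝ} (hS : IsPreconnected S) {δ : ℝ} (hδ : 0 ≤ δ)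
    (hv : volume S ≤ ENNReal.ofReal δ) {x y : ℝ} (hx : x ∈ S) (hy : y ∈ S) : |x - y| ≤ δ := by
  have main : ∀ x ∈ S, ∀ y ∈ S, y - x ≤ δ := by
    intro x hx y hy
    have h1 : Icc x y ⊆ S := hS.ordConnected.out hx hy
    have h2 := (measure_mono h1).trans hv
    rw [Real.volume_Icc, ENNReal.ofReal_le_ofReal_iff hδ] at h2
    exact h2
  rw [abs_le]
  constructor <;> linarith [main x hx y hy, main y hy x hx]

/-- connected piece of image of the circle has small diameter -/
lemma dist_le_of_volume {S C : Set ℂ} {δ : ℝ} (hδ : 0 ≤ δ)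
    (h1 : volume (re '' S) ≤ ENNReal.ofReal δ) (h2 : volume (im '' S) ≤ ENNReal.ofReal δ)
    (hC : IsPreconnected C) (hCS : C ⊆ S) {z w : ℂ} (hz : z ∈ C) (hw : w ∈ C) :
    dist z w ≤ 2 * δ := by
  have a1 := sub_le_of_volume (hC.image re continuous_re.continuousOn) hδ
    ((measure_mono (image_mono hCS)).trans h1) (mem_image_of_mem _ hz) (mem_image_of_mem _ hw)
  have a2 := sub_le_of_volume (hC.image im continuous_im.continuousOn) hδ
    ((measure_mono (image_mono hCS)).trans h2) (mem_image_of_mem _ hz) (mem_image_of_mem _ hw)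
  rw [dist_eq_norm]
  have := norm_le_abs_re_add_abs_im (z - w)
  simp only [sub_re, sub_im] at this
  linarith
end P2

section P3
open Set Complex Metric Filter Topology

/-- the family for the Riemann mapping theorem -/
structure RFam (W : Set ℂ) (w₀ : ℂ) (f : ℂ → ℂ) : Prop where
  diff : DifferentiableOn ℂ f W
  inj : InjOn f W
  maps : MapsTo f W (ball 0 1)
  zero : f w₀ = 0

lemma RFam.lip {W : Set ℂ} {w₀ : ℂ} {f : ℂ → ℂ} (hf : RFam W w₀ f) {z x : ℂ} {d : ℝ}
    (hd : ball z d ⊆ W) (hx : x ∈ ball z d) : dist (f x) (f z) ≤ 2 / d * dist x z := by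
  refine dist_le_div_mul_dist_of_mapsTo_ball (hf.diff.mono hd) ?_ hx
  intro y hy
  have hd0 : 0 < d := pos_of_mem_ball hx
  have h1 := hf.maps (hd hy)
  have h2 := hf.maps (hd (mem_ball_self hd0))
  rw [mem_ball] at *
  have := dist_triangle_right (f y) (f z) 0
  rw [mem_closedBall]
  linarith

lemma RFam.limit {W : Set ℂ} (hW : IsOpen W) {w₀ : ℂ} {f : ℕ → ℂ → ℂ}
    (hf : ∀ n, RFam W w₀ (f n)) (U : Ultrafilter ℕ) :
    ∃ g : ℂ → ℂ, TendstoLocallyUniformlyOn f g U W ∧ ∀ z ∈ W, ‖g z‖ ≤ 1 := by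
  have hlim : ∀ z : ℂ, ∃ y : ℂ, z ∈ W → y ∈ closedBall (0:ℂ) 1 ∧ Tendsto (fun n => f n z) U (𝓝 y) := by
    intro z
    by_cases hz : z ∈ W
    · have hc : IsCompact (closedBall (0:ℂ) 1) := isCompact_closedBall _ _
      obtain ⟨y, hy, hle⟩ := hc.ultrafilter_le_nhds (U.map (fun n => f n z)) (by
        rw [le_principal_iff, Ultrafilter.mem_coe, Ultrafilter.mem_map]
        exact Filter.univ_mem' (fun n => ball_subset_closedBall ((hf n).maps hz)))
      exact ⟨y, fun _ => ⟨hy, hle⟩⟩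
    · exact ⟨0, fun h => absurd h hz⟩
  choose g hg using hlim
  refine ⟨g, ?_, fun z hz => by simpa using (hg z hz).1⟩
  rw [Metric.tendstoLocallyUniformlyOn_iff]
  intro ε hε z hz
  obtain ⟨d, hd0, hd⟩ := Metric.isOpen_iff.1 hW z hz
  refine ⟨ball z (min d (ε * d / 8)), mem_nhdsWithin_of_mem_nhds (ball_mem_nhds _ (by positivity)), ?_⟩
  have hz' := (hg z hz).2
  filter_upwards [Metric.tendsto_nhds.1 hz' (ε / 4) (by positivity)] with n hn x hx
  rw [mem_ball, lt_min_iff] at hx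
  have hxd : x ∈ ball z d := hx.1
  have hb : 2 / d * dist x z ≤ ε / 4 := by
    rw [div_mul_eq_mul_div, div_le_iff₀ hd0]; linarith [hx.2]
  have h1 := ((hf n).lip hd hxd).trans hb
  have h2 : dist (g x) (g z) ≤ ε / 4 :=
    le_of_tendsto (((hg x (hd hxd)).2).dist hz') (Eventually.of_forall fun n => ((hf n).lip hd hxd).trans hb)
  have h3 := dist_triangle (g x) (g z) (f n x)
  have h4 := dist_triangle (g z) (f n z) (f n x)
  rw [dist_comm] at h1
  rw [dist_comm] at hn
  linarith

lemma hurwitz {W : Set ℂ} (hW : IsOpen W) (hc : IsPreconnected W) {f : ℕ → ℂ → ℂ} {g : ℂ → ℂ}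
    {U : Filter ℕ} [U.NeBot] (hf : ∀ n, DifferentiableOn ℂ (f n) W) (hi : ∀ n, InjOn (f n) W)
    (h : TendstoLocallyUniformlyOn f g U W) {w₀ : ℂ} (hw : w₀ ∈ W) (hd : deriv g w₀ ≠ 0) :
    InjOn g W := by
  intro a ha b hb hab
  by_contra hne
  have hg : DifferentiableOn ℂ g W := h.differentiableOn (Eventually.of_forall hf) hW
  have hga : AnalyticOnNhd ℂ (fun z => g z - g a) W :=
    (hg.analyticOnNhd hW).sub analyticOnNhd_const
  have hiso : ∀ᶠ z in 𝓝[≠] b, g z - g a ≠ 0 := by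
    rcases (hga b hb).eventually_eq_zero_or_eventually_ne_zero with h0 | h0
    · exfalso
      have := hga.eqOn_zero_of_preconnected_of_eventuallyEq_zero hc hb h0
      apply hd
      have he : g =ᶠ[𝓝 w₀] fun _ => g a := by
        filter_upwards [hW.mem_nhds hw] with z hz
        exact sub_eq_zero.1 (this hz)
      rw [he.deriv_eq]; simp
    · exact h0
  rw [eventually_nhdsWithin_iff] at hiso
  have hWa : ∀ᶠ z in 𝓝 b, z ∈ W ∧ z ≠ a := by
    have e1 : ∀ᶠ z in 𝓝 b, z ∈ W := hW.mem_nhds hb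
    have e2 : ∀ᶠ z in 𝓝 b, z ≠ a := isOpen_ne.mem_nhds (Ne.symm hne)
    exact e1.and e2
  obtain ⟨ρ, hρ, hball⟩ := Metric.eventually_nhds_iff_ball.1 (hiso.and hWa)
  have hcb : closedBall b (ρ/2) ⊆ ball b ρ := closedBall_subset_ball (by linarith)
  have hsph : IsCompact (sphere b (ρ/2)) := isCompact_sphere _ _
  have hsW : sphere b (ρ/2) ⊆ W := fun z hz => (hball z (hcb (sphere_subset_closedBall hz))).2.1
  have hne0 : (sphere b (ρ/2)).Nonempty := (NormedSpace.sphere_nonempty).2 (by positivity)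
  obtain ⟨z₀, hz₀, hmin⟩ := hsph.exists_isMinOn hne0
    (f := fun z => ‖g z - g a‖) ((hga.continuousOn.mono hsW).norm)
  set m := ‖g z₀ - g a‖ with hm
  have hm0 : 0 < m := by
    rw [hm, norm_pos_iff]
    refine (hball z₀ (hcb (sphere_subset_closedBall hz₀))).1 ?_
    rintro rfl
    simp at hz₀
    linarith
  have hK : IsCompact (closedBall b (ρ/2) ∪ {a}) := (isCompact_closedBall _ _).union isCompact_singleton
  have hKW : closedBall b (ρ/2) ∪ {a} ⊆ W := by
    rintro z (hz | rfl)
    · exact (hball z (hcb hz)).2.1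
    · exact ha
  have hun := (tendstoLocallyUniformlyOn_iff_forall_isCompact hW).1 h _ hKW hK
  rw [Metric.tendstoUniformlyOn_iff] at hun
  obtain ⟨n, hn⟩ := (hun (m/4) (by positivity)).exists
  have hna := hn a (Or.inr rfl)
  have hest : ∀ z ∈ closedBall b (ρ/2), ‖(g z - g a) - (f n z - f n a)‖ < m / 2 := by
    intro z hz
    have h1 := hn z (Or.inl hz)
    rw [dist_eq_norm] at h1 hna
    have : (g z - g a) - (f n z - f n a) = (g z - f n z) - (g a - f n a) := by ring
    rw [this]
    exact (norm_sub_le _ _).trans_lt (by linarith)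
  have hfne : ∀ z ∈ closedBall b (ρ/2), f n z - f n a ≠ 0 := by
    intro z hz h0
    have := hball z (hcb hz)
    exact this.2.2 (hi n this.2.1 ha (sub_eq_zero.1 h0))
  have hcl : closure (ball b (ρ/2)) = closedBall b (ρ/2) := closure_ball b (by positivity)
  have hdc : DiffContOnCl ℂ (fun z => (f n z - f n a)⁻¹) (ball b (ρ/2)) := by
    refine DifferentiableOn.diffContOnCl ?_
    rw [hcl]
    refine DifferentiableOn.inv ?_ hfne
    exact ((hf n).mono (fun z hz => hKW (Or.inl hz))).sub_const _
  have hmax := Complex.norm_le_of_forall_mem_frontier_norm_le (C := 2 / m) isBounded_ball hdc (by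
    intro z hz
    rw [frontier_ball b (by positivity)] at hz
    have h1 := hest z (sphere_subset_closedBall hz)
    have h2 : m ≤ ‖g z - g a‖ := hmin hz
    have h3 := norm_sub_norm_le (g z - g a) (f n z - f n a)
    rw [norm_inv, inv_le_comm₀ (norm_pos_iff.2 (hfne z (sphere_subset_closedBall hz))) (by positivity)]
    rw [inv_div]; linarith) (subset_closure (mem_ball_self (by positivity) : b ∈ ball b (ρ/2)))
  have hbb : b ∈ closedBall b (ρ/2) := mem_closedBall_self (by positivity)
  have h1 := hest b hbb
  rw [hab, sub_self, zero_sub, norm_neg] at h1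
  rw [norm_inv, inv_le_comm₀ (norm_pos_iff.2 (hfne b hbb)) (by positivity), inv_div] at hmax
  linarith

/-- Blaschke factor -/
noncomputable def bla (a z : ℂ) : ℂ := (z - a) / (1 - (starRingEnd ℂ) a * z)

lemma bla_den {a z : ℂ} (ha : ‖a‖ < 1) (hz : ‖z‖ < 1) : 1 - (starRingEnd ℂ) a * z ≠ 0 := by
  intro h
  have h1 : (starRingEnd ℂ) a * z = 1 := (sub_eq_zero.1 h).symm
  have h2 := congrArg norm h1
  rw [norm_mul, RCLike.norm_conj, norm_one] at h2
  nlinarith [norm_nonneg a, norm_nonneg z]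

lemma bla_lt {a z : ℂ} (ha : ‖a‖ < 1) (hz : ‖z‖ < 1) : ‖bla a z‖ < 1 := by
  have hd := norm_pos_iff.2 (bla_den ha hz)
  rw [bla, norm_div, div_lt_one hd]
  refine lt_of_pow_lt_pow_left₀ 2 hd.le ?_
  have e : ‖1 - (starRingEnd ℂ) a * z‖ ^ 2 - ‖z - a‖ ^ 2 = (1 - ‖a‖ ^ 2) * (1 - ‖z‖ ^ 2) := by
    rw [← normSq_eq_norm_sq, ← normSq_eq_norm_sq, ← normSq_eq_norm_sq, ← normSq_eq_norm_sq]
    simp only [normSq_apply, sub_re, sub_im, one_re, one_im, mul_re, mul_im, conj_re, conj_im]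
    ring
  have : 0 < (1 - ‖a‖ ^ 2) * (1 - ‖z‖ ^ 2) := by
    apply mul_pos <;> nlinarith [norm_nonneg a, norm_nonneg z]
  linarith

lemma bla_inj {a z w : ℂ} (ha : ‖a‖ < 1) (hz : ‖z‖ < 1) (hw : ‖w‖ < 1) (h : bla a z = bla a w) :
    z = w := by
  rw [bla, bla, div_eq_div_iff (bla_den ha hz) (bla_den ha hw)] at h
  have h1 : (1 - (starRingEnd ℂ) a * a) * (z - w) = 0 := by linear_combination h
  rcases mul_eq_zero.1 h1 with h2 | h2
  · exact absurd h2 (bla_den ha ha)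
  · exact sub_eq_zero.1 h2

lemma bla_hasDerivAt {a z : ℂ} (ha : ‖a‖ < 1) (hz : ‖z‖ < 1) :
    HasDerivAt (bla a) ((1 - (starRingEnd ℂ) a * a) / (1 - (starRingEnd ℂ) a * z) ^ 2) z := by
  have h1 : HasDerivAt (fun z => z - a) 1 z := (hasDerivAt_id z).sub_const a
  have h2 : HasDerivAt (fun z => 1 - (starRingEnd ℂ) a * z) (-(starRingEnd ℂ) a) z := by
    simpa using ((hasDerivAt_id z).const_mul ((starRingEnd ℂ) a)).const_sub 1
  have := h1.div h2 (bla_den ha hz)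
  convert! this using 1
  congr 1
  ring

lemma norm_one_sub_conj (a : ℂ) (ha : ‖a‖ < 1) : ‖1 - (starRingEnd ℂ) a * a‖ = 1 - ‖a‖ ^ 2 := by
  rw [mul_comm, mul_conj, normSq_eq_norm_sq, ← ofReal_one, ← ofReal_sub, norm_real, Real.norm_eq_abs,
    abs_of_nonneg]
  nlinarith [norm_nonneg a]

/-- Koebe step -/
lemma koebe_step {W : Set ℂ} (hW : IsOpen W) (hsc : IsSimplyConnected W) {w₀ : ℂ} (hw : w₀ ∈ W)
    {f : ℂ → ℂ} (hf : RFam W w₀ f) (hd : deriv f w₀ ≠ 0) {ω : ℂ} (hω : ‖ω‖ < 1)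
    (hωf : ω ∉ f '' W) : ∃ F, RFam W w₀ F ∧ ‖deriv f w₀‖ < ‖deriv F w₀‖ := by
  have hf1 : ∀ z ∈ W, ‖f z‖ < 1 := fun z hz => by simpa using hf.maps hz
  have hfd : ∀ z ∈ W, HasDerivAt f (deriv f z) z := fun z hz =>
    (hf.diff.differentiableAt (hW.mem_nhds hz)).hasDerivAt
  set g : ℂ → ℂ := fun z => bla ω (f z) with hg
  have hgd : ∀ z ∈ W, HasDerivAt g ((1 - (starRingEnd ℂ) ω * ω) / (1 - (starRingEnd ℂ) ω * f z) ^ 2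
      * deriv f z) z := fun z hz => (bla_hasDerivAt hω (hf1 z hz)).comp z (hfd z hz)
  have hgc : ContinuousOn g W := fun z hz => (hgd z hz).continuousAt.continuousWithinAt
  have hg0 : ∀ z ∈ W, g z ≠ 0 := by
    intro z hz h0
    simp only [hg, bla, div_eq_zero_iff] at h0
    rcases h0 with h0 | h0
    · exact hωf ⟨z, hz, sub_eq_zero.1 h0⟩
    · exact bla_den hω (hf1 z hz) h0
  obtain ⟨h, hhc, hh⟩ := exists_continuousOn_pow_eq hsc hW hgc
    (by rintro ⟨z, hz, h0⟩; exact hg0 z hz h0) two_ne_zero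
  have hh0 : ∀ z ∈ W, h z ≠ 0 := fun z hz h0 => by
    have := hh z; rw [h0] at this; exact hg0 z hz (by rw [← this]; simp)
  have hh1 : ∀ z ∈ W, ‖h z‖ < 1 := fun z hz => by
    have h1 := bla_lt hω (hf1 z hz)
    have h2 : ‖h z‖ ^ 2 = ‖g z‖ := by rw [← norm_pow, hh]
    have h3 : ‖h z‖ ^ 2 < 1 := by rw [h2]; exact h1
    nlinarith [norm_nonneg (h z)]
  have hhd : ∀ z ∈ W, HasDerivAt h ((2 * h z)⁻¹ * ((1 - (starRingEnd ℂ) ω * ω) /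
      (1 - (starRingEnd ℂ) ω * f z) ^ 2 * deriv f z)) z := by
    intro z hz
    have hcz : ContinuousAt h z := hhc.continuousAt (hW.mem_nhds hz)
    rw [hasDerivAt_iff_tendsto_slope]
    have hs := hasDerivAt_iff_tendsto_slope.1 (hgd z hz)
    have h2 : Tendsto (fun w => (h w + h z)⁻¹) (𝓝[≠] z) (𝓝 (2 * h z)⁻¹) := by
      have : Tendsto (fun w => h w + h z) (𝓝[≠] z) (𝓝 (h z + h z)) :=
        (hcz.tendsto.add_const _).mono_left nhdsWithin_le_nhds
      rw [two_mul]
      refine this.inv₀ ?_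
      rw [← two_mul]; exact mul_ne_zero two_ne_zero (hh0 z hz)
    refine (h2.mul hs).congr' ?_
    have hne : ∀ᶠ w in 𝓝[≠] z, h w + h z ≠ 0 := by
      have : Tendsto (fun w => h w + h z) (𝓝[≠] z) (𝓝 (h z + h z)) :=
        (hcz.tendsto.add_const _).mono_left nhdsWithin_le_nhds
      refine this.eventually_ne ?_
      rw [← two_mul]; exact mul_ne_zero two_ne_zero (hh0 z hz)
    filter_upwards [hne, self_mem_nhdsWithin] with w hw1 hw2
    have hw2' : w - z ≠ 0 := sub_ne_zero.2 hw2
    rw [slope_def_field, slope_def_field, ← hh w, ← hh z]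
    field_simp
    ring
  set b := h w₀ with hb
  have hb1 : ‖b‖ < 1 := hh1 w₀ hw
  have hFd : ∀ z ∈ W, HasDerivAt (fun z => bla b (h z)) ((1 - (starRingEnd ℂ) b * b) /
      (1 - (starRingEnd ℂ) b * h z) ^ 2 * ((2 * h z)⁻¹ * ((1 - (starRingEnd ℂ) ω * ω) /
      (1 - (starRingEnd ℂ) ω * f z) ^ 2 * deriv f z))) z :=
    fun z hz => (bla_hasDerivAt hb1 (hh1 z hz)).comp z (hhd z hz)
  refine ⟨fun z => bla b (h z), ⟨?_, ?_, ?_, ?_⟩, ?_⟩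
  · exact fun z hz => (hFd z hz).differentiableAt.differentiableWithinAt
  · intro z hz w hw' hzw
    have h1 := bla_inj hb1 (hh1 z hz) (hh1 w hw') hzw
    have h2 : g z = g w := by rw [← hh z, ← hh w, h1]
    exact hf.inj hz hw' (bla_inj hω (hf1 z hz) (hf1 w hw') h2)
  · intro z hz
    simpa using bla_lt hb1 (hh1 z hz)
  · simp [bla, hb]
  · rw [(hFd w₀ hw).deriv, ← hb, hf.zero]
    have hbω : ‖b‖ ^ 2 = ‖ω‖ := by
      rw [← norm_pow, hb, hh]
      simp [hg, hf.zero, bla]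
    have hb0 : 0 < ‖b‖ := norm_pos_iff.2 (hh0 w₀ hw)
    have hs : 0 < ‖deriv f w₀‖ := norm_pos_iff.2 hd
    simp only [mul_zero, sub_zero, one_pow, div_one]
    rw [norm_mul, norm_mul, norm_mul, norm_div, norm_pow, norm_inv, norm_mul,
      norm_one_sub_conj b hb1, norm_one_sub_conj ω hω, ← hbω]
    have h5 : 0 < 1 - ‖b‖ ^ 2 := by nlinarith
    have e : (1 - ‖b‖ ^ 2) / (1 - ‖b‖ ^ 2) ^ 2 * ((‖(2:ℂ)‖ * ‖b‖)⁻¹ * ((1 - (‖b‖ ^ 2) ^ 2) * ‖deriv f w₀‖))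
      = (1 + ‖b‖ ^ 2) / (2 * ‖b‖) * ‖deriv f w₀‖ := by
      rw [Complex.norm_ofNat]
      field_simp
      ring
    rw [e]
    have h6 : 1 < (1 + ‖b‖ ^ 2) / (2 * ‖b‖) := by
      rw [lt_div_iff₀ (by positivity)]
      nlinarith [sq_pos_of_pos (sub_pos.2 hb1)]
    nlinarith

/-- Riemann mapping theorem for bounded domains -/
theorem riemann_mapping {W : Set ℂ} (hW : IsOpen W) (hsc : IsSimplyConnected W)
    (hb : Bornology.IsBounded W) {w₀ : ℂ} (hw : w₀ ∈ W) :
    ∃ f : ℂ → ℂ, DifferentiableOn ℂ f W ∧ InjOn f W ∧ f '' W = ball 0 1 ∧ f w₀ = 0 := by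
  obtain ⟨d, hd0, hd⟩ := Metric.isOpen_iff.1 hW w₀ hw
  obtain ⟨M, hM⟩ := hb.subset_ball w₀
  have hM0 : 0 < M := pos_of_mem_ball (hM hw)
  have hfam0 : RFam W w₀ (fun z => (z - w₀) / M) := by
    refine ⟨by fun_prop, ?_, ?_, by simp⟩
    · intro z _ w _ h
      have hMc : (M:ℂ) ≠ 0 := by exact_mod_cast hM0.ne'
      simp only [div_left_inj' hMc] at h
      simpa using h
    · intro z hz
      have := hM hz
      rw [mem_ball, dist_eq_norm] at this
      simp only [mem_ball, dist_zero_right, norm_div, norm_real, Real.norm_eq_abs, abs_of_pos hM0]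
      rwa [div_lt_one hM0]
  set S : Set ℝ := {s | ∃ f, RFam W w₀ f ∧ s = ‖deriv f w₀‖} with hS
  have hbdd : BddAbove S := by
    refine ⟨1 / d, ?_⟩
    rintro s ⟨f, hf, rfl⟩
    refine norm_deriv_le_div_of_mapsTo_ball (hf.diff.mono hd) ?_ hd0
    intro z hz
    have := hf.maps (hd hz)
    rw [hf.zero]; exact ball_subset_closedBall this
  have hpos : 0 < sSup S := by
    have h1 : ‖deriv (fun z : ℂ => (z - w₀) / M) w₀‖ ≤ sSup S := le_csSup hbdd ⟨_, hfam0, rfl⟩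
    have h2 : deriv (fun z : ℂ => (z - w₀) / M) w₀ = 1 / M := by
      exact (((hasDerivAt_id w₀).sub_const w₀).div_const (M:ℂ)).deriv
    rw [h2] at h1
    have : 0 < ‖(1 / M : ℂ)‖ := by
      rw [norm_pos_iff]; exact one_div_ne_zero (by exact_mod_cast hM0.ne')
    linarith
  have hne : S.Nonempty := ⟨_, _, hfam0, rfl⟩
  obtain ⟨u, -, hu, huS⟩ := exists_seq_tendsto_sSup hne hbdd
  choose f hf hfu using huS
  obtain ⟨g, hg, hg1⟩ := RFam.limit hW hf (hyperfilter ℕ)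
  have hgd : DifferentiableOn ℂ g W := hg.differentiableOn (Eventually.of_forall fun n => (hf n).diff) hW
  have hder : ‖deriv g w₀‖ = sSup S := by
    have h1 := (hg.deriv (Eventually.of_forall fun n => (hf n).diff) hW).tendsto_at hw
    have h2 := h1.norm
    have h3 : Tendsto u (hyperfilter ℕ : Filter ℕ) (𝓝 (sSup S)) :=
      hu.mono_left (by rw [← Nat.cofinite_eq_atTop]; exact hyperfilter_le_cofinite)
    refine tendsto_nhds_unique h2 (h3.congr (fun n => ?_))
    rw [hfu n]; rfl
  have hgd0 : deriv g w₀ ≠ 0 := by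
    rw [← norm_pos_iff, hder]; exact hpos
  have hinj : InjOn g W := hurwitz hW hsc.isPathConnected.isConnected.isPreconnected
    (fun n => (hf n).diff) (fun n => (hf n).inj) hg hw hgd0
  have hzero : g w₀ = 0 := by
    refine tendsto_nhds_unique (hg.tendsto_at hw) ?_
    simp only [(hf _).zero]; exact tendsto_const_nhds
  have hmaps : MapsTo g W (ball 0 1) := by
    intro z hz
    by_contra hcon
    have h1 : ‖g z‖ = 1 := by
      refine le_antisymm (hg1 z hz) ?_
      simpa using hcon
    have hmax : IsMaxOn (norm ∘ g) W z := fun y hy => by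
      simp only [mem_ofPred_eq, Function.comp, h1]; exact hg1 y hy
    have := eqOn_of_isPreconnected_of_isMaxOn_norm hsc.isPathConnected.isConnected.isPreconnected hW
      hgd hz hmax hw
    simp only [hzero, Function.const] at this
    rw [← this] at h1
    simp at h1
  have hfam : RFam W w₀ g := ⟨hgd, hinj, hmaps, hzero⟩
  refine ⟨g, hgd, hinj, Subset.antisymm hmaps.image_subset ?_, hzero⟩
  intro ω hω
  by_contra hcon
  obtain ⟨F, hF, hlt⟩ := koebe_step hW hsc hw hfam hgd0 (by simpa using hω) hcon
  have := le_csSup hbdd ⟨F, hF, rfl⟩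
  rw [hder] at hlt
  linarith

lemma inj_not_const {W : Set ℂ} (hW : IsOpen W) {f : ℂ → ℂ} (hi : InjOn f W) {z : ℂ} (hz : z ∈ W) :
    ¬ ∀ᶠ w in 𝓝 z, f w = f z := by
  intro h
  have h1 : ∀ᶠ w in 𝓝 z, w ∈ W := hW.mem_nhds hz
  have h2 : ∀ᶠ w in 𝓝[≠] z, w = z := by
    filter_upwards [nhdsWithin_le_nhds (h.and h1)] with w hw
    exact hi hw.2 hz hw.1
  have h3 : ∀ᶠ w in 𝓝[≠] z, w ≠ z := self_mem_nhdsWithin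
  obtain ⟨w, hw⟩ := (h2.and h3).exists
  exact hw.2 hw.1

lemma holo_image_mem {W : Set ℂ} (hW : IsOpen W) {f : ℂ → ℂ} (hf : DifferentiableOn ℂ f W)
    (hi : InjOn f W) {z : ℂ} (hz : z ∈ W) {N : Set ℂ} (hN : N ∈ 𝓝 z) : f '' N ∈ 𝓝 (f z) := by
  rcases (hf.analyticAt (hW.mem_nhds hz)).eventually_constant_or_nhds_le_map_nhds with h | h
  · exact (inj_not_const hW hi hz h).elim
  · exact h (image_mem_map hN)

lemma holo_inv {W : Set ℂ} (hW : IsOpen W) {f φ : ℂ → ℂ} (hf : DifferentiableOn ℂ f W)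
    (hi : InjOn f W) (hφ : ∀ z ∈ W, φ (f z) = z) : DifferentiableOn ℂ φ (f '' W) := by
  have hcont : ∀ z ∈ W, ContinuousAt φ (f z) := by
    intro z hz
    rw [ContinuousAt, hφ z hz]
    intro N hN
    rw [mem_map]
    refine mem_of_superset (holo_image_mem hW hf hi hz (inter_mem hN (hW.mem_nhds hz))) ?_
    rintro _ ⟨w, ⟨hw, hwW⟩, rfl⟩
    simpa [hφ w hwW] using hw
  have hright : ∀ z ∈ W, ∀ᶠ y in 𝓝 (f z), y ∈ f '' W := fun z hz =>
    holo_image_mem hW hf hi hz (hW.mem_nhds hz)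
  have hd1 : ∀ z ∈ W, deriv f z ≠ 0 → DifferentiableAt ℂ φ (f z) := by
    intro z hz h0
    refine (HasDerivAt.of_local_left_inverse (f := f) (f' := deriv f z) (hcont z hz) ?_ h0 ?_).differentiableAt
    · rw [hφ z hz]; exact (hf.differentiableAt (hW.mem_nhds hz)).hasDerivAt
    · filter_upwards [hright z hz]
      rintro _ ⟨w, hw, rfl⟩
      rw [hφ w hw]
  rintro _ ⟨z, hz, rfl⟩
  refine DifferentiableAt.differentiableWithinAt ?_
  refine (analyticAt_of_differentiable_on_punctured_nhds_of_continuousAt ?_ (hcont z hz)).differentiableAt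
  have han := (hf.analyticAt (hW.mem_nhds hz)).deriv
  have hne : ∀ᶠ w in 𝓝[≠] z, deriv f w ≠ 0 := by
    rcases han.eventually_eq_zero_or_eventually_ne_zero with h | h
    · exfalso
      obtain ⟨r, hr, hball⟩ := Metric.eventually_nhds_iff_ball.1 (h.and (hW.mem_nhds hz : ∀ᶠ w in 𝓝 z, w ∈ W))
      refine inj_not_const hW hi hz ?_
      filter_upwards [ball_mem_nhds z hr] with w hw
      exact isOpen_ball.is_const_of_deriv_eq_zero (convex_ball z r).isPreconnected
        (hf.mono fun y hy => (hball y hy).2) (fun y hy => (hball y hy).1) hw (mem_ball_self hr)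
    · exact h
  rw [eventually_nhdsWithin_iff] at hne ⊢
  have h1 : Tendsto φ (𝓝 (f z)) (𝓝 z) := by simpa [ContinuousAt, hφ z hz] using hcont z hz
  filter_upwards [h1.eventually hne, hright z hz]
  rintro _ h2 ⟨w, hw, rfl⟩ h3
  rw [hφ w hw] at h2
  refine hd1 w hw (h2 ?_)
  rintro rfl
  exact h3 rfl

/-- Riemann map together with its holomorphic inverse. -/
theorem riemann_mapping_pair {W : Set ℂ} (hW : IsOpen W) (hsc : IsSimplyConnected W)
    (hb : Bornology.IsBounded W) {w₀ : ℂ} (hw : w₀ ∈ W) :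
    ∃ ψ φ : ℂ → ℂ, DifferentiableOn ℂ ψ W ∧ DifferentiableOn ℂ φ (ball 0 1) ∧
      MapsTo ψ W (ball 0 1) ∧ MapsTo φ (ball 0 1) W ∧ (∀ z ∈ W, φ (ψ z) = z) ∧
      (∀ z ∈ ball (0:ℂ) 1, ψ (φ z) = z) := by
  obtain ⟨ψ, h1, h2, h3, -⟩ := riemann_mapping hW hsc hb hw
  have hinv : ∀ z ∈ W, Function.invFunOn ψ W (ψ z) = z := fun z hz => h2.leftInvOn_invFunOn hz
  refine ⟨ψ, Function.invFunOn ψ W, h1, h3 ▸ holo_inv hW h1 h2 hinv, fun z hz => h3 ▸ ⟨z, hz, rfl⟩, ?_, hinv, ?_⟩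
  · intro z hz
    rw [← h3] at hz
    obtain ⟨w, hw, rfl⟩ := hz
    rw [hinv w hw]; exact hw
  · intro z hz
    rw [← h3] at hz
    obtain ⟨w, hw, rfl⟩ := hz
    rw [hinv w hw]
end P3

section P4
open Set Complex Metric Filter Topology

lemma arc_preconn (p u : ℂ) (hu : ‖u‖ = 1) {r : ℝ} (hr : 0 < r) {S : Set ℝ} (hS : IsUpperSet S) :
    IsPreconnected {z : ℂ | z ∈ sphere p r ∧ inner ℝ u (z - p) ∈ S} := by
  have hcos : ∀ θ : ℝ, inner ℝ u ((r : ℂ) * u * exp (θ * I)) = r * Real.cos θ := by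
    intro θ
    rw [Complex.inner, ← Complex.ofReal_re (r * Real.cos θ)]
    have h1 : (starRingEnd ℂ) u * u = 1 := by
      rw [mul_comm, mul_conj, normSq_eq_norm_sq, hu]; simp
    have : r * u * exp (θ * I) * (starRingEnd ℂ) u = r * exp (θ * I) := by
      linear_combination (r * exp (θ * I)) * h1
    rw [this, exp_mul_I]
    simp [← ofReal_cos, ← ofReal_sin]
  have hT : OrdConnected {θ : ℝ | θ ∈ Icc (-Real.pi) Real.pi ∧ r * Real.cos θ ∈ S} := by
    refine ⟨fun a ha b hb x hx => ⟨⟨ha.1.1.trans hx.1, hx.2.trans hb.1.2⟩, ?_⟩⟩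
    have key : ∀ c, c ∈ Icc (-Real.pi) Real.pi → |x| ≤ |c| → r * Real.cos c ∈ S → r * Real.cos x ∈ S := by
      intro c hc hxc h
      refine hS ?_ h
      rw [← Real.cos_abs x, ← Real.cos_abs c]
      exact mul_le_mul_of_nonneg_left (Real.cos_le_cos_of_nonneg_of_le_pi (abs_nonneg _) (abs_le.2 hc) hxc) hr.le
    rcases le_total 0 x with h0 | h0
    · refine key b hb.1 ?_ hb.2
      rw [abs_of_nonneg h0, abs_of_nonneg (h0.trans hx.2)]; exact hx.2
    · refine key a ha.1 ?_ ha.2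
      rw [abs_of_nonpos h0, abs_of_nonpos (hx.1.trans h0)]; linarith [hx.1]
  have himg : {z : ℂ | z ∈ sphere p r ∧ inner ℝ u (z - p) ∈ S} =
      (fun θ : ℝ => p + r * u * exp (θ * I)) '' {θ : ℝ | θ ∈ Icc (-Real.pi) Real.pi ∧ r * Real.cos θ ∈ S} := by
    ext z
    constructor
    · rintro ⟨hz, hzS⟩
      have hu0 : u ≠ 0 := by rw [← norm_pos_iff, hu]; exact one_pos
      have hr0 : (r : ℂ) ≠ 0 := by exact_mod_cast hr.ne'
      have hn : ‖(z - p) / (r * u)‖ = 1 := by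
        rw [mem_sphere, dist_eq_norm] at hz
        rw [norm_div, norm_mul, hu, hz, norm_real, Real.norm_eq_abs, abs_of_pos hr, mul_one, div_self hr.ne']
      have he : exp (arg ((z - p) / (r * u)) * I) = (z - p) / (r * u) := by
        have := norm_mul_exp_arg_mul_I ((z - p) / (r * u))
        rwa [hn, ofReal_one, one_mul] at this
      have hz' : p + r * u * exp (arg ((z - p) / (r * u)) * I) = z := by
        rw [he]; field_simp; ring
      refine ⟨arg ((z - p) / (r * u)), ⟨⟨(neg_pi_lt_arg _).le, arg_le_pi _⟩, ?_⟩, hz'⟩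
      rw [← hcos]
      convert! hzS using 1
      congr 1
      linear_combination hz'
    · rintro ⟨θ, ⟨hθ, hθS⟩, rfl⟩
      refine ⟨?_, ?_⟩
      · simp [hu, abs_of_pos hr, norm_exp_ofReal_mul_I]
      · rw [add_sub_cancel_left, hcos]; exact hθS
  rw [himg]
  refine hT.isPreconnected.image _ ?_
  fun_prop

lemma arcA {ζ : ℂ} (hζ : ‖ζ‖ = 1) (η : ℝ) (hη : 0 ≤ η) :
    IsPreconnected (sphere (0:ℂ) 1 ∩ closedBall ζ η) := by
  convert! arc_preconn 0 ζ hζ one_pos (S := Ici (1 - η ^ 2 / 2)) (isUpperSet_Ici _) using 1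
  ext z
  simp only [mem_inter_iff, mem_sphere, mem_closedBall, mem_ofPred_eq, dist_eq_norm, sub_zero, mem_Ici]
  refine and_congr_right fun hz => ?_
  rw [← sq_le_sq₀ (norm_nonneg _) hη, norm_sub_sq_real, hz, hζ, real_inner_comm]
  constructor <;> intro h <;> linarith

lemma arcB {ζ : ℂ} (hζ : ‖ζ‖ = 1) (η : ℝ) (hη : 0 ≤ η) :
    IsPreconnected (sphere (0:ℂ) 1 \ ball ζ η) := by
  convert! arc_preconn 0 (-ζ) (by simpa using hζ) one_pos (S := Ici (η ^ 2 / 2 - 1)) (isUpperSet_Ici _) using 1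
  ext z
  simp only [Set.mem_sdiff, mem_sphere, mem_ball, mem_ofPred_eq, dist_eq_norm, sub_zero, mem_Ici, not_lt]
  refine and_congr_right fun hz => ?_
  rw [← sq_le_sq₀ hη (norm_nonneg _), norm_sub_sq_real, hz, hζ, inner_neg_left, real_inner_comm]
  constructor <;> intro h <;> linarith

lemma arcC {ζ : ℂ} (hζ : ‖ζ‖ = 1) {r : ℝ} (hr : 0 < r) :
    IsPreconnected (sphere ζ r ∩ ball (0:ℂ) 1) := by
  convert! arc_preconn ζ (-ζ) (by simpa using hζ) hr (S := Ioi (r ^ 2 / 2)) (isUpperSet_Ioi _) using 1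
  ext z
  simp only [mem_inter_iff, mem_sphere, mem_ball, mem_ofPred_eq, dist_eq_norm, sub_zero, mem_Ioi]
  refine and_congr_right fun hz => ?_
  rw [← sq_lt_sq₀ (norm_nonneg _) zero_le_one, inner_neg_left]
  have : ‖z‖ ^ 2 = 1 + 2 * inner ℝ ζ (z - ζ) + r ^ 2 := by
    rw [← hz, ← one_pow 2, ← hζ, ← norm_add_sq_real]; simp
  rw [this]
  constructor <;> intro h <;> linarith

/-- Data of a Jordan domain -/
structure JD (W : Set ℂ) (c : ℂ → ℂ) : Prop where
  op : IsOpen W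
  sc : IsSimplyConnected W
  bd : Bornology.IsBounded W
  fr : frontier W = c '' sphere 0 1
  cont : ContinuousOn c (sphere 0 1)
  inj : InjOn c (sphere 0 1)

lemma JD.compactJ {W : Set ℂ} {c : ℂ → ℂ} (h : JD W c) : IsCompact (frontier W) := by
  rw [h.fr]; exact (isCompact_sphere _ _).image_of_continuousOn h.cont

lemma JD.conn {W : Set ℂ} {c : ℂ → ℂ} (h : JD W c) : IsConnected W := h.sc.isPathConnected.isConnected

lemma JD.disj {W : Set ℂ} {c : ℂ → ℂ} (h : JD W c) : W ∩ frontier W = ∅ := by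
  rw [h.op.frontier_eq]; ext z; simp

/-- a connected set off the frontier that meets W is inside W -/
lemma sub_of_preconn {W C : Set ℂ} (hC : IsPreconnected C) (hd : C ∩ frontier W = ∅)
    (hne : (C ∩ W).Nonempty) : C ⊆ W := by
  by_contra hcon
  obtain ⟨z, hz, hzW⟩ := not_subset.1 hcon
  have hnf : ∀ x ∈ C, x ∉ frontier W := fun x hx hx2 => by
    have : x ∈ C ∩ frontier W := ⟨hx, hx2⟩
    rw [hd] at this; exact this
  have hinn : ∀ x ∈ C, x ∈ W → x ∈ interior W := fun x hx hxW => by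
    by_contra h1
    exact hnf x hx ⟨subset_closure hxW, h1⟩
  have hext : ∀ x ∈ C, x ∉ W → x ∈ (closure W)ᶜ := fun x hx hxW h1 =>
    hnf x hx ⟨h1, fun h2 => hxW (interior_subset h2)⟩
  obtain ⟨w, hw, hwW⟩ := hne
  obtain ⟨y, -, hy1, hy2⟩ := hC (interior W) (closure W)ᶜ isOpen_interior isClosed_closure.isOpen_compl
    (fun x hx => by
      by_cases hxW : x ∈ W
      · exact Or.inl (hinn x hx hxW)
      · exact Or.inr (hext x hx hxW)) ⟨w, hw, hinn w hw hwW⟩ ⟨z, hz, hext z hz hzW⟩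
  exact hy2 (subset_closure (interior_subset hy1))

lemma JD.small {W : Set ℂ} {c : ℂ → ℂ} (h : JD W c) {ε : ℝ} (hε : 0 < ε) :
    ∃ δ > 0, ∀ Z ⊆ frontier W, (∀ a ∈ Z, ∀ b ∈ Z, dist a b ≤ δ) →
      ∃ J' ⊆ frontier W, IsCompact J' ∧ IsPreconnected J' ∧ Z ⊆ J' ∧ ∀ a ∈ J', ∃ b ∈ Z, dist a b ≤ ε := by
  have hcomp := isCompact_sphere (0:ℂ) 1
  have huc := Metric.uniformContinuousOn_iff.1 (hcomp.uniformContinuousOn_of_continuous h.cont) ε hε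
  obtain ⟨η, hη, hcη⟩ := huc
  have hic := continuousOn_invFunOn_of_compact hcomp h.cont h.inj
  rw [← h.fr] at hic
  obtain ⟨δ, hδ, hiδ⟩ := Metric.uniformContinuousOn_iff.1
    (h.compactJ.uniformContinuousOn_of_continuous hic) (η / 2) (by positivity)
  refine ⟨δ / 2, by positivity, fun Z hZ hdiam => ?_⟩
  rcases Z.eq_empty_or_nonempty with rfl | ⟨z0, hz0⟩
  · exact ⟨∅, empty_subset _, isCompact_empty, isPreconnected_empty, Subset.rfl, by simp⟩
  have hrep : ∀ z ∈ frontier W, Function.invFunOn c (sphere 0 1) z ∈ sphere (0:ℂ) 1 ∧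
      c (Function.invFunOn c (sphere 0 1) z) = z := by
    intro z hz
    rw [h.fr] at hz
    exact ⟨Function.invFunOn_mem hz, Function.invFunOn_eq hz⟩
  set ζ := Function.invFunOn c (sphere 0 1) z0 with hζ
  have hζ1 := hrep z0 (hZ hz0)
  rw [← hζ] at hζ1
  have hsub : sphere (0:ℂ) 1 ∩ closedBall ζ (η / 2) ⊆ sphere 0 1 := inter_subset_left
  refine ⟨c '' (sphere (0:ℂ) 1 ∩ closedBall ζ (η / 2)), ?_, ?_, ?_, ?_, ?_⟩
  · rw [h.fr]; exact image_mono hsub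
  · exact (hcomp.inter_right isClosed_closedBall).image_of_continuousOn (h.cont.mono hsub)
  · exact (arcA (by simpa using hζ1.1) _ (by positivity)).image _ (h.cont.mono hsub)
  · intro z hz
    refine ⟨_, ⟨(hrep z (hZ hz)).1, ?_⟩, (hrep z (hZ hz)).2⟩
    exact (hiδ z (hZ hz) z0 (hZ hz0) ((hdiam z hz z0 hz0).trans_lt (by linarith))).le
  · rintro _ ⟨w, ⟨hw, hwb⟩, rfl⟩
    refine ⟨z0, hz0, ?_⟩
    have := hcη w hw ζ hζ1.1 ((mem_closedBall.1 hwb).trans_lt (by linarith))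
    rw [hζ1.2] at this
    exact this.le

lemma JD.split {W : Set ℂ} {c : ℂ → ℂ} (h : JD W c) {p : ℂ} (hp : p ∈ frontier W) {r : ℝ} (hr : 0 < r) :
    ∃ J'' ⊆ frontier W, IsCompact J'' ∧ IsPreconnected J'' ∧ frontier W \ ball p r ⊆ J'' ∧
      ∃ r' > 0, r' ≤ r ∧ J'' ∩ ball p r' = ∅ := by
  have hcomp := isCompact_sphere (0:ℂ) 1
  have hp' := hp
  rw [h.fr] at hp'
  obtain ⟨ζ, hζ, rfl⟩ := hp'
  obtain ⟨η, hη, hcη⟩ := Metric.continuousOn_iff.1 h.cont ζ hζ r hr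
  have hsub : sphere (0:ℂ) 1 \ ball ζ η ⊆ sphere 0 1 := sdiff_subset
  have hK : IsCompact (c '' (sphere (0:ℂ) 1 \ ball ζ η)) :=
    (hcomp.diff isOpen_ball).image_of_continuousOn (h.cont.mono hsub)
  have hnot : c ζ ∈ (c '' (sphere (0:ℂ) 1 \ ball ζ η))ᶜ := by
    rintro ⟨w, ⟨hw, hw2⟩, hwe⟩
    have := h.inj hw hζ hwe
    subst this
    exact hw2 (mem_ball_self hη)
  obtain ⟨r1, hr1, hb⟩ := Metric.isOpen_iff.1 hK.isClosed.isOpen_compl _ hnot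
  refine ⟨c '' (sphere (0:ℂ) 1 \ ball ζ η), ?_, hK, ?_, ?_, min r1 r, lt_min hr1 hr, min_le_right _ _, ?_⟩
  · rw [h.fr]; exact image_mono hsub
  · exact (arcB (by simpa using hζ) _ hη.le).image _ (h.cont.mono hsub)
  · rintro z ⟨hz, hzb⟩
    rw [h.fr] at hz
    obtain ⟨w, hw, rfl⟩ := hz
    exact ⟨w, ⟨hw, fun hwb => hzb (hcη w hw hwb)⟩, rfl⟩
  · ext z
    simp only [mem_inter_iff, mem_empty_iff_false, iff_false, not_and]
    intro h1 h2
    exact hb (ball_subset_ball (min_le_left _ _) h2) h1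

/-- local connectivity of a Jordan domain at the boundary -/
lemma JD.locconn {W : Set ℂ} {c : ℂ → ℂ} (h : JD W c) {p : ℂ} (hp : p ∈ frontier W) {r : ℝ} (hr : 0 < r) :
    ∃ r' > 0, ∀ x ∈ W ∩ ball p r', ∀ y ∈ W ∩ ball p r', ∃ C ⊆ W ∩ ball p r, IsPreconnected C ∧ x ∈ C ∧ y ∈ C := by
  obtain ⟨J'', hJs, hJc, hJp, hJd, r', hr', hrr, hdis⟩ := h.split hp hr
  refine ⟨r', hr', fun x hx y hy => ?_⟩
  have hfr : ∀ z ∈ W, z ∉ frontier W := fun z hz hz2 => by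
    have : z ∈ W ∩ frontier W := ⟨hz, hz2⟩
    rw [h.disj] at this; exact this
  have hnX : ball p r' ⊆ (J'' ∪ sphere p r)ᶜ := by
    rintro z hz (h1 | h1)
    · have : z ∈ J'' ∩ ball p r' := ⟨h1, hz⟩
      rw [hdis] at this; exact this
    · rw [mem_sphere] at h1; rw [mem_ball] at hz; linarith
  have hinn : (J'' ∪ sphere p r) ∩ frontier W = J'' := by
    ext z
    constructor
    · rintro ⟨h1 | h1, h2⟩
      · exact h1
      · exact hJd ⟨h2, by rw [mem_ball, mem_sphere.1 h1]; exact lt_irrefl _⟩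
    · exact fun h1 => ⟨Or.inl h1, hJs h1⟩
  have hq := janiszewski (X := J'' ∪ sphere p r) (Y := frontier W) (p := x) (q := y)
    (hJc.union (isCompact_sphere _ _)) h.compactJ (by rw [hinn]; exact hJp) (hnX hx.2) (hfr x hx.1)
    ((convex_ball p r').isPreconnected.subset_connectedComponentIn hx.2 hnX hy.2)
    (h.conn.isPreconnected.subset_connectedComponentIn hx.1 hfr hy.1)
  have hxm : x ∈ (J'' ∪ sphere p r ∪ frontier W)ᶜ := by
    rintro (h1 | h1)
    · exact hnX hx.2 h1
    · exact hfr x hx.1 h1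
  set C := connectedComponentIn (J'' ∪ sphere p r ∪ frontier W)ᶜ x
  have hCp : IsPreconnected C := isPreconnected_connectedComponentIn
  have hCx : x ∈ C := mem_connectedComponentIn hxm
  have hCs : C ⊆ (J'' ∪ sphere p r ∪ frontier W)ᶜ := connectedComponentIn_subset _ _
  refine ⟨C, subset_inter ?_ ?_, hCp, hCx, hq⟩
  · refine sub_of_preconn hCp ?_ ⟨x, hCx, hx.1⟩
    ext z; simp only [mem_inter_iff, mem_empty_iff_false, iff_false, not_and]
    intro h1 h2; exact hCs h1 (Or.inr h2)
  · refine sub_of_preconn hCp ?_ ⟨x, hCx, ball_subset_ball hrr hx.2⟩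
    ext z; simp only [mem_inter_iff, mem_empty_iff_false, iff_false, not_and]
    intro h1 h2
    rw [frontier_ball p hr.ne'] at h2
    exact hCs h1 (Or.inl (Or.inr h2))

open MeasureTheory in
lemma proj_aux {W : Set ℂ} {ψ φ : ℂ → ℂ} (hφc : ContinuousOn φ (ball 0 1))
    (hψm : MapsTo ψ W (ball 0 1)) (hφm : MapsTo φ (ball 0 1) W) (h1 : ∀ z ∈ W, φ (ψ z) = z)
    (h2 : ∀ z ∈ ball (0:ℂ) 1, ψ (φ z) = z) {e δ r : ℝ} (he : 0 < e) (hδ : 0 < δ) {p : ℂ} (hr : 0 < r)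
    (hK : ∀ z ∈ closedBall (0:ℂ) (1 - e), φ z ∉ ball p r) (π : ℂ →L[ℝ] ℝ) (s : ℝ → ℂ)
    (hπ : ∀ z, |π z| ≤ ‖z‖) (hs : ∀ x, π (s x) = x) (hsn : ∀ x, ‖s x‖ = |x|)
    (hv : volume (π '' (ψ '' (sphere p r ∩ W))) ≤ ENNReal.ofReal δ) {C : Set ℂ} (hC : C ⊆ W ∩ ball p r) :
    volume (π '' (ψ '' C)) ≤ ENNReal.ofReal (δ + 2 * e) := by
  have hsub : π '' (ψ '' C) ⊆ π '' (ψ '' (sphere p r ∩ W)) ∪ (Icc (-1) (-(1 - e)) ∪ Icc (1 - e) 1) := by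
    rintro _ ⟨_, ⟨z, hz, rfl⟩, rfl⟩
    by_contra hcon
    rw [mem_union, not_or, mem_union, not_or] at hcon
    obtain ⟨hc1, hc2, hc3⟩ := hcon
    have hzW := (hC hz).1
    have hψz := hψm hzW
    have hn : |π (ψ z)| < 1 := (hπ _).trans_lt (by simpa using hψz)
    have hx : |π (ψ z)| < 1 - e := by
      rw [abs_lt] at hn ⊢
      constructor
      · by_contra h3; exact hc2 ⟨hn.1.le, by linarith⟩
      · by_contra h3; exact hc3 ⟨by linarith, hn.2.le⟩
    have hchord : IsPreconnected (ball (0:ℂ) 1 ∩ π ⁻¹' {π (ψ z)}) :=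
      ((convex_ball (0:ℂ) 1).inter ((convex_singleton _).linear_preimage π.toLinearMap)).isPreconnected
    have him := hchord.image φ (hφc.mono inter_subset_left)
    have hin : φ '' (ball (0:ℂ) 1 ∩ π ⁻¹' {π (ψ z)}) ⊆ ball p r := by
      refine sub_of_preconn him ?_ ⟨z, ⟨ψ z, ⟨hψz, rfl⟩, h1 z hzW⟩, (hC hz).2⟩
      ext y
      simp only [mem_inter_iff, mem_empty_iff_false, iff_false, not_and]
      rintro ⟨w, ⟨hw, hw2⟩, rfl⟩ hy
      rw [frontier_ball p hr.ne'] at hy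
      exact hc1 ⟨w, ⟨φ w, ⟨hy, hφm hw⟩, h2 w hw⟩, hw2⟩
    have hsx : s (π (ψ z)) ∈ closedBall (0:ℂ) (1 - e) := by
      simp only [mem_closedBall, dist_zero_right, hsn]; exact hx.le
    refine hK _ hsx (hin ⟨_, ⟨closedBall_subset_ball (by linarith) hsx, by simp [hs]⟩, rfl⟩)
  refine (measure_mono hsub).trans ((measure_union_le _ _).trans ?_)
  have h3 : volume (Icc (-1) (-(1 - e)) ∪ Icc (1 - e) 1) ≤ ENNReal.ofReal (2 * e) := by
    refine (measure_union_le _ _).trans ?_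
    rw [Real.volume_Icc, Real.volume_Icc, ← ENNReal.ofReal_add (by linarith) (by linarith)]
    exact ENNReal.ofReal_le_ofReal (by linarith)
  rw [ENNReal.ofReal_add hδ.le (by positivity)]
  exact add_le_add hv h3

lemma JD.osc_psi {W : Set ℂ} {c : ℂ → ℂ} (h : JD W c) {ψ φ : ℂ → ℂ} (hψd : DifferentiableOn ℂ ψ W)
    (hφc : ContinuousOn φ (ball 0 1))
    (hψm : MapsTo ψ W (ball 0 1)) (hφm : MapsTo φ (ball 0 1) W) (h1 : ∀ z ∈ W, φ (ψ z) = z)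
    (h2 : ∀ z ∈ ball (0:ℂ) 1, ψ (φ z) = z) {p : ℂ} (hp : p ∈ frontier W) {ε : ℝ} (hε : 0 < ε) :
    ∃ r > 0, ∀ x ∈ W ∩ ball p r, ∀ y ∈ W ∩ ball p r, dist (ψ x) (ψ y) ≤ ε := by
  set e := ε / 6 with he
  have he0 : 0 < e := by positivity
  have hsubb : closedBall (0:ℂ) (1 - e) ⊆ ball 0 1 := closedBall_subset_ball (by linarith)
  have hK : IsCompact (φ '' closedBall (0:ℂ) (1 - e)) :=
    (isCompact_closedBall _ _).image_of_continuousOn (hφc.mono hsubb)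
  have hpK : p ∈ (φ '' closedBall (0:ℂ) (1 - e))ᶜ := by
    rintro ⟨z, hz, rfl⟩
    have : φ z ∈ W ∩ frontier W := ⟨hφm (hsubb hz), hp⟩
    rw [h.disj] at this; exact this
  obtain ⟨R, hR, hRb⟩ := Metric.isOpen_iff.1 hK.isClosed.isOpen_compl p hpK
  have hinj : InjOn ψ W := fun a ha b hb hab => by rw [← h1 a ha, ← h1 b hb, hab]
  obtain ⟨r, ⟨hr0, hrR⟩, hre, him⟩ := length_area h.op hψd hinj
    (isBounded_ball.subset hψm.image_subset) p he0 hR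
  obtain ⟨r', hr', hlc⟩ := h.locconn hp hr0
  refine ⟨r', hr', fun x hx y hy => ?_⟩
  obtain ⟨C, hC, hCp, hxC, hyC⟩ := hlc x hx y hy
  have hKr : ∀ z ∈ closedBall (0:ℂ) (1 - e), φ z ∉ ball p r := fun z hz hz2 =>
    hRb (ball_subset_ball hrR.le hz2) ⟨z, hz, rfl⟩
  have a1 := proj_aux hφc hψm hφm h1 h2 he0 he0 hr0 hKr reCLM (fun x => (x:ℂ)) abs_re_le_norm
    (fun x => by simp) (fun x => by simp) hre hC
  have a2 := proj_aux hφc hψm hφm h1 h2 he0 he0 hr0 hKr imCLM (fun x => (x:ℂ) * I) abs_im_le_norm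
    (fun x => by simp) (fun x => by simp) him hC
  have := dist_le_of_volume (S := ψ '' C) (by positivity) a1 a2
    (hCp.image ψ (hψd.continuousOn.mono (hC.trans inter_subset_left))) Subset.rfl
    (mem_image_of_mem _ hxC) (mem_image_of_mem _ hyC)
  linarith

lemma JD.osc_phi {W : Set ℂ} {c : ℂ → ℂ} (h : JD W c) {ψ φ : ℂ → ℂ} (hψd : DifferentiableOn ℂ ψ W)
    (hφd : DifferentiableOn ℂ φ (ball 0 1))
    (hψm : MapsTo ψ W (ball 0 1)) (hφm : MapsTo φ (ball 0 1) W) (h1 : ∀ z ∈ W, φ (ψ z) = z)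
    (h2 : ∀ z ∈ ball (0:ℂ) 1, ψ (φ z) = z) {ζ : ℂ} (hζ : ‖ζ‖ = 1) {ε : ℝ} (hε : 0 < ε) :
    ∃ r > 0, ∀ x ∈ ball (0:ℂ) 1 ∩ ball ζ r, ∀ y ∈ ball (0:ℂ) 1 ∩ ball ζ r, dist (φ x) (φ y) ≤ ε := by
  have h0 : (0:ℂ) ∈ ball (0:ℂ) 1 := by simp
  have hφ0 := hφm h0
  -- points near φ 0 have preimage near 0
  obtain ⟨ε0, hε0, hnear⟩ := Metric.continuousAt_iff.1
    ((hψd.differentiableAt (h.op.mem_nhds hφ0)).continuousAt) (1/2) (by norm_num)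
  rw [h2 0 h0] at hnear
  set e := min (ε / 4) (ε0 / 2) with he
  have he0 : 0 < e := by positivity
  obtain ⟨δ0, hδ0, hsm⟩ := h.small (ε := e / 2) (by positivity)
  set δ := min (δ0 / 2) (e / 4) with hδ
  have hδpos : 0 < δ := by positivity
  have hinj : InjOn φ (ball 0 1) := fun a ha b hb hab => by rw [← h2 a ha, ← h2 b hb, hab]
  obtain ⟨r, ⟨hr0, hrR⟩, hre, him⟩ := length_area isOpen_ball hφd hinj
    (h.bd.subset hφm.image_subset) ζ hδpos (R := 1/2) (by norm_num)
  set A := sphere ζ r ∩ ball (0:ℂ) 1 with hA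
  have hAp : IsPreconnected A := arcC hζ hr0
  have hΓp := hAp.image φ (hφd.continuousOn.mono inter_subset_right)
  have hΓd : ∀ z ∈ φ '' A, ∀ w ∈ φ '' A, dist z w ≤ 2 * δ := fun z hz w hw =>
    dist_le_of_volume hδpos.le hre him hΓp Subset.rfl hz hw
  have hΓcd : ∀ z ∈ closure (φ '' A), ∀ w ∈ closure (φ '' A), dist z w ≤ 2 * δ := by
    intro z hz w hw
    have hc : IsClosed {q : ℂ × ℂ | dist q.1 q.2 ≤ 2 * δ} := isClosed_le (by fun_prop) (by fun_prop)
    have : closure ((φ '' A) ×ˢ (φ '' A)) ⊆ {q : ℂ × ℂ | dist q.1 q.2 ≤ 2 * δ} :=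
      hc.closure_subset_iff.2 fun q hq => hΓd _ hq.1 _ hq.2
    rw [closure_prod_eq] at this
    exact this (mk_mem_prod hz hw)
  obtain ⟨J', hJs, hJc, hJp, hZ, hJn⟩ := hsm (closure (φ '' A) ∩ frontier W) inter_subset_right
    (fun a ha b hb => (hΓcd a ha.1 b hb.1).trans (by linarith [min_le_left (δ0/2) (e/4)]))
  -- a point of the arc
  have hAne : ((1 - r : ℝ) : ℂ) * ζ ∈ A := by
    constructor
    · rw [mem_sphere, dist_eq_norm]
      have : ((1 - r : ℝ) : ℂ) * ζ - ζ = -((r:ℝ):ℂ) * ζ := by push_cast; ring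
      rw [this, norm_mul, hζ, norm_neg, norm_real, Real.norm_eq_abs, abs_of_pos hr0, mul_one]
    · rw [mem_ball, dist_zero_right, norm_mul, hζ, norm_real, Real.norm_eq_abs, abs_of_pos (by linarith), mul_one]
      linarith
  set k0 := φ (((1 - r : ℝ) : ℂ) * ζ) with hk0
  have hk0Γ : k0 ∈ closure (φ '' A) := subset_closure ⟨_, hAne, rfl⟩
  set K := closure (φ '' A) ∪ J' with hK
  have hbA : Bornology.IsBounded (φ '' A) := h.bd.subset ((image_mono inter_subset_right).trans hφm.image_subset)
  have hKc : IsCompact K := (hbA.isCompact_closure).union hJc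
  have hKb : K ⊆ closedBall k0 e := by
    have h2δ : 2 * δ ≤ e / 2 := by linarith [min_le_right (δ0/2) (e/4)]
    rintro z (hz | hz)
    · exact (hΓcd z hz k0 hk0Γ).trans (by linarith)
    · obtain ⟨b, hb, hzb⟩ := hJn z hz
      exact (dist_triangle z b k0).trans (by linarith [hΓcd b hb.1 k0 hk0Γ])
  have hKJ : K ∩ frontier W = J' := by
    ext z
    constructor
    · rintro ⟨hz | hz, hz2⟩
      · exact hZ ⟨hz, hz2⟩
      · exact hz
    · exact fun hz => ⟨Or.inr hz, hJs hz⟩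
  have hfr : ∀ z ∈ W, z ∉ frontier W := fun z hz hz2 => by
    have : z ∈ W ∩ frontier W := ⟨hz, hz2⟩
    rw [h.disj] at this; exact this
  have hcl : φ 0 ∉ closedBall k0 e := by
    intro hcon
    have h3 : dist k0 (φ 0) < ε0 := by
      rw [dist_comm]
      exact (mem_closedBall.1 hcon).trans_lt (by linarith [min_le_right (ε/4) (ε0/2)])
    have := hnear h3
    rw [hk0, h2 _ hAne.2, dist_zero_right, norm_mul, hζ, norm_real, Real.norm_eq_abs,
      abs_of_pos (by linarith)] at this
    linarith
  have key : ∀ x ∈ ball (0:ℂ) 1 ∩ ball ζ r, φ x ∈ closedBall k0 e := by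
    rintro x ⟨hx1, hxr⟩
    by_contra hxe
    have hc1 : φ x ∈ connectedComponentIn Kᶜ (φ 0) :=
      (isPreconnected_compl_closedBall_complex e he0 k0).subset_connectedComponentIn hcl
        (compl_subset_compl.2 hKb) hxe
    have hc2 : φ x ∈ connectedComponentIn (frontier W)ᶜ (φ 0) :=
      h.conn.isPreconnected.subset_connectedComponentIn hφ0 hfr (hφm hx1)
    have hq := janiszewski hKc h.compactJ (by rw [hKJ]; exact hJp) (fun hh => hcl (hKb hh))
      (hfr _ hφ0) hc1 hc2
    have h0m : φ 0 ∈ (K ∪ frontier W)ᶜ := by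
      rintro (hh | hh)
      · exact hcl (hKb hh)
      · exact hfr _ hφ0 hh
    have hCs := connectedComponentIn_subset (K ∪ frontier W)ᶜ (φ 0)
    have hCp : IsPreconnected (connectedComponentIn (K ∪ frontier W)ᶜ (φ 0)) :=
      isPreconnected_connectedComponentIn
    have hC0 := mem_connectedComponentIn h0m
    set C := connectedComponentIn (K ∪ frontier W)ᶜ (φ 0)
    have hCW : C ⊆ W := by
      refine sub_of_preconn hCp ?_ ⟨_, hC0, hφ0⟩
      ext z; simp only [mem_inter_iff, mem_empty_iff_false, iff_false, not_and]
      intro h1 h2; exact hCs h1 (Or.inr h2)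
    have hCi := hCp.image ψ (hψd.continuousOn.mono hCW)
    have hsub : ψ '' C ⊆ ball ζ r := by
      refine sub_of_preconn hCi ?_ ⟨x, ⟨φ x, hq, h2 x hx1⟩, hxr⟩
      ext z; simp only [mem_inter_iff, mem_empty_iff_false, iff_false, not_and]
      rintro ⟨w, hw, rfl⟩ hz
      rw [frontier_ball ζ hr0.ne'] at hz
      exact hCs hw (Or.inl (Or.inl (subset_closure ⟨ψ w, ⟨hz, hψm (hCW hw)⟩, h1 w (hCW hw)⟩)))
    have : (0:ℂ) ∈ ball ζ r := hsub ⟨φ 0, hC0, h2 0 h0⟩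
    rw [mem_ball, dist_zero_left, hζ] at this
    linarith
  refine ⟨r, hr0, fun x hx y hy => ?_⟩
  have := dist_triangle_right (φ x) (φ y) k0
  have h3 := mem_closedBall.1 (key x hx)
  have h4 := mem_closedBall.1 (key y hy)
  linarith [min_le_left (ε/4) (ε0/2)]

lemma tendsto_of_osc {A : Set ℂ} {f : ℂ → ℂ} {p : ℂ} (hp : p ∈ closure A)
    (h : ∀ ε > 0, ∃ r > 0, ∀ x ∈ A ∩ ball p r, ∀ y ∈ A ∩ ball p r, dist (f x) (f y) ≤ ε) :
    ∃ y, Tendsto f (𝓝[A] p) (𝓝 y) := by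
  haveI : (𝓝[A] p).NeBot := mem_closure_iff_nhdsWithin_neBot.1 hp
  rw [← cauchy_map_iff_exists_tendsto]
  refine Metric.cauchy_iff.2 ⟨map_neBot, fun ε hε => ?_⟩
  obtain ⟨r, hr, hosc⟩ := h (ε / 2) (by positivity)
  refine ⟨f '' (A ∩ ball p r), image_mem_map (inter_mem_nhdsWithin A (ball_mem_nhds p hr)), ?_⟩
  rintro _ ⟨x, hx, rfl⟩ _ ⟨y, hy, rfl⟩
  exact (hosc x hx y hy).trans_lt (by linarith)

lemma tendsto_of_contOn {A : Set ℂ} (hA : IsOpen A) {f : ℂ → ℂ} (hf : ContinuousOn f A) {p : ℂ} (hp : p ∈ A) :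
    ∃ y, Tendsto f (𝓝[A] p) (𝓝 y) := ⟨f p, hf p hp⟩

lemma extendFrom_eq_on {A : Set ℂ} {f : ℂ → ℂ} (hf : ContinuousOn f A) {p : ℂ} (hp : p ∈ A) :
    extendFrom A f p = f p := extendFrom_eq (subset_closure hp) (hf p hp)

/-- Caratheodory: the Riemann map of a Jordan domain extends -/
lemma JD.extend {W : Set ℂ} {c : ℂ → ℂ} (h : JD W c) :
    ∃ ψ φ : ℂ → ℂ, ContinuousOn ψ (closure W) ∧ ContinuousOn φ (closedBall 0 1) ∧
      MapsTo ψ (closure W) (closedBall 0 1) ∧ MapsTo φ (closedBall 0 1) (closure W) ∧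
      MapsTo ψ W (ball 0 1) ∧ MapsTo φ (ball 0 1) W ∧
      (∀ z ∈ closure W, φ (ψ z) = z) ∧ (∀ z ∈ closedBall (0:ℂ) 1, ψ (φ z) = z) := by
  obtain ⟨w₀, hw⟩ := h.conn.nonempty
  obtain ⟨ψ, φ, hψd, hφd, hψm, hφm, h1, h2⟩ := riemann_mapping_pair h.op h.sc h.bd hw
  have hcb : closure (ball (0:ℂ) 1) = closedBall 0 1 := closure_ball _ one_ne_zero
  have hψe : ContinuousOn (extendFrom W ψ) (closure W) := by
    refine continuousOn_extendFrom Subset.rfl fun p hp => ?_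
    by_cases hpW : p ∈ W
    · exact tendsto_of_contOn h.op hψd.continuousOn hpW
    · refine tendsto_of_osc hp fun ε hε => h.osc_psi hψd hφd.continuousOn hψm hφm h1 h2 ?_ hε
      rw [h.op.frontier_eq]; exact ⟨hp, hpW⟩
  have hφe : ContinuousOn (extendFrom (ball 0 1) φ) (closedBall 0 1) := by
    refine continuousOn_extendFrom hcb.ge fun p hp => ?_
    by_cases hpW : p ∈ ball (0:ℂ) 1
    · exact tendsto_of_contOn isOpen_ball hφd.continuousOn hpW
    · refine tendsto_of_osc (hcb.ge hp) fun ε hε => h.osc_phi hψd hφd hψm hφm h1 h2 ?_ hε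
      simp at hp hpW
      linarith
  have eψ : ∀ z ∈ W, extendFrom W ψ z = ψ z := fun z hz => extendFrom_eq_on hψd.continuousOn hz
  have eφ : ∀ z ∈ ball (0:ℂ) 1, extendFrom (ball 0 1) φ z = φ z := fun z hz =>
    extendFrom_eq_on hφd.continuousOn hz
  have m1 : MapsTo (extendFrom W ψ) W (ball 0 1) := fun z hz => by rw [eψ z hz]; exact hψm hz
  have m2 : MapsTo (extendFrom (ball 0 1) φ) (ball 0 1) W := fun z hz => by rw [eφ z hz]; exact hφm hz
  have M1 : MapsTo (extendFrom W ψ) (closure W) (closedBall 0 1) := by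
    rw [← hcb]; exact m1.closure_of_continuousOn hψe
  have M2 : MapsTo (extendFrom (ball 0 1) φ) (closedBall 0 1) (closure W) := by
    have := m2.closure_of_continuousOn (by rw [hcb]; exact hφe)
    rwa [hcb] at this
  refine ⟨_, _, hψe, hφe, M1, M2, m1, m2, ?_, ?_⟩
  · have : EqOn (extendFrom (ball 0 1) φ ∘ extendFrom W ψ) id (closure W) := by
      refine Set.EqOn.of_subset_closure (s := W) ?_ (hφe.comp hψe M1) continuousOn_id subset_closure Subset.rfl
      intro z hz
      simp only [Function.comp, id]
      rw [eφ _ (m1 hz), eψ z hz, h1 z hz]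
    exact this
  · have : EqOn (extendFrom W ψ ∘ extendFrom (ball 0 1) φ) id (closedBall 0 1) := by
      refine Set.EqOn.of_subset_closure (s := ball 0 1) ?_ (hψe.comp hφe M2) continuousOn_id
        ball_subset_closedBall hcb.ge
      intro z hz
      simp only [Function.comp, id]
      rw [eψ _ (m2 hz), eφ z hz, h2 z hz]
    exact this

/-- Schoenflies for Jordan domains -/
theorem JD.schoenflies {W : Set ℂ} {c : ℂ → ℂ} (h : JD W c) :
    ∃ F : ℂ → ℂ, ContinuousOn F (closedBall 0 1) ∧ InjOn F (closedBall 0 1) ∧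
      F '' closedBall 0 1 = closure W ∧ (∀ z ∈ sphere (0:ℂ) 1, F z = c z) ∧ F '' ball 0 1 = W := by
  obtain ⟨ψ, φ, hψ, hφ, M1, M2, m1, m2, h1, h2⟩ := h.extend
  have hcW : ∀ z ∈ sphere (0:ℂ) 1, c z ∈ closure W ∧ c z ∉ W := by
    intro z hz
    have : c z ∈ frontier W := by rw [h.fr]; exact ⟨z, hz, rfl⟩
    rw [h.op.frontier_eq] at this; exact this
  have hκ : ∀ z ∈ sphere (0:ℂ) 1, ‖ψ (c z)‖ = 1 := by
    intro z hz
    have h3 := M1 (hcW z hz).1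
    rw [mem_closedBall, dist_zero_right] at h3
    refine le_antisymm h3 (not_lt.1 fun h4 => ?_)
    have := m2 (show ψ (c z) ∈ ball (0:ℂ) 1 by simpa using h4)
    rw [h1 _ (hcW z hz).1] at this
    exact (hcW z hz).2 this
  -- radial extension
  set K : ℂ → ℂ := fun z => (‖z‖ : ℂ) * ψ (c (z / ‖z‖)) with hK
  have hdir : ∀ z : ℂ, z ≠ 0 → z / ‖z‖ ∈ sphere (0:ℂ) 1 := by
    intro z hz
    simp [hz]
  have hKn : ∀ z, ‖K z‖ = ‖z‖ := by
    intro z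
    by_cases hz : z = 0
    · simp [hK, hz]
    · simp only [hK, norm_mul, hκ _ (hdir z hz), mul_one]; simp
  have hKc : Continuous K := by
    rw [continuous_iff_continuousAt]
    intro z
    by_cases hz : z = 0
    · subst hz
      have h0 : K 0 = 0 := by simp [hK]
      rw [ContinuousAt, h0]
      refine squeeze_zero_norm (fun z => (hKn z).le) ?_
      exact tendsto_norm_zero
    · have hcomp : ContinuousOn (fun z => ψ (c (z / ‖z‖))) {0}ᶜ := by
        refine hψ.comp (h.cont.comp ?_ fun z hz => hdir z hz) fun z hz => (hcW _ (hdir z hz)).1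
        refine ContinuousOn.div continuousOn_id (by fun_prop) ?_
        intro x hx; simpa using hx
      have := hcomp.continuousAt (isOpen_compl_singleton.mem_nhds hz)
      exact (by fun_prop : ContinuousAt (fun z : ℂ => (‖z‖ : ℂ)) z).mul this
  have hKi : Function.Injective K := by
    intro z w hzw
    have hn : ‖z‖ = ‖w‖ := by rw [← hKn z, ← hKn w, hzw]
    by_cases hz : z = 0
    · subst hz; rw [norm_zero] at hn; exact (norm_eq_zero.1 hn.symm).symm
    have hw : w ≠ 0 := by
      rintro rfl; rw [norm_zero] at hn; exact hz (norm_eq_zero.1 hn)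
    have hne : ((‖w‖ : ℝ) : ℂ) ≠ 0 := by simpa using hw
    simp only [hK, hn] at hzw
    have h3 := mul_left_cancel₀ hne hzw
    have hz' := hdir z hz
    rw [hn] at hz'
    have h4 : c (z / ‖w‖) = c (w / ‖w‖) := by
      rw [← h1 _ (hcW _ hz').1, ← h1 _ (hcW _ (hdir w hw)).1, h3]
    have h5 := h.inj hz' (hdir w hw) h4
    field_simp at h5
    exact h5
  have hKsph : K '' sphere 0 1 = sphere 0 1 := by
    apply Subset.antisymm
    · rintro _ ⟨z, hz, rfl⟩
      simpa [hKn] using hz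
    · intro w hw
      have hwn : ‖w‖ = 1 := by simpa using hw
      have hwb : w ∈ closedBall (0:ℂ) 1 := sphere_subset_closedBall hw
      have h3 : φ w ∈ frontier W := by
        rw [h.op.frontier_eq]
        refine ⟨M2 hwb, fun h4 => ?_⟩
        have := m1 h4
        rw [h2 w hwb] at this
        simp [hwn] at this
      rw [h.fr] at h3
      obtain ⟨z, hz, hz2⟩ := h3
      refine ⟨z, hz, ?_⟩
      have hzn : ‖z‖ = 1 := by simpa using hz
      simp only [hK, hzn, ofReal_one, div_one, one_mul, hz2, h2 w hwb]
  have hKsurj : Function.Surjective K := by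
    intro w
    by_cases hw : w = 0
    · exact ⟨0, by simp [hK, hw]⟩
    have hm := hdir w hw
    rw [← hKsph] at hm
    obtain ⟨z, hz, hzw⟩ := hm
    have hzn : ‖z‖ = 1 := by simpa using hz
    have hne : ((‖w‖ : ℝ) : ℂ) ≠ 0 := by simpa using hw
    refine ⟨‖w‖ * z, ?_⟩
    simp only [hK, hzn, ofReal_one, div_one, one_mul] at hzw
    simp only [hK, norm_mul, hzn, mul_one, norm_real, norm_norm]
    rw [mul_div_cancel_left₀ _ hne, hzw, mul_div_cancel₀ _ hne]
  have hKcb : K '' closedBall 0 1 = closedBall 0 1 := by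
    ext w
    obtain ⟨z, rfl⟩ := hKsurj w
    rw [hKi.mem_set_image]; simp [hKn]
  have hKb : K '' ball 0 1 = ball 0 1 := by
    ext w
    obtain ⟨z, rfl⟩ := hKsurj w
    rw [hKi.mem_set_image]; simp [hKn]
  refine ⟨φ ∘ K, hφ.comp hKc.continuousOn (fun z hz => by rw [← hKcb]; exact ⟨z, hz, rfl⟩), ?_, ?_, ?_, ?_⟩
  · intro z hz w hw hzw
    have hz' : K z ∈ closedBall (0:ℂ) 1 := by rw [← hKcb]; exact ⟨z, hz, rfl⟩
    have hw' : K w ∈ closedBall (0:ℂ) 1 := by rw [← hKcb]; exact ⟨w, hw, rfl⟩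
    apply hKi
    rw [← h2 _ hz', ← h2 _ hw']
    exact congrArg ψ hzw
  · rw [image_comp, hKcb]
    exact Subset.antisymm M2.image_subset fun z hz => ⟨ψ z, M1 hz, h1 z hz⟩
  · intro z hz
    have hzn : ‖z‖ = 1 := by simpa using hz
    simp only [hK, Function.comp, hzn, ofReal_one, div_one, one_mul]
    exact h1 _ (hcW z hz).1
  · rw [image_comp, hKb]
    exact Subset.antisymm m2.image_subset fun z hz => ⟨ψ z, m1 hz, h1 z (subset_closure hz)⟩
end P4

section P5
open Set Complex Metric Filter Topology

lemma sc_of_retract {O W : Set ℂ} (hO : IsSimplyConnected O) (hWO : W ⊆ O) (hne : W.Nonempty)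
    (hr : ∀ K : Set ℂ, IsCompact K → K ⊆ W → ∃ r : ℂ → ℂ, ContinuousOn r O ∧ MapsTo r O W ∧ ∀ z ∈ K, r z = z) :
    IsSimplyConnected W := by
  rw [isSimplyConnected_iff_exists_homotopy_refl_forall_mem] at hO ⊢
  obtain ⟨hO1, hO2⟩ := hO
  constructor
  · obtain ⟨x, hx⟩ := hne
    refine ⟨x, hx, fun {y} hy => ?_⟩
    obtain ⟨γ, hγ⟩ := hO1.joinedIn x (hWO hx) y (hWO hy)
    obtain ⟨r, hr1, hr2, hr3⟩ := hr {x, y} (by simp) (by rintro z (rfl | rfl) <;> assumption)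
    refine ⟨⟨⟨fun t => r (γ t), hr1.comp_continuous γ.continuous hγ⟩, ?_, ?_⟩, fun t => hr2 (hγ t)⟩
    · simp [hr3]
    · simp [hr3]
  · intro x p hp
    obtain ⟨F, hF⟩ := hO2 x p (fun t => hWO (hp t))
    obtain ⟨r, hr1, hr2, hr3⟩ := hr (range p) (isCompact_range p.continuous) (by rintro _ ⟨t, rfl⟩; exact hp t)
    have hx : r x = x := hr3 x ⟨0, p.source⟩
    refine ⟨⟨⟨⟨fun t => r (F t), hr1.comp_continuous F.continuous hF⟩, ?_, ?_⟩, ?_⟩, fun t => hr2 (hF t)⟩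
    · intro t
      simp [hr3]
    · intro t; simp [hx]
    · rintro t y (rfl | rfl) <;> simp [hx]

/-- Push lemma: the part of a simply connected open set left of a flat line is simply connected. -/
lemma push_left {O : Set ℂ} (hO : IsOpen O) (hsc : IsSimplyConnected O)
    (hconn : OrdConnected {y : ℝ | (y : ℂ) * I ∈ O}) (hne2 : ∃ y : ℝ, (y : ℂ) * I ∈ O) :
    IsSimplyConnected (O ∩ {z | z.re < 0}) := by
  obtain ⟨y0, hy0⟩ := hne2
  refine sc_of_retract hsc inter_subset_left ?_ ?_
  · obtain ⟨r, hr, hb⟩ := Metric.isOpen_iff.1 hO _ hy0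
    refine ⟨(y0:ℂ) * I - ((r/2 : ℝ) : ℂ), hb ?_, ?_⟩
    · rw [mem_ball, dist_eq_norm]
      have : (y0:ℂ) * I - ((r/2 : ℝ) : ℂ) - y0 * I = - ((r/2 : ℝ) : ℂ) := by ring
      rw [this, norm_neg, norm_real, Real.norm_eq_abs, abs_of_pos (by positivity)]; linarith
    · simp; linarith
  · intro K hK hKW
    -- the Tietze extension
    obtain ⟨g, hg1, hg2⟩ : ∃ g : ℂ → ℝ, ContinuousOn g O ∧ (∀ z ∈ O, ((g z : ℝ) : ℂ) * I ∈ O) ∧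
        True ∧ ∀ z ∈ O, z.re = 0 → g z = z.im := by
      let X : Set O := {z | z.1.re = 0}
      have hX : IsClosed X := isClosed_eq (by fun_prop) (by fun_prop)
      let f : C(X, ℝ) := ⟨fun z => z.1.1.im, by fun_prop⟩
      obtain ⟨g, hg, hgf⟩ := ContinuousMap.exists_extension_forall_mem_of_isClosedEmbedding f
        (t := {y : ℝ | (y : ℂ) * I ∈ O}) (e := Subtype.val) (fun x => by
          have h1 := x.1.2
          have h2 : x.1.1.re = 0 := x.2
          have : x.1.1 = ((x.1.1.im : ℝ) : ℂ) * I := by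
            apply Complex.ext <;> simp [h2]
          change ((x.1.1.im : ℝ) : ℂ) * I ∈ O
          rw [← this]; exact h1) ⟨y0, hy0⟩ hX.isClosedEmbedding_subtypeVal
      classical
      refine ⟨fun z => if h : z ∈ O then g ⟨z, h⟩ else 0, ?_, ?_, trivial, ?_⟩
      · rw [continuousOn_iff_continuous_domRestrict]
        convert! g.continuous using 1
        ext z; simp
      · intro z hz; simp only [hz, dif_pos]; exact hg ⟨z, hz⟩
      · intro z hz h0
        simp only [hz, dif_pos]
        have := congrFun hgf ⟨⟨z, hz⟩, h0⟩
        exact this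
    obtain ⟨hg2, -, hg3⟩ := hg2
    set ρ : ℂ → ℂ := fun z => if z.re ≤ 0 then z else (g z : ℂ) * I with hρ
    have hρc : ContinuousOn ρ O := by
      refine ContinuousOn.if ?_ ?_ ?_
      · rintro z ⟨hz, hzf⟩
        have h0 : z.re = 0 := frontier_le_subset_eq continuous_re continuous_const hzf
        rw [hg3 z hz h0]
        apply Complex.ext <;> simp [h0]
      · exact continuousOn_id
      · refine ContinuousOn.mul ?_ continuousOn_const
        exact continuous_ofReal.comp_continuousOn (hg1.mono inter_subset_left)
    have hρm : ∀ z ∈ O, ρ z ∈ O ∧ (ρ z).re ≤ 0 := by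
      intro z hz
      simp only [hρ]
      split_ifs with h
      · exact ⟨hz, h⟩
      · exact ⟨hg2 z hz, by simp⟩
    -- the push amount
    obtain ⟨δ, hδc, hδ⟩ : ∃ δ : ℂ → ℝ, Continuous δ ∧ ∀ z ∈ O, 0 < δ z ∧ ball z (δ z) ⊆ O := by
      by_cases hO' : Oᶜ.Nonempty
      · refine ⟨fun z => infDist z Oᶜ, continuous_infDist_pt _, fun z hz => ⟨?_, ?_⟩⟩
        · exact (hO.isClosed_compl.notMem_iff_infDist_pos hO').1 (by simpa using hz)
        · intro w hw
          by_contra hwO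
          have := infDist_le_dist_of_mem (x := z) (show w ∈ Oᶜ from hwO)
          rw [mem_ball, dist_comm] at hw
          linarith
      · refine ⟨fun _ => 1, continuous_const, fun z _ => ⟨one_pos, ?_⟩⟩
        rw [not_nonempty_iff_eq_empty, compl_empty_iff] at hO'
        rw [hO']; exact subset_univ _
    set κ : ℂ → ℝ := fun z => if K = ∅ then 1 else infDist z K with hκ
    have hκc : Continuous κ := by
      simp only [hκ]; split_ifs
      · exact continuous_const
      · exact continuous_infDist_pt _
    have hκ0 : ∀ z, 0 ≤ κ z := by
      intro z; simp only [hκ]; split_ifs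
      · exact zero_le_one
      · exact infDist_nonneg
    have hκK : ∀ z ∈ K, κ z = 0 := by
      intro z hz
      have : K ≠ ∅ := by rintro rfl; exact hz
      simp only [hκ, this, if_false]; exact infDist_zero_of_mem hz
    have hκp : ∀ z ∉ K, 0 < κ z := by
      intro z hz
      simp only [hκ]; split_ifs with h
      · exact zero_lt_one
      · exact (hK.isClosed.notMem_iff_infDist_pos (nonempty_iff_ne_empty.2 h)).1 hz
    set ε : ℂ → ℝ := fun z => min (κ z) (δ z / 2) with hε
    have hεc : Continuous ε := by fun_prop
    refine ⟨fun z => ρ z - (ε (ρ z) : ℂ), ?_, ?_, ?_⟩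
    · exact hρc.sub (continuous_ofReal.comp_continuousOn (hεc.comp_continuousOn hρc))
    · intro z hz
      obtain ⟨h1, h2⟩ := hρm z hz
      obtain ⟨h3, h4⟩ := hδ _ h1
      have hε0 : 0 ≤ ε (ρ z) := le_min (hκ0 _) (by linarith)
      refine ⟨h4 ?_, ?_⟩
      · rw [mem_ball, dist_eq_norm, sub_sub_cancel_left, norm_neg, norm_real, Real.norm_eq_abs, abs_of_nonneg hε0]
        exact (min_le_right _ _).trans_lt (by linarith)
      · simp only [mem_ofPred_eq, sub_re, ofReal_re]
        by_cases hzK : ρ z ∈ K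
        · have := (hKW hzK).2
          simp only [mem_ofPred_eq] at this
          linarith
        · have : 0 < ε (ρ z) := lt_min (hκp _ hzK) (by linarith)
          linarith
    · intro z hz
      have h1 : z.re ≤ 0 := le_of_lt (hKW hz).2
      have h2 : ρ z = z := by simp [hρ, h1]
      have h3 : 0 < δ z := (hδ z (hKW hz).1).1
      have h4 : ε z = 0 := by simp only [hε, hκK z hz]; exact min_eq_left (by linarith)
      simp only [h2, h4]; simp

lemma push_right {O : Set ℂ} (hO : IsOpen O) (hsc : IsSimplyConnected O)
    (hconn : OrdConnected {y : ℝ | (y : ℂ) * I ∈ O}) (hne2 : ∃ y : ℝ, (y : ℂ) * I ∈ O) :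
    IsSimplyConnected (O ∩ {z | 0 < z.re}) := by
  let e : ℂ ≃ₜ ℂ := Homeomorph.neg ℂ
  have hmem : ∀ z, z ∈ e '' O ↔ -z ∈ O := by
    intro z
    constructor
    · rintro ⟨w, hw, rfl⟩; simpa [e] using hw
    · intro h; exact ⟨-z, h, by simp [e]⟩
  have h1 := push_left (O := e '' O) (e.isOpenMap _ hO) (by simpa using (e.isSimplyConnected_image).2 hsc)
    (by
      refine ⟨fun a ha b hb x hx => ?_⟩
      simp only [mem_ofPred_eq, hmem] at ha hb ⊢
      have := hconn.out (x := -b) (y := -a) (by simpa using hb) (by simpa using ha) (show -x ∈ Icc (-b) (-a) from ⟨by linarith [hx.2], by linarith [hx.1]⟩)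
      simpa using this)
    (by
      obtain ⟨y, hy⟩ := hne2
      exact ⟨-y, by rw [hmem]; simpa using hy⟩)
  have h2 : O ∩ {z | 0 < z.re} = e '' (e '' O ∩ {z | z.re < 0}) := by
    ext z
    constructor
    · rintro ⟨h3, h4⟩
      exact ⟨-z, ⟨by rw [hmem]; simpa using h3, by simpa using h4⟩, by simp [e]⟩
    · rintro ⟨w, ⟨h3, h4⟩, rfl⟩
      rw [hmem] at h3
      exact ⟨h3, by simpa [e] using h4⟩
  rw [h2]
  exact (e.isSimplyConnected_image).2 h1
end P5

section P5b
open Set Complex Metric Filter Topology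

/-- a chord of the unit disc from -1 to 1 together with its two sides -/
structure ChordCfg (α : ℝ → ℂ) (W1 W2 : Set ℂ) : Prop where
  cont : ContinuousOn α (Icc (-1) 1)
  inj : InjOn α (Icc (-1) 1)
  left : α (-1) = -1
  right : α 1 = 1
  mem : ∀ t ∈ Ioo (-1:ℝ) 1, α t ∈ ball (0:ℂ) 1
  op1 : IsOpen W1
  op2 : IsOpen W2
  sc1 : IsSimplyConnected W1
  sc2 : IsSimplyConnected W2
  disj : Disjoint W1 W2
  union : W1 ∪ W2 = ball 0 1 \ α '' Icc (-1) 1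
  cl1 : ∀ t ∈ Ioo (-1:ℝ) 1, α t ∈ closure W1
  cl2 : ∀ t ∈ Ioo (-1:ℝ) 1, α t ∈ closure W2

variable {α : ℝ → ℂ} {W1 W2 : Set ℂ}

lemma ChordCfg.swap (h : ChordCfg α W1 W2) : ChordCfg α W2 W1 :=
  ⟨h.cont, h.inj, h.left, h.right, h.mem, h.op2, h.op1, h.sc2, h.sc1, h.disj.symm,
    by rw [union_comm]; exact h.union, h.cl2, h.cl1⟩

lemma ChordCfg.compactA (h : ChordCfg α W1 W2) : IsCompact (α '' Icc (-1) 1) :=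
  isCompact_Icc.image_of_continuousOn h.cont

lemma Icc_cases {t : ℝ} (ht : t ∈ Icc (-1:ℝ) 1) : t = -1 ∨ t = 1 ∨ t ∈ Ioo (-1:ℝ) 1 := by
  rcases eq_or_lt_of_le ht.1 with h | h
  · exact Or.inl h.symm
  · rcases eq_or_lt_of_le ht.2 with h' | h'
    · exact Or.inr (Or.inl h')
    · exact Or.inr (Or.inr ⟨h, h'⟩)

lemma ChordCfg.sub1 (h : ChordCfg α W1 W2) : W1 ⊆ ball 0 1 := fun z hz => by
  have : z ∈ W1 ∪ W2 := Or.inl hz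
  rw [h.union] at this; exact this.1

lemma ChordCfg.nA1 (h : ChordCfg α W1 W2) {z : ℂ} (hz : z ∈ W1) : z ∉ α '' Icc (-1) 1 := by
  have : z ∈ W1 ∪ W2 := Or.inl hz
  rw [h.union] at this; exact this.2

lemma sphere_im_zero {z : ℂ} (hz : z ∈ sphere (0:ℂ) 1) (h0 : z.im = 0) : (z = -1 ∧ z.re = -1) ∨ (z = 1 ∧ z.re = 1) := by
  have h1 : ‖z‖ ^ 2 = 1 := by rw [mem_sphere_zero_iff_norm.1 hz]; norm_num
  rw [← normSq_eq_norm_sq, normSq_apply, h0] at h1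
  have h2 : (z.re - 1) * (z.re + 1) = 0 := by linarith
  rcases mul_eq_zero.1 h2 with h | h
  · right; have : z.re = 1 := by linarith
    exact ⟨by apply Complex.ext <;> simp [this, h0], this⟩
  · left; have : z.re = -1 := by linarith
    exact ⟨by apply Complex.ext <;> simp [this, h0], this⟩

lemma ChordCfg.sphereA (h : ChordCfg α W1 W2) {z : ℂ} (hz : z ∈ sphere (0:ℂ) 1) (hA : z ∈ α '' Icc (-1) 1) :
    z.im = 0 := by
  obtain ⟨t, ht, rfl⟩ := hA
  rcases Icc_cases ht with rfl | rfl | ht'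
  · rw [h.left]; simp
  · rw [h.right]; simp
  · have := h.mem t ht'
    simp at hz this; linarith

lemma ChordCfg.pmA (h : ChordCfg α W1 W2) {z : ℂ} (hz : z ∈ sphere (0:ℂ) 1) (h0 : z.im = 0) :
    α z.re = z ∧ z.re ∈ Icc (-1:ℝ) 1 := by
  rcases sphere_im_zero hz h0 with ⟨h1, h2⟩ | ⟨h1, h2⟩
  · rw [h2, h.left, h1]; simp
  · rw [h2, h.right, h1]; simp

lemma ChordCfg.loc (h : ChordCfg α W1 W2) {z : ℂ} (hz : z ∈ sphere (0:ℂ) 1) (h0 : z.im ≠ 0) :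
    (z ∈ closure W1 ∧ z ∉ closure W2) ∨ (z ∈ closure W2 ∧ z ∉ closure W1) := by
  have hzA : z ∈ (α '' Icc (-1) 1)ᶜ := fun hA => h0 (h.sphereA hz hA)
  obtain ⟨r, hr, hb⟩ := Metric.isOpen_iff.1 h.compactA.isClosed.isOpen_compl z hzA
  have hpre : IsPreconnected (ball z r ∩ ball (0:ℂ) 1) := ((convex_ball z r).inter (convex_ball 0 1)).isPreconnected
  have hsub : ball z r ∩ ball (0:ℂ) 1 ⊆ W1 ∪ W2 := fun w hw => by
    rw [h.union]; exact ⟨hw.2, hb hw.1⟩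
  have hzcl : z ∈ closure (ball z r ∩ ball (0:ℂ) 1) := by
    have : z ∈ closure (ball (0:ℂ) 1) := by
      rw [closure_ball _ one_ne_zero]; exact sphere_subset_closedBall hz
    exact isOpen_ball.inter_closure ⟨mem_ball_self hr, this⟩
  have key : ∀ U V : Set ℂ, Disjoint U V → V ⊆ ball 0 1 → ball z r ∩ ball (0:ℂ) 1 ⊆ U →
      z ∈ closure U ∧ z ∉ closure V := by
    intro U V hd hV hU
    refine ⟨closure_mono hU hzcl, fun hcl => ?_⟩
    obtain ⟨w, hw, hwV⟩ := Metric.mem_closure_iff.1 hcl r hr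
    exact disjoint_left.1 hd (hU ⟨by rwa [mem_ball, dist_comm], hV hw⟩) hw
  rcases hpre.subset_or_subset h.op1 h.op2 h.disj hsub with h1 | h1
  · exact Or.inl (key _ _ h.disj h.swap.sub1 h1)
  · exact Or.inr (key _ _ h.disj.symm h.sub1 h1)

/-- open half circle -/
def hcirc (s : ℝ) : Set ℂ := {z | z ∈ sphere (0:ℂ) 1 ∧ 0 < s * z.im}

lemma hcirc_preconn {s : ℝ} (hs : s = 1 ∨ s = -1) : IsPreconnected (hcirc s) := by
  have := arc_preconn 0 ((s:ℂ) * I) (by rcases hs with rfl | rfl <;> simp) one_pos (S := Ioi 0) (isUpperSet_Ioi _)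
  convert! this using 1
  ext z
  simp only [hcirc, mem_ofPred_eq, sub_zero, mem_Ioi, Complex.inner]
  simp [mul_comm]

lemma ChordCfg.half (h : ChordCfg α W1 W2) {s : ℝ} (hs : s = 1 ∨ s = -1) :
    (∀ z ∈ hcirc s, z ∈ closure W1 ∧ z ∉ closure W2) ∨ (∀ z ∈ hcirc s, z ∈ closure W2 ∧ z ∉ closure W1) := by
  have hloc : ∀ z ∈ hcirc s, (z ∈ closure W1 ∧ z ∉ closure W2) ∨ (z ∈ closure W2 ∧ z ∉ closure W1) := by
    rintro z ⟨hz, hz2⟩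
    exact h.loc hz (by intro h0; rw [h0] at hz2; simp at hz2)
  by_contra hcon
  rw [not_or] at hcon
  obtain ⟨h1, h2⟩ := hcon
  push Not at h1 h2
  obtain ⟨a, ha, ha1⟩ := h1
  obtain ⟨b, hb, hb1⟩ := h2
  obtain ⟨x, hx, hx1, hx2⟩ := hcirc_preconn hs (closure W2)ᶜ (closure W1)ᶜ isClosed_closure.isOpen_compl
    isClosed_closure.isOpen_compl (fun z hz => (hloc z hz).imp (fun h => h.2) (fun h => h.2))
    ⟨b, hb, by rcases hloc b hb with h3 | h3; exacts [h3.2, absurd (hb1 h3.1) h3.2]⟩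
    ⟨a, ha, by rcases hloc a ha with h3 | h3; exacts [absurd (ha1 h3.1) h3.2, h3.2]⟩
  rcases hloc x hx with h3 | h3
  · exact hx2 h3.1
  · exact hx1 h3.1

lemma ChordCfg.closure1 (h : ChordCfg α W1 W2) {z : ℂ} (hz : z ∈ closure W1) (hzW : z ∉ W1) :
    z ∈ α '' Icc (-1) 1 ∨ (z ∈ sphere (0:ℂ) 1 ∧ z.im ≠ 0) := by
  by_cases hA : z ∈ α '' Icc (-1) 1
  · exact Or.inl hA
  right
  have hzc : z ∈ closedBall (0:ℂ) 1 := by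
    have := closure_mono h.sub1 hz
    rwa [closure_ball _ one_ne_zero] at this
  have hnb : z ∉ ball (0:ℂ) 1 := by
    intro hb
    have : z ∈ W1 ∪ W2 := by rw [h.union]; exact ⟨hb, hA⟩
    rcases this with h1 | h1
    · exact hzW h1
    · obtain ⟨w, hw1, hw2⟩ := mem_closure_iff.1 hz W2 h.op2 h1
      exact disjoint_left.1 h.disj hw2 hw1
  have hs : z ∈ sphere (0:ℂ) 1 := by
    simp at hzc hnb ⊢; linarith
  refine ⟨hs, fun h0 => hA ?_⟩
  obtain ⟨h1, h2⟩ := h.pmA hs h0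
  exact ⟨_, h2, h1⟩

lemma ChordCfg.notboth (h : ChordCfg α W1 W2) (h1 : ∀ z ∈ hcirc 1, z ∉ closure W2)
    (h2 : ∀ z ∈ hcirc (-1), z ∉ closure W2) : False := by
  obtain ⟨p, hp⟩ := h.sc2.nonempty
  have hfr : frontier W2 ⊆ α '' Icc (-1) 1 := by
    rw [h.op2.frontier_eq]
    rintro z ⟨hz, hzW⟩
    rcases h.swap.closure1 hz hzW with h3 | ⟨h3, h4⟩
    · exact h3
    · rcases lt_or_gt_of_ne h4 with h5 | h5
      · exact absurd hz (h2 z ⟨h3, by linarith⟩)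
      · exact absurd hz (h1 z ⟨h3, by linarith⟩)
  have hA2 : α '' Icc (-1) 1 ⊆ closedBall 0 1 := by
    rintro _ ⟨t, ht, rfl⟩
    rcases Icc_cases ht with rfl | rfl | ht'
    · rw [h.left]; simp
    · rw [h.right]; simp
    · exact ball_subset_closedBall (h.mem t ht')
  have hq : (2:ℂ) ∉ α '' Icc (-1) 1 := fun hh => by
    have := hA2 hh
    simp at this
  have hc := arc_not_separate (by norm_num : (-1:ℝ) ≤ 1) h.cont h.inj (h.swap.nA1 hp) hq
  have hsub : connectedComponentIn (α '' Icc (-1) 1)ᶜ p ⊆ W2 := by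
    refine sub_of_preconn isPreconnected_connectedComponentIn ?_
      ⟨p, mem_connectedComponentIn (h.swap.nA1 hp), hp⟩
    ext z; simp only [mem_inter_iff, mem_empty_iff_false, iff_false, not_and]
    intro h3 h4
    exact connectedComponentIn_subset _ _ h3 (hfr h4)
  have := h.swap.sub1 (hsub hc)
  simp at this

/-- oriented chord -/
structure OC (α : ℝ → ℂ) (W1 W2 : Set ℂ) : Prop extends ChordCfg α W1 W2 where
  up1 : ∀ z ∈ hcirc 1, z ∈ closure W1 ∧ z ∉ closure W2
  dn1 : ∀ z ∈ hcirc (-1), z ∈ closure W2 ∧ z ∉ closure W1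

lemma ChordCfg.orient (h : ChordCfg α W1 W2) : OC α W1 W2 ∨ OC α W2 W1 := by
  rcases h.half (s := 1) (Or.inl rfl) with h1 | h1 <;> rcases h.half (s := -1) (Or.inr rfl) with h2 | h2
  · exact (h.notboth (fun z hz => (h1 z hz).2) (fun z hz => (h2 z hz).2)).elim
  · exact Or.inl ⟨h, h1, h2⟩
  · exact Or.inr ⟨h.swap, h1, h2⟩
  · exact (h.swap.notboth (fun z hz => (h1 z hz).2) (fun z hz => (h2 z hz).2)).elim

open Classical in
noncomputable def capMap (s : ℝ) (α : ℝ → ℂ) (z : ℂ) : ℂ := if 0 ≤ s * z.im then z else α z.re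

lemma re_mem_of_sphere {z : ℂ} (hz : z ∈ sphere (0:ℂ) 1) (h0 : z.im ≠ 0) : z.re ∈ Ioo (-1:ℝ) 1 := by
  have h1 : ‖z‖ ^ 2 = 1 := by rw [mem_sphere_zero_iff_norm.1 hz]; norm_num
  rw [← normSq_eq_norm_sq, normSq_apply] at h1
  have : 0 < z.im * z.im := mul_self_pos.2 h0
  constructor <;> nlinarith

/-- the point of the half circle above/below t -/
noncomputable def lowpt (s t : ℝ) : ℂ := (t : ℂ) - ((s * Real.sqrt (1 - t ^ 2) : ℝ) : ℂ) * I

lemma lowpt_mem {s t : ℝ} (hs : s = 1 ∨ s = -1) (ht : t ∈ Icc (-1:ℝ) 1) : lowpt s t ∈ sphere (0:ℂ) 1 := by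
  have h1 : 0 ≤ 1 - t ^ 2 := by nlinarith [ht.1, ht.2]
  have h2 := Real.mul_self_sqrt h1
  have h3 : normSq (lowpt s t) = 1 := by
    rw [normSq_apply]
    rcases hs with rfl | rfl <;> simp [lowpt] <;> nlinarith
  rw [mem_sphere_zero_iff_norm]
  rw [normSq_eq_norm_sq] at h3
  have := norm_nonneg (lowpt s t)
  nlinarith

lemma ChordCfg.cap_low (h : ChordCfg α W1 W2) {s t : ℝ} (hs : s = 1 ∨ s = -1) (ht : t ∈ Icc (-1:ℝ) 1) :
    capMap s α (lowpt s t) = α t := by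
  have hre : (lowpt s t).re = t := by simp [lowpt]
  have him : s * (lowpt s t).im = - Real.sqrt (1 - t ^ 2) := by
    rcases hs with rfl | rfl <;> simp [lowpt]
  have h1 : 0 ≤ 1 - t ^ 2 := by nlinarith [ht.1, ht.2]
  unfold capMap
  split_ifs with h0
  · rw [him] at h0
    have h2 : Real.sqrt (1 - t^2) = 0 := le_antisymm (by linarith) (Real.sqrt_nonneg _)
    have h3 : (lowpt s t).im = 0 := by simp [lowpt, h2]
    have := (h.pmA (lowpt_mem hs ht) h3).1
    rw [hre] at this; exact this.symm
  · rw [hre]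

lemma ChordCfg.jd (h : ChordCfg α W1 W2) {s : ℝ} (hs : s = 1 ∨ s = -1)
    (h1 : ∀ z ∈ hcirc s, z ∈ closure W1) (h2 : ∀ z ∈ hcirc (-s), z ∉ closure W1) : JD W1 (capMap s α) := by
  have hs0 : s ≠ 0 := by rcases hs with rfl | rfl <;> norm_num
  have hAcl : α '' Icc (-1) 1 ⊆ closure W1 := by
    have hc : closure (Ioo (-1:ℝ) 1) = Icc (-1) 1 := closure_Ioo (by norm_num)
    rw [← hc]
    refine (ContinuousOn.image_closure (by rw [hc]; exact h.cont)).trans ?_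
    refine closure_minimal ?_ isClosed_closure
    rintro _ ⟨t, ht, rfl⟩; exact h.cl1 t ht
  refine ⟨h.op1, h.sc1, isBounded_ball.subset h.sub1, ?_, ?_, ?_⟩
  · rw [h.op1.frontier_eq]
    apply Subset.antisymm
    · rintro z ⟨hz, hzW⟩
      rcases h.closure1 hz hzW with ⟨t, ht, rfl⟩ | ⟨h3, h4⟩
      · exact ⟨lowpt s t, lowpt_mem hs ht, h.cap_low hs ht⟩
      · refine ⟨z, h3, ?_⟩
        rw [capMap, if_pos]
        by_contra h5
        exact h2 z ⟨h3, by linarith⟩ hz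
    · rintro _ ⟨z, hz, rfl⟩
      have hnW : z ∉ W1 := fun hh => by
        have := h.sub1 hh
        simp at hz this; linarith
      have hAA : z.re ∈ Icc (-1:ℝ) 1 → α z.re ∈ closure W1 \ W1 := fun hh =>
        ⟨hAcl ⟨_, hh, rfl⟩, fun h5 => h.nA1 h5 ⟨_, hh, rfl⟩⟩
      unfold capMap
      split_ifs with h0
      · rcases eq_or_lt_of_le h0 with h3 | h3
        · have h4 : z.im = 0 := by
            rcases mul_eq_zero.1 h3.symm with h5 | h5
            · exact absurd h5 hs0
            · exact h5
          obtain ⟨h5, h6⟩ := h.pmA hz h4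
          have := hAA h6
          rwa [h5] at this
        · exact ⟨h1 z ⟨hz, h3⟩, hnW⟩
      · exact hAA (Ioo_subset_Icc_self (re_mem_of_sphere hz (by intro h5; apply h0; rw [h5]; simp)))
  · unfold capMap
    refine ContinuousOn.if ?_ ?_ ?_
    · rintro z ⟨hz, hzf⟩
      have h0 : 0 = s * z.im := frontier_le_subset_eq (f := fun _ : ℂ => (0:ℝ)) (g := fun z : ℂ => s * z.im) continuous_const (by fun_prop) hzf
      have h4 : z.im = 0 := by
        rcases mul_eq_zero.1 h0.symm with h5 | h5
        · exact absurd h5 hs0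
        · exact h5
      exact (h.pmA hz h4).1.symm
    · exact continuousOn_id
    · refine h.cont.comp continuous_re.continuousOn ?_
      rintro z ⟨hz, -⟩
      by_cases h4 : z.im = 0
      · exact (h.pmA hz h4).2
      · exact Ioo_subset_Icc_self (re_mem_of_sphere hz h4)
  · have hmix : ∀ z ∈ sphere (0:ℂ) 1, ∀ w ∈ sphere (0:ℂ) 1, ¬ 0 ≤ s * w.im → z ≠ α w.re := by
      intro z hz w hw hw0 he
      have := h.mem _ (re_mem_of_sphere hw (by intro h5; apply hw0; rw [h5]; simp))
      rw [← he] at this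
      simp at hz this; linarith
    intro z hz w hw hzw
    unfold capMap at hzw
    split_ifs at hzw with h3 h4 h4
    · exact hzw
    · exact absurd hzw (hmix z hz w hw h4)
    · exact absurd hzw.symm (hmix w hw z hz h3)
    · have hz0 : z.im ≠ 0 := by intro h5; apply h3; rw [h5]; simp
      have hw0 : w.im ≠ 0 := by intro h5; apply h4; rw [h5]; simp
      have hre := h.inj (Ioo_subset_Icc_self (re_mem_of_sphere hz hz0)) (Ioo_subset_Icc_self (re_mem_of_sphere hw hw0)) hzw
      have e1 : ‖z‖ ^ 2 = 1 := by rw [mem_sphere_zero_iff_norm.1 hz]; norm_num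
      have e2 : ‖w‖ ^ 2 = 1 := by rw [mem_sphere_zero_iff_norm.1 hw]; norm_num
      rw [← normSq_eq_norm_sq, normSq_apply] at e1 e2
      have e3 : (z.im - w.im) * (z.im + w.im) = 0 := by rw [hre] at e1; linarith
      rcases mul_eq_zero.1 e3 with e4 | e4
      · exact Complex.ext hre (by linarith)
      · exfalso
        have : s * z.im = -(s * w.im) := by rw [show z.im = -w.im by linarith]; ring
        linarith

lemma OC.jd1 (h : OC α W1 W2) : JD W1 (capMap 1 α) :=
  h.toChordCfg.jd (Or.inl rfl) (fun z hz => (h.up1 z hz).1) (fun z hz => (h.dn1 z hz).2)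

lemma OC.jd2 (h : OC α W1 W2) : JD W2 (capMap (-1) α) :=
  h.toChordCfg.swap.jd (Or.inr rfl) (fun z hz => (h.dn1 z hz).1) (fun z hz => (h.up1 z (by simpa using hz)).2)

lemma OC.inter (h : OC α W1 W2) {z : ℂ} (h1 : z ∈ closure W1) (h2 : z ∈ closure W2) : z ∈ α '' Icc (-1) 1 := by
  have hz1 : z ∉ W1 := fun hz => by
    obtain ⟨w, hw1, hw2⟩ := mem_closure_iff.1 h2 W1 h.op1 hz
    exact disjoint_left.1 h.disj hw1 hw2
  rcases h.toChordCfg.closure1 h1 hz1 with h3 | ⟨h3, h4⟩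
  · exact h3
  · rcases h.toChordCfg.loc h3 h4 with h5 | h5
    · exact absurd h2 h5.2
    · exact absurd h1 h5.2

lemma OC.cover (h : OC α W1 W2) {z : ℂ} (hz : z ∈ closedBall (0:ℂ) 1) : z ∈ closure W1 ∨ z ∈ closure W2 := by
  have hA : ∀ t ∈ Icc (-1:ℝ) 1, α t ∈ closure W1 := by
    intro t ht
    have : α t ∈ frontier W1 := by
      rw [h.jd1.fr]; exact ⟨lowpt 1 t, lowpt_mem (Or.inl rfl) ht, h.toChordCfg.cap_low (Or.inl rfl) ht⟩
    exact frontier_subset_closure this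
  by_cases hzA : z ∈ α '' Icc (-1) 1
  · obtain ⟨t, ht, rfl⟩ := hzA; exact Or.inl (hA t ht)
  by_cases hb : z ∈ ball (0:ℂ) 1
  · have : z ∈ W1 ∪ W2 := by rw [h.union]; exact ⟨hb, hzA⟩
    exact this.imp (fun h => subset_closure h) (fun h => subset_closure h)
  · have hs : z ∈ sphere (0:ℂ) 1 := by simp at hz hb ⊢; linarith
    have h0 : z.im ≠ 0 := fun h0 => hzA ⟨_, (h.toChordCfg.pmA hs h0).2, (h.toChordCfg.pmA hs h0).1⟩
    exact (h.toChordCfg.loc hs h0).imp (fun h => h.1) (fun h => h.1)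

lemma OC.closure_sub1 (h : OC α W1 W2) {z : ℂ} (hz : z ∈ closure W1) (hb : z ∉ ball (0:ℂ) 1) :
    z ∈ sphere (0:ℂ) 1 ∧ 0 ≤ z.im := by
  have hzc := closure_mono h.toChordCfg.sub1 hz
  rw [closure_ball _ one_ne_zero] at hzc
  have hs : z ∈ sphere (0:ℂ) 1 := by simp at hzc hb ⊢; linarith
  refine ⟨hs, not_lt.1 fun h0 => (h.dn1 z ⟨hs, by linarith⟩).2 hz⟩

lemma OC.closure_sub2 (h : OC α W1 W2) {z : ℂ} (hz : z ∈ closure W2) (hb : z ∉ ball (0:ℂ) 1) :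
    z ∈ sphere (0:ℂ) 1 ∧ z.im ≤ 0 := by
  have hzc := closure_mono h.toChordCfg.swap.sub1 hz
  rw [closure_ball _ one_ne_zero] at hzc
  have hs : z ∈ sphere (0:ℂ) 1 := by simp at hzc hb ⊢; linarith
  refine ⟨hs, not_lt.1 fun h0 => (h.up1 z ⟨hs, by linarith⟩).2 hz⟩
end P5b

section P5c
open Set Complex Metric Filter Topology

lemma JD.matchMap {W V : Set ℂ} {c d : ℂ → ℂ} (hW : JD W c) (hV : JD V d) :
    ∃ H H' : ℂ → ℂ, ContinuousOn H (closure W) ∧ ContinuousOn H' (closure V) ∧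
      MapsTo H (closure W) (closure V) ∧ MapsTo H' (closure V) (closure W) ∧
      (∀ z ∈ closure W, H' (H z) = z) ∧ (∀ z ∈ closure V, H (H' z) = z) ∧
      (∀ z ∈ sphere (0:ℂ) 1, H (c z) = d z) ∧ (∀ z ∈ sphere (0:ℂ) 1, H' (d z) = c z) := by
  obtain ⟨F, hFc, hFi, hFI, hFs, -⟩ := hW.schoenflies
  obtain ⟨E, hEc, hEi, hEI, hEs, -⟩ := hV.schoenflies
  have hK : IsCompact (closedBall (0:ℂ) 1) := isCompact_closedBall _ _
  have hF' := continuousOn_invFunOn_of_compact hK hFc hFi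
  have hE' := continuousOn_invFunOn_of_compact hK hEc hEi
  rw [hFI] at hF'
  rw [hEI] at hE'
  have hFl : ∀ z ∈ closedBall (0:ℂ) 1, Function.invFunOn F (closedBall 0 1) (F z) = z := fun z hz =>
    hFi.leftInvOn_invFunOn hz
  have hEl : ∀ z ∈ closedBall (0:ℂ) 1, Function.invFunOn E (closedBall 0 1) (E z) = z := fun z hz =>
    hEi.leftInvOn_invFunOn hz
  have hFr : ∀ z ∈ closure W, ∃ w ∈ closedBall (0:ℂ) 1, F w = z := fun z hz => by
    rw [← hFI] at hz; exact hz
  have hEr : ∀ z ∈ closure V, ∃ w ∈ closedBall (0:ℂ) 1, E w = z := fun z hz => by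
    rw [← hEI] at hz; exact hz
  have hFm : MapsTo (Function.invFunOn F (closedBall 0 1)) (closure W) (closedBall 0 1) := fun z hz => by
    obtain ⟨w, hw, rfl⟩ := hFr z hz; rw [hFl w hw]; exact hw
  have hEm : MapsTo (Function.invFunOn E (closedBall 0 1)) (closure V) (closedBall 0 1) := fun z hz => by
    obtain ⟨w, hw, rfl⟩ := hEr z hz; rw [hEl w hw]; exact hw
  refine ⟨fun z => E (Function.invFunOn F (closedBall 0 1) z), fun z => F (Function.invFunOn E (closedBall 0 1) z),
    hEc.comp hF' hFm, hFc.comp hE' hEm, ?_, ?_, ?_, ?_, ?_, ?_⟩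
  · intro z hz; rw [← hEI]; exact ⟨_, hFm hz, rfl⟩
  · intro z hz; rw [← hFI]; exact ⟨_, hEm hz, rfl⟩
  · intro z hz; obtain ⟨w, hw, rfl⟩ := hFr z hz; simp only [hFl w hw, hEl w hw]
  · intro z hz; obtain ⟨w, hw, rfl⟩ := hEr z hz; simp only [hFl w hw, hEl w hw]
  · intro z hz
    have hz' := sphere_subset_closedBall hz
    simp only [← hFs z hz, hFl z hz', hEs z hz]
  · intro z hz
    have hz' := sphere_subset_closedBall hz
    simp only [← hEs z hz, hEl z hz', hFs z hz]

open Classical in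
noncomputable def gl (W1 W2 : Set ℂ) (H1 H2 : ℂ → ℂ) (z : ℂ) : ℂ :=
  if z ∈ closure W1 then H1 z else if z ∈ closure W2 then H2 z else z

variable {α β : ℝ → ℂ} {W1 W2 V1 V2 : Set ℂ}

lemma gl_1 {H1 H2 : ℂ → ℂ} {z : ℂ} (hz : z ∈ closure W1) : gl W1 W2 H1 H2 z = H1 z := by
  simp [gl, hz]

lemma gl_2 (h : OC α W1 W2) (h' : OC β V1 V2) {H1 H2 : ℂ → ℂ}
    (hH1 : ∀ z ∈ sphere (0:ℂ) 1, H1 (capMap 1 α z) = capMap 1 β z)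
    (hH2 : ∀ z ∈ sphere (0:ℂ) 1, H2 (capMap (-1) α z) = capMap (-1) β z)
    {z : ℂ} (hz : z ∈ closure W2) : gl W1 W2 H1 H2 z = H2 z := by
  by_cases hz1 : z ∈ closure W1
  · rw [gl_1 hz1]
    obtain ⟨t, ht, rfl⟩ := h.inter hz1 hz
    have e1 := hH1 _ (lowpt_mem (Or.inl rfl) ht)
    have e2 := hH2 _ (lowpt_mem (Or.inr rfl) ht)
    rw [h.toChordCfg.cap_low (Or.inl rfl) ht, h'.toChordCfg.cap_low (Or.inl rfl) ht] at e1
    rw [h.toChordCfg.cap_low (Or.inr rfl) ht, h'.toChordCfg.cap_low (Or.inr rfl) ht] at e2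
    rw [e1, e2]
  · simp [gl, hz, hz1]

lemma gl_3 (h : OC α W1 W2) {H1 H2 : ℂ → ℂ}
    (hH1 : ∀ z ∈ sphere (0:ℂ) 1, H1 (capMap 1 α z) = capMap 1 β z)
    (hH2 : ∀ z ∈ sphere (0:ℂ) 1, H2 (capMap (-1) α z) = capMap (-1) β z)
    {z : ℂ} (hz : z ∉ ball (0:ℂ) 1) : gl W1 W2 H1 H2 z = z := by
  unfold gl
  split_ifs with h1 h2
  · obtain ⟨h3, h4⟩ := h.closure_sub1 h1 hz
    have := hH1 z h3
    simpa [capMap, h4] using this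
  · obtain ⟨h3, h4⟩ := h.closure_sub2 h2 hz
    have := hH2 z h3
    simpa [capMap, h4] using this
  · rfl

lemma gl_cont (h : OC α W1 W2) (h' : OC β V1 V2) {H1 H2 : ℂ → ℂ}
    (hc1 : ContinuousOn H1 (closure W1)) (hc2 : ContinuousOn H2 (closure W2))
    (hH1 : ∀ z ∈ sphere (0:ℂ) 1, H1 (capMap 1 α z) = capMap 1 β z)
    (hH2 : ∀ z ∈ sphere (0:ℂ) 1, H2 (capMap (-1) α z) = capMap (-1) β z) :
    Continuous (gl W1 W2 H1 H2) := by
  have a1 : ContinuousOn (gl W1 W2 H1 H2) (closure W1) := hc1.congr fun z hz => gl_1 hz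
  have a2 : ContinuousOn (gl W1 W2 H1 H2) (closure W2) := hc2.congr fun z hz => gl_2 h h' hH1 hH2 hz
  have a3 : ContinuousOn (gl W1 W2 H1 H2) (ball 0 1)ᶜ := continuousOn_id.congr fun z hz => gl_3 h hH1 hH2 hz
  have := (a1.union_of_isClosed a2 isClosed_closure isClosed_closure).union_of_isClosed a3
    (isClosed_closure.union isClosed_closure) isOpen_ball.isClosed_compl
  rw [← continuousOn_univ]
  convert this using 1
  symm
  rw [eq_univ_iff_forall]
  intro z
  by_cases hz : z ∈ ball (0:ℂ) 1
  · exact Or.inl (h.cover (ball_subset_closedBall hz))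
  · exact Or.inr hz

lemma gl_inv (h : OC α W1 W2) (h' : OC β V1 V2) {H1 H2 H1' H2' : ℂ → ℂ}
    (hm1 : MapsTo H1 (closure W1) (closure V1)) (hm2 : MapsTo H2 (closure W2) (closure V2))
    (hH1 : ∀ z ∈ sphere (0:ℂ) 1, H1 (capMap 1 α z) = capMap 1 β z)
    (hH2 : ∀ z ∈ sphere (0:ℂ) 1, H2 (capMap (-1) α z) = capMap (-1) β z)
    (hH1' : ∀ z ∈ sphere (0:ℂ) 1, H1' (capMap 1 β z) = capMap 1 α z)
    (hH2' : ∀ z ∈ sphere (0:ℂ) 1, H2' (capMap (-1) β z) = capMap (-1) α z)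
    (hi1 : ∀ z ∈ closure W1, H1' (H1 z) = z) (hi2 : ∀ z ∈ closure W2, H2' (H2 z) = z) (z : ℂ) :
    gl V1 V2 H1' H2' (gl W1 W2 H1 H2 z) = z := by
  by_cases hz : z ∈ ball (0:ℂ) 1
  · rcases h.cover (ball_subset_closedBall hz) with h1 | h1
    · rw [gl_1 h1, gl_1 (hm1 h1), hi1 z h1]
    · rw [gl_2 h h' hH1 hH2 h1, gl_2 h' h hH1' hH2' (hm2 h1), hi2 z h1]
  · rw [gl_3 h hH1 hH2 hz, gl_3 h' hH1' hH2' hz]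

theorem OC.cl (h : OC α W1 W2) (h' : OC β V1 V2) :
    ∃ Ψ : ℂ ≃ₜ ℂ, (∀ z ∉ ball (0:ℂ) 1, Ψ z = z) ∧ ∀ t ∈ Icc (-1:ℝ) 1, Ψ (α t) = β t := by
  obtain ⟨H1, H1', c1, c1', m1, m1', i1, i1', e1, e1'⟩ := h.jd1.matchMap h'.jd1
  obtain ⟨H2, H2', c2, c2', m2, m2', i2, i2', e2, e2'⟩ := h.jd2.matchMap h'.jd2
  refine ⟨⟨⟨gl W1 W2 H1 H2, gl V1 V2 H1' H2', gl_inv h h' m1 m2 e1 e2 e1' e2' i1 i2,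
    gl_inv h' h m1' m2' e1' e2' e1 e2 i1' i2'⟩, gl_cont h h' c1 c2 e1 e2, gl_cont h' h c1' c2' e1' e2'⟩,
    fun z hz => gl_3 h e1 e2 hz, ?_⟩
  intro t ht
  have hl := lowpt_mem (s := 1) (Or.inl rfl) ht
  have hA : α t ∈ closure W1 := by
    have : α t ∈ frontier W1 := by
      rw [h.jd1.fr]; exact ⟨lowpt 1 t, hl, h.toChordCfg.cap_low (Or.inl rfl) ht⟩
    exact frontier_subset_closure this
  have := e1 _ hl
  rw [h.toChordCfg.cap_low (Or.inl rfl) ht, h'.toChordCfg.cap_low (Or.inl rfl) ht] at this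
  exact (gl_1 hA).trans this

lemma convex_sc {s : Set ℂ} (hs : Convex ℝ s) (hne : s.Nonempty) : IsSimplyConnected s := by
  have := hs.contractibleSpace hne
  exact SimplyConnectedSpace.ofContractible s

lemma std_half_convex (s : ℝ) : Convex ℝ (ball (0:ℂ) 1 ∩ {z | 0 < s * z.im}) := by
  refine (convex_ball _ _).inter ?_
  intro x hx y hy a b ha hb hab
  simp only [Set.mem_ofPred_eq, add_im, real_smul, mul_im, ofReal_re, ofReal_im, zero_mul, add_zero] at *
  rcases eq_or_lt_of_le ha with h | h
  · have : b = 1 := by linarith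
    rw [← h, this]; linarith
  · nlinarith [mul_pos h hx, mul_nonneg hb hy.le]

lemma std_half_ne (s : ℝ) (hs : s = 1 ∨ s = -1) : (ball (0:ℂ) 1 ∩ {z | 0 < s * z.im}).Nonempty := by
  refine ⟨((s/2 : ℝ) : ℂ) * I, ?_, ?_⟩
  · rcases hs with rfl | rfl <;> simp <;> norm_num
  · rcases hs with rfl | rfl <;> simp; norm_num

lemma std_half_closure {s : ℝ} (hs : s = 1 ∨ s = -1) {z : ℂ} (hz : ‖z‖ ≤ 1) (hs' : 0 ≤ s * z.im) :
    z ∈ closure (ball (0:ℂ) 1 ∩ {z | 0 < s * z.im}) := by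
  have hs2 : s * s = 1 := by rcases hs with rfl | rfl <;> norm_num
  have hs3 : |s| = 1 := by rcases hs with rfl | rfl <;> norm_num
  have hlim : Tendsto (fun e : ℝ => (((1 - e : ℝ)) : ℂ) * z + ((e * s / 2 : ℝ) : ℂ) * I) (𝓝[>] 0) (𝓝 z) := by
    have : Continuous (fun e : ℝ => (((1 - e : ℝ)) : ℂ) * z + ((e * s / 2 : ℝ) : ℂ) * I) := by fun_prop
    have h2 := this.tendsto 0
    have h3 : (fun e : ℝ => (((1 - e : ℝ)) : ℂ) * z + ((e * s / 2 : ℝ) : ℂ) * I) 0 = z := by simp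
    replace h2 := h2.trans (le_of_eq (congrArg 𝓝 h3))
    exact Tendsto.mono_left h2 nhdsWithin_le_nhds
  refine mem_closure_of_tendsto hlim ?_
  have : Ioo (0:ℝ) 1 ∈ 𝓝[>] (0:ℝ) := Ioo_mem_nhdsGT (by norm_num)
  filter_upwards [this] with e he
  constructor
  · rw [mem_ball_zero_iff]
    calc _ ≤ ‖(((1 - e : ℝ)) : ℂ) * z‖ + ‖((e * s / 2 : ℝ) : ℂ) * I‖ := norm_add_le _ _
      _ = (1 - e) * ‖z‖ + e / 2 := by
        rw [norm_mul, norm_mul, Complex.norm_real, Complex.norm_real, Complex.norm_I, Real.norm_eq_abs, Real.norm_eq_abs,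
          abs_of_pos (by linarith [he.2]), abs_div, abs_mul, hs3, abs_of_pos he.1]; norm_num
      _ < 1 := by nlinarith [he.1, he.2]
  · simp only [Set.mem_ofPred_eq, add_im, mul_im, ofReal_re, ofReal_im, I_re, I_im]
    nlinarith [he.1, he.2, mul_nonneg (sub_nonneg.2 he.2.le) hs']

lemma ofReal_image : (fun t : ℝ => (t:ℂ)) '' Icc (-1) 1 = closedBall (0:ℂ) 1 ∩ {z | z.im = 0} := by
  ext z
  constructor
  · rintro ⟨t, ht, rfl⟩
    refine ⟨?_, by simp⟩
    simp [abs_le]; exact ht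
  · rintro ⟨h1, h2⟩
    have h3 : z = (z.re : ℂ) := Complex.ext (by simp) (by simpa using h2)
    refine ⟨z.re, ?_, h3.symm⟩
    rw [mem_closedBall_zero_iff, h3, Complex.norm_real, Real.norm_eq_abs, abs_le] at h1
    exact h1

lemma std_OC : OC (fun t : ℝ => (t:ℂ)) (ball (0:ℂ) 1 ∩ {z | 0 < (1:ℝ) * z.im}) (ball (0:ℂ) 1 ∩ {z | 0 < (-1:ℝ) * z.im}) where
  cont := by fun_prop
  inj := fun a _ b _ hab => by simpa using hab
  left := by simp
  right := by simp
  mem := fun t ht => by simp [abs_lt]; exact ht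
  op1 := isOpen_ball.inter (isOpen_lt continuous_const (by fun_prop))
  op2 := isOpen_ball.inter (isOpen_lt continuous_const (by fun_prop))
  sc1 := convex_sc (std_half_convex _) (std_half_ne _ (Or.inl rfl))
  sc2 := convex_sc (std_half_convex _) (std_half_ne _ (Or.inr rfl))
  disj := by
    rw [Set.disjoint_left]
    rintro z ⟨_, h1⟩ ⟨_, h2⟩
    simp only [Set.mem_ofPred_eq] at h1 h2
    linarith
  union := by
    rw [ofReal_image]
    ext z
    simp only [mem_union, mem_inter_iff, Set.mem_ofPred_eq, Set.mem_sdiff, not_and]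
    constructor
    · rintro (⟨h1, h2⟩ | ⟨h1, h2⟩)
      · exact ⟨h1, fun _ => by intro h; rw [h] at h2; simp at h2⟩
      · exact ⟨h1, fun _ => by intro h; rw [h] at h2; simp at h2⟩
    · rintro ⟨h1, h2⟩
      rcases lt_or_gt_of_ne (h2 (ball_subset_closedBall h1)) with h | h
      · exact Or.inr ⟨h1, by linarith⟩
      · exact Or.inl ⟨h1, by linarith⟩
  cl1 := fun t ht => std_half_closure (Or.inl rfl) (by simp [abs_le]; exact ⟨ht.1.le, ht.2.le⟩) (by simp)
  cl2 := fun t ht => std_half_closure (Or.inr rfl) (by simp [abs_le]; exact ⟨ht.1.le, ht.2.le⟩) (by simp)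
  up1 := by
    rintro z ⟨h1, h2⟩
    refine ⟨std_half_closure (Or.inl rfl) (by simpa using h1.le) h2.le, fun h => ?_⟩
    have hc : IsClosed {z : ℂ | 0 ≤ (-1:ℝ) * z.im} := isClosed_le continuous_const (by fun_prop)
    have := closure_minimal (fun w hw => (by exact hw.2.le : (0:ℝ) ≤ (-1:ℝ) * w.im)) hc h
    simp only [Set.mem_ofPred_eq] at this
    linarith
  dn1 := by
    rintro z ⟨h1, h2⟩
    refine ⟨std_half_closure (Or.inr rfl) (by simpa using h1.le) h2.le, fun h => ?_⟩
    have hc : IsClosed {z : ℂ | 0 ≤ (1:ℝ) * z.im} := isClosed_le continuous_const (by fun_prop)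
    have := closure_minimal (fun w hw => (by exact hw.2.le : (0:ℝ) ≤ (1:ℝ) * w.im)) hc h
    simp only [Set.mem_ofPred_eq] at this
    linarith

theorem ChordCfg.cl (h : ChordCfg α W1 W2) :
    ∃ Ψ : ℂ ≃ₜ ℂ, (∀ z ∉ ball (0:ℂ) 1, Ψ z = z) ∧ ∀ t ∈ Icc (-1:ℝ) 1, Ψ (α t) = t := by
  rcases h.orient with h | h
  · exact h.cl std_OC
  · exact h.cl std_OC
end P5c

section P6
open Set Filter Topology

/-- graph of a function -/
def gr (f : ℝ → ℝ) : Set (ℝ × ℝ) := {p | p.2 = f p.1}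

lemma fiberHomeo (Y : ℝ → ℝ → ℝ) (hc : Continuous (fun p : ℝ × ℝ => Y p.1 p.2))
    (hm : ∀ x, StrictMono (Y x)) (hs : ∀ x, Function.Surjective (Y x)) :
    ∃ Φ : (ℝ × ℝ) ≃ₜ (ℝ × ℝ), ∀ x y, Φ (x, y) = (x, Y x y) := by
  choose Z hZ using hs
  have hZ' : ∀ x y, Z x (Y x y) = y := fun x y => (hm x).injective (hZ x (Y x y))
  have hcZ : Continuous (fun p : ℝ × ℝ => Z p.1 p.2) := by
    rw [continuous_iff_continuousAt]
    rintro ⟨x0, z0⟩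
    rw [ContinuousAt, tendsto_order]
    constructor
    · intro c hc0
      have h1 : Y x0 c < z0 := by rw [← hZ x0 z0]; exact hm x0 hc0
      have h2 : Continuous (fun p : ℝ × ℝ => Y p.1 c) :=
        hc.comp (continuous_fst.prodMk continuous_const)
      filter_upwards [(isOpen_lt h2 continuous_snd).mem_nhds h1] with p hp
      have hp : Y p.1 c < p.2 := hp
      rw [← hZ p.1 p.2] at hp
      exact (hm p.1).lt_iff_lt.1 hp
    · intro c hc0
      have h1 : z0 < Y x0 c := by rw [← hZ x0 z0]; exact hm x0 hc0
      have h2 : Continuous (fun p : ℝ × ℝ => Y p.1 c) :=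
        hc.comp (continuous_fst.prodMk continuous_const)
      filter_upwards [(isOpen_lt continuous_snd h2).mem_nhds h1] with p hp
      have hp : p.2 < Y p.1 c := hp
      rw [← hZ p.1 p.2] at hp
      exact (hm p.1).lt_iff_lt.1 hp
  exact ⟨⟨⟨fun p => (p.1, Y p.1 p.2), fun p => (p.1, Z p.1 p.2), fun p => by simp [hZ'], fun p => by simp [hZ]⟩,
    continuous_fst.prodMk hc, continuous_fst.prodMk hcZ⟩, fun x y => rfl⟩

/-- clamp to [0,1] -/
noncomputable def cl01 (t : ℝ) : ℝ := max 0 (min t 1)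

lemma cl01_nonneg (t : ℝ) : 0 ≤ cl01 t := le_max_left _ _
lemma cl01_le (t : ℝ) : cl01 t ≤ 1 := max_le zero_le_one (min_le_right _ _)
lemma cl01_mono : Monotone cl01 := fun a b h => max_le_max le_rfl (min_le_min h le_rfl)
lemma cl01_cont : Continuous cl01 := by unfold cl01; fun_prop
lemma cl01_of_le {t : ℝ} (h : t ≤ 0) : cl01 t = 0 := by
  unfold cl01; rw [max_eq_left]; exact (min_le_left _ _).trans h
lemma cl01_of_ge {t : ℝ} (h : 1 ≤ t) : cl01 t = 1 := by
  unfold cl01; rw [min_eq_right h]; exact max_eq_right zero_le_one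
lemma cl01_of_mem {t : ℝ} (h : 0 ≤ t) (h' : t ≤ 1) : cl01 t = t := by
  unfold cl01; rw [min_eq_left h']; exact max_eq_right h

noncomputable def tm (a b c d y : ℝ) : ℝ := (d - c) * cl01 ((y - a) / (b - a))

lemma tm_low {a b c d y : ℝ} (hab : a ≤ b) (hy : y ≤ a) : tm a b c d y = 0 := by
  unfold tm
  rw [cl01_of_le (div_nonpos_of_nonpos_of_nonneg (by linarith) (by linarith)), mul_zero]

lemma tm_high {a b c d y : ℝ} (hab : a ≤ b) (hcd : a = b → c = d) (hy : b ≤ y) : tm a b c d y = d - c := by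
  unfold tm
  rcases eq_or_lt_of_le hab with h | h
  · rw [hcd h]; simp
  · rw [cl01_of_ge ((one_le_div (by linarith)).2 (by linarith)), mul_one]

lemma tm_mono {a b c d : ℝ} (hab : a ≤ b) (hcd : c ≤ d) : Monotone (tm a b c d) := by
  intro y y' h
  unfold tm
  refine mul_le_mul_of_nonneg_left (cl01_mono ?_) (by linarith)
  exact div_le_div_of_nonneg_right (by linarith) (by linarith)

lemma tm_strict {a b c d y y' : ℝ} (hab : a < b) (hcd : c < d) (h1 : a ≤ y) (h2 : y < b) (h : y < y') :
    tm a b c d y < tm a b c d y' := by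
  unfold tm
  have hb : 0 < b - a := by linarith
  refine mul_lt_mul_of_pos_left ?_ (by linarith)
  rw [cl01_of_mem (div_nonneg (by linarith) hb.le) ((div_le_one hb).2 (by linarith))]
  unfold cl01
  refine lt_max_of_lt_right (lt_min ?_ ?_)
  · exact div_lt_div_of_pos_right (by linarith) hb
  · exact (div_lt_one hb).2 (by linarith)

lemma tm_abs {a b c d y : ℝ} (hcd : c ≤ d) : |tm a b c d y| ≤ d - c := by
  unfold tm
  rw [abs_mul, abs_of_nonneg (sub_nonneg.2 hcd), abs_of_nonneg (cl01_nonneg _)]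
  exact mul_le_of_le_one_right (by linarith) (cl01_le _)

lemma tm_cont {X : Type*} [TopologicalSpace X] {a b c d y : X → ℝ} (ha : Continuous a) (hb : Continuous b)
    (hc : Continuous c) (hd : Continuous d) (hy : Continuous y) 
    (hcd : ∀ x, c x ≤ d x) (he : ∀ x, a x = b x → c x = d x) :
    Continuous (fun x => tm (a x) (b x) (c x) (d x) (y x)) := by
  rw [continuous_iff_continuousAt]
  intro x
  by_cases h : a x = b x
  · have h0 : tm (a x) (b x) (c x) (d x) (y x) = 0 := by unfold tm; rw [he x h]; simp
    rw [ContinuousAt, h0]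
    refine squeeze_zero_norm (a := fun x => d x - c x) (fun z => ?_) ?_
    · rw [Real.norm_eq_abs]; exact tm_abs (hcd z)
    · have := (hd.tendsto x).sub (hc.tendsto x)
      rw [he x h, sub_self] at this
      exact this
  · unfold tm
    refine ContinuousAt.mul (hd.sub hc).continuousAt (cl01_cont.continuousAt.comp ?_)
    exact ContinuousAt.div (hy.sub ha).continuousAt (hb.sub ha).continuousAt (by intro h1; apply h; linarith)

noncomputable def interp (M : ℕ) (v w : ℕ → ℝ) (y : ℝ) : ℝ :=
  w 0 + min (y - v 0) 0 + max (y - v M) 0 + ∑ k ∈ Finset.range M, tm (v k) (v (k+1)) (w k) (w (k+1)) y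

lemma interp_strict {M : ℕ} {v w : ℕ → ℝ} (hv : Monotone v) (hw : Monotone w) (he : ∀ k, v k = v (k+1) ↔ w k = w (k+1))
    : StrictMono (interp M v w) := by
  intro y y' h
  unfold interp
  have h1 : min (y - v 0) 0 ≤ min (y' - v 0) 0 := min_le_min (by linarith) le_rfl
  have h2 : max (y - v M) 0 ≤ max (y' - v M) 0 := max_le_max (by linarith) le_rfl
  have h3 : ∀ k ∈ Finset.range M, tm (v k) (v (k+1)) (w k) (w (k+1)) y ≤ tm (v k) (v (k+1)) (w k) (w (k+1)) y' :=
    fun k _ => tm_mono (hv (Nat.le_succ k)) (hw (Nat.le_succ k)) h.le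
  by_cases c1 : y < v 0
  · have : min (y - v 0) 0 < min (y' - v 0) 0 := by
      rw [min_eq_left (by linarith)]; exact lt_min (by linarith) (by linarith)
    have := Finset.sum_le_sum h3
    linarith
  by_cases c2 : v M < y'
  · have : max (y - v M) 0 < max (y' - v M) 0 := by
      rw [max_eq_left (a := y' - v M) (by linarith)]; exact max_lt (by linarith) (by linarith)
    have := Finset.sum_le_sum h3
    linarith
  push Not at c1 c2
  have : ∑ k ∈ Finset.range M, tm (v k) (v (k+1)) (w k) (w (k+1)) y < ∑ k ∈ Finset.range M, tm (v k) (v (k+1)) (w k) (w (k+1)) y' := by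
    have hex : ∃ k, y < v k := ⟨M, by linarith⟩
    classical
    have hk := Nat.find_spec hex
    have hmin := fun j => Nat.find_min (m := j) hex
    set k := Nat.find hex
    have hk0 : k ≠ 0 := by rintro h0; rw [h0] at hk; linarith
    obtain ⟨j, hj⟩ := Nat.exists_eq_succ_of_ne_zero hk0
    have hjl : v j ≤ y := not_lt.1 (hmin j (by omega))
    rw [hj] at hk
    have hjM : j < M := by
      by_contra hcon
      have := hv (not_lt.1 hcon); linarith
    refine Finset.sum_lt_sum h3 ⟨j, Finset.mem_range.2 hjM, ?_⟩
    have hvj : v j < v (j+1) := by linarith [hk]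
    have hwj : w j < w (j+1) := lt_of_le_of_ne (hw (Nat.le_succ j)) fun h => hvj.ne ((he j).2 h)
    exact tm_strict hvj hwj hjl hk h
  linarith

lemma interp_val {M : ℕ} {v w : ℕ → ℝ} (hv : Monotone v) (hw : Monotone w) (he : ∀ k, v k = v (k+1) ↔ w k = w (k+1))
    {k : ℕ} (hk : k ≤ M) : interp M v w (v k) = w k := by
  unfold interp
  rw [min_eq_right (by linarith [hv (Nat.zero_le k)]), max_eq_right (by linarith [hv hk])]
  have : ∑ j ∈ Finset.range M, tm (v j) (v (j+1)) (w j) (w (j+1)) (v k) = ∑ j ∈ Finset.range k, (w (j+1) - w j) := by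
    rw [← Finset.sum_range_add_sum_Ico _ hk]
    have e2 : ∑ j ∈ Finset.Ico k M, tm (v j) (v (j+1)) (w j) (w (j+1)) (v k) = 0 := by
      refine Finset.sum_eq_zero fun j hj => ?_
      exact tm_low (hv (Nat.le_succ j)) (hv (Finset.mem_Ico.1 hj).1)
    rw [e2, add_zero]
    refine Finset.sum_congr rfl fun j hj => ?_
    exact tm_high (hv (Nat.le_succ j)) (he j).1 (hv (Finset.mem_range.1 hj))
  rw [this, Finset.sum_range_sub]
  ring

lemma interp_cont {M : ℕ} {v w : ℕ → ℝ} (hv : Monotone v) (hw : Monotone w) (he : ∀ k, v k = v (k+1) ↔ w k = w (k+1))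
    : Continuous (interp M v w) := by
  unfold interp
  refine (by fun_prop : Continuous fun y => w 0 + min (y - v 0) 0 + max (y - v M) 0).add ?_
  refine continuous_finsetSum _ fun k _ => ?_
  exact tm_cont continuous_const continuous_const continuous_const continuous_const continuous_id
    (fun _ => hw (Nat.le_succ k)) (fun _ => (he k).1)

lemma interp_surj {M : ℕ} {v w : ℕ → ℝ} (hv : Monotone v) (hw : Monotone w) (he : ∀ k, v k = v (k+1) ↔ w k = w (k+1))
    : Function.Surjective (interp M v w) := by
  have h3 : ∀ y, 0 ≤ ∑ k ∈ Finset.range M, tm (v k) (v (k+1)) (w k) (w (k+1)) y := fun y => 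
    Finset.sum_nonneg fun k _ => mul_nonneg (sub_nonneg.2 (hw (Nat.le_succ k))) (cl01_nonneg _)
  refine (interp_cont hv hw he).surjective ?_ ?_
  · have : Tendsto (fun y : ℝ => y + (w 0 - v M)) atTop atTop := tendsto_atTop_add_const_right _ _ tendsto_id
    refine tendsto_atTop_mono' _ ?_ this
    filter_upwards [eventually_ge_atTop (v 0)] with y hy
    unfold interp
    rw [min_eq_right (by linarith)]
    have := le_max_left (y - v M) 0
    linarith [h3 y]
  · have : Tendsto (fun y : ℝ => y + (w 0 - v 0)) atBot atBot := tendsto_atBot_add_const_right _ _ tendsto_id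
    refine tendsto_atBot_mono' _ ?_ this
    filter_upwards [eventually_le_atBot (v 0)] with y hy
    unfold interp
    rw [min_eq_left (by linarith), max_eq_right (by linarith [hv (Nat.zero_le M)]), Finset.sum_eq_zero]
    · linarith
    · intro k _
      exact tm_low (hv (Nat.le_succ k)) (hy.trans (hv (Nat.zero_le k)))

/-- order statistics of a finite family -/
noncomputable def ostat {M : ℕ} (f : Fin (M+1) → ℝ → ℝ) (k : ℕ) (x : ℝ) : ℝ :=
  f (Tuple.sort (fun i => f i x) ⟨min k M, by omega⟩) x

lemma ostat_mono {M : ℕ} (f : Fin (M+1) → ℝ → ℝ) (x : ℝ) : Monotone (fun k => ostat f k x) := by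
  intro a b h
  exact Tuple.monotone_sort (fun i => f i x) (Fin.mk_le_mk.2 (by omega))

lemma ostat_lt {M : ℕ} (f : Fin (M+1) → ℝ → ℝ) (k : ℕ) (hk : k ≤ M) (x c : ℝ) :
    ostat f k x < c ↔ ∃ s : Finset (Fin (M+1)), s.card = k + 1 ∧ ∀ i ∈ s, f i x < c := by
  set σ := Tuple.sort (fun i => f i x) with hσ
  have hmono : Monotone (fun i => f (σ i) x) := Tuple.monotone_sort (fun i => f i x)
  have hkk : (⟨min k M, by omega⟩ : Fin (M+1)) = ⟨k, by omega⟩ := by simp [hk]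
  have hos : ostat f k x = f (σ ⟨k, by omega⟩) x := by unfold ostat; rw [hkk]
  rw [hos]
  constructor
  · intro h
    refine ⟨(Finset.Iic ⟨k, by omega⟩).map σ.toEmbedding, by simp, ?_⟩
    intro i hi
    simp only [Finset.mem_map, Finset.mem_Iic] at hi
    obtain ⟨j, hj, rfl⟩ := hi
    exact (hmono hj).trans_lt h
  · rintro ⟨s, hs, h⟩
    by_contra hcon
    have : s ⊆ (Finset.Iio ⟨k, by omega⟩).map σ.toEmbedding := by
      intro i hi
      simp only [Finset.mem_map, Finset.mem_Iio]
      refine ⟨σ.symm i, ?_, by simp⟩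
      by_contra h2
      have := hmono (not_lt.1 h2)
      simp at this
      linarith [h i hi]
    have := Finset.card_le_card this
    simp at this
    omega

lemma lt_ostat {M : ℕ} (f : Fin (M+1) → ℝ → ℝ) (k : ℕ) (hk : k ≤ M) (x c : ℝ) :
    c < ostat f k x ↔ ∃ s : Finset (Fin (M+1)), s.card = M + 1 - k ∧ ∀ i ∈ s, c < f i x := by
  set σ := Tuple.sort (fun i => f i x) with hσ
  have hmono : Monotone (fun i => f (σ i) x) := Tuple.monotone_sort (fun i => f i x)
  have hkk : (⟨min k M, by omega⟩ : Fin (M+1)) = ⟨k, by omega⟩ := by simp [hk]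
  have hos : ostat f k x = f (σ ⟨k, by omega⟩) x := by unfold ostat; rw [hkk]
  rw [hos]
  constructor
  · intro h
    refine ⟨(Finset.Ici ⟨k, by omega⟩).map σ.toEmbedding, by simp, ?_⟩
    intro i hi
    simp only [Finset.mem_map, Finset.mem_Ici] at hi
    obtain ⟨j, hj, rfl⟩ := hi
    exact h.trans_le (hmono hj)
  · rintro ⟨s, hs, h⟩
    by_contra hcon
    have : s ⊆ (Finset.Ioi ⟨k, by omega⟩).map σ.toEmbedding := by
      intro i hi
      simp only [Finset.mem_map, Finset.mem_Ioi]
      refine ⟨σ.symm i, ?_, by simp⟩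
      by_contra h2
      have := hmono (not_lt.1 h2)
      simp at this
      linarith [h i hi]
    have := Finset.card_le_card this
    simp at this
    omega

lemma ostat_cont {M : ℕ} {f : Fin (M+1) → ℝ → ℝ} (hf : ∀ i, Continuous (f i)) (k : ℕ) :
    Continuous (ostat f k) := by
  wlog hk : k ≤ M generalizing k
  · have : ostat f k = ostat f M := by
      funext x; unfold ostat; congr 3; rw [min_eq_right (by omega), min_self]
    rw [this]; exact this ▸ this ▸ (‹∀ (k : ℕ), k ≤ M → Continuous (ostat f k)› M le_rfl)
  rw [continuous_iff_continuousAt]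
  intro x
  rw [ContinuousAt, tendsto_order]
  constructor
  · intro c hc
    obtain ⟨s, hs, h⟩ := (lt_ostat f k hk x c).1 hc
    have : ∀ᶠ z in 𝓝 x, ∀ i ∈ s, c < f i z :=
      (Filter.eventually_all_finset s).2 fun i hi => ((hf i).tendsto x).eventually (lt_mem_nhds (h i hi))
    filter_upwards [this] with z hz
    exact (lt_ostat f k hk z c).2 ⟨s, hs, hz⟩
  · intro c hc
    obtain ⟨s, hs, h⟩ := (ostat_lt f k hk x c).1 hc
    have : ∀ᶠ z in 𝓝 x, ∀ i ∈ s, f i z < c :=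
      (Filter.eventually_all_finset s).2 fun i hi => ((hf i).tendsto x).eventually (gt_mem_nhds (h i hi))
    filter_upwards [this] with z hz
    exact (ostat_lt f k hk z c).2 ⟨s, hs, hz⟩

/-- the order statistic can be computed with any sorting permutation -/
lemma ostat_eq {M : ℕ} (f : Fin (M+1) → ℝ → ℝ) (x : ℝ) (σ : Equiv.Perm (Fin (M+1)))
    (hσ : Monotone (fun i => f (σ i) x)) (k : ℕ) : ostat f k x = f (σ ⟨min k M, by omega⟩) x := by
  have := (Tuple.comp_sort_eq_comp_iff_monotone (f := fun i => f i x) (σ := σ)).2 hσ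
  exact (congrFun this ⟨min k M, by omega⟩).symm

lemma c2_fin {M : ℕ} {f g : Fin (M+1) → ℝ → ℝ} (hf : ∀ i, Continuous (f i)) (hg : ∀ i, Continuous (g i))
    (hp : ∀ i j x, f i x < f j x ↔ g i x < g j x) :
    ∃ Y : ℝ → ℝ → ℝ, Continuous (fun p : ℝ × ℝ => Y p.1 p.2) ∧ (∀ x, StrictMono (Y x)) ∧
      (∀ x, Function.Surjective (Y x)) ∧ ∀ i x, Y x (f i x) = g i x := by
  have hle : ∀ i j x, f i x ≤ f j x ↔ g i x ≤ g j x := fun i j x => by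
    rw [← not_lt, ← not_lt, hp]
  have heq : ∀ i j x, f i x = f j x ↔ g i x = g j x := fun i j x => by
    rw [le_antisymm_iff, le_antisymm_iff, hle, hle]
  have hgs : ∀ x k, ostat g k x = g (Tuple.sort (fun i => f i x) ⟨min k M, by omega⟩) x := fun x k =>
    ostat_eq g x _ (fun a b hab => (hle _ _ x).1 (Tuple.monotone_sort (fun i => f i x) hab)) k
  have hev : ∀ x k, ostat f k x = ostat f (k+1) x ↔ ostat g k x = ostat g (k+1) x := fun x k => by
    rw [hgs, hgs]; exact heq _ _ x
  refine ⟨fun x => interp M (fun k => ostat f k x) (fun k => ostat g k x), ?_,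
    fun x => interp_strict (ostat_mono f x) (ostat_mono g x) (hev x),
    fun x => interp_surj (ostat_mono f x) (ostat_mono g x) (hev x), ?_⟩
  · unfold interp
    have cf := fun k => (ostat_cont hf k).comp (continuous_fst : Continuous (Prod.fst : ℝ × ℝ → ℝ))
    have cg := fun k => (ostat_cont hg k).comp (continuous_fst : Continuous (Prod.fst : ℝ × ℝ → ℝ))
    refine Continuous.add ?_ ?_
    · exact ((cg 0).add ((continuous_snd.sub (cf 0)).min continuous_const)).add
        ((continuous_snd.sub (cf M)).max continuous_const)
    · refine continuous_finsetSum _ fun k _ => ?_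
      exact tm_cont (cf k) (cf (k+1)) (cg k) (cg (k+1)) continuous_snd
        (fun p => ostat_mono g p.1 (Nat.le_succ k)) (fun p => (hev p.1 k).1)
  · intro i x
    set σ := Tuple.sort (fun i => f i x) with hσ
    set k := σ.symm i with hk
    have hkM : (k : ℕ) ≤ M := by omega
    have e1 : (⟨min (k:ℕ) M, by omega⟩ : Fin (M+1)) = k := by ext; simp [hkM]
    have e2 : ostat f k x = f i x := by
      unfold ostat; rw [e1, ← hσ, hk]; simp
    have e3 : ostat g k x = g i x := by
      rw [hgs, e1, ← hσ, hk]; simp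
    have := interp_val (ostat_mono f x) (ostat_mono g x) (hev x) hkM
    simp only [e2, e3] at this
    exact this

theorem c2 {ι : Type*} [Finite ι] {f g : ι → ℝ → ℝ} (hf : ∀ i, Continuous (f i)) (hg : ∀ i, Continuous (g i))
    (hp : ∀ i j x, f i x < f j x ↔ g i x < g j x) :
    ∃ Y : ℝ → ℝ → ℝ, Continuous (fun p : ℝ × ℝ => Y p.1 p.2) ∧ (∀ x, StrictMono (Y x)) ∧
      (∀ x, Function.Surjective (Y x)) ∧ ∀ i x, Y x (f i x) = g i x := by
  obtain ⟨n, ⟨e⟩⟩ := Finite.exists_equiv_fin ι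
  cases n with
  | zero =>
    exact ⟨fun _ y => y, continuous_snd, fun _ => strictMono_id, fun _ => Function.surjective_id, fun i => (e i).elim0⟩
  | succ M =>
    obtain ⟨Y, h1, h2, h3, h4⟩ := c2_fin (f := fun k => f (e.symm k)) (g := fun k => g (e.symm k))
      (fun _ => hf _) (fun _ => hg _) (fun _ _ x => hp _ _ x)
    exact ⟨Y, h1, h2, h3, fun i x => by simpa using h4 (e i) x⟩

/-- order homeomorphism of the line through finitely many prescribed values -/
theorem line_interp {ι : Type*} [Finite ι] (a b : ι → ℝ) (hp : ∀ i j, a i < a j ↔ b i < b j) :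
    ∃ φ : ℝ ≃o ℝ, ∀ i, φ (a i) = b i := by
  obtain ⟨Y, h1, h2, h3, h4⟩ := c2 (f := fun i _ => a i) (g := fun i _ => b i) (fun _ => continuous_const)
    (fun _ => continuous_const) (fun i j _ => hp i j)
  exact ⟨(h2 0).orderIsoOfSurjective _ (h3 0), fun i => h4 i 0⟩
end P6

section P7
open Set Filter Topology

structure GA {ι : Type*} (f : ι → ℝ → ℝ) : Prop where
  cont : ∀ i, Continuous (f i)
  ex : ∀ i j, i ≠ j → ∃ x, f i x = f j x
  uniq : ∀ i j, i ≠ j → ∀ x y, f i x = f j x → f i y = f j y → x = y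
  lt : ∀ i j, i ≠ j → ∃ x, f i x < f j x
  tri : ∀ i j k x, f i x = f j x → f i x = f k x → i = j ∨ i = k ∨ j = k

lemma ivt_zero {D : ℝ → ℝ} (hD : Continuous D) {a b : ℝ} (ha : D a ≤ 0) (hb : 0 ≤ D b) :
    ∃ z ∈ uIcc a b, D z = 0 := by
  have := intermediate_value_uIcc (f := D) (a := a) (b := b) hD.continuousOn
  exact this (by rw [uIcc_of_le (ha.trans hb)]; exact ⟨ha, hb⟩)

lemma sgn1 {D : ℝ → ℝ} (hD : Continuous D) {e : ℝ} (he : D e = 0) (hu : ∀ x, D x = 0 → x = e)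
    {p q : ℝ} (hp : D p < 0) (hq : 0 < D q) :
    ∃ s : ℝ, (s = 1 ∨ s = -1) ∧ ∀ x, 0 < s * (x - e) ↔ 0 < D x := by
  have key : ∀ a b, D a ≤ 0 → 0 ≤ D b → e ∈ uIcc a b := fun a b ha hb => by
    obtain ⟨z, hz, h0⟩ := ivt_zero hD ha hb
    rwa [hu z h0] at hz
  have ne : ∀ x, x ≠ e → D x ≠ 0 := fun x hx h => hx (hu x h)
  have hpe : p ≠ e := by rintro rfl; linarith
  have hqe : q ≠ e := by rintro rfl; linarith
  have h0 := key p q hp.le hq.le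
  rcases lt_or_gt_of_ne hpe with h | h
  · have hq' : e < q := by
      rcases lt_or_gt_of_ne hqe with h' | h'
      · rw [mem_uIcc] at h0; rcases h0 with h0 | h0 <;> linarith
      · exact h'
    refine ⟨1, Or.inl rfl, fun x => ⟨fun hx => ?_, fun hx => ?_⟩⟩
    · have hx : e < x := by linarith
      by_contra hcon
      have := key x q (not_lt.1 hcon) hq.le
      rw [mem_uIcc] at this; rcases this with h0 | h0 <;> linarith
    · have := key p x hp.le hx.le
      have hne : x ≠ e := by rintro rfl; linarith
      rw [mem_uIcc] at this
      rcases this with h0 | h0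
      · have := lt_of_le_of_ne h0.2 hne.symm; linarith
      · linarith
  · have hq' : q < e := by
      rcases lt_or_gt_of_ne hqe with h' | h'
      · exact h'
      · rw [mem_uIcc] at h0; rcases h0 with h0 | h0 <;> linarith
    refine ⟨-1, Or.inr rfl, fun x => ⟨fun hx => ?_, fun hx => ?_⟩⟩
    · have hx : x < e := by linarith
      by_contra hcon
      have := key x q (not_lt.1 hcon) hq.le
      rw [mem_uIcc] at this; rcases this with h0 | h0 <;> linarith
    · have := key p x hp.le hx.le
      have hne : x ≠ e := by rintro rfl; linarith
      rw [mem_uIcc] at this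
      rcases this with h0 | h0
      · linarith
      · have := lt_of_le_of_ne h0.1 hne; linarith

/-- crossing data of a good arrangement -/
lemma GA.ev {ι : Type*} {f : ι → ℝ → ℝ} (h : GA f) :
    ∃ (ev s : ι → ι → ℝ), (∀ i j, ev i j = ev j i) ∧ (∀ i j, i ≠ j → s j i = - s i j) ∧
      (∀ i j, i ≠ j → s i j = 1 ∨ s i j = -1) ∧
      (∀ i j, i ≠ j → ∀ x, f i x = f j x ↔ x = ev i j) ∧
      (∀ i j, i ≠ j → ∀ x, 0 < s i j * (x - ev i j) ↔ f j x < f i x) := by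
  classical
  have h1 : ∀ i j, ∃ e, i ≠ j → ∀ x, f i x = f j x ↔ x = e := by
    intro i j
    by_cases hij : i = j
    · exact ⟨0, fun h => absurd hij h⟩
    · obtain ⟨e, he⟩ := h.ex i j hij
      exact ⟨e, fun _ x => ⟨fun hx => h.uniq i j hij x e hx he, fun hx => hx ▸ he⟩⟩
  choose ev hev using h1
  have hsym : ∀ i j, i ≠ j → ev i j = ev j i := fun i j hij =>
    ((hev j i hij.symm _).1 ((hev i j hij _).2 rfl).symm)
  have h2 : ∀ i j, ∃ s : ℝ, i ≠ j → (s = 1 ∨ s = -1) ∧ ∀ x, 0 < s * (x - ev i j) ↔ f j x < f i x := by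
    intro i j
    by_cases hij : i = j
    · exact ⟨0, fun h => absurd hij h⟩
    · obtain ⟨p, hp⟩ := h.lt i j hij
      obtain ⟨q, hq⟩ := h.lt j i (Ne.symm hij)
      obtain ⟨s, hs, hs'⟩ := sgn1 (D := fun x => f i x - f j x) ((h.cont i).sub (h.cont j)) (e := ev i j)
        (sub_eq_zero.2 ((hev i j hij _).2 rfl)) (fun x hx => (hev i j hij x).1 (sub_eq_zero.1 hx))
        (sub_neg.2 hp) (sub_pos.2 hq)
      exact ⟨s, fun _ => ⟨hs, fun x => by rw [hs', sub_pos]⟩⟩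
  choose s hs using h2
  refine ⟨ev, s, fun i j => ?_, fun i j hij => ?_, fun i j hij => (hs i j hij).1, hev, fun i j hij => (hs i j hij).2⟩
  · by_cases hij : i = j
    · rw [hij]
    · exact hsym i j hij
  · obtain ⟨a1, a2⟩ := hs i j hij
    obtain ⟨b1, b2⟩ := hs j i hij.symm
    have e := hsym i j hij
    rw [← e] at b2
    have ha := a2 (ev i j + 1)
    have hb := b2 (ev i j + 1)
    rcases a1 with a1 | a1 <;> rcases b1 with b1 | b1 <;> rw [a1] at ha ⊢ <;> rw [b1] at hb ⊢
    · have := ha.1 (by norm_num); have := hb.1 (by norm_num); linarith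
    · norm_num
    · have ha := a2 (ev i j - 1)
      have hb := b2 (ev i j - 1)
      rw [a1] at ha; rw [b1] at hb
      have := ha.1 (by norm_num); have := hb.1 (by norm_num); linarith

lemma finite_gap {κ : Type*} [Finite κ] (a : κ → ℝ) : ∃ ε > 0, ∀ k, |a k| < ε → a k = 0 := by
  classical
  cases nonempty_fintype κ
  by_cases hne : (Finset.univ.filter fun k => a k ≠ 0).Nonempty
  · obtain ⟨k, hk, hmin⟩ := Finset.exists_min_image _ (fun k => |a k|) hne
    refine ⟨|a k|, abs_pos.2 (Finset.mem_filter.1 hk).2, fun j hj => ?_⟩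
    by_contra h
    have := hmin j (by simp [h])
    linarith
  · refine ⟨1, one_pos, fun k _ => ?_⟩
    by_contra h
    exact hne ⟨k, by simp [h]⟩

/-- clamp to [-1,1] -/
noncomputable def clp (t : ℝ) : ℝ := max (-1) (min t 1)
lemma clp_abs (t : ℝ) : |clp t| ≤ 1 := by
  unfold clp; rw [abs_le]; exact ⟨le_max_left _ _, max_le (by norm_num) (min_le_right _ _)⟩
lemma clp_lip (a b : ℝ) : |clp a - clp b| ≤ |a - b| := by
  unfold clp
  exact (abs_max_sub_max_le_max _ _ _ _).trans (max_le (by simp) 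
    ((abs_min_sub_min_le_max _ _ _ _).trans (max_le le_rfl (by simp))))
lemma clp_neg (a : ℝ) : clp (-a) = - clp a := by
  unfold clp
  rcases le_total a 1 with h | h <;> rcases le_total a (-1) with h' | h' <;>
  simp [max_def, min_def] <;> split_ifs <;> linarith
lemma clp_pos {a : ℝ} : 0 < clp a ↔ 0 < a := by unfold clp; simp
lemma clp_of_ge {a : ℝ} (h : 1 ≤ a) : clp a = 1 := by
  unfold clp; rw [min_eq_right h]; norm_num
lemma clp_cont : Continuous clp := by unfold clp; fun_prop
lemma clp_mono : Monotone clp := fun _ _ h => max_le_max le_rfl (min_le_min h le_rfl)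

lemma sum_lt_one {ι : Type*} (s : Finset ι) (a : ι → ℝ) (h1 : ∀ j ∈ s, a j < 1)
    (h2 : ∀ j ∈ s, ∀ k ∈ s, j ≠ k → a j = 0 ∨ a k = 0) : ∑ j ∈ s, a j < 1 := by
  by_cases h : ∀ j ∈ s, a j = 0
  · rw [Finset.sum_eq_zero h]; exact one_pos
  · push Not at h
    obtain ⟨j, hj, hj0⟩ := h
    rw [Finset.sum_eq_single_of_mem j hj]
    · exact h1 j hj
    · intro k hk hkj
      rcases h2 j hj k hk hkj.symm with h3 | h3
      · exact absurd h3 hj0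
      · exact h3

theorem GA.canon {ι : Type*} [Fintype ι] {f : ι → ℝ → ℝ} (h : GA f) :
    ∃ (f' : ι → ℝ → ℝ) (K : ℝ), 0 ≤ K ∧ (∀ i x y, |f' i x - f' i y| ≤ K * |x - y|) ∧
      (∀ i x, |f' i x| ≤ Fintype.card ι) ∧ (∀ i j x, f i x < f j x ↔ f' i x < f' j x) ∧
      ∀ (S : Finset ι) (x : ℝ), (∀ i ∈ S, ∀ j ∉ S, f i x < f j x) →
        (∀ i ∈ S, f' i x < 2 * (S.card : ℝ) - Fintype.card ι) ∧
        (∀ j ∉ S, 2 * (S.card : ℝ) - Fintype.card ι < f' j x) := by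
  classical
  obtain ⟨ev, s, esym, ssym, sval, hev, hs⟩ := h.ev
  obtain ⟨ε0, hε0, hgap⟩ := finite_gap (fun p : (ι × ι) × (ι × ι) => ev p.1.1 p.1.2 - ev p.2.1 p.2.2)
  set ε := ε0 / 2 with hε
  have hεp : 0 < ε := by positivity
  have gap : ∀ i j k l, |ev i j - ev k l| < 2 * ε → ev i j = ev k l := fun i j k l hh => 
    sub_eq_zero.1 (hgap ((i, j), (k, l)) (by simp only; linarith))
  have K1 : ∀ i j k x, i ≠ j → i ≠ k → j ≠ k → |x - ev i j| < ε → |x - ev i k| < ε → False := by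
    intro i j k x hij hik hjk h1 h2
    have e : ev i j = ev i k := by
      refine gap _ _ _ _ ?_
      have : ev i j - ev i k = (x - ev i k) - (x - ev i j) := by ring
      rw [this]
      exact (abs_sub _ _).trans_lt (by linarith)
    rcases h.tri i j k (ev i j) ((hev i j hij _).2 rfl) ((hev i k hik _).2 e) with h3 | h3 | h3
    exacts [hij h3, hik h3, hjk h3]
  have K2 : ∀ q p r x, f q x < f p x → f p x < f r x → ε ≤ |x - ev q r| := by
    intro q p r x h1 h2
    by_contra hcon
    push Not at hcon
    have hqp : q ≠ p := by rintro rfl; linarith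
    have hpr : p ≠ r := by rintro rfl; linarith
    have hqr : q ≠ r := by rintro rfl; linarith
    have he := (hev q r hqr _).2 rfl
    have hz : ∀ z ∈ uIcc x (ev q r), |x - z| < ε := fun z hz => by
      have := abs_sub_left_of_mem_uIcc hz
      rw [abs_sub_comm x z]
      rw [abs_sub_comm] at hcon
      linarith
    rcases lt_or_ge (f p (ev q r)) (f q (ev q r)) with h3 | h3
    · obtain ⟨z, hz1, hz2⟩ := ivt_zero (D := fun x => f q x - f p x) ((h.cont q).sub (h.cont p))
        (a := x) (b := ev q r) (by linarith) (by linarith)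
      have : z = ev q p := (hev q p hqp z).1 (by linarith)
      exact K1 q p r x hqp hqr hpr (by rw [← this]; exact hz z hz1) hcon
    · obtain ⟨z, hz1, hz2⟩ := ivt_zero (D := fun x => f p x - f r x) ((h.cont p).sub (h.cont r))
        (a := x) (b := ev q r) (by linarith) (by linarith)
      have : z = ev r p := (hev r p hpr.symm z).1 (by linarith)
      exact K1 r q p x hqr.symm hpr.symm hqp (by rw [esym]; exact hcon) (by rw [← this]; exact hz z hz1)
  set φ : ι → ι → ℝ → ℝ := fun i j x => if i = j then 0 else clp (s i j * (x - ev i j) / ε) with hφ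
  have φd : ∀ i x, φ i i x = 0 := fun i x => by simp [hφ]
  have φo : ∀ i j, i ≠ j → ∀ x, φ i j x = clp (s i j * (x - ev i j) / ε) := fun i j hij x => by simp [hφ, hij]
  have φn : ∀ i j x, φ j i x = - φ i j x := by
    intro i j x
    by_cases hij : i = j
    · subst hij; simp [φd]
    · rw [φo i j hij, φo j i (Ne.symm hij), ssym i j hij, esym j i, ← clp_neg]; congr 1; ring
  have φabs : ∀ i j x, |φ i j x| ≤ 1 := fun i j x => by
    by_cases hij : i = j
    · subst hij; simp [φd]
    · rw [φo i j hij]; exact clp_abs _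
  have φpos : ∀ i j x, 0 < φ i j x ↔ f j x < f i x := by
    intro i j x
    by_cases hij : i = j
    · subst hij; simp [φd]
    · rw [φo i j hij, clp_pos, ← hs i j hij]
      exact div_pos_iff_of_pos_right hεp
  have φsat : ∀ i j x, f j x < f i x → ε ≤ |x - ev i j| → φ i j x = 1 := by
    intro i j x hx he
    have hij : i ≠ j := by rintro rfl; linarith
    rw [φo i j hij]
    refine clp_of_ge ((one_le_div hεp).2 ?_)
    have h1 := (hs i j hij x).2 hx
    have : s i j * (x - ev i j) = |x - ev i j| := by
      rw [← abs_of_pos h1, abs_mul]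
      rcases sval i j hij with h2 | h2 <;> rw [h2] <;> norm_num
    rw [this]; exact he
  have φlip : ∀ i j x y, |φ i j x - φ i j y| ≤ (1 / ε) * |x - y| := by
    intro i j x y
    by_cases hij : i = j
    · subst hij; simp only [φd, sub_self, abs_zero]; positivity
    · rw [φo i j hij, φo i j hij]
      refine (clp_lip _ _).trans (le_of_eq ?_)
      have : s i j * (x - ev i j) / ε - s i j * (y - ev i j) / ε = s i j * ((1 / ε) * (x - y)) := by ring
      rw [this, abs_mul, abs_mul, abs_of_pos (by positivity : 0 < 1 / ε)]
      rcases sval i j hij with h2 | h2 <;> rw [h2] <;> norm_num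
  have φle : ∀ i j x, φ i j x ≤ 1 := fun i j x => (abs_le.1 (φabs i j x)).2
  have φge : ∀ i j x, -1 ≤ φ i j x := fun i j x => (abs_le.1 (φabs i j x)).1
  have mono : ∀ p q x, f q x < f p x → ∑ j, φ q j x < ∑ j, φ p j x := by
    intro p q x hqp
    refine Finset.sum_lt_sum (fun j _ => ?_) ⟨q, Finset.mem_univ _, ?_⟩
    · rcases lt_or_ge (f j x) (f q x) with h1 | h1
      · have := φsat p j x (h1.trans hqp) (by rw [esym]; exact K2 j q p x h1 hqp)
        rw [this]; exact φle _ _ _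
      rcases lt_or_ge (f p x) (f j x) with h2 | h2
      · have := φsat j q x (hqp.trans h2) (by rw [esym]; exact K2 q p j x hqp h2)
        rw [φn j q, this]; exact φge _ _ _
      · have a1 : φ q j x ≤ 0 := not_lt.1 fun hh => by have := (φpos q j x).1 hh; linarith
        have a2 : 0 ≤ φ p j x := by
          have := not_lt.1 fun hh => (by have := (φpos j p x).1 hh; linarith : ¬ (0 < φ j p x)) hh
          rw [φn p j] at this; linarith
        linarith
    · rw [φd]; exact (φpos p q x).2 hqp
  have sat1 : ∀ i j k x, i ≠ j → i ≠ k → j ≠ k → |φ i j x| = 1 ∨ |φ i k x| = 1 := by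
    intro i j k x hij hik hjk
    have aux : ∀ j, i ≠ j → ε ≤ |x - ev i j| → |φ i j x| = 1 := by
      intro j hij he
      rcases lt_trichotomy (f i x) (f j x) with h1 | h1 | h1
      · rw [φn j i, φsat j i x h1 (by rw [esym]; exact he)]; norm_num
      · have := (hev i j hij x).1 h1
        rw [this] at he; simp at he; linarith
      · rw [φsat i j x h1 he]; norm_num
    by_contra hcon
    push Not at hcon
    exact K1 i j k x hij hik hjk (not_le.1 fun hh => hcon.1 (aux j hij hh)) (not_le.1 fun hh => hcon.2 (aux k hik hh))
  refine ⟨fun i x => ∑ j, φ i j x, Fintype.card ι * (1 / ε), by positivity, ?_, ?_, ?_, ?_⟩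
  · intro i x y
    rw [← Finset.sum_sub_distrib]
    refine (Finset.abs_sum_le_sum_abs _ _).trans ((Finset.sum_le_sum fun j _ => φlip i j x y).trans (le_of_eq ?_))
    rw [Finset.sum_const, Finset.card_univ, nsmul_eq_mul]; ring
  · intro i x
    refine (Finset.abs_sum_le_sum_abs _ _).trans ((Finset.sum_le_sum fun j _ => φabs i j x).trans (le_of_eq ?_))
    simp
  · intro i j x
    constructor
    · exact mono j i x
    · intro hlt
      by_contra hcon
      rcases eq_or_lt_of_le (not_lt.1 hcon) with h1 | h1
      · have : ∑ k, φ i k x = ∑ k, φ j k x := by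
          by_cases hij : i = j
          · rw [hij]
          · refine Finset.sum_congr rfl fun k _ => ?_
            have hx := (hev i j hij x).1 h1.symm
            have z : φ i j x = 0 := by rw [φo i j hij, hx]; simp [clp]
            by_cases hki : k = i
            · subst hki; rw [φd, φn k j, z]; simp
            by_cases hkj : k = j
            · subst hkj; rw [φd, z]
            have e1 : |φ i k x| = 1 := by
              rcases sat1 i j k x hij (Ne.symm hki) (Ne.symm hkj) with h2 | h2
              · rw [z] at h2; simp at h2
              · exact h2
            have e2 : |φ j k x| = 1 := by
              rcases sat1 j i k x (Ne.symm hij) (Ne.symm hkj) (Ne.symm hki) with h2 | h2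
              · rw [φn i j, z] at h2; simp at h2
              · exact h2
            have e3 : 0 < φ i k x ↔ 0 < φ j k x := by rw [φpos, φpos, h1]
            rcases eq_or_eq_neg_of_abs_eq e1 with h3 | h3 <;> rcases eq_or_eq_neg_of_abs_eq e2 with h4 | h4 <;>
              rw [h3, h4] at e3 ⊢ <;> norm_num at e3
        linarith
      · have := mono i j x h1
        linarith
  · intro S x hS
    have hsplit : ∀ i, ∑ j, φ i j x = ∑ j ∈ S, φ i j x + ∑ j ∈ Sᶜ, φ i j x := fun i =>
      (Finset.sum_add_sum_compl S _).symm
    have hcardc : ((Sᶜ).card : ℝ) = Fintype.card ι - S.card := by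
      rw [Finset.card_compl, Nat.cast_sub (Finset.card_le_univ S)]
    constructor
    · intro i hi
      simp only
      rw [hsplit]
      have b1 : ∑ j ∈ S, φ i j x ≤ S.card - 1 := by
        rw [← Finset.add_sum_erase _ _ hi, φd, zero_add]
        refine (Finset.sum_le_sum fun j _ => φle i j x).trans (le_of_eq ?_)
        rw [Finset.sum_const, Finset.card_erase_of_mem hi, nsmul_eq_mul, mul_one, Nat.cast_sub]
        · simp
        · exact Finset.card_pos.2 ⟨i, hi⟩
      have b2 : ∑ j ∈ Sᶜ, (φ i j x + 1) < 1 := by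
        have neg : ∀ j ∈ Sᶜ, φ i j x < 0 := fun j hj => by
          have := (φpos j i x).2 (hS i hi j (Finset.mem_compl.1 hj))
          rw [φn i j] at this; linarith
        refine sum_lt_one _ _ (fun j hj => by linarith [neg j hj]) (fun j hj k hk hjk => ?_)
        have hij : i ≠ j := by rintro rfl; exact Finset.mem_compl.1 hj hi
        have hik : i ≠ k := by rintro rfl; exact Finset.mem_compl.1 hk hi
        rcases sat1 i j k x hij hik hjk with h3 | h3
        · left; rw [abs_of_neg (neg j hj)] at h3; linarith
        · right; rw [abs_of_neg (neg k hk)] at h3; linarith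
      rw [Finset.sum_add_distrib, Finset.sum_const, nsmul_eq_mul, mul_one, hcardc] at b2
      linarith
    · intro i hi
      simp only
      rw [hsplit]
      have hi' : i ∈ Sᶜ := Finset.mem_compl.2 hi
      have b1 : -((Sᶜ).card - 1 : ℝ) ≤ ∑ j ∈ Sᶜ, φ i j x := by
        rw [← Finset.add_sum_erase _ _ hi', φd, zero_add]
        refine le_trans (le_of_eq ?_) (Finset.sum_le_sum fun j _ => φge i j x)
        rw [Finset.sum_const, Finset.card_erase_of_mem hi', nsmul_eq_mul, Nat.cast_sub]
        · simp
        · exact Finset.card_pos.2 ⟨i, hi'⟩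
      have b2 : ∑ j ∈ S, (1 - φ i j x) < 1 := by
        have pos : ∀ j ∈ S, 0 < φ i j x := fun j hj => (φpos i j x).2 (hS j hj i hi)
        refine sum_lt_one _ _ (fun j hj => by linarith [pos j hj]) (fun j hj k hk hjk => ?_)
        have hij : i ≠ j := by rintro rfl; exact hi hj
        have hik : i ≠ k := by rintro rfl; exact hi hk
        rcases sat1 i j k x hij hik hjk with h3 | h3
        · left; rw [abs_of_pos (pos j hj)] at h3; linarith
        · right; rw [abs_of_pos (pos k hk)] at h3; linarith
      rw [Finset.sum_sub_distrib, Finset.sum_const, nsmul_eq_mul, mul_one] at b2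
      rw [hcardc] at b1
      linarith
end P7

section P7b
open Set Filter Topology

/-- Φ preserves the sides of the graphs -/
def Pres (Φ : (ℝ × ℝ) ≃ₜ (ℝ × ℝ)) (f g : ℝ → ℝ) : Prop :=
  ∀ p : ℝ × ℝ, (f p.1 < p.2 ↔ g (Φ p).1 < (Φ p).2) ∧ (p.2 < f p.1 ↔ (Φ p).2 < g (Φ p).1)

/-- Φ flips the sides of the graphs -/
def Flip (Φ : (ℝ × ℝ) ≃ₜ (ℝ × ℝ)) (f g : ℝ → ℝ) : Prop :=
  ∀ p : ℝ × ℝ, (f p.1 < p.2 ↔ (Φ p).2 < g (Φ p).1) ∧ (p.2 < f p.1 ↔ g (Φ p).1 < (Φ p).2)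

lemma Pres.trans {Φ Ψ : (ℝ × ℝ) ≃ₜ (ℝ × ℝ)} {f g k : ℝ → ℝ} (h : Pres Φ f g) (h' : Pres Ψ g k) :
    Pres (Φ.trans Ψ) f k := fun p => ⟨(h p).1.trans (h' (Φ p)).1, (h p).2.trans (h' (Φ p)).2⟩

lemma Pres.transFlip {Φ Ψ : (ℝ × ℝ) ≃ₜ (ℝ × ℝ)} {f g k : ℝ → ℝ} (h : Pres Φ f g) (h' : Flip Ψ g k) :
    Flip (Φ.trans Ψ) f k := fun p => ⟨(h p).1.trans (h' (Φ p)).1, (h p).2.trans (h' (Φ p)).2⟩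

lemma Pres.on {Φ : (ℝ × ℝ) ≃ₜ (ℝ × ℝ)} {f g : ℝ → ℝ} (h : Pres Φ f g) (p : ℝ × ℝ) :
    p.2 = f p.1 ↔ (Φ p).2 = g (Φ p).1 := by
  have := h p
  rw [le_antisymm_iff, le_antisymm_iff, ← not_lt, ← not_lt, ← not_lt, ← not_lt, this.1, this.2]

lemma Flip.on {Φ : (ℝ × ℝ) ≃ₜ (ℝ × ℝ)} {f g : ℝ → ℝ} (h : Flip Φ f g) (p : ℝ × ℝ) :
    p.2 = f p.1 ↔ (Φ p).2 = g (Φ p).1 := by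
  have := h p
  rw [le_antisymm_iff, le_antisymm_iff, ← not_lt, ← not_lt, ← not_lt, ← not_lt, this.1, this.2]
  tauto

lemma image_gr_of_on {Φ : (ℝ × ℝ) ≃ₜ (ℝ × ℝ)} {f g : ℝ → ℝ} (h : ∀ p : ℝ × ℝ, p.2 = f p.1 ↔ (Φ p).2 = g (Φ p).1) :
    Φ '' gr f = gr g := by
  ext q
  constructor
  · rintro ⟨p, hp, rfl⟩; exact (h p).1 hp
  · intro hq
    refine ⟨Φ.symm q, (h _).2 ?_, by simp⟩
    have hq : q.2 = g q.1 := hq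
    simpa using hq

lemma Pres.image {Φ : (ℝ × ℝ) ≃ₜ (ℝ × ℝ)} {f g : ℝ → ℝ} (h : Pres Φ f g) : Φ '' gr f = gr g :=
  image_gr_of_on h.on
lemma Flip.image {Φ : (ℝ × ℝ) ≃ₜ (ℝ × ℝ)} {f g : ℝ → ℝ} (h : Flip Φ f g) : Φ '' gr f = gr g :=
  image_gr_of_on h.on

lemma Pres.mk' {Φ : (ℝ × ℝ) ≃ₜ (ℝ × ℝ)} {f g : ℝ → ℝ} 
    (h1 : ∀ p : ℝ × ℝ, f p.1 < p.2 → g (Φ p).1 < (Φ p).2)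
    (h2 : ∀ p : ℝ × ℝ, p.2 < f p.1 → (Φ p).2 < g (Φ p).1)
    (h3 : ∀ p : ℝ × ℝ, p.2 = f p.1 → (Φ p).2 = g (Φ p).1) : Pres Φ f g := by
  intro p
  rcases lt_trichotomy p.2 (f p.1) with h | h | h
  · have := h2 p h
    exact ⟨⟨fun h' => absurd h h'.not_gt, fun h' => absurd this h'.not_gt⟩, ⟨fun _ => this, fun _ => h⟩⟩
  · have := h3 p h
    exact ⟨⟨fun h' => absurd h h'.ne', fun h' => absurd this h'.ne'⟩, ⟨fun h' => absurd h h'.ne, fun h' => absurd this h'.ne⟩⟩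
  · have := h1 p h
    exact ⟨⟨fun _ => this, fun _ => h⟩, ⟨fun h' => absurd h h'.not_gt, fun h' => absurd this h'.not_gt⟩⟩

lemma Flip.mk' {Φ : (ℝ × ℝ) ≃ₜ (ℝ × ℝ)} {f g : ℝ → ℝ} 
    (h1 : ∀ p : ℝ × ℝ, f p.1 < p.2 → (Φ p).2 < g (Φ p).1)
    (h2 : ∀ p : ℝ × ℝ, p.2 < f p.1 → g (Φ p).1 < (Φ p).2)
    (h3 : ∀ p : ℝ × ℝ, p.2 = f p.1 → (Φ p).2 = g (Φ p).1) : Flip Φ f g := by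
  intro p
  rcases lt_trichotomy p.2 (f p.1) with h | h | h
  · have := h2 p h
    exact ⟨⟨fun h' => absurd h h'.not_gt, fun h' => absurd this h'.not_gt⟩, ⟨fun _ => this, fun _ => h⟩⟩
  · have := h3 p h
    exact ⟨⟨fun h' => absurd h h'.ne', fun h' => absurd this h'.ne⟩, ⟨fun h' => absurd h h'.ne, fun h' => absurd this h'.ne'⟩⟩
  · have := h1 p h
    exact ⟨⟨fun _ => this, fun _ => h⟩, ⟨fun h' => absurd h h'.not_gt, fun h' => absurd this h'.not_gt⟩⟩

lemma above_preconn {f : ℝ → ℝ} (hf : Continuous f) : IsPreconnected {p : ℝ × ℝ | f p.1 < p.2} := by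
  have : {p : ℝ × ℝ | f p.1 < p.2} = (fun p : ℝ × ℝ => (p.1, p.2 + f p.1)) '' (univ ×ˢ Ioi 0) := by
    ext ⟨x, y⟩
    constructor
    · intro h; exact ⟨(x, y - f x), ⟨trivial, by simpa using h⟩, by simp⟩
    · rintro ⟨⟨a, b⟩, ⟨-, hb⟩, he⟩
      simp only [Prod.mk.injEq] at he
      obtain ⟨rfl, rfl⟩ := he
      have : (0:ℝ) < b := hb
      simp [this]
  rw [this]
  exact (isPreconnected_univ.prod isPreconnected_Ioi).image _ (by fun_prop)

lemma below_preconn {f : ℝ → ℝ} (hf : Continuous f) : IsPreconnected {p : ℝ × ℝ | p.2 < f p.1} := by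
  have : {p : ℝ × ℝ | p.2 < f p.1} = (fun p : ℝ × ℝ => (p.1, p.2 + f p.1)) '' (univ ×ˢ Iio 0) := by
    ext ⟨x, y⟩
    constructor
    · intro h; exact ⟨(x, y - f x), ⟨trivial, by simpa using h⟩, by simp⟩
    · rintro ⟨⟨a, b⟩, ⟨-, hb⟩, he⟩
      simp only [Prod.mk.injEq] at he
      obtain ⟨rfl, rfl⟩ := he
      have : b < (0:ℝ) := hb
      simp [this]
  rw [this]
  exact (isPreconnected_univ.prod isPreconnected_Iio).image _ (by fun_prop)

/-- a preconnected set avoiding a graph lies on one side -/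
lemma side_of_preconn {g : ℝ → ℝ} (hg : Continuous g) {C : Set (ℝ × ℝ)} (hC : IsPreconnected C)
    (h : ∀ p ∈ C, p.2 ≠ g p.1) : (∀ p ∈ C, g p.1 < p.2) ∨ (∀ p ∈ C, p.2 < g p.1) := by
  have o1 : IsOpen {p : ℝ × ℝ | g p.1 < p.2} := isOpen_lt (hg.comp continuous_fst) continuous_snd
  have o2 : IsOpen {p : ℝ × ℝ | p.2 < g p.1} := isOpen_lt continuous_snd (hg.comp continuous_fst)
  have o3 : Disjoint {p : ℝ × ℝ | g p.1 < p.2} {p : ℝ × ℝ | p.2 < g p.1} := by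
    rw [Set.disjoint_left]; intro p (hp : g p.1 < p.2) (hp' : p.2 < g p.1); exact lt_asymm hp hp'
  have o4 : C ⊆ {p : ℝ × ℝ | g p.1 < p.2} ∪ {p : ℝ × ℝ | p.2 < g p.1} := by
    intro p hp
    rcases lt_or_gt_of_ne (h p hp) with h' | h'
    · exact Or.inr h'
    · exact Or.inl h'
  rcases hC.subset_or_subset o1 o2 o3 o4 with h' | h'
  · exact Or.inl fun p hp => h' hp
  · exact Or.inr fun p hp => h' hp

theorem side_dich {f g : ℝ → ℝ} (hf : Continuous f) (hg : Continuous g) {Φ : (ℝ × ℝ) ≃ₜ (ℝ × ℝ)}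
    (h : Φ '' gr f = gr g) : Pres Φ f g ∨ Flip Φ f g := by
  have hon : ∀ p : ℝ × ℝ, p.2 = f p.1 ↔ (Φ p).2 = g (Φ p).1 := by
    intro p
    constructor
    · intro hp; have : Φ p ∈ Φ '' gr f := ⟨p, hp, rfl⟩
      rw [h] at this; exact this
    · intro hp; have : Φ p ∈ gr g := hp
      rw [← h] at this
      obtain ⟨q, hq, hqp⟩ := this
      rw [← Φ.injective hqp]; exact hq
  have a := side_of_preconn hg ((above_preconn hf).image Φ Φ.continuous.continuousOn) (by
    rintro _ ⟨p, hp, rfl⟩ hh; exact (ne_of_gt (show f p.1 < p.2 from hp)) ((hon p).2 hh))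
  have b := side_of_preconn hg ((below_preconn hf).image Φ Φ.continuous.continuousOn) (by
    rintro _ ⟨p, hp, rfl⟩ hh; exact (ne_of_lt (show p.2 < f p.1 from hp)) ((hon p).2 hh))
  have three : ∀ q, ∃ p, Φ p = q := Φ.surjective
  rcases a with a | a <;> rcases b with b | b
  · exfalso
    obtain ⟨p, hp⟩ := three (0, g 0 - 1)
    rcases lt_trichotomy p.2 (f p.1) with h1 | h1 | h1
    · have := b _ ⟨p, h1, rfl⟩; rw [hp] at this; simp at this; linarith
    · have := (hon p).1 h1; rw [hp] at this; simp at this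
    · have := a _ ⟨p, h1, rfl⟩; rw [hp] at this; simp at this; linarith
  · exact Or.inl (Pres.mk' (fun p hp => a _ ⟨p, hp, rfl⟩) (fun p hp => b _ ⟨p, hp, rfl⟩) (fun p => (hon p).1))
  · exact Or.inr (Flip.mk' (fun p hp => a _ ⟨p, hp, rfl⟩) (fun p hp => b _ ⟨p, hp, rfl⟩) (fun p => (hon p).1))
  · exfalso
    obtain ⟨p, hp⟩ := three (0, g 0 + 1)
    rcases lt_trichotomy p.2 (f p.1) with h1 | h1 | h1
    · have := b _ ⟨p, h1, rfl⟩; rw [hp] at this; simp at this; linarith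
    · have := (hon p).1 h1; rw [hp] at this; simp at this
    · have := a _ ⟨p, h1, rfl⟩; rw [hp] at this; simp at this; linarith

lemma GA.transport {ι : Type*} {f g : ι → ℝ → ℝ} (h : GA f) (hg : ∀ i, Continuous (g i))
    {Φ : (ℝ × ℝ) ≃ₜ (ℝ × ℝ)} (hp : ∀ i, Pres Φ (f i) (g i)) : GA g where
  cont := hg
  ex i j hij := by
    obtain ⟨x, hx⟩ := h.ex i j hij
    have h1 := ((hp i).on (x, f i x)).1 rfl
    have h2 := ((hp j).on (x, f i x)).1 hx
    exact ⟨_, h1.symm.trans h2⟩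
  uniq i j hij x y hx hy := by
    have aux : ∀ x, g i x = g j x → (Φ.symm (x, g i x)).2 = f i (Φ.symm (x, g i x)).1 ∧ 
        f i (Φ.symm (x, g i x)).1 = f j (Φ.symm (x, g i x)).1 := by
      intro x hx
      have h1 := ((hp i).on (Φ.symm (x, g i x))).2 (by simp)
      have h2 := ((hp j).on (Φ.symm (x, g i x))).2 (by simpa using hx)
      exact ⟨h1, h1.symm.trans h2⟩
    obtain ⟨a1, a2⟩ := aux x hx
    obtain ⟨b1, b2⟩ := aux y hy
    have e := h.uniq i j hij _ _ a2 b2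
    have : Φ.symm (x, g i x) = Φ.symm (y, g i y) := Prod.ext e (by rw [a1, b1, e])
    exact congrArg Prod.fst (Φ.symm.injective this)
  lt i j hij := by
    obtain ⟨x, hx⟩ := h.lt i j hij
    have h1 := ((hp i).on (x, f i x)).1 rfl
    have h2 := ((hp j) (x, f i x)).2.1 hx
    exact ⟨_, h1 ▸ h2⟩
  tri i j k x h1 h2 := by
    have a1 := ((hp i).on (Φ.symm (x, g i x))).2 (by simp)
    have a2 := ((hp j).on (Φ.symm (x, g i x))).2 (by simpa using h1)
    have a3 := ((hp k).on (Φ.symm (x, g i x))).2 (by simpa using h2)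
    exact h.tri i j k _ (a1.symm.trans a2) (a1.symm.trans a3)

/-- fiberwise version of `c2` -/
theorem c2_homeo {ι : Type*} [Finite ι] {f g : ι → ℝ → ℝ} (hf : ∀ i, Continuous (f i)) (hg : ∀ i, Continuous (g i))
    (hp : ∀ i j x, f i x < f j x ↔ g i x < g j x) :
    ∃ Φ : (ℝ × ℝ) ≃ₜ (ℝ × ℝ), (∀ p, (Φ p).1 = p.1) ∧ ∀ i, Pres Φ (f i) (g i) := by
  obtain ⟨Y, h1, h2, h3, h4⟩ := c2 hf hg hp
  obtain ⟨Φ, hΦ⟩ := fiberHomeo Y h1 h2 h3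
  refine ⟨Φ, fun p => by rw [← Prod.mk.eta (p := p), hΦ], fun i p => ?_⟩
  obtain ⟨x, y⟩ := p
  rw [hΦ]
  simp only [← h4 i x, (h2 x).lt_iff_lt, and_self]

lemma lip_cont {f : ℝ → ℝ} {K : ℝ} (h : ∀ x y, |f x - f y| ≤ K * |x - y|) : Continuous f := by
  have : LipschitzWith K.toNNReal f := LipschitzWith.of_dist_le_mul fun x y => by
    rw [Real.dist_eq, Real.dist_eq]
    exact (h x y).trans (mul_le_mul_of_nonneg_right (Real.le_coe_toNNReal K) (abs_nonneg _))
  exact this.continuous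

/-- the tilting homeomorphism -/
def tiltH (c : ℝ) : (ℝ × ℝ) ≃ₜ (ℝ × ℝ) where
  toFun p := (p.1 + c * p.2, p.2)
  invFun p := (p.1 - c * p.2, p.2)
  left_inv p := by simp
  right_inv p := by simp
  continuous_toFun := by fun_prop
  continuous_invFun := by fun_prop

lemma tiltH_apply (c : ℝ) (p : ℝ × ℝ) : tiltH c p = (p.1 + c * p.2, p.2) := rfl

theorem tilt_pres {f : ℝ → ℝ} {K c B : ℝ} (hf : ∀ x y, |f x - f y| ≤ K * |x - y|) (hc : 0 < c) (hK : c * K < 1)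
    (hB : ∀ x, |f x| ≤ B) :
    ∃ g : ℝ → ℝ, Continuous g ∧ (∀ x, |g x| ≤ B) ∧ Pres (tiltH c) f g := by
  have hfc := lip_cont hf
  have hup : ∀ x y, x ≤ y → f y - f x ≤ K * (y - x) ∧ f x - f y ≤ K * (y - x) := fun x y hxy => by
    have := hf y x
    rw [abs_of_nonneg (sub_nonneg.2 hxy), abs_le] at this
    exact ⟨this.2, by linarith [this.1]⟩
  have hm : StrictMono (fun x => x + c * f x) := by
    intro x y hxy
    have := (hup x y hxy.le).2
    simp only
    nlinarith
  have hs : Function.Surjective (fun x => x + c * f x) := by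
    refine Continuous.surjective (by fun_prop) ?_ ?_
    · refine tendsto_atTop_mono (fun x => ?_) (tendsto_atTop_add_const_right _ (-(c * B)) tendsto_id)
      have := (abs_le.1 (hB x)).1
      simp only [id]; nlinarith
    · refine tendsto_atBot_mono (fun x => ?_) (tendsto_atBot_add_const_right _ (c * B) tendsto_id)
      have := (abs_le.1 (hB x)).2
      simp only [id]; nlinarith
  set φ := hm.orderIsoOfSurjective _ hs with hφ
  have hφa : ∀ x, φ x = x + c * f x := fun x => rfl
  refine ⟨fun x => f (φ.symm x), hfc.comp φ.symm.continuous, fun x => hB _, Pres.mk' ?_ ?_ ?_⟩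
  · rintro ⟨x, y⟩ h
    simp only [tiltH_apply] at *
    set x' := φ.symm (x + c * y) with hx'
    have e : x' + c * f x' = x + c * y := by rw [← hφa, hx']; simp
    by_contra hcon
    push Not at hcon
    have h1 : x' ≤ x := by nlinarith
    have := (hup x' x h1).2
    have h2 : x - x' = c * (f x' - y) := by linarith
    rw [h2] at this
    have h3 : K * (c * (f x' - y)) ≤ 1 * (f x' - y) := by
      rw [← mul_assoc, mul_comm K c]
      exact mul_le_mul_of_nonneg_right hK.le (by linarith)
    linarith
  · rintro ⟨x, y⟩ h
    simp only [tiltH_apply] at *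
    set x' := φ.symm (x + c * y) with hx'
    have e : x' + c * f x' = x + c * y := by rw [← hφa, hx']; simp
    by_contra hcon
    push Not at hcon
    have h1 : x ≤ x' := by nlinarith
    have := (hup x x' h1).2
    have h2 : x' - x = c * (y - f x') := by linarith
    rw [h2] at this
    have h3 : K * (c * (y - f x')) ≤ 1 * (y - f x') := by
      rw [← mul_assoc, mul_comm K c]
      exact mul_le_mul_of_nonneg_right hK.le (by linarith)
    linarith
  · rintro ⟨x, y⟩ h
    simp only [tiltH_apply] at *
    rw [h, ← hφa, OrderIso.symm_apply_apply]
end P7b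

section P8a
open Set Filter Topology Complex Metric

lemma sc_image {X Y : Type*} [TopologicalSpace X] [TopologicalSpace Y] {s : Set X} (hs : IsSimplyConnected s)
    {f : X → Y} {g : Y → X} (hf : ContinuousOn f s) (hg : ContinuousOn g (f '' s)) (hgf : ∀ x ∈ s, g (f x) = x) :
    IsSimplyConnected (f '' s) := by
  have := hs.simplyConnectedSpace
  have hm : ∀ y : (f '' s : Set Y), g y ∈ s := fun y => by
    obtain ⟨x, hx, hxy⟩ := y.2; rw [← hxy, hgf x hx]; exact hx
  have e : s ≃ₜ (f '' s : Set Y) :=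
    { toFun := fun x => ⟨f x, x, x.2, rfl⟩
      invFun := fun y => ⟨g y, hm y⟩
      left_inv := fun x => Subtype.ext (hgf x x.2)
      right_inv := fun y => by
        obtain ⟨x, hx, hxy⟩ := y.2
        apply Subtype.ext
        show f (g y) = y
        rw [← hxy, hgf x hx]
      continuous_toFun := (continuousOn_iff_continuous_domRestrict.1 hf).subtype_mk _
      continuous_invFun := (continuousOn_iff_continuous_domRestrict.1 hg).subtype_mk hm }
  exact e.symm.toHomotopyEquiv.simplyConnectedSpace

/-- a (possibly unbounded) closed cell `D` with interior `O`, identified with (part of) the closed disc -/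
structure Cell (D O : Set (ℝ × ℝ)) (Θ : ℝ × ℝ → ℂ) (Θ' : ℂ → ℝ × ℝ) : Prop where
  clD : IsClosed D
  opO : IsOpen O
  sub : O ⊆ D
  c1 : ContinuousOn Θ D
  c2 : ContinuousOn Θ' (Θ '' D)
  inv : ∀ p ∈ D, Θ' (Θ p) = p
  im : Θ '' O = ball 0 1
  bd : ∀ p ∈ D, p ∉ O → Θ p ∉ ball (0:ℂ) 1

variable {D O : Set (ℝ × ℝ)} {Θ : ℝ × ℝ → ℂ} {Θ' : ℂ → ℝ × ℝ}

lemma Cell.memO (h : Cell D O Θ Θ') {p : ℝ × ℝ} (hp : p ∈ D) : p ∈ O ↔ Θ p ∈ ball (0:ℂ) 1 :=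
  ⟨fun hp => by rw [← h.im]; exact ⟨p, hp, rfl⟩, fun hp' => by by_contra hc; exact h.bd p hp hc hp'⟩

lemma Cell.inv' (h : Cell D O Θ Θ') {w : ℂ} (hw : w ∈ ball (0:ℂ) 1) : Θ' w ∈ O ∧ Θ (Θ' w) = w := by
  rw [← h.im] at hw
  obtain ⟨p, hp, rfl⟩ := hw
  rw [h.inv p (h.sub hp)]; exact ⟨hp, rfl⟩

lemma Cell.pre (h : Cell D O Θ Θ') {Ψ : ℂ ≃ₜ ℂ} (hΨ : ∀ z, z ∉ ball (0:ℂ) 1 → Ψ z = z) :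
    ∃ F : ℝ × ℝ → ℝ × ℝ, Continuous F ∧ (∀ p, p ∉ O → F p = p) ∧ (∀ p ∈ D, F p = Θ' (Ψ (Θ p))) ∧
      (∀ p ∈ O, F p ∈ O ∧ Θ (F p) = Ψ (Θ p)) := by
  classical
  have hb : ∀ w ∈ ball (0:ℂ) 1, Ψ w ∈ ball (0:ℂ) 1 := by
    intro w hw; by_contra hc
    have := hΨ _ hc
    exact hc (by rw [Ψ.injective this]; exact hw)
  have key : ∀ p ∈ D, p ∉ O → Θ' (Ψ (Θ p)) = p := fun p hp hpO => by
    rw [hΨ _ (h.bd p hp hpO), h.inv p hp]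
  let F : ℝ × ℝ → ℝ × ℝ := fun p => if p ∈ O then Θ' (Ψ (Θ p)) else p
  have hF1 : ∀ p, p ∉ O → F p = p := fun p hp => if_neg hp
  have hF2 : ∀ p ∈ D, F p = Θ' (Ψ (Θ p)) := fun p hp => by
    by_cases hpO : p ∈ O
    · exact if_pos hpO
    · rw [hF1 p hpO, key p hp hpO]
  refine ⟨F, ?_, hF1, hF2, ?_⟩
  · have hu : D ∪ Oᶜ = univ := by
      apply eq_univ_of_forall; intro p
      by_cases hpO : p ∈ O
      · exact Or.inl (h.sub hpO)
      · exact Or.inr hpO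
    rw [← continuousOn_univ, ← hu]
    refine ContinuousOn.union_of_isClosed ?_ ?_ h.clD h.opO.isClosed_compl
    · refine ContinuousOn.congr ?_ hF2
      refine h.c2.comp (Ψ.continuous.comp_continuousOn h.c1) ?_
      intro p hp
      by_cases hpO : p ∈ O
      · have : Ψ (Θ p) ∈ Θ '' O := by rw [h.im]; exact hb _ ((h.memO hp).1 hpO)
        exact image_mono h.sub this
      · show Ψ (Θ p) ∈ _
        rw [hΨ _ (h.bd p hp hpO)]; exact ⟨p, hp, rfl⟩
    · exact continuousOn_id.congr hF1
  · intro p hp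
    rw [hF2 p (h.sub hp)]
    exact h.inv' (hb _ ((h.memO (h.sub hp)).1 hp))

lemma Cell.homeo (h : Cell D O Θ Θ') {Ψ : ℂ ≃ₜ ℂ} (hΨ : ∀ z, z ∉ ball (0:ℂ) 1 → Ψ z = z) :
    ∃ F : (ℝ × ℝ) ≃ₜ (ℝ × ℝ), (∀ p, p ∉ O → F p = p) ∧ 
      (∀ p ∈ O, F p ∈ O ∧ Θ (F p) = Ψ (Θ p)) := by
  obtain ⟨F, a1, a2, a3, a4⟩ := h.pre hΨ
  have hΨ' : ∀ z, z ∉ ball (0:ℂ) 1 → Ψ.symm z = z := fun z hz => by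
    conv_lhs => rw [← hΨ z hz]
    simp
  obtain ⟨F', b1, b2, b3, b4⟩ := h.pre hΨ'
  refine ⟨⟨⟨F, F', fun p => ?_, fun p => ?_⟩, a1, b1⟩, a2, a4⟩
  · by_cases hp : p ∈ O
    · rw [b3 _ (h.sub (a4 p hp).1), (a4 p hp).2]; simp [h.inv p (h.sub hp)]
    · rw [a2 p hp, b2 p hp]
  · by_cases hp : p ∈ O
    · rw [a3 _ (h.sub (b4 p hp).1), (b4 p hp).2]; simp [h.inv p (h.sub hp)]
    · rw [b2 p hp, a2 p hp]

theorem Cell.straighten (h : Cell D O Θ Θ') (G : (ℝ × ℝ) ≃ₜ (ℝ × ℝ))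
    (hoc : OrdConnected {r : ℝ | G (0, r) ∈ O}) (hne : ∃ r : ℝ, G (0, r) ∈ O)
    {α : ℝ → ℂ} (hα : ContinuousOn α (Icc (-1) 1)) (hinj : InjOn α (Icc (-1) 1))
    (hl : α (-1) = -1) (hr : α 1 = 1) 
    (him : α '' Ioo (-1) 1 = Θ '' {p | p ∈ O ∧ (G.symm p).1 = 0}) :
    ∃ F : (ℝ × ℝ) ≃ₜ (ℝ × ℝ), (∀ p, p ∉ O → F p = p) ∧ 
      ∀ p ∈ O, (G.symm p).1 = 0 ↔ (Θ (F p)).im = 0 := by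
  set A : ℂ → ℂ := fun z => Θ (G (z.re, z.im)) with hA
  set B : ℂ → ℂ := fun w => ((G.symm (Θ' w)).1 : ℂ) + ((G.symm (Θ' w)).2 : ℂ) * I with hB
  have hcΘ' : ContinuousOn Θ' (ball 0 1) := h.c2.mono (by rw [← h.im]; exact image_mono h.sub)
  have hBc : ContinuousOn B (ball 0 1) := by
    have : Continuous fun p : ℝ × ℝ => ((G.symm p).1 : ℂ) + ((G.symm p).2 : ℂ) * I := by
      have := G.symm.continuous; fun_prop
    exact this.comp_continuousOn hcΘ'
  have hBre : ∀ w, (B w).re = (G.symm (Θ' w)).1 := fun w => by simp [hB]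
  have hBim : ∀ w, (B w).im = (G.symm (Θ' w)).2 := fun w => by simp [hB]
  have hAB : ∀ w ∈ ball (0:ℂ) 1, A (B w) = w := fun w hw => by
    rw [hA]; simp only [hBre, hBim]
    simp [(h.inv' hw).2]
  set O' : Set ℂ := {z | G (z.re, z.im) ∈ O} with hO'
  have hcont : Continuous fun z : ℂ => G (z.re, z.im) := G.continuous.comp (continuous_re.prodMk continuous_im)
  have hO'o : IsOpen O' := h.opO.preimage hcont
  have hAc : ContinuousOn A O' := h.c1.comp hcont.continuousOn fun z hz => h.sub hz
  have hAb : ∀ z ∈ O', A z ∈ ball (0:ℂ) 1 := fun z hz => (h.memO (h.sub hz)).1 hz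
  have hBA : ∀ z ∈ O', B (A z) = z := fun z hz => by
    apply Complex.ext
    · rw [hBre, hA]; simp only; rw [h.inv _ (h.sub hz)]; simp
    · rw [hBim, hA]; simp only; rw [h.inv _ (h.sub hz)]; simp
  have hBO : ∀ w ∈ ball (0:ℂ) 1, B w ∈ O' := fun w hw => by
    show G ((B w).re, (B w).im) ∈ O
    rw [hBre, hBim]; simp [(h.inv' hw).1]
  have hO'e : O' = B '' ball 0 1 := by
    ext z; constructor
    · intro hz; exact ⟨A z, hAb z hz, hBA z hz⟩
    · rintro ⟨w, hw, rfl⟩; exact hBO w hw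
  have hO'sc : IsSimplyConnected O' := by
    rw [hO'e]
    refine sc_image (g := A) (convex_sc (convex_ball 0 1) ⟨0, by simp⟩) hBc ?_ hAB
    rw [← hO'e]; exact hAc
  have hoc' : OrdConnected {y : ℝ | (y:ℂ) * I ∈ O'} := by
    convert! hoc using 3; simp [hO']
  have hne' : ∃ y : ℝ, (y:ℂ) * I ∈ O' := by
    obtain ⟨r, hr⟩ := hne; exact ⟨r, by simpa [hO'] using hr⟩
  have sc1 := push_left hO'o hO'sc hoc' hne'
  have sc2 := push_right hO'o hO'sc hoc' hne'
  have im_open : ∀ s : Set ℂ, IsOpen s → IsOpen (A '' (O' ∩ s)) := by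
    intro s hs
    have : A '' (O' ∩ s) = ball 0 1 ∩ B ⁻¹' s := by
      ext w; constructor
      · rintro ⟨z, ⟨hz, hzs⟩, rfl⟩; exact ⟨hAb z hz, by simpa [hBA z hz] using hzs⟩
      · rintro ⟨hw, hws⟩; exact ⟨B w, ⟨hBO w hw, hws⟩, hAB w hw⟩
    rw [this]
    exact hBc.isOpen_inter_preimage isOpen_ball hs
  have im_sc : ∀ s : Set ℂ, IsSimplyConnected (O' ∩ s) → IsSimplyConnected (A '' (O' ∩ s)) := by
    intro s hs
    refine sc_image hs (hAc.mono inter_subset_left) (hBc.mono ?_) fun z hz => hBA z hz.1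
    rintro _ ⟨z, hz, rfl⟩; exact hAb z hz.1
  have hIm : α '' Ioo (-1) 1 = A '' (O' ∩ {z | z.re = 0}) := by
    rw [him]; ext w; constructor
    · rintro ⟨p, ⟨hp, hp0⟩, rfl⟩
      refine ⟨B (Θ p), ⟨hBO _ ((h.memO (h.sub hp)).1 hp), ?_⟩, hAB _ ((h.memO (h.sub hp)).1 hp)⟩
      show (B (Θ p)).re = 0
      rw [hBre, h.inv p (h.sub hp), hp0]
    · rintro ⟨z, ⟨hz, hz0⟩, rfl⟩
      have hz0 : z.re = 0 := hz0
      exact ⟨G (z.re, z.im), ⟨hz, by simp [hz0]⟩, rfl⟩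
  have hmem : ∀ t ∈ Ioo (-1:ℝ) 1, ∃ z, z ∈ O' ∧ z.re = 0 ∧ A z = α t := by
    intro t ht
    have : α t ∈ α '' Ioo (-1) 1 := ⟨t, ht, rfl⟩
    rw [hIm] at this
    obtain ⟨z, ⟨h1, h2⟩, h3⟩ := this
    exact ⟨z, h1, h2, h3⟩
  have clo : ∀ s : Set ℂ, (∀ z : ℂ, z.re = 0 → z ∈ closure s) → ∀ t ∈ Ioo (-1:ℝ) 1, α t ∈ closure (A '' (O' ∩ s)) := by
    intro s hs t ht
    obtain ⟨z, hz, hz0, hzα⟩ := hmem t ht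
    rw [← hzα]
    have h1 : z ∈ closure (O' ∩ s) := hO'o.inter_closure ⟨hz, hs z hz0⟩
    have h2 : ContinuousWithinAt A (O' ∩ s) z := (hAc z hz).mono inter_subset_left
    exact h2.mem_closure_image h1
  have cfg : ChordCfg α (A '' (O' ∩ {z | z.re < 0})) (A '' (O' ∩ {z | 0 < z.re})) := by
    refine ⟨hα, hinj, hl, hr, ?_, ?_, ?_, im_sc _ sc1, im_sc _ sc2, ?_, ?_, ?_, ?_⟩
    · intro t ht
      obtain ⟨z, hz, hz0, hzα⟩ := hmem t ht
      rw [← hzα]; exact hAb z hz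
    · exact im_open _ (isOpen_lt continuous_re continuous_const)
    · exact im_open _ (isOpen_lt continuous_const continuous_re)
    · rw [Set.disjoint_left]
      rintro _ ⟨z, ⟨hz, hz1⟩, rfl⟩ ⟨w, ⟨hw, hw1⟩, hwz⟩
      have : w = z := by rw [← hBA w hw, hwz, hBA z hz]
      subst this
      exact lt_asymm (show w.re < 0 from hz1) hw1
    · have hIcc : α '' Icc (-1) 1 ∩ ball 0 1 = α '' Ioo (-1) 1 := by
        ext w; constructor
        · rintro ⟨⟨t, ht, rfl⟩, hb⟩
          refine ⟨t, ⟨lt_of_le_of_ne ht.1 ?_, lt_of_le_of_ne ht.2 ?_⟩, rfl⟩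
          · rintro rfl; rw [hl] at hb; simp at hb
          · rintro rfl; rw [hr] at hb; simp at hb
        · rintro ⟨t, ht, rfl⟩
          refine ⟨⟨t, Ioo_subset_Icc_self ht, rfl⟩, ?_⟩
          obtain ⟨z, hz, hz0, hzα⟩ := hmem t ht
          rw [← hzα]; exact hAb z hz
      have : ball 0 1 \ α '' Icc (-1) 1 = ball 0 1 \ α '' Ioo (-1) 1 := by
        rw [← hIcc]; ext w; simp
      rw [this, hIm]
      ext w; constructor
      · rintro (⟨z, ⟨hz, hz1⟩, rfl⟩ | ⟨z, ⟨hz, hz1⟩, rfl⟩)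
        · refine ⟨hAb z hz, ?_⟩
          rintro ⟨w, ⟨hw, hw0⟩, hwz⟩
          have : w = z := by rw [← hBA w hw, hwz, hBA z hz]
          subst this
          have h0 : w.re = 0 := hw0
          exact absurd (show w.re < 0 from hz1) (by rw [h0]; simp)
        · refine ⟨hAb z hz, ?_⟩
          rintro ⟨w, ⟨hw, hw0⟩, hwz⟩
          have : w = z := by rw [← hBA w hw, hwz, hBA z hz]
          subst this
          have h0 : w.re = 0 := hw0
          exact absurd (show 0 < w.re from hz1) (by rw [h0]; simp)
      · rintro ⟨hw, hw'⟩
        rcases lt_trichotomy (B w).re 0 with h' | h' | h'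
        · exact Or.inl ⟨B w, ⟨hBO w hw, h'⟩, hAB w hw⟩
        · exact absurd ⟨B w, ⟨hBO w hw, h'⟩, hAB w hw⟩ hw'
        · exact Or.inr ⟨B w, ⟨hBO w hw, h'⟩, hAB w hw⟩
    · refine clo _ fun z hz => ?_
      rw [closure_setOfPred_re_lt]; exact hz.le
    · refine clo _ fun z hz => ?_
      rw [closure_setOfPred_lt_re]; exact hz.ge
  obtain ⟨Ψ, hΨ1, hΨ2⟩ := cfg.cl
  obtain ⟨F, hF1, hF2⟩ := h.homeo hΨ1
  refine ⟨F, hF1, fun p hp => ?_⟩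
  rw [(hF2 p hp).2]
  have hpb := (h.memO (h.sub hp)).1 hp
  constructor
  · intro h0
    have : Θ p ∈ Θ '' {p | p ∈ O ∧ (G.symm p).1 = 0} := ⟨p, ⟨hp, h0⟩, rfl⟩
    rw [← him] at this
    obtain ⟨t, ht, hte⟩ := this
    rw [← hte, hΨ2 t (Ioo_subset_Icc_self ht)]; simp
  · intro h0
    have hb : Ψ (Θ p) ∈ ball (0:ℂ) 1 := by
      by_contra hc
      have := hΨ1 _ hc
      exact hc (by rw [Ψ.injective this]; exact hpb)
    have : Ψ (Θ p) ∈ closedBall (0:ℂ) 1 ∩ {z | z.im = 0} := ⟨ball_subset_closedBall hb, h0⟩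
    rw [← ofReal_image] at this
    obtain ⟨t, ht, hte⟩ := this
    have hte' : Θ p = α t := Ψ.injective (by rw [hΨ2 t ht, ← hte])
    have ht' : t ∈ Ioo (-1:ℝ) 1 := by
      refine ⟨lt_of_le_of_ne ht.1 ?_, lt_of_le_of_ne ht.2 ?_⟩
      · rintro rfl; rw [hte', hl] at hpb; simp at hpb
      · rintro rfl; rw [hte', hr] at hpb; simp at hpb
    have : Θ p ∈ α '' Ioo (-1) 1 := ⟨t, ht', hte'.symm⟩
    rw [him] at this
    obtain ⟨q, ⟨hq, hq0⟩, hqp⟩ := this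
    rw [← h.inv p (h.sub hp), ← hqp, h.inv q (h.sub hq)]; exact hq0
end P8a

section P8b
open Set Filter Topology Complex Metric

lemma sq_disc : ∃ R : ℂ ≃ₜ ℂ, (∀ z : ℂ, (|z.re| < 1 ∧ |z.im| < 1) ↔ R z ∈ ball (0:ℂ) 1) ∧
    (∀ z, (R z).im = 0 ↔ z.im = 0) ∧ R 1 = 1 ∧ R (-1) = -1 := by
  set s : Set ℂ := {z | |z.re| < 1 ∧ |z.im| < 1} with hs
  have hse : s = (Ioo (-1) 1) ×ℂ (Ioo (-1) 1) := by
    ext z; simp [hs, mem_reProdIm, abs_lt]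
  have hso : IsOpen s := by rw [hse]; exact isOpen_Ioo.reProdIm isOpen_Ioo
  have hsc : Convex ℝ s := by
    have : s = (Complex.reLm ⁻¹' Ioo (-1:ℝ) 1) ∩ (Complex.imLm ⁻¹' Ioo (-1:ℝ) 1) := hse
    rw [this]
    exact ((convex_Ioo (-1:ℝ) 1).linear_preimage _).inter ((convex_Ioo (-1:ℝ) 1).linear_preimage _)
  have hs0 : s ∈ 𝓝 (0:ℂ) := hso.mem_nhds (by simp [hs])
  have hsb : Bornology.IsVonNBounded ℝ s := by
    rw [NormedSpace.isVonNBounded_iff, hse]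
    exact (Metric.isBounded_Ioo _ _).reProdIm (Metric.isBounded_Ioo _ _)
  have hbb : Bornology.IsVonNBounded ℝ (ball (0:ℂ) 1) := by
    rw [NormedSpace.isVonNBounded_iff]; exact isBounded_ball
  have hb0 : ball (0:ℂ) 1 ∈ 𝓝 (0:ℂ) := ball_mem_nhds _ one_pos
  have hbc := convex_ball (0:ℂ) 1
  set R := gaugeRescaleHomeomorph s (ball (0:ℂ) 1) hsc hs0 hsb hbc hb0 hbb with hR
  have hRa : ∀ z, R z = (gauge s z / gauge (ball (0:ℂ) 1) z) • z := fun z => rfl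
  have himg : R '' s = ball (0:ℂ) 1 := by
    have := image_gaugeRescaleHomeomorph_interior hsc hs0 hsb hbc hb0 hbb
    rwa [hso.interior_eq, isOpen_ball.interior_eq] at this
  have hmem : ∀ z, z ∈ s ↔ R z ∈ ball (0:ℂ) 1 := fun z => by
    rw [← himg]; exact (R.injective.mem_set_image).symm
  have hcl : ∀ z ∈ closure s, R z ∈ closure (ball (0:ℂ) 1) := 
    mapsTo_gaugeRescale_closure hsc hs0 hbc (by simp) (absorbent_nhds_zero hb0)
  have hpos : ∀ z : ℂ, z ≠ 0 → 0 < gauge s z / gauge (ball (0:ℂ) 1) z := fun z hz =>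
    div_pos ((gauge_pos (absorbent_nhds_zero hs0) hsb).2 hz) ((gauge_pos (absorbent_nhds_zero hb0) hbb).2 hz)
  have hone : ∀ z : ℂ, ‖z‖ = 1 → z ∈ closure s → z ∉ s → R z = z := by
    intro z hz h1 h2
    have a1 := hcl z h1
    have a2 := mt (hmem z).2 h2
    rw [closure_ball _ one_ne_zero, hRa, mem_closedBall_zero_iff, norm_smul, hz] at a1
    rw [hRa, mem_ball_zero_iff, norm_smul, hz] at a2
    have hp := hpos z (by rintro rfl; simp at hz)
    rw [Real.norm_of_nonneg hp.le] at a1 a2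
    have : gauge s z / gauge (ball (0:ℂ) 1) z = 1 := by linarith
    rw [hRa, this, one_smul]
  have hcs : ∀ z : ℂ, |z.re| ≤ 1 → |z.im| ≤ 1 → z ∈ closure s := by
    intro z h1 h2
    rw [hse, closure_reProdIm, closure_Ioo (by norm_num)]
    exact ⟨abs_le.1 h1, abs_le.1 h2⟩
  refine ⟨R, hmem, fun z => ?_, hone 1 (by simp) (hcs _ (by simp) (by simp)) (by simp [hs]),
    hone (-1) (by simp) (hcs _ (by simp) (by simp)) (by simp [hs])⟩
  by_cases hz : z = 0
  · subst hz; rw [hRa]; simp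
  · rw [hRa, Complex.smul_im, smul_eq_mul, mul_eq_zero]
    simp [(hpos z hz).ne']

lemma homeo_mem {O : Set (ℝ × ℝ)} {F : (ℝ × ℝ) ≃ₜ (ℝ × ℝ)} (h : ∀ p, p ∉ O → F p = p) {p : ℝ × ℝ} (hp : p ∈ O) :
    F p ∈ O := by
  by_contra hc
  have := F.injective (h _ hc)
  rw [this] at hc; exact hc hp

theorem comp_cell {l u : ℝ → ℝ} (hl : Continuous l) (hu : Continuous u) {a b : ℝ} (ha : a < 0) (hb : 0 < b)
    (hlu : ∀ x ∈ Icc a b, l x < u x) (G : (ℝ × ℝ) ≃ₜ (ℝ × ℝ)) {s t : ℝ} (hst : s < t)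
    (h0 : G (0, s) = (0, l 0)) (h1 : G (0, t) = (0, u 0))
    {O : Set (ℝ × ℝ)} (hO : O = {p | a < p.1 ∧ p.1 < b ∧ l p.1 < p.2 ∧ p.2 < u p.1})
    (hmid : ∀ r, G (0, r) ∈ O ↔ r ∈ Ioo s t) :
    ∃ F : (ℝ × ℝ) ≃ₜ (ℝ × ℝ), (∀ p, p ∉ O → F p = p) ∧ ∀ p ∈ O, (G.symm p).1 = 0 ↔ (F p).1 = 0 := by
  obtain ⟨R, R1, R2, R3, R4⟩ := sq_disc
  obtain ⟨φ, hφ⟩ := line_interp ![a, 0, b] ![-1, 0, 1] (by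
    intro i j
    fin_cases i <;> fin_cases j <;> simp [ha, hb, (ha.trans hb)] <;>
      constructor <;> intro h <;> linarith)
  have φa : φ a = -1 := hφ 0
  have φ0 : φ 0 = 0 := hφ 1
  have φb : φ b = 1 := hφ 2
  set D : Set (ℝ × ℝ) := {p | a ≤ p.1 ∧ p.1 ≤ b ∧ l p.1 ≤ p.2 ∧ p.2 ≤ u p.1} with hD
  have hDm : ∀ p, p ∈ D ↔ a ≤ p.1 ∧ p.1 ≤ b ∧ l p.1 ≤ p.2 ∧ p.2 ≤ u p.1 := fun p => Iff.rfl
  have hOm : ∀ p, p ∈ O ↔ a < p.1 ∧ p.1 < b ∧ l p.1 < p.2 ∧ p.2 < u p.1 := fun p => by rw [hO]; rfl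
  have hpos : ∀ p ∈ D, 0 < u p.1 - l p.1 := fun p hp => sub_pos.2 (hlu _ ⟨hp.1, hp.2.1⟩)
  set V : ℝ × ℝ → ℝ := fun p => 2 * (p.2 - l p.1) / (u p.1 - l p.1) - 1 with hV
  set Z : ℝ × ℝ → ℂ := fun p => (V p : ℂ) + (φ p.1 : ℂ) * I with hZ
  have Zre : ∀ p, (Z p).re = V p := fun p => by simp [hZ]
  have Zim : ∀ p, (Z p).im = φ p.1 := fun p => by simp [hZ]
  set Z' : ℂ → ℝ × ℝ := fun z => (φ.symm z.im, l (φ.symm z.im) + (z.re + 1) / 2 * (u (φ.symm z.im) - l (φ.symm z.im))) with hZ'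
  have hφc := φ.continuous
  have hφc' := φ.symm.continuous
  have Z'c : Continuous Z' := by fun_prop
  have Zc : ContinuousOn Z D := by
    have : ContinuousOn V D := by
      refine ContinuousOn.sub (ContinuousOn.div (by fun_prop) (by fun_prop) fun p hp => (hpos p hp).ne') continuousOn_const
    have h2 : ContinuousOn (fun p : ℝ × ℝ => φ p.1) D := by fun_prop
    have e1 := continuous_ofReal.comp_continuousOn this
    have e2 := continuous_ofReal.comp_continuousOn h2
    exact e1.add (e2.mul continuousOn_const)
  have Zinv : ∀ p ∈ D, Z' (Z p) = p := fun p hp => by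
    simp only [hZ', Zre, Zim, OrderIso.symm_apply_apply]
    refine Prod.ext rfl ?_
    have := (hpos p hp).ne'
    simp only [hV]; field_simp; ring
  have hVlt : ∀ p ∈ D, (|V p| < 1 ↔ l p.1 < p.2 ∧ p.2 < u p.1) := fun p hp => by
    have := hpos p hp
    rw [abs_lt]
    simp only [hV]
    have e1 : -1 < 2 * (p.2 - l p.1) / (u p.1 - l p.1) - 1 ↔ 0 < 2 * (p.2 - l p.1) / (u p.1 - l p.1) := by
      constructor <;> intro h <;> linarith
    have e2 : 2 * (p.2 - l p.1) / (u p.1 - l p.1) - 1 < 1 ↔ 2 * (p.2 - l p.1) / (u p.1 - l p.1) < 2 := by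
      constructor <;> intro h <;> linarith
    rw [e1, e2, lt_div_iff₀ this, div_lt_iff₀ this]
    constructor
    · rintro ⟨h1, h2⟩; constructor <;> linarith
    · rintro ⟨h1, h2⟩; constructor <;> linarith
  have hφlt : ∀ x, |φ x| < 1 ↔ a < x ∧ x < b := fun x => by
    rw [abs_lt, ← φa, ← φb, φ.lt_iff_lt, φ.lt_iff_lt]
  have hOZ : ∀ p ∈ D, (p ∈ O ↔ R (Z p) ∈ ball (0:ℂ) 1) := fun p hp => by
    rw [← R1, Zre, Zim, hVlt p hp, hφlt, hOm]; tauto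
  have hOD : O ⊆ D := fun p hp => by
    obtain ⟨h1, h2, h3, h4⟩ := (hOm p).1 hp; exact ⟨h1.le, h2.le, h3.le, h4.le⟩
  have cell : Cell D O (fun p => R (Z p)) (fun w => Z' (R.symm w)) := by
    refine ⟨?_, ?_, hOD, R.continuous.comp_continuousOn Zc, (Z'c.comp R.symm.continuous).continuousOn, ?_, ?_, ?_⟩
    · refine (isClosed_le continuous_const continuous_fst).inter ((isClosed_le continuous_fst continuous_const).inter
        ((isClosed_le (hl.comp continuous_fst) continuous_snd).inter (isClosed_le continuous_snd (hu.comp continuous_fst))))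
    · rw [hO]
      refine (isOpen_lt continuous_const continuous_fst).inter ((isOpen_lt continuous_fst continuous_const).inter
        ((isOpen_lt (hl.comp continuous_fst) continuous_snd).inter (isOpen_lt continuous_snd (hu.comp continuous_fst))))
    · intro p hp; simp [Zinv p hp]
    · ext w; constructor
      · rintro ⟨p, hp, rfl⟩; exact (hOZ p (hOD hp)).1 hp
      · intro hw
        have hw' : R (R.symm w) ∈ ball (0:ℂ) 1 := by simpa using hw
        rw [← R1] at hw'
        set z := R.symm w with hz
        have hx : a < φ.symm z.im ∧ φ.symm z.im < b := by rw [← hφlt]; simpa using hw'.2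
        have hlu' := hlu _ ⟨hx.1.le, hx.2.le⟩
        obtain ⟨h3, h4⟩ := abs_lt.1 hw'.1
        have hO : Z' z ∈ O := by
          rw [hOm]
          refine ⟨hx.1, hx.2, ?_, ?_⟩
          · simp only [hZ']; nlinarith
          · simp only [hZ']; nlinarith
        refine ⟨Z' z, hO, ?_⟩
        have : Z (Z' z) = z := by
          apply Complex.ext
          · rw [Zre]; simp only [hV, hZ']
            have := (sub_pos.2 hlu').ne'
            field_simp; ring
          · rw [Zim]; simp [hZ']
        simp only [this]; simp [hz]
    · intro p hp hpO; exact mt (hOZ p hp).2 hpO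
  have l0u0 : l 0 < u 0 := hlu 0 ⟨ha.le, hb.le⟩
  set q : ℝ → ℝ := fun r => s + (r + 1) / 2 * (t - s) with hq
  have qmem : ∀ r, r ∈ Ioo (-1:ℝ) 1 ↔ q r ∈ Ioo s t := fun r => by
    simp only [hq, mem_Ioo]
    constructor
    · rintro ⟨h1, h2⟩; constructor <;> nlinarith
    · rintro ⟨h1, h2⟩; constructor <;> nlinarith
  have qinj : ∀ r r', q r = q r' → r = r' := fun r r' h => by
    simp only [hq] at h
    have : (r - r') * (t - s) = 0 := by linarith
    rcases mul_eq_zero.1 this with h | h <;> linarith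
  have qD : ∀ r ∈ Icc (-1:ℝ) 1, G (0, q r) ∈ D := by
    intro r hr
    rcases eq_or_lt_of_le hr.1 with h | h
    · have : q r = s := by simp [hq, ← h]
      rw [this, h0, hDm]; exact ⟨ha.le, hb.le, le_rfl, l0u0.le⟩
    rcases eq_or_lt_of_le hr.2 with h' | h'
    · have : q r = t := by simp [hq, h']
      rw [this, h1, hDm]; exact ⟨ha.le, hb.le, l0u0.le, le_rfl⟩
    · exact hOD ((hmid _).2 ((qmem r).1 ⟨h, h'⟩))
  obtain ⟨F, hF1, hF2⟩ := cell.straighten G (by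
      have : {r : ℝ | G (0, r) ∈ O} = Ioo s t := by ext r; exact hmid r
      rw [this]; exact ordConnected_Ioo) ⟨(s + t) / 2, (hmid _).2 ⟨by linarith, by linarith⟩⟩
    (α := fun r => R (Z (G (0, q r)))) 
    (by
      have : Continuous fun r : ℝ => G (0, q r) := G.continuous.comp (by fun_prop)
      exact cell.c1.comp this.continuousOn qD)
    (by
      intro r hr r' hr' h
      have : Z (G (0, q r)) = Z (G (0, q r')) := R.injective h
      have e := Zinv _ (qD r hr)
      rw [this, Zinv _ (qD r' hr')] at e
      have := G.injective e
      exact (qinj _ _ (by simpa using this)).symm)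
    (by
      have : q (-1) = s := by simp [hq]
      simp only [this, h0]
      have : Z (0, l 0) = -1 := by apply Complex.ext <;> simp [Zre, Zim, hV, φ0]
      rw [this, R4])
    (by
      have : q 1 = t := by simp [hq]
      simp only [this, h1]
      have : Z (0, u 0) = 1 := by 
        apply Complex.ext
        · have := (sub_pos.2 l0u0).ne'
          rw [Zre]; simp only [hV]; field_simp; norm_num
        · simp [Zim, φ0]
      rw [this, R3])
    (by
      ext w; constructor
      · rintro ⟨r, hr, rfl⟩
        exact ⟨G (0, q r), ⟨(hmid _).2 ((qmem r).1 hr), by simp⟩, rfl⟩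
      · rintro ⟨p, ⟨hp, hp0⟩, rfl⟩
        have e : p = G (0, (G.symm p).2) := by
          rw [← hp0]; simp
        have hm : (G.symm p).2 ∈ Ioo s t := (hmid _).1 (by rw [← e]; exact hp)
        set y := (G.symm p).2
        have hqy : q (2 * (y - s) / (t - s) - 1) = y := by
          have := (sub_pos.2 hst).ne'
          simp only [hq]; field_simp; ring
        refine ⟨2 * (y - s) / (t - s) - 1, (qmem _).2 (by rw [hqy]; exact hm), ?_⟩
        simp only [hqy, ← e])
  refine ⟨F, hF1, fun p hp => (hF2 p hp).trans ?_⟩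
  rw [R2, Zim]
  constructor
  · intro h; apply φ.injective; rw [h, φ0]
  · intro h; rw [h, φ0]
end P8b

section P8c
open Set Filter Topology Complex Metric

lemma cay_iff (z : ℂ) (hz : z + 1 ≠ 0) : ‖(z - 1) / (z + 1)‖ < 1 ↔ 0 < z.re := by
  rw [norm_div, div_lt_one (norm_pos_iff.2 hz), ← sq_lt_sq₀ (norm_nonneg _) (norm_nonneg _),
    ← normSq_eq_norm_sq, ← normSq_eq_norm_sq, normSq_apply, normSq_apply]
  simp
  constructor <;> intro h <;> nlinarith

lemma cay_ne {z : ℂ} (hz : 0 ≤ z.re) : z + 1 ≠ 0 := by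
  intro h
  have := congrArg Complex.re h
  simp at this; linarith

lemma cay_inv {z : ℂ} (hz : z + 1 ≠ 0) : (1 + (z - 1) / (z + 1)) / (1 - (z - 1) / (z + 1)) = z := by
  have : 1 - (z - 1) / (z + 1) = 2 / (z + 1) := by field_simp; ring
  rw [this]; field_simp; ring

lemma cay_inv' {w : ℂ} (hw : 1 - w ≠ 0) : (1 + w) / (1 - w) + 1 ≠ 0 ∧
    ((1 + w) / (1 - w) - 1) / ((1 + w) / (1 - w) + 1) = w := by
  have : (1 + w) / (1 - w) + 1 = 2 / (1 - w) := by field_simp; ring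
  rw [this]
  refine ⟨div_ne_zero two_ne_zero hw, ?_⟩
  field_simp; ring

lemma cay_im {z : ℂ} (hz : z + 1 ≠ 0) : ((z - 1) / (z + 1)).im = 0 ↔ z.im = 0 := by
  rw [← conj_eq_iff_im, ← conj_eq_iff_im, map_div₀, map_sub, map_add, map_one]
  constructor
  · intro h
    have hz' : (starRingEnd ℂ) z + 1 ≠ 0 := by
      intro hc
      apply hz
      have := congrArg (starRingEnd ℂ) hc
      simpa using this
    rw [← cay_inv hz', h, cay_inv hz]
  · intro h; rw [h]

lemma re_tendsto_cobounded {z : ℝ → ℂ} (hz : Tendsto z atTop (cocompact ℂ)) :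
    Tendsto (fun r => (z r - 1) / (z r + 1)) atTop (𝓝 1) := by
  have h1 : Tendsto (fun r => z r + 1) atTop (Bornology.cobounded ℂ) := by
    rw [cobounded_eq_cocompact]
    exact ((Homeomorph.addRight (1:ℂ)).isClosedEmbedding.tendsto_cocompact).comp hz
  have h2 := (tendsto_inv₀_cobounded.comp h1).const_mul (2:ℂ)
  have h3 : Tendsto (fun r => 1 - 2 * (z r + 1)⁻¹) atTop (𝓝 1) := by
    have := h2.const_sub (1:ℂ)
    simpa using this
  refine h3.congr' ?_
  have h4 : ∀ᶠ r in atTop, z r + 1 ≠ 0 := by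
    have : ∀ᶠ w in Bornology.cobounded ℂ, w ≠ 0 := Bornology.eventually_ne_cobounded 0
    exact h1.eventually this
  filter_upwards [h4] with r hr
  field_simp; ring

theorem top_cell {u : ℝ → ℝ} (hu : Continuous u) (G : (ℝ × ℝ) ≃ₜ (ℝ × ℝ)) {s : ℝ}
    (h0 : G (0, s) = (0, u 0))
    {O : Set (ℝ × ℝ)} (hO : O = {p | u p.1 < p.2})
    (hmid : ∀ r, G (0, r) ∈ O ↔ s < r) :
    ∃ F : (ℝ × ℝ) ≃ₜ (ℝ × ℝ), (∀ p, p ∉ O → F p = p) ∧ ∀ p ∈ O, (G.symm p).1 = 0 ↔ (F p).1 = 0 := by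
  classical
  have hOm : ∀ p, p ∈ O ↔ u p.1 < p.2 := fun p => by rw [hO]; rfl
  set D : Set (ℝ × ℝ) := {p | u p.1 ≤ p.2} with hD
  have hDm : ∀ p, p ∈ D ↔ u p.1 ≤ p.2 := fun p => Iff.rfl
  have hOD : O ⊆ D := fun p hp => ((hOm p).1 hp).le
  let T : (ℝ × ℝ) ≃ₜ ℂ :=
    { toFun := fun p => ((p.2 - u p.1 : ℝ) : ℂ) + (p.1 : ℂ) * I
      invFun := fun z => (z.im, z.re + u z.im)
      left_inv := fun p => by simp
      right_inv := fun z => by apply Complex.ext <;> simp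
      continuous_toFun := by fun_prop
      continuous_invFun := by fun_prop }
  have Tre : ∀ p, (T p).re = p.2 - u p.1 := fun p => by 
    show (((p.2 - u p.1 : ℝ) : ℂ) + (p.1 : ℂ) * I).re = _
    simp
  have Tim : ∀ p, (T p).im = p.1 := fun p => by 
    show (((p.2 - u p.1 : ℝ) : ℂ) + (p.1 : ℂ) * I).im = _
    simp
  have Tne : ∀ p ∈ D, T p + 1 ≠ 0 := fun p hp => cay_ne (by rw [Tre]; have := (hDm p).1 hp; linarith)
  have hOZ : ∀ p ∈ D, (p ∈ O ↔ (T p - 1) / (T p + 1) ∈ ball (0:ℂ) 1) := fun p hp => by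
    rw [mem_ball_zero_iff, cay_iff _ (Tne p hp), Tre, hOm, sub_pos]
  have cell : Cell D O (fun p => (T p - 1) / (T p + 1)) (fun w => T.symm ((1 + w) / (1 - w))) := by
    refine ⟨?_, ?_, hOD, ?_, ?_, ?_, ?_, ?_⟩
    · exact isClosed_le (hu.comp continuous_fst) continuous_snd
    · rw [hO]; exact isOpen_lt (hu.comp continuous_fst) continuous_snd
    · have := T.continuous
      exact ContinuousOn.div (by fun_prop) (by fun_prop) Tne
    · refine T.symm.continuous.comp_continuousOn (ContinuousOn.div (by fun_prop) (by fun_prop) ?_)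
      rintro _ ⟨p, hp, rfl⟩
      have := Tne p hp
      have e : 1 - (T p - 1) / (T p + 1) = 2 / (T p + 1) := by field_simp; ring
      rw [e]; exact div_ne_zero two_ne_zero this
    · intro p hp; simp [cay_inv (Tne p hp)]
    · ext w; constructor
      · rintro ⟨p, hp, rfl⟩; exact (hOZ p (hOD hp)).1 hp
      · intro hw
        have hw1 : 1 - w ≠ 0 := by
          intro h
          have : w = 1 := by linear_combination -h
          rw [this] at hw; simp at hw
        obtain ⟨a1, a2⟩ := cay_inv' hw1
        have : 0 < ((1 + w) / (1 - w)).re := by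
          rw [← cay_iff _ a1, a2]; simpa using hw
        refine ⟨T.symm ((1 + w) / (1 - w)), ?_, by simp [a2]⟩
        rw [hOm, ← sub_pos, ← Tre]; simpa using this
    · intro p hp hpO; exact mt (hOZ p hp).2 hpO
  have gD : ∀ r, s ≤ r → G (0, r) ∈ D := by
    intro r hr
    rcases eq_or_lt_of_le hr with h | h
    · rw [← h, h0, hDm]
    · exact hOD ((hmid _).2 h)
  set q : ℝ → ℝ := fun r => s + (1 + r) / (1 - r) with hq
  have qinj : ∀ r r', r < 1 → r' < 1 → q r = q r' → r = r' := fun r r' h1 h2 h => by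
    simp only [hq, add_right_inj] at h
    have e1 : (1 - r) ≠ 0 := by linarith
    have e2 : (1 - r') ≠ 0 := by linarith
    rw [div_eq_div_iff e1 e2] at h
    linarith
  have qge : ∀ r, -1 ≤ r → r < 1 → s ≤ q r := fun r h1 h2 => by
    have : 0 ≤ (1 + r) / (1 - r) := div_nonneg (by linarith) (by linarith)
    simp only [hq]; linarith
  have qgt : ∀ r, -1 < r → r < 1 → s < q r := fun r h1 h2 => by
    have : 0 < (1 + r) / (1 - r) := div_pos (by linarith) (by linarith)
    simp only [hq]; linarith
  have hlim : Tendsto q (𝓝[<] 1) atTop := by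
    refine tendsto_atTop_add_const_left _ s ?_
    have h1 : Tendsto (fun r : ℝ => 1 + r) (𝓝[<] 1) (𝓝 2) := by
      have : Tendsto (fun r : ℝ => 1 + r) (𝓝 1) (𝓝 (1 + 1)) := Continuous.tendsto (by fun_prop) 1
      norm_num at this
      exact this.mono_left nhdsWithin_le_nhds
    have h2 : Tendsto (fun r : ℝ => 1 - r) (𝓝[<] 1) (𝓝[>] 0) := by
      refine tendsto_nhdsWithin_iff.2 ⟨?_, ?_⟩
      · have : Tendsto (fun r : ℝ => 1 - r) (𝓝 1) (𝓝 (1 - 1)) := Continuous.tendsto (by fun_prop) 1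
        norm_num at this
        exact this.mono_left nhdsWithin_le_nhds
      · filter_upwards [self_mem_nhdsWithin] with r hr
        have hr : r < 1 := hr
        exact sub_pos.2 hr
    simpa [div_eq_mul_inv] using h1.pos_mul_atTop two_pos (tendsto_inv_nhdsGT_zero.comp h2)
  have hcoc : Tendsto (fun r => T (G (0, r))) atTop (cocompact ℂ) := by
    have h1 : Tendsto (fun r : ℝ => ((0:ℝ), r)) atTop (cocompact (ℝ × ℝ)) := by
      have hce : IsClosedEmbedding (fun r : ℝ => ((0:ℝ), r)) := by
        refine ⟨isEmbedding_prodMkRight 0, ?_⟩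
        have : range (fun r : ℝ => ((0:ℝ), r)) = {p | p.1 = 0} := by
          ext p; constructor
          · rintro ⟨r, rfl⟩; rfl
          · intro hp; exact ⟨p.2, Prod.ext hp.symm rfl⟩
        rw [this]; exact isClosed_eq continuous_fst continuous_const
      exact hce.tendsto_cocompact.mono_left atTop_le_cocompact
    exact (T.isClosedEmbedding.tendsto_cocompact.comp G.isClosedEmbedding.tendsto_cocompact).comp h1
  set α : ℝ → ℂ := fun r => if r < 1 then (T (G (0, q r)) - 1) / (T (G (0, q r)) + 1) else 1 with hα
  have α1 : ∀ r, r < 1 → α r = (T (G (0, q r)) - 1) / (T (G (0, q r)) + 1) := fun r hr => if_pos hr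
  have α2 : α 1 = 1 := if_neg (lt_irrefl _)
  have hαO : ∀ r ∈ Ioo (-1:ℝ) 1, α r ∈ ball (0:ℂ) 1 := fun r hr => by
    rw [α1 r hr.2, ← hOZ _ (gD _ (qge r hr.1.le hr.2))]
    exact (hmid _).2 (qgt r hr.1 hr.2)
  have qs : q (-1) = s := by simp [hq]
  have αm1 : α (-1) = -1 := by
    rw [α1 _ (by norm_num), qs, h0]
    have : T (0, u 0) = 0 := by apply Complex.ext <;> simp [Tre, Tim]
    rw [this]; simp
  obtain ⟨F, hF1, hF2⟩ := cell.straighten G (by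
      have : {r : ℝ | G (0, r) ∈ O} = Ioi s := by ext r; exact hmid r
      rw [this]; exact ordConnected_Ioi) ⟨s + 1, (hmid _).2 (by linarith)⟩
    (α := α)
    (by
      intro r hr
      rcases eq_or_lt_of_le hr.2 with h | h
      · subst h
        rw [← continuousWithinAt_sdiff_self, ContinuousWithinAt, α2]
        have : Icc (-1:ℝ) 1 \ {1} ⊆ Iio 1 := fun x hx => lt_of_le_of_ne hx.1.2 hx.2
        refine Tendsto.mono_left ?_ (nhdsWithin_mono _ this)
        refine ((re_tendsto_cobounded hcoc).comp hlim).congr' ?_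
        filter_upwards [self_mem_nhdsWithin] with x hx
        exact (α1 x hx).symm
      · have hc : ContinuousOn (fun r => (T (G (0, q r)) - 1) / (T (G (0, q r)) + 1)) (Ico (-1) 1) := by
          have hqc : ContinuousOn q (Ico (-1) 1) := 
            continuousOn_const.add (ContinuousOn.div (by fun_prop) (by fun_prop) fun x hx => by have := hx.2; linarith)
          have : ContinuousOn (fun r : ℝ => G (0, q r)) (Ico (-1) 1) := 
            G.continuous.comp_continuousOn (continuousOn_const.prodMk hqc)
          exact cell.c1.comp this fun x hx => gD _ (qge x hx.1 hx.2)
        have h1 : ContinuousWithinAt α (Ico (-1) 1) r := 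
          (hc.congr fun x hx => α1 x hx.2) r ⟨hr.1, h⟩
        refine h1.mono_of_mem_nhdsWithin ?_
        have : Iio (1:ℝ) ∈ 𝓝 r := Iio_mem_nhds h
        filter_upwards [self_mem_nhdsWithin, mem_nhdsWithin_of_mem_nhds this] with x hx hx'
        exact ⟨hx.1, hx'⟩)
    (by
      have key : ∀ r ∈ Icc (-1:ℝ) 1, r < 1 → α r ≠ 1 := by
        intro r hr hr1 h
        rw [α1 r hr1] at h
        have := Tne _ (gD _ (qge r hr.1 hr1))
        rw [div_eq_one_iff_eq this] at h
        have : (2:ℂ) = 0 := by linear_combination -h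
        norm_num at this
      intro r hr r' hr' h
      rcases eq_or_lt_of_le hr.2 with h1 | h1 <;> rcases eq_or_lt_of_le hr'.2 with h2 | h2
      · rw [h1, h2]
      · rw [h1, α2] at h; exact absurd h.symm (key r' hr' h2)
      · rw [h2, α2] at h; exact absurd h (key r hr h1)
      · rw [α1 r h1, α1 r' h2] at h
        have e1 := cay_inv (Tne _ (gD _ (qge r hr.1 h1)))
        rw [h, cay_inv (Tne _ (gD _ (qge r' hr'.1 h2)))] at e1
        have := G.injective (T.injective e1)
        exact (qinj _ _ h2 h1 (by simpa using this)).symm)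
    αm1 α2
    (by
      ext w; constructor
      · rintro ⟨r, hr, rfl⟩
        exact ⟨G (0, q r), ⟨(hmid _).2 (qgt r hr.1 hr.2), by simp⟩, (α1 r hr.2).symm⟩
      · rintro ⟨p, ⟨hp, hp0⟩, rfl⟩
        have e : p = G (0, (G.symm p).2) := by
          rw [← hp0]; simp
        have hm : s < (G.symm p).2 := (hmid _).1 (by rw [← e]; exact hp)
        set y := (G.symm p).2
        have hy : 0 < y - s + 1 := by linarith
        set r := (y - s - 1) / (y - s + 1) with hr
        have r1 : r < 1 := by rw [hr, div_lt_one hy]; linarith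
        have r2 : -1 < r := by rw [hr, lt_div_iff₀ hy]; linarith
        have hqy : q r = y := by
          have : 1 - r = 2 / (y - s + 1) := by rw [hr]; field_simp; ring
          have h2 : 1 + r = 2 * (y - s) / (y - s + 1) := by rw [hr]; field_simp; ring
          simp only [hq, this, h2]; field_simp; ring
        refine ⟨r, ⟨r2, r1⟩, ?_⟩
        rw [α1 r r1]
        simp only [hqy, ← e])
  refine ⟨F, hF1, fun p hp => (hF2 p hp).trans ?_⟩
  rw [cay_im (Tne _ (hOD (homeo_mem hF1 hp))), Tim]

/-- vertical reflection -/
def vrefl : (ℝ × ℝ) ≃ₜ (ℝ × ℝ) where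
  toFun p := (p.1, -p.2)
  invFun p := (p.1, -p.2)
  left_inv p := by simp
  right_inv p := by simp
  continuous_toFun := by fun_prop
  continuous_invFun := by fun_prop

lemma vrefl_apply (p : ℝ × ℝ) : vrefl p = (p.1, -p.2) := rfl
lemma vrefl_symm_apply (p : ℝ × ℝ) : vrefl.symm p = (p.1, -p.2) := rfl

theorem bot_cell {u : ℝ → ℝ} (hu : Continuous u) (G : (ℝ × ℝ) ≃ₜ (ℝ × ℝ)) {s : ℝ}
    (h0 : G (0, s) = (0, u 0))
    {O : Set (ℝ × ℝ)} (hO : O = {p | p.2 < u p.1})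
    (hmid : ∀ r, G (0, r) ∈ O ↔ r < s) :
    ∃ F : (ℝ × ℝ) ≃ₜ (ℝ × ℝ), (∀ p, p ∉ O → F p = p) ∧ ∀ p ∈ O, (G.symm p).1 = 0 ↔ (F p).1 = 0 := by
  have hOm : ∀ p, p ∈ O ↔ p.2 < u p.1 := fun p => by rw [hO]; rfl
  obtain ⟨F, h1, h2⟩ := top_cell (u := fun x => - u x) hu.neg ((vrefl.trans G).trans vrefl) (s := -s)
    (by simp [vrefl_apply, h0]) (O := {p | - u p.1 < p.2}) rfl (by
      intro r
      have := hmid (-r)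
      rw [hOm] at this
      show - u _ < _ ↔ _
      simp only [Homeomorph.trans_apply, vrefl_apply, neg_lt_neg_iff]
      rw [this]; constructor <;> intro h <;> linarith)
  refine ⟨(vrefl.trans F).trans vrefl, fun p hp => ?_, fun p hp => ?_⟩
  · have : vrefl p ∉ {p : ℝ × ℝ | - u p.1 < p.2} := by
      intro h
      have h : - u p.1 < - p.2 := h
      exact hp ((hOm p).2 (by linarith))
    rw [Homeomorph.trans_apply, Homeomorph.trans_apply, h1 _ this]
    simp [vrefl_apply]
  · have h3 := (hOm p).1 hp
    have : vrefl p ∈ {p : ℝ × ℝ | - u p.1 < p.2} := by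
      show - u p.1 < - p.2
      linarith
    have := h2 _ this
    simp [vrefl_apply, vrefl_symm_apply] at this ⊢
    exact this
end P8c

section P8d
open Set Filter Topology

theorem glue_many {κ : Type*} [Finite κ] (O : κ → Set (ℝ × ℝ)) (hd : ∀ i j, i ≠ j → Disjoint (O i) (O j))
    (F : κ → (ℝ × ℝ) ≃ₜ (ℝ × ℝ)) (hF : ∀ i p, p ∉ O i → F i p = p) :
    ∃ H : (ℝ × ℝ) ≃ₜ (ℝ × ℝ), (∀ i, ∀ p ∈ O i, H p = F i p) ∧ ∀ p, (∀ i, p ∉ O i) → H p = p := by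
  classical
  have := Fintype.ofFinite κ
  suffices h : ∀ s : Finset κ, ∃ H : (ℝ × ℝ) ≃ₜ (ℝ × ℝ), (∀ i ∈ s, ∀ p ∈ O i, H p = F i p) ∧ 
      ∀ p, (∀ i ∈ s, p ∉ O i) → H p = p by
    obtain ⟨H, h1, h2⟩ := h Finset.univ
    exact ⟨H, fun i => h1 i (Finset.mem_univ i), fun p hp => h2 p fun i _ => hp i⟩
  intro s
  induction s using Finset.induction_on with
  | empty => exact ⟨Homeomorph.refl _, by simp, by simp⟩
  | insert a s ha ih =>
    obtain ⟨H, h1, h2⟩ := ih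
    refine ⟨(F a).trans H, ?_, ?_⟩
    · intro i hi p hp
      rw [Homeomorph.trans_apply]
      rcases Finset.mem_insert.1 hi with hia | his
      · subst hia
        apply h2
        intro j hj hpj
        exact (Set.disjoint_left.1 (hd i j (fun he => ha (he ▸ hj))) (homeo_mem (hF i) hp)) hpj
      · have : p ∉ O a := fun hpa => Set.disjoint_left.1 (hd i a (fun he => ha (he ▸ his))) hp hpa
        rw [hF a p this, h1 i his p hp]
    · intro p hp
      rw [Homeomorph.trans_apply, hF a p (hp a (Finset.mem_insert_self _ _)), h2 p fun i hi => hp i (Finset.mem_insert_of_mem hi)]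

lemma exists_inf {ι : Type*} {g : ι → ℝ → ℝ} (hg : ∀ i, Continuous (g i)) (s : Finset ι) (hs : s.Nonempty) :
    ∃ u : ℝ → ℝ, Continuous u ∧ (∀ x c, c < u x ↔ ∀ j ∈ s, c < g j x) ∧ ∀ x, ∃ j ∈ s, u x = g j x := by
  refine ⟨fun x => s.inf' hs fun j => g j x, ?_, fun x c => ?_, fun x => ?_⟩
  · exact Continuous.finset_inf'_apply hs fun i _ => hg i
  · exact Finset.lt_inf'_iff hs
  · exact Finset.exists_mem_eq_inf' hs _

lemma exists_sup {ι : Type*} {g : ι → ℝ → ℝ} (hg : ∀ i, Continuous (g i)) (s : Finset ι) (hs : s.Nonempty) :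
    ∃ u : ℝ → ℝ, Continuous u ∧ (∀ x c, u x < c ↔ ∀ j ∈ s, g j x < c) ∧ ∀ x, ∃ j ∈ s, u x = g j x := by
  refine ⟨fun x => s.sup' hs fun j => g j x, ?_, fun x c => ?_, fun x => ?_⟩
  · exact Continuous.finset_sup'_apply hs fun i _ => hg i
  · exact Finset.sup'_lt_iff hs
  · exact Finset.exists_mem_eq_sup' hs _

lemma gap_find {m : ℕ} {t : Fin m → ℝ} (ht : StrictMono t) {r : ℝ} (hr : ∀ j, r ≠ t j) :
    ∃ k, k ≤ m ∧ (∀ j : Fin m, (j:ℕ) < k → t j < r) ∧ (∀ j : Fin m, k ≤ (j:ℕ) → r < t j) := by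
  classical
  have hex : ∃ k, ∀ j : Fin m, k ≤ (j:ℕ) → r < t j := ⟨m, fun j hj => absurd j.2 (not_lt.2 hj)⟩
  refine ⟨Nat.find hex, Nat.find_min' hex fun j hj => absurd j.2 (not_lt.2 hj), ?_, Nat.find_spec hex⟩
  intro j hj
  have := Nat.find_min hex hj
  push Not at this
  obtain ⟨i, hi, hti⟩ := this
  have h0 : (i : ℕ) < Nat.find hex ∨ Nat.find hex ≤ (i:ℕ) := lt_or_ge _ _
  have h1 : t i < r := lt_of_le_of_ne hti (hr i).symm
  exact lt_of_le_of_lt (ht.monotone hi) h1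

theorem cell_k {m : ℕ} (hm : 0 < m) {g : Fin m → ℝ → ℝ} (hg : ∀ i, Continuous (g i)) (G : (ℝ × ℝ) ≃ₜ (ℝ × ℝ))
    {t : Fin m → ℝ} (ht : StrictMono t) (h0 : ∀ i, G (0, t i) = (0, g i 0))
    (hlo : ∀ i r, r < t i → (G (0, r)).2 < g i (G (0, r)).1)
    (hhi : ∀ i r, t i < r → g i (G (0, r)).1 < (G (0, r)).2) (k : ℕ) (hk : k ≤ m) :
    ∃ (O : Set (ℝ × ℝ)) (F : (ℝ × ℝ) ≃ₜ (ℝ × ℝ)), 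
      (∀ p ∈ O, (∀ j : Fin m, (j:ℕ) < k → g j p.1 < p.2) ∧ (∀ j : Fin m, k ≤ (j:ℕ) → p.2 < g j p.1)) ∧
      (∀ r, (∀ j : Fin m, (j:ℕ) < k → t j < r) → (∀ j : Fin m, k ≤ (j:ℕ) → r < t j) → G (0, r) ∈ O) ∧
      (∀ y, (∀ j : Fin m, (j:ℕ) < k → g j 0 < y) → (∀ j : Fin m, k ≤ (j:ℕ) → y < g j 0) → ((0:ℝ), y) ∈ O) ∧
      (∀ p, p ∉ O → F p = p) ∧ ∀ p ∈ O, (G.symm p).1 = 0 ↔ (F p).1 = 0 := by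
  have gm : ∀ i j, i < j → g i 0 < g j 0 := by
    intro i j hij
    have := hhi i (t j) (ht hij)
    rw [h0 j] at this; exact this
  have gm' : ∀ i j, i ≤ j → g i 0 ≤ g j 0 := fun i j hij => by
    rcases eq_or_lt_of_le hij with h | h
    · rw [h]
    · exact (gm i j h).le
  rcases Nat.eq_zero_or_pos k with rfl | hkpos
  · -- bottom cell
    obtain ⟨u, hu, hu1, hu2⟩ := exists_inf hg Finset.univ ⟨⟨0, hm⟩, Finset.mem_univ _⟩
    have u0 : u 0 = g ⟨0, hm⟩ 0 := by
      obtain ⟨j, -, hj⟩ := hu2 0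
      apply le_antisymm
      · by_contra hc
        push Not at hc
        exact lt_irrefl _ ((hu1 0 _).1 hc _ (Finset.mem_univ _))
      · rw [hj]; exact gm' _ _ (Nat.zero_le _)
    obtain ⟨F, hF1, hF2⟩ := bot_cell hu G (s := t ⟨0, hm⟩) (by rw [h0, u0]) (O := {p | p.2 < u p.1}) rfl (by
      intro r
      show (G (0, r)).2 < u _ ↔ _
      rw [hu1]
      constructor
      · intro h
        have := h ⟨0, hm⟩ (Finset.mem_univ _)
        by_contra hc
        push Not at hc
        rcases eq_or_lt_of_le hc with h' | h'
        · rw [← h', h0] at this; exact lt_irrefl _ this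
        · exact lt_asymm this (hhi _ _ h')
      · intro h j _
        exact hlo j r (h.trans_le (ht.monotone (Nat.zero_le _))))
    refine ⟨{p | p.2 < u p.1}, F, ?_, ?_, ?_, hF1, hF2⟩
    · intro p hp
      exact ⟨fun j hj => absurd hj (Nat.not_lt_zero _), fun j _ => (hu1 _ _).1 hp j (Finset.mem_univ _)⟩
    · intro r _ h
      show (G (0, r)).2 < u _
      rw [hu1]
      intro j _; exact hlo j r (h j (Nat.zero_le _))
    · intro y _ h
      show y < u 0
      rw [hu1]; intro j _; exact h j (Nat.zero_le _)
  rcases eq_or_lt_of_le hk with rfl | hkm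
  · -- top cell
    set last : Fin k := ⟨k - 1, by omega⟩ with hlast
    have hle : ∀ j : Fin k, j ≤ last := fun j => by rw [Fin.le_def]; simp [hlast]; omega
    obtain ⟨u, hu, hu1, hu2⟩ := exists_sup hg Finset.univ ⟨last, Finset.mem_univ _⟩
    have u0 : u 0 = g last 0 := by
      obtain ⟨j, -, hj⟩ := hu2 0
      apply le_antisymm
      · rw [hj]; exact gm' _ _ (hle _)
      · by_contra hc
        push Not at hc
        exact lt_irrefl _ ((hu1 0 _).1 hc _ (Finset.mem_univ _))
    obtain ⟨F, hF1, hF2⟩ := top_cell hu G (s := t last) (by rw [h0, u0]) (O := {p | u p.1 < p.2}) rfl (by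
      intro r
      show u _ < (G (0, r)).2 ↔ _
      rw [hu1]
      constructor
      · intro h
        have := h last (Finset.mem_univ _)
        by_contra hc
        push Not at hc
        rcases eq_or_lt_of_le hc with h' | h'
        · rw [h', h0] at this; exact lt_irrefl _ this
        · exact lt_asymm this (hlo _ _ h')
      · intro h j _
        exact hhi j r (lt_of_le_of_lt (ht.monotone (hle j)) h))
    refine ⟨{p | u p.1 < p.2}, F, ?_, ?_, ?_, hF1, hF2⟩
    · intro p hp
      exact ⟨fun j _ => (hu1 _ _).1 hp j (Finset.mem_univ _), fun j hj => absurd j.2 (not_lt.2 hj)⟩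
    · intro r h _
      show u _ < (G (0, r)).2
      rw [hu1]
      intro j _; exact hhi j r (h j j.2)
    · intro y h _
      show u 0 < y
      rw [hu1]; intro j _; exact h j j.2
  · -- compact cell
    set jl : Fin m := ⟨k - 1, by omega⟩ with hjl
    set ju : Fin m := ⟨k, hkm⟩ with hju
    obtain ⟨l, hl, hl1, hl2⟩ := exists_sup hg (Finset.univ.filter fun j : Fin m => (j:ℕ) < k) 
      ⟨jl, by simp [hjl]; omega⟩
    obtain ⟨u, hu, hu1, hu2⟩ := exists_inf hg (Finset.univ.filter fun j : Fin m => k ≤ (j:ℕ)) 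
      ⟨ju, by simp [hju]⟩
    simp only [Finset.mem_filter, Finset.mem_univ, true_and] at hl1 hl2 hu1 hu2
    have hlel : ∀ j : Fin m, (j:ℕ) < k → j ≤ jl := fun j hj => by rw [Fin.le_def]; simp [hjl]; omega
    have hleu : ∀ j : Fin m, k ≤ (j:ℕ) → ju ≤ j := fun j hj => by rw [Fin.le_def]; simp [hju]; omega
    have hjlk : (jl:ℕ) < k := by simp [hjl]; omega
    have hjuk : k ≤ (ju:ℕ) := le_rfl
    have l0 : l 0 = g jl 0 := by
      obtain ⟨j, hjk, hj⟩ := hl2 0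
      apply le_antisymm
      · rw [hj]; exact gm' _ _ (hlel j hjk)
      · by_contra hc
        push Not at hc
        exact lt_irrefl _ ((hl1 0 _).1 hc _ hjlk)
    have u0 : u 0 = g ju 0 := by
      obtain ⟨j, hjk, hj⟩ := hu2 0
      apply le_antisymm
      · by_contra hc
        push Not at hc
        exact lt_irrefl _ ((hu1 0 _).1 hc _ hjuk)
      · rw [hj]; exact gm' _ _ (hleu j hjk)
    have hlu : jl < ju := by rw [Fin.lt_def]; simp [hjl, hju]; omega
    set s := t jl with hs
    set e := t ju with he
    have hse : s < e := ht hlu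
    set P : ℝ → ℝ := fun r => (G (0, r)).1 with hP
    have Pc : Continuous P := continuous_fst.comp (G.continuous.comp (by fun_prop))
    have P0 : P s = 0 := by simp [hP, hs, h0]
    have hmidl : ∀ r ∈ Ioo s e, l (G (0, r)).1 < (G (0, r)).2 := fun r hr => by
      rw [hl1]; intro j hj; exact hhi j r (lt_of_le_of_lt (ht.monotone (hlel j hj)) hr.1)
    have hmidu : ∀ r ∈ Ioo s e, (G (0, r)).2 < u (G (0, r)).1 := fun r hr => by
      rw [hu1]; intro j hj; exact hlo j r (lt_of_lt_of_le hr.2 (ht.monotone (hleu j hj)))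
    have hlt0 : l 0 < u 0 := by rw [l0, u0]; exact gm _ _ hlu
    have hPU : ∀ r ∈ Icc s e, l (P r) < u (P r) := by
      intro r hr
      rcases eq_or_lt_of_le hr.1 with h | h
      · rw [← h, P0]; exact hlt0
      rcases eq_or_lt_of_le hr.2 with h' | h'
      · have : P r = 0 := by simp [hP, h', he, h0]
        rw [this]; exact hlt0
      · exact (hmidl r ⟨h, h'⟩).trans (hmidu r ⟨h, h'⟩)
    obtain ⟨rc, hrc, hmin⟩ := isCompact_Icc.exists_isMinOn (nonempty_Icc.2 hse.le) (Pc.continuousOn (s := Icc s e))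
    obtain ⟨rd, hrd, hmax⟩ := isCompact_Icc.exists_isMaxOn (nonempty_Icc.2 hse.le) (Pc.continuousOn (s := Icc s e))
    have hU : IsOpen {x | l x < u x} := isOpen_lt hl hu
    obtain ⟨ε, hε, hεU⟩ := Metric.isOpen_iff.1 hU (P rc) (hPU rc hrc)
    obtain ⟨δ, hδ, hδU⟩ := Metric.isOpen_iff.1 hU (P rd) (hPU rd hrd)
    have hc0 : P rc ≤ 0 := by rw [← P0]; exact hmin (left_mem_Icc.2 hse.le)
    have hd0 : 0 ≤ P rd := by rw [← P0]; exact hmax (left_mem_Icc.2 hse.le)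
    have hlu' : ∀ x ∈ Icc (P rc - ε / 2) (P rd + δ / 2), l x < u x := by
      intro x hx
      rcases lt_or_ge x (P rc) with h | h
      · exact hεU (by rw [Metric.mem_ball, Real.dist_eq, abs_lt]; constructor <;> linarith [hx.1])
      rcases lt_or_ge (P rd) x with h' | h'
      · exact hδU (by rw [Metric.mem_ball, Real.dist_eq, abs_lt]; constructor <;> linarith [hx.2])
      · have hoc : OrdConnected (P '' Icc s e) := (isPreconnected_Icc.image _ Pc.continuousOn).ordConnected
        obtain ⟨r, hr, rfl⟩ := hoc.out ⟨rc, hrc, rfl⟩ ⟨rd, hrd, rfl⟩ ⟨h, h'⟩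
        exact hPU r hr
    set O : Set (ℝ × ℝ) := {p | P rc - ε / 2 < p.1 ∧ p.1 < P rd + δ / 2 ∧ l p.1 < p.2 ∧ p.2 < u p.1} with hO
    have hmid : ∀ r, G (0, r) ∈ O ↔ r ∈ Ioo s e := by
      intro r
      constructor
      · rintro ⟨-, -, h3, h4⟩
        have h3 := (hl1 _ _).1 h3 jl hjlk
        have h4 := (hu1 _ _).1 h4 ju hjuk
        constructor
        · by_contra hc
          push Not at hc
          rcases eq_or_lt_of_le hc with h' | h'
          · rw [h', hs, h0] at h3; exact lt_irrefl _ h3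
          · exact lt_asymm h3 (hlo _ _ h')
        · by_contra hc
          push Not at hc
          rcases eq_or_lt_of_le hc with h' | h'
          · rw [← h', he, h0] at h4; exact lt_irrefl _ h4
          · exact lt_asymm h4 (hhi _ _ h')
      · intro hr
        have h1 : P rc ≤ P r := hmin (Ioo_subset_Icc_self hr)
        have h2 : P r ≤ P rd := hmax (Ioo_subset_Icc_self hr)
        refine ⟨?_, ?_, hmidl r hr, hmidu r hr⟩
        · show _ < P r; linarith
        · show P r < _; linarith
    obtain ⟨F, hF1, hF2⟩ := comp_cell hl hu (a := P rc - ε / 2) (b := P rd + δ / 2) (by linarith) (by linarith)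
      hlu' G hse (by rw [hs, h0, l0]) (by rw [he, h0, u0]) hO hmid
    refine ⟨O, F, ?_, ?_, ?_, hF1, hF2⟩
    · rintro p ⟨-, -, h3, h4⟩
      exact ⟨(hl1 _ _).1 h3, (hu1 _ _).1 h4⟩
    · intro r h1 h2
      exact (hmid r).2 ⟨h1 jl hjlk, h2 ju hjuk⟩
    · intro y h1 h2
      exact ⟨by show _ < (0:ℝ); linarith, by show (0:ℝ) < _; linarith, (hl1 _ _).2 h1, (hu1 _ _).2 h2⟩

theorem straighten_all {m : ℕ} (hm : 0 < m) {g : Fin m → ℝ → ℝ} (hg : ∀ i, Continuous (g i)) (G : (ℝ × ℝ) ≃ₜ (ℝ × ℝ))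
    {t : Fin m → ℝ} (ht : StrictMono t) (h0 : ∀ i, G (0, t i) = (0, g i 0))
    (hlo : ∀ i r, r < t i → (G (0, r)).2 < g i (G (0, r)).1)
    (hhi : ∀ i r, t i < r → g i (G (0, r)).1 < (G (0, r)).2) :
    ∃ F : (ℝ × ℝ) ≃ₜ (ℝ × ℝ), (∀ p, (G.symm p).1 = 0 ↔ (F p).1 = 0) ∧ (∀ i, Pres F (g i) (g i)) ∧
      ∀ i x, F (x, g i x) = (x, g i x) := by
  have gm : StrictMono fun i => g i 0 := by
    intro i j hij
    have := hhi i (t j) (ht hij)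
    rw [h0 j] at this; exact this
  choose O F h1 h2 h3 h4 h5 using fun k : Fin (m + 1) => cell_k hm hg G ht h0 hlo hhi k (Nat.lt_succ_iff.1 k.2)
  have hd' : ∀ i j, i < j → Disjoint (O i) (O j) := by
    intro i j hij
    rw [Set.disjoint_left]
    intro p hp hp'
    have him : (i : ℕ) < m := by have := j.2; have : (i:ℕ) < j := hij; omega
    have a := (h1 i p hp).2 ⟨i, him⟩ le_rfl
    have b := (h1 j p hp').1 ⟨i, him⟩ hij
    exact lt_asymm a b
  have hd : ∀ i j, i ≠ j → Disjoint (O i) (O j) := fun i j hij => by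
    rcases lt_or_gt_of_ne hij with h | h
    · exact hd' i j h
    · exact (hd' j i h).symm
  obtain ⟨H, H1, H2⟩ := glue_many O hd F h4
  have hgr : ∀ i x, H (x, g i x) = (x, g i x) := by
    intro i x
    apply H2
    intro k hk
    rcases lt_or_ge (i:ℕ) k with h | h
    · exact lt_irrefl _ ((h1 k _ hk).1 i h)
    · exact lt_irrefl _ ((h1 k _ hk).2 i h)
  refine ⟨H, fun p => ?_, fun i => ?_, hgr⟩
  · by_cases hp : ∃ k, p ∈ O k
    · obtain ⟨k, hk⟩ := hp
      rw [H1 k p hk]; exact h5 k p hk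
    · push Not at hp
      rw [H2 p hp]
      constructor
      · intro hp0
        have e : p = G (0, (G.symm p).2) := by rw [← hp0]; simp
        by_cases hr : ∀ j, (G.symm p).2 ≠ t j
        · obtain ⟨k, hk, a, b⟩ := gap_find ht hr
          exact absurd (by rw [e]; exact h2 ⟨k, Nat.lt_succ_iff.2 hk⟩ _ a b) (hp ⟨k, Nat.lt_succ_iff.2 hk⟩)
        · push Not at hr
          obtain ⟨j, hj⟩ := hr
          rw [e, hj, h0]
      · intro hp0
        have e : p = (0, p.2) := Prod.ext hp0 rfl
        by_cases hr : ∀ j, p.2 ≠ g j 0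
        · obtain ⟨k, hk, a, b⟩ := gap_find gm hr
          exact absurd (by rw [e]; exact h3 ⟨k, Nat.lt_succ_iff.2 hk⟩ _ a b) (hp ⟨k, Nat.lt_succ_iff.2 hk⟩)
        · push Not at hr
          obtain ⟨j, hj⟩ := hr
          rw [e, hj, ← h0]; simp
  · have side : ∀ p, (g i p.1 < p.2 → g i (H p).1 < (H p).2) ∧ (p.2 < g i p.1 → (H p).2 < g i (H p).1) := by
      intro p
      by_cases hp : ∃ k, p ∈ O k
      · obtain ⟨k, hk⟩ := hp
        have hk' : H p ∈ O k := by rw [H1 k p hk]; exact homeo_mem (h4 k) hk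
        rcases lt_or_ge (i:ℕ) k with h | h
        · exact ⟨fun _ => (h1 k _ hk').1 i h, fun h' => absurd h' ((h1 k _ hk).1 i h).not_gt⟩
        · exact ⟨fun h' => absurd h' ((h1 k _ hk).2 i h).not_gt, fun _ => (h1 k _ hk').2 i h⟩
      · push Not at hp
        rw [H2 p hp]; exact ⟨id, id⟩
    refine Pres.mk' (fun p => (side p).1) (fun p => (side p).2) ?_
    rintro ⟨x, y⟩ h
    have h : y = g i x := h
    subst h
    rw [hgr]
end P8d

section P8e
open Set Filter Topology

lemma common_pos (P : ℕ → ℝ → Prop) (M : ℕ) (h : ∀ i ≤ M, ∃ δ > 0, P i δ)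
    (hm : ∀ i δ δ', 0 < δ' → δ' ≤ δ → P i δ → P i δ') : ∃ δ > 0, ∀ i ≤ M, P i δ := by
  induction M with
  | zero =>
    obtain ⟨δ, h1, h2⟩ := h 0 le_rfl
    exact ⟨δ, h1, fun i hi => by rw [Nat.le_zero.1 hi]; exact h2⟩
  | succ M ih =>
    obtain ⟨δ, h1, h2⟩ := ih fun i hi => h i (by omega)
    obtain ⟨δ', h1', h2'⟩ := h (M+1) le_rfl
    refine ⟨min δ δ', lt_min h1 h1', fun i hi => ?_⟩
    rcases Nat.lt_or_ge i (M+1) with h3 | h3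
    · exact hm i δ _ (lt_min h1 h1') (min_le_left _ _) (h2 i (by omega))
    · have : i = M+1 := by omega
      subst this
      exact hm _ δ' _ (lt_min h1 h1') (min_le_right _ _) h2'

lemma kappa (X ℓ : ℕ → ℝ) (hℓ : ∀ k, ℓ (k+1) = ℓ k + 2) {η : ℝ} (hη : 0 < η) (hη1 : η ≤ 1) (M : ℕ) :
    ∃ (κ : ℝ → ℝ) (C : ℝ), Continuous κ ∧ (∀ y, |κ y| ≤ C) ∧
      (∀ j ≤ M, ∀ y, (0 < j → ℓ j + η ≤ y) → (j < M → y ≤ ℓ (j+1) - η) → κ y = X j) ∧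
      (∀ k < M, ∀ y, |y - ℓ (k+1)| ≤ η → κ y ∈ uIcc (X k) (X (k+1))) ∧
      (∀ y, (∃ j ≤ M, (0 < j → ℓ j + η ≤ y) ∧ (j < M → y ≤ ℓ (j+1) - η)) ∨ ∃ k < M, |y - ℓ (k+1)| ≤ η) := by
  have hmono : Monotone ℓ := monotone_nat_of_le_succ fun k => by rw [hℓ]; linarith
  induction M with
  | zero =>
    refine ⟨fun _ => X 0, |X 0|, continuous_const, fun _ => le_rfl, ?_, ?_, ?_⟩
    · intro j hj y _ _; rw [Nat.le_zero.1 hj]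
    · intro k hk; omega
    · intro y; left; exact ⟨0, le_rfl, fun h => absurd h (by omega), fun h => absurd h (by omega)⟩
  | succ M ih =>
    obtain ⟨κ, C, hc, hC, h1, h2, h3⟩ := ih
    set w : ℝ → ℝ := fun y => cl01 ((y - ℓ (M+1) + η) / (2 * η)) with hw
    have w0 : ∀ y, y ≤ ℓ (M+1) - η → w y = 0 := fun y hy => 
      cl01_of_le (div_nonpos_of_nonpos_of_nonneg (by linarith) (by linarith))
    have w1 : ∀ y, ℓ (M+1) + η ≤ y → w y = 1 := fun y hy => 
      cl01_of_ge ((one_le_div (by linarith)).2 (by linarith))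
    refine ⟨fun y => κ y + (X (M+1) - X M) * w y, C + |X (M+1) - X M|, ?_, ?_, ?_, ?_, ?_⟩
    · exact hc.add (continuous_const.mul (cl01_cont.comp (by fun_prop)))
    · intro y
      refine (abs_add_le _ _).trans (add_le_add (hC y) ?_)
      rw [abs_mul, abs_of_nonneg (cl01_nonneg _)]
      exact mul_le_of_le_one_right (abs_nonneg _) (cl01_le _)
    · intro j hj y hj1 hj2
      rcases Nat.lt_or_ge j (M+1) with h | h
      · have hy := hj2 h
        have hl := hmono (show j+1 ≤ M+1 by omega)
        simp only
        rw [w0 y (by linarith), h1 j (by omega) y hj1 fun h => hj2 (by omega)]; ring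
      · have : j = M+1 := by omega
        subst this
        have hy := hj1 (by omega)
        simp only
        rw [w1 y hy, h1 M le_rfl y (fun _ => by rw [hℓ] at hy; linarith) (fun h => absurd h (by omega))]; ring
    · intro k hk y hy
      rw [abs_le] at hy
      rcases Nat.lt_or_ge k M with h | h
      · have hl := hmono (show k+1 ≤ M by omega)
        simp only
        rw [w0 y (by rw [hℓ]; linarith), mul_zero, add_zero]
        exact h2 k h y (abs_le.2 hy)
      · have : k = M := by omega
        subst this
        simp only
        rw [h1 k le_rfl y (fun _ => by rw [hℓ] at hy; linarith) (fun h => absurd h (by omega))]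
        have hw0 : 0 ≤ w y := cl01_nonneg _
        have hw1 : w y ≤ 1 := cl01_le _
        rcases le_total (X k) (X (k+1)) with h | h
        · rw [uIcc_of_le h]; constructor <;> nlinarith
        · rw [uIcc_of_ge h]; constructor <;> nlinarith
    · intro y
      rcases le_or_gt y (ℓ (M+1) - η) with h | h
      · rcases h3 y with ⟨j, hj, hj1, hj2⟩ | ⟨k, hk, hy⟩
        · left
          refine ⟨j, by omega, hj1, fun _ => ?_⟩
          rcases Nat.lt_or_ge j M with h' | h'
          · exact hj2 h'
          · have : j = M := by omega
            subst this; exact h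
        · right; exact ⟨k, by omega, hy⟩
      · rcases le_or_gt y (ℓ (M+1) + η) with h' | h'
        · right; exact ⟨M, by omega, abs_le.2 ⟨by linarith, by linarith⟩⟩
        · left; exact ⟨M+1, le_rfl, fun _ => h'.le, fun h => absurd h (by omega)⟩

lemma surj_pert {φ : ℝ → ℝ} (hc : Continuous φ) {B : ℝ} (hB : ∀ x, |φ x - x| ≤ B) : Function.Surjective φ := by
  intro y
  obtain ⟨z, -, hz⟩ := ivt_zero (D := fun x => φ x - y) (by fun_prop) (a := y - B) (b := y + B)
    (by have := abs_le.1 (hB (y - B)); linarith) (by have := abs_le.1 (hB (y + B)); linarith)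
  exact ⟨z, by linarith⟩

lemma tau_mono {C κ δ : ℝ} (hκ : |κ| ≤ C) (hδ : 0 < δ) {x y : ℝ} (hxy : x ≤ y) :
    y - x ≤ (y + C * clp ((y - κ)/δ) - κ * (1 - |clp ((y-κ)/δ)|)) -
     (x + C * clp ((x - κ)/δ) - κ * (1 - |clp ((x-κ)/δ)|)) := by
  have h : clp ((x - κ)/δ) ≤ clp ((y-κ)/δ) := clp_mono (by gcongr)
  generalize clp ((x - κ)/δ) = a at *
  generalize clp ((y - κ)/δ) = b at *
  have h1 := abs_abs_sub_abs_le b a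
  rw [abs_of_nonneg (sub_nonneg.2 h)] at h1
  have h2 : |κ * (|b| - |a|)| ≤ C * (b - a) := by
    rw [abs_mul]; exact mul_le_mul hκ h1 (abs_nonneg _) ((abs_nonneg _).trans hκ)
  have h3 := (abs_le.1 h2).1
  nlinarith

lemma tau_pert {C κ δ : ℝ} (hκ : |κ| ≤ C) (x : ℝ) :
    |(x + C * clp ((x - κ)/δ) - κ * (1 - |clp ((x-κ)/δ)|)) - x| ≤ 2 * C := by
  have h := clp_abs ((x-κ)/δ)
  generalize clp ((x - κ)/δ) = a at *
  have hC : 0 ≤ C := (abs_nonneg _).trans hκ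
  have e : x + C * a - κ * (1 - |a|) - x = C * a - κ * (1 - |a|) := by ring
  rw [e]
  refine (abs_sub _ _).trans ?_
  rw [abs_mul, abs_mul, abs_of_nonneg hC, abs_of_nonneg (by linarith : (0:ℝ) ≤ 1 - |a|)]
  nlinarith [abs_nonneg a, mul_le_mul_of_nonneg_right hκ (by linarith : (0:ℝ) ≤ 1 - |a|)]

lemma D_gap {D : ℝ → ℝ} (hD : Continuous D) {X δ C : ℝ} (hδ : 0 < δ) (hz : ∀ x, D x = 0 → x = X)
    (hb : ∀ x, |D x - x| ≤ C) :
    ∃ ε > 0, (∀ x, X + δ ≤ x → ε ≤ D x) ∧ ∀ x, x ≤ X - δ → D x ≤ -ε := by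
  have hpos : ∀ x, X < x → 0 < D x := by
    intro x hx
    by_contra hn
    obtain ⟨z, hz1, hz2⟩ := ivt_zero hD (a := x) (b := max x (C+1)) (not_lt.1 hn)
      (by have := abs_le.1 (hb (max x (C+1))); have := le_max_right x (C+1); linarith)
    rw [uIcc_of_le (le_max_left _ _)] at hz1
    have := hz z hz2
    linarith [hz1.1]
  have hneg : ∀ x, x < X → D x < 0 := by
    intro x hx
    by_contra hn
    obtain ⟨z, hz1, hz2⟩ := ivt_zero hD (b := x) (a := min x (-C-1)) 
      (by have := abs_le.1 (hb (min x (-C-1))); have := min_le_right x (-C-1); linarith) (not_lt.1 hn)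
    rw [uIcc_of_le (min_le_left _ _)] at hz1
    have := hz z hz2
    linarith [hz1.2]
  have c1 := (isCompact_Icc (a := X+δ) (b := max (X+δ) (C+1))).exists_isMinOn ⟨X+δ, le_rfl, le_max_left _ _⟩ hD.continuousOn
  have c2 := (isCompact_Icc (a := min (X-δ) (-C-1)) (b := X-δ)).exists_isMaxOn ⟨X-δ, min_le_left _ _, le_rfl⟩ hD.continuousOn
  obtain ⟨p, hp, hp'⟩ := c1
  obtain ⟨q, hq, hq'⟩ := c2
  have p0 := hpos p (by linarith [hp.1])
  have q0 := hneg q (by linarith [hq.2])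
  refine ⟨min 1 (min (D p) (- D q)), lt_min one_pos (lt_min p0 (by linarith)), ?_, ?_⟩
  · intro x hx
    rcases le_or_gt x (max (X+δ) (C+1)) with h | h
    · exact (min_le_right _ _).trans ((min_le_left _ _).trans (hp' ⟨hx, h⟩))
    · have := abs_le.1 (hb x); have := le_max_right (X+δ) (C+1)
      exact (min_le_left _ _).trans (by linarith)
  · intro x hx
    rcases le_or_gt (min (X-δ) (-C-1)) x with h | h
    · have h1 : D x ≤ D q := hq' ⟨h, hx⟩
      have := (min_le_right 1 (min (D p) (- D q))).trans (min_le_right _ _)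
      linarith
    · have := abs_le.1 (hb x); have := min_le_right (X-δ) (-C-1)
      have := (min_le_left 1 (min (D p) (- D q)))
      linarith

theorem shear {M : ℕ} {f : ℕ → ℝ → ℝ} {K B : ℝ} (hK : 0 ≤ K) (hf : ∀ i x y, |f i x - f i y| ≤ K * |x - y|)
    (hB : ∀ i x, |f i x| ≤ B) {X ℓ : ℕ → ℝ} (hℓ : ∀ k, ℓ (k+1) = ℓ k + 2)
    (sep : ∀ k < M, ∀ x ∈ uIcc (X k) (X (k+1)), (∀ i ≤ k, f i x < ℓ (k+1)) ∧ ∀ i, k < i → i ≤ M → ℓ (k+1) < f i x) :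
    ∃ (Φ : (ℝ × ℝ) ≃ₜ (ℝ × ℝ)) (g : ℕ → ℝ → ℝ), (∀ i ≤ M, ∀ x y, |g i x - g i y| ≤ K * |x - y|) ∧
      (∀ i ≤ M, ∀ x, |g i x| ≤ B) ∧ (∀ i ≤ M, Pres Φ (f i) (g i)) ∧
      ∀ i ≤ M, ∀ x, ((Φ (x, f i x)).1 < 0 ↔ x < X i) ∧ ((Φ (x, f i x)).1 = 0 ↔ x = X i) := by
  have hfc : ∀ i, Continuous (f i) := fun i => lip_cont (hf i)
  -- margin
  have hmar : ∃ η > 0, ∀ k < M, ∀ x ∈ uIcc (X k) (X (k+1)), ∀ i ≤ M, η ≤ |f i x - ℓ (k+1)| := by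
    have := common_pos (fun k η => k < M → ∀ x ∈ uIcc (X k) (X (k+1)), ∀ i ≤ M, η ≤ |f i x - ℓ (k+1)|) M ?_ ?_
    · obtain ⟨η, h1, h2⟩ := this
      exact ⟨η, h1, fun k hk => h2 k hk.le hk⟩
    · intro k _
      by_cases hk : k < M
      · have := common_pos (fun i η => i ≤ M → ∀ x ∈ uIcc (X k) (X (k+1)), η ≤ |f i x - ℓ (k+1)|) M ?_ ?_
        · obtain ⟨η, h1, h2⟩ := this
          exact ⟨η, h1, fun _ x hx i hi => h2 i hi hi x hx⟩
        · intro i hi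
          have hc : Continuous fun x => |f i x - ℓ (k+1)| := ((hfc i).sub continuous_const).abs
          obtain ⟨p, hp, hp'⟩ := (isCompact_uIcc (a := X k) (b := X (k+1))).exists_isMinOn ⟨X k, left_mem_uIcc⟩ hc.continuousOn
          refine ⟨_, ?_, fun _ x hx => hp' hx⟩
          rw [gt_iff_lt, abs_pos, sub_ne_zero]
          rcases Nat.lt_or_ge k i with h | h
          · exact ((sep k hk p hp).2 i h hi).ne'
          · exact ((sep k hk p hp).1 i h).ne
        · intro i δ δ' _ h1 h2 h3 x hx; exact h1.trans (h2 h3 x hx)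
      · exact ⟨1, one_pos, fun h => absurd h hk⟩
    · intro k δ δ' _ h1 h2 h3 x hx i hi; exact h1.trans (h2 h3 x hx i hi)
  obtain ⟨η0, hη0, hmar⟩ := hmar
  obtain ⟨η, hη, hη1, hη2⟩ : ∃ η > 0, η ≤ 1 ∧ 2 * η < η0 := ⟨min 1 (η0/3), lt_min one_pos (by linarith), min_le_left _ _, by
    have := min_le_right 1 (η0/3); linarith⟩
  have mlo : ∀ k < M, ∀ x ∈ uIcc (X k) (X (k+1)), ∀ i ≤ k, f i x < ℓ (k+1) - 2 * η := by
    intro k hk x hx i hi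
    have h1 := hmar k hk x hx i (by omega)
    have h2 := (sep k hk x hx).1 i hi
    rw [abs_of_neg (by linarith)] at h1; linarith
  have mhi : ∀ k < M, ∀ x ∈ uIcc (X k) (X (k+1)), ∀ i, k < i → i ≤ M → ℓ (k+1) + 2 * η < f i x := by
    intro k hk x hx i hi hi'
    have h1 := hmar k hk x hx i (by omega)
    have h2 := (sep k hk x hx).2 i hi hi'
    rw [abs_of_pos (by linarith)] at h1; linarith
  obtain ⟨κ, C, hκc, hC, k1, k2, k3⟩ := kappa X ℓ hℓ hη hη1 M
  have C0 : 0 ≤ C := (abs_nonneg _).trans (hC 0)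
  obtain ⟨δ1, hδ1, hδK⟩ : ∃ δ1 > 0, K * δ1 ≤ η := ⟨η / (K+1), by positivity, by
    rw [mul_div_assoc']; rw [div_le_iff₀ (by linarith)]; nlinarith⟩
  have near : ∀ i ≤ M, ∀ x, |x - X i| ≤ δ1 → κ (f i x) = X i := by
    intro i hi x hx
    have h0 : |f i x - f i (X i)| ≤ η := (hf i x (X i)).trans ((mul_le_mul_of_nonneg_left hx hK).trans hδK)
    rw [abs_le] at h0
    apply k1 i hi
    · intro h
      obtain ⟨k, rfl⟩ : ∃ k, i = k+1 := ⟨i-1, by omega⟩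
      have := mhi k (by omega) _ right_mem_uIcc (k+1) (by omega) hi
      linarith
    · intro h
      have := mlo i h _ left_mem_uIcc i le_rfl
      linarith
  have fix : ∀ i ≤ M, ∀ x, x - κ (f i x) = 0 → x = X i := by
    intro i hi x hx
    rcases k3 (f i x) with ⟨j, hj, hj1, hj2⟩ | ⟨k, hk, hy⟩
    · have hxj : x = X j := by rw [← k1 j hj _ hj1 hj2]; linarith
      rcases lt_trichotomy i j with h | h | h
      · exfalso
        obtain ⟨k, rfl⟩ : ∃ k, j = k+1 := ⟨j-1, by omega⟩
        have := mlo k (by omega) (X (k+1)) right_mem_uIcc i (by omega)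
        rw [hxj] at hj1
        have := hj1 (by omega); linarith
      · rw [hxj, h]
      · exfalso
        have := mhi j (by omega) (X j) left_mem_uIcc i h hi
        rw [hxj] at hj2
        have := hj2 (by omega); linarith
    · exfalso
      have hxu : x ∈ uIcc (X k) (X (k+1)) := by
        have := k2 k hk _ hy
        rwa [← show x = κ (f i x) by linarith] at this
      rw [abs_le] at hy
      rcases Nat.lt_or_ge k i with h | h
      · have := mhi k hk x hxu i h hi; linarith
      · have := mlo k hk x hxu i h; linarith
  have hgap : ∃ δ2 > 0, ∀ i ≤ M, (∀ x, X i + δ1 ≤ x → δ2 ≤ x - κ (f i x)) ∧ ∀ x, x ≤ X i - δ1 → x - κ (f i x) ≤ -δ2 := by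
    apply common_pos (fun i δ2 => (∀ x, X i + δ1 ≤ x → δ2 ≤ x - κ (f i x)) ∧ ∀ x, x ≤ X i - δ1 → x - κ (f i x) ≤ -δ2) M
    · intro i hi
      exact D_gap (D := fun x => x - κ (f i x)) (continuous_id.sub (hκc.comp (hfc i))) hδ1 (fix i hi) (C := C)
        (fun x => by simpa using hC (f i x))
    · intro i δ δ' _ h1 h2
      exact ⟨fun x hx => h1.trans (h2.1 x hx), fun x hx => (h2.2 x hx).trans (by linarith)⟩
  obtain ⟨δ2, hδ2, hgap⟩ := hgap
  set δ := min δ1 δ2 with hδd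
  have hδ : 0 < δ := lt_min hδ1 hδ2
  have hXC : ∀ i ≤ M, |X i| ≤ C := fun i hi => by
    rw [← near i hi (X i) (by simpa using hδ1.le)]; exact hC _
  -- τ
  let τ : ℝ → ℝ → ℝ := fun k x => x + C * clp ((x - k)/δ) - k * (1 - |clp ((x-k)/δ)|)
  have τc : Continuous fun p : ℝ × ℝ => τ p.1 p.2 := by
    have : Continuous fun p : ℝ × ℝ => clp ((p.2 - p.1)/δ) := clp_cont.comp (by fun_prop)
    exact (continuous_snd.add (continuous_const.mul this)).sub (continuous_fst.mul (continuous_const.sub this.abs))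
  have τm : ∀ k, |k| ≤ C → ∀ x y, x ≤ y → y - x ≤ τ k y - τ k x := fun k hk x y hxy => tau_mono hk hδ hxy
  have τs : ∀ k, |k| ≤ C → StrictMono (τ k) := fun k hk x y hxy => by have := τm k hk x y hxy.le; linarith
  have τsurj : ∀ k, |k| ≤ C → Function.Surjective (τ k) := fun k hk =>
    surj_pert (τc.comp (by fun_prop : Continuous fun x : ℝ => (k, x))) (B := 2*C) fun x => tau_pert hk x
  obtain ⟨Ψ, hΨ⟩ := fiberHomeo (fun y x => τ (κ y) x) (τc.comp ((hκc.comp continuous_fst).prodMk continuous_snd))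
    (fun y => τs _ (hC y)) (fun y => τsurj _ (hC y))
  let Φ : (ℝ × ℝ) ≃ₜ (ℝ × ℝ) := ((Homeomorph.prodComm ℝ ℝ).trans Ψ).trans (Homeomorph.prodComm ℝ ℝ)
  have hΦ : ∀ x y, Φ (x, y) = (τ (κ y) x, y) := fun x y => by
    show (Ψ (y, x)).swap = _
    rw [hΨ]; rfl
  have key : ∀ i ≤ M, ∀ x, τ (κ (f i x)) x = τ (X i) x := by
    intro i hi x
    by_cases hx : |x - X i| ≤ δ1
    · rw [near i hi x hx]
    · rw [not_le, lt_abs] at hx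
      rcases hx with hx | hx
      · have a1 : clp ((x - X i)/δ) = 1 := clp_of_ge ((one_le_div hδ).2 ((min_le_left _ _).trans hx.le))
        have a2 : clp ((x - κ (f i x))/δ) = 1 := clp_of_ge ((one_le_div hδ).2 ((min_le_right _ _).trans
          ((hgap i hi).1 x (by linarith))))
        simp only [τ, a1, a2]; norm_num
      · have a1 : clp ((x - X i)/δ) = -1 := by
          rw [← neg_neg ((x - X i)/δ), clp_neg, ← neg_div, clp_of_ge ((one_le_div hδ).2 ((min_le_left _ _).trans hx.le))]
        have a2 : clp ((x - κ (f i x))/δ) = -1 := by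
          rw [← neg_neg ((x - κ (f i x))/δ), clp_neg, ← neg_div, clp_of_ge ((one_le_div hδ).2 ((min_le_right _ _).trans ?_))]
          have := (hgap i hi).2 x (by linarith); linarith
        simp only [τ, a1, a2]; norm_num
  have hinv : ∀ i, ∃ s : ℝ → ℝ, i ≤ M → ∀ u, τ (X i) (s u) = u := by
    intro i
    by_cases hi : i ≤ M
    · choose s hs using τsurj _ (hXC i hi)
      exact ⟨s, fun _ => hs⟩
    · exact ⟨id, fun h => absurd h hi⟩
  choose s hs using hinv
  have hs' : ∀ i ≤ M, ∀ x, s i (τ (X i) x) = x := fun i hi x => (τs _ (hXC i hi)).injective (hs i hi _)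
  have slip : ∀ i ≤ M, ∀ u v, |s i u - s i v| ≤ |u - v| := by
    intro i hi u v
    have hu := hs i hi u
    have hv := hs i hi v
    rcases le_total (s i u) (s i v) with h | h
    · have := τm _ (hXC i hi) _ _ h
      rw [hu, hv] at this
      rw [abs_sub_comm, abs_of_nonneg (by linarith), abs_sub_comm]; exact this.trans (le_abs_self _)
    · have := τm _ (hXC i hi) _ _ h
      rw [hu, hv] at this
      rw [abs_of_nonneg (by linarith)]; exact this.trans (le_abs_self _)
  have glip : ∀ i ≤ M, ∀ x y, |f i (s i x) - f i (s i y)| ≤ K * |x - y| := fun i hi x y =>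
    (hf i _ _).trans (mul_le_mul_of_nonneg_left (slip i hi x y) hK)
  have τ0 : ∀ i, τ (X i) (X i) = 0 := by
    intro i
    have : clp 0 = 0 := by unfold clp; norm_num
    simp [τ, this]
  refine ⟨Φ, fun i u => f i (s i u), glip, fun i _ x => hB i _, ?_, ?_⟩
  · intro i hi
    have himg : Φ '' gr (f i) = gr (fun u => f i (s i u)) := by
      apply image_gr_of_on
      rintro ⟨x, y⟩
      rw [hΦ]
      constructor
      · intro (h : y = f i x)
        show y = f i (s i (τ (κ y) x))
        rw [h, key i hi, hs' i hi]
      · intro (h : y = f i (s i (τ (κ y) x)))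
        set x' := s i (τ (κ y) x) with hx'
        have h1 : τ (κ y) x' = τ (κ y) x := by
          have := key i hi x'
          rw [← h] at this
          rw [this, hx', hs i hi]
        have := (τs _ (hC y)).injective h1
        show y = f i x
        rw [← this]; exact h
    rcases side_dich (hfc i) (lip_cont (glip i hi)) himg with h | h
    · exact h
    · exfalso
      have h1 := (h (0, B+1)).1.1 (by have := abs_le.1 (hB i 0); show f i 0 < B + 1; linarith)
      rw [hΦ] at h1
      have h2 : B + 1 < f i (s i (τ (κ (B+1)) 0)) := h1
      have := abs_le.1 (hB i (s i (τ (κ (B+1)) 0)))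
      linarith
  · intro i hi x
    rw [hΦ]
    simp only
    rw [key i hi, ← τ0 i]
    exact ⟨(τs _ (hXC i hi)).lt_iff_lt, (τs _ (hXC i hi)).injective.eq_iff⟩

end P8e

section P8f
open Set Filter Topology

lemma sort_fin {ι : Type*} [Fintype ι] {t : ι → ℝ} (ht : Function.Injective t) {m : ℕ} (hm : Fintype.card ι = m) :
    ∃ e : Fin m ≃ ι, StrictMono (t ∘ e) := by
  let e0 : Fin m ≃ ι := (Fintype.equivFinOfCardEq hm).symm
  let σ := Tuple.sort (t ∘ e0)
  refine ⟨σ.trans e0, ?_⟩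
  have h1 : Monotone ((t ∘ e0) ∘ σ) := Tuple.monotone_sort _
  exact h1.strictMono_of_injective ((ht.comp e0.injective).comp σ.injective)

theorem lemmaV_fin {M : ℕ} {f : Fin (M+1) → ℝ → ℝ} (hf : GA f) (G : (ℝ × ℝ) ≃ₜ (ℝ × ℝ)) {t : Fin (M+1) → ℝ}
    (ht : StrictMono t) (hon : ∀ i, (G (0, t i)).2 = f i (G (0, t i)).1)
    (hlo : ∀ i r, r < t i → (G (0, r)).2 < f i (G (0, r)).1)
    (hhi : ∀ i r, t i < r → f i (G (0, r)).1 < (G (0, r)).2) :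
    ∃ (h : (ℝ × ℝ) ≃ₜ (ℝ × ℝ)) (g : Fin (M+1) → ℝ → ℝ) (K B : ℝ), 0 ≤ K ∧
      (∀ i x y, |g i x - g i y| ≤ K * |x - y|) ∧ (∀ i x, |g i x| ≤ B) ∧ (∀ i, Pres h (f i) (g i)) ∧
      (∀ p, (G.symm p).1 = 0 ↔ (h p).1 = 0) ∧ ∀ i x, ((h (x, f i x)).1 < 0 ↔ x < (G (0, t i)).1) := by
  obtain ⟨f', K, hK, hlip, hB, hord, hlev⟩ := hf.canon
  obtain ⟨Φ1, hΦx, hΦp⟩ := c2_homeo hf.cont (fun i => lip_cont (hlip i)) hord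
  let ix : ℕ → Fin (M+1) := fun i => ⟨min i M, by omega⟩
  have ixv : ∀ i ≤ M, ((ix i : Fin (M+1)) : ℕ) = i := fun i hi => min_eq_left hi
  have ixf : ∀ i : Fin (M+1), ix i = i := fun i => Fin.ext (min_eq_left (by omega))
  let X : ℕ → ℝ := fun i => (G (0, t (ix i))).1
  have hord' : ∀ k < M, ∀ x ∈ uIcc (X k) (X (k+1)), ∀ i j : Fin (M+1), (i:ℕ) ≤ k → k < (j:ℕ) → f i x < f j x := by
    intro k hk x hx i j hi hj
    have hc : Continuous fun r : ℝ => (G (0, r)).1 := by fun_prop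
    obtain ⟨r, hr, hrx⟩ := intermediate_value_uIcc (a := t (ix k)) (b := t (ix (k+1))) hc.continuousOn hx
    have hkk : t (ix k) < t (ix (k+1)) := ht (by rw [Fin.lt_def, ixv k hk.le, ixv (k+1) hk]; omega)
    rw [uIcc_of_le hkk.le] at hr
    have hik : t i ≤ t (ix k) := ht.monotone (by rw [Fin.le_def, ixv k hk.le]; exact hi)
    have hjk : t (ix (k+1)) ≤ t j := ht.monotone (by rw [Fin.le_def, ixv (k+1) hk]; exact hj)
    simp only at hrx
    have a1 : f i x ≤ (G (0, r)).2 := by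
      rcases eq_or_lt_of_le (hik.trans hr.1) with h | h
      · rw [← hrx, ← h, hon i]
      · have := hhi i r h; rw [hrx] at this; exact this.le
    have a2 : (G (0, r)).2 ≤ f j x := by
      rcases eq_or_lt_of_le (hr.2.trans hjk) with h | h
      · rw [← hrx, h, hon j]
      · have := hlo j r h; rw [hrx] at this; exact this.le
    rcases eq_or_lt_of_le hr.2 with h | h
    · have := hhi i r (by linarith); rw [hrx] at this; linarith
    · have := hlo j r (by linarith); rw [hrx] at this; linarith
  have sep : ∀ k < M, ∀ x ∈ uIcc (X k) (X (k+1)), (∀ i ≤ k, f' (ix i) x < 2 * ((k+1 : ℕ) : ℝ) - (M+1 : ℕ)) ∧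
      ∀ i, k < i → i ≤ M → 2 * ((k+1 : ℕ) : ℝ) - (M+1 : ℕ) < f' (ix i) x := by
    intro k hk x hx
    have hcard : (Finset.univ.filter fun i : Fin (M+1) => (i:ℕ) ≤ k).card = k+1 := by
      have : (Finset.univ.filter fun i : Fin (M+1) => (i:ℕ) ≤ k) = Finset.Iic (⟨k, by omega⟩ : Fin (M+1)) := by
        ext i; simp [Fin.le_def]
      rw [this, Fin.card_Iic]
    have := hlev (Finset.univ.filter fun i : Fin (M+1) => (i:ℕ) ≤ k) x (by
      intro i hi j hj
      simp at hi hj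
      exact hord' k hk x hx i j hi hj)
    rw [hcard, Fintype.card_fin] at this
    refine ⟨fun i hi => this.1 _ ?_, fun i hi hi' => this.2 _ ?_⟩
    · simp; rw [ixv i (by omega)]; exact hi
    · simp; rw [ixv i hi']; exact hi
  obtain ⟨Φ2, g, hg1, hg2, hg3, hg4⟩ := shear (M := M) (f := fun i => f' (ix i)) (X := X)
    (ℓ := fun k => 2 * (k : ℝ) - (M+1 : ℕ)) hK (fun i => hlip _) (fun i => hB _) (fun k => by push_cast; ring) sep
  have hΦP : ∀ i : Fin (M+1), Pres (Φ1.trans Φ2) (f i) (g i) := fun i => (hΦp i).trans (by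
    have := hg3 i (by omega)
    simp only [ixf] at this; exact this)
  have hΦon : ∀ (i : Fin (M+1)) x, Φ1 (x, f i x) = (x, f' i x) := by
    intro i x
    have h1 := ((hΦp i).on (x, f i x)).1 rfl
    rw [hΦx] at h1
    exact Prod.ext (hΦx _) h1
  have hGi : ∀ i, G (0, t i) = ((G (0, t i)).1, f i (G (0, t i)).1) := fun i => Prod.ext rfl (hon i)
  have hX : ∀ i : Fin (M+1), X i = (G (0, t i)).1 := fun i => by simp only [X, ixf]
  obtain ⟨F, F1, F2, F3⟩ := straighten_all (m := M+1) (by omega) (g := fun i => g i) (fun i => lip_cont (hg1 i (by omega))) 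
    ((G.trans Φ1).trans Φ2) ht (by
      intro i
      show Φ2 (Φ1 (G (0, t i))) = _
      have h0 : (Φ2 (Φ1 (G (0, t i)))).1 = 0 := by
        rw [hGi, hΦon]
        have := ((hg4 i (by omega) (G (0, t i)).1).2).2 (by rw [hX])
        simp only [ixf] at this; exact this
      have h1 := ((hΦP i).on (G (0, t i))).1 (hon i)
      have h2 : (Φ2 (Φ1 (G (0, t i)))).2 = g i (Φ2 (Φ1 (G (0, t i)))).1 := h1
      rw [h0] at h2
      exact Prod.ext h0 h2) (fun i r hr => ((hΦP i _).2).1 (hlo i r hr)) (fun i r hr => ((hΦP i _).1).1 (hhi i r hr))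
  refine ⟨(Φ1.trans Φ2).trans F, fun i => g i, K, _, hK, fun i => hg1 i (by omega), fun i => hg2 i (by omega), 
    fun i => (hΦP i).trans (F2 i), ?_, ?_⟩
  · intro p
    have := F1 (Φ2 (Φ1 p))
    rw [Homeomorph.trans_apply, Homeomorph.trans_apply, ← this]
    simp [Homeomorph.symm_trans_apply]
  · intro i x
    rw [Homeomorph.trans_apply, Homeomorph.trans_apply, hΦon]
    have h1 := hg3 i (by omega)
    simp only [ixf] at h1
    have h2 := (h1.on (x, f' i x)).1 rfl
    have h3 : F (Φ2 (x, f' i x)) = Φ2 (x, f' i x) := by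
      have : Φ2 (x, f' i x) = ((Φ2 (x, f' i x)).1, g i (Φ2 (x, f' i x)).1) := Prod.ext rfl h2
      rw [this, F3]
    rw [h3, ← hX]
    have := (hg4 i (by omega) x).1
    simp only [ixf] at this; exact this

theorem lemmaV {ι : Type*} [Fintype ι] [Nonempty ι] {f : ι → ℝ → ℝ} (hf : GA f) (G : (ℝ × ℝ) ≃ₜ (ℝ × ℝ)) {t : ι → ℝ}
    (ht : Function.Injective t) (hon : ∀ i, (G (0, t i)).2 = f i (G (0, t i)).1)
    (hlo : ∀ i r, r < t i → (G (0, r)).2 < f i (G (0, r)).1)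
    (hhi : ∀ i r, t i < r → f i (G (0, r)).1 < (G (0, r)).2) :
    ∃ (h : (ℝ × ℝ) ≃ₜ (ℝ × ℝ)) (g : ι → ℝ → ℝ) (K B : ℝ), 0 ≤ K ∧
      (∀ i x y, |g i x - g i y| ≤ K * |x - y|) ∧ (∀ i x, |g i x| ≤ B) ∧ (∀ i, Pres h (f i) (g i)) ∧
      (∀ p, (G.symm p).1 = 0 ↔ (h p).1 = 0) ∧ ∀ i x, ((h (x, f i x)).1 < 0 ↔ x < (G (0, t i)).1) := by
  obtain ⟨M, hM⟩ : ∃ M, Fintype.card ι = M + 1 := ⟨Fintype.card ι - 1, by have := Fintype.card_pos (α := ι); omega⟩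
  obtain ⟨e, he⟩ := sort_fin ht hM
  have hGA : GA fun i => f (e i) := {
    cont := fun i => hf.cont _
    ex := fun i j hij => hf.ex _ _ (e.injective.ne hij)
    uniq := fun i j hij => hf.uniq _ _ (e.injective.ne hij)
    lt := fun i j hij => hf.lt _ _ (e.injective.ne hij)
    tri := fun i j k x h1 h2 => by
      have := hf.tri _ _ _ x h1 h2
      simpa only [e.injective.eq_iff] using this }
  obtain ⟨h, g, K, B, hK, h1, h2, h3, h4, h5⟩ := lemmaV_fin hGA G he (fun i => hon _) (fun i => hlo _) (fun i => hhi _)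
  refine ⟨h, fun i => g (e.symm i), K, B, hK, fun i => h1 _, fun i => h2 _, fun i => ?_, h4, fun i x => ?_⟩
  · have := h3 (e.symm i); simpa using this
  · have := h5 (e.symm i) x; simpa using this

end P8f

section P9a
open Set Filter Topology

lemma GA.transport2 {ι : Type*} {f g : ι → ℝ → ℝ} (h : GA f) (hg : ∀ i, Continuous (g i))
    {Φ : (ℝ × ℝ) ≃ₜ (ℝ × ℝ)} (hp : ∀ i, Φ '' gr (f i) = gr (g i)) : GA g := by
  have hon : ∀ i (p : ℝ × ℝ), p.2 = f i p.1 ↔ (Φ p).2 = g i (Φ p).1 := by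
    intro i p
    rcases side_dich (h.cont i) (hg i) (hp i) with h | h
    · exact h.on p
    · exact h.on p
  have hon' : ∀ i x, ((Φ.symm (x, g i x)).2 = f i (Φ.symm (x, g i x)).1) := fun i x => by
    rw [hon]; simp
  refine ⟨hg, ?_, ?_, ?_, ?_⟩
  · intro i j hij
    obtain ⟨x, hx⟩ := h.ex i j hij
    exact ⟨(Φ (x, f i x)).1, by rw [← (hon i (x, f i x)).1 rfl, ← (hon j (x, f i x)).1 hx]⟩
  · intro i j hij x y hx hy
    have h1 := hon' i x
    have h2 := hon' j x
    have h3 := hon' i y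
    have h4 := hon' j y
    rw [← hx] at h2
    rw [← hy] at h4
    have h5 := h.uniq i j hij _ _ (h1.symm.trans h2) (h3.symm.trans h4)
    have h6 : Φ.symm (x, g i x) = Φ.symm (y, g i y) := Prod.ext h5 (by rw [h1, h3, h5])
    have := Φ.symm.injective h6
    exact congrArg Prod.fst this
  · intro i j hij
    obtain ⟨x, hx⟩ := h.lt i j hij
    obtain ⟨y, hy⟩ := h.lt j i hij.symm
    have h1 := (hon i (x, f i x)).1 rfl
    have h2 := (hon i (y, f i y)).1 rfl
    rcases side_dich (h.cont j) (hg j) (hp j) with h | h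
    · have := ((h (x, f i x)).2).1 hx
      exact ⟨_, h1 ▸ this⟩
    · have := ((h (y, f i y)).1).1 hy
      exact ⟨_, h2 ▸ this⟩
  · intro i j k x h1 h2
    have a1 := hon' i x
    have a2 := hon' j x
    have a3 := hon' k x
    rw [← h1] at a2
    rw [← h2] at a3
    exact h.tri i j k _ (a1.symm.trans a2) (a1.symm.trans a3)

/-- the homeomorphism parametrizing the graph of `f`, leftwards -/
def grH (f : ℝ → ℝ) (hf : Continuous f) : (ℝ × ℝ) ≃ₜ (ℝ × ℝ) where
  toFun p := (-p.2, p.1 + f (-p.2))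
  invFun p := (p.2 - f p.1, -p.1)
  left_inv p := by simp
  right_inv p := by simp
  continuous_toFun := by fun_prop
  continuous_invFun := by fun_prop

/-- insertion data: the line `r ↦ G (0,r)` crosses `f i` at time `t i` in direction `s i` -/
structure INS {ι : Type*} (f : ι → ℝ → ℝ) (G : (ℝ × ℝ) ≃ₜ (ℝ × ℝ)) (t s : ι → ℝ) : Prop where
  ga : GA f
  inj : Function.Injective t
  sg : ∀ i, s i = 1 ∨ s i = -1
  up : ∀ i r, 0 < s i * (r - t i) ↔ f i (G (0, r)).1 < (G (0, r)).2
  dn : ∀ i r, s i * (r - t i) < 0 ↔ (G (0, r)).2 < f i (G (0, r)).1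

lemma INS.on {ι : Type*} {f : ι → ℝ → ℝ} {G : (ℝ × ℝ) ≃ₜ (ℝ × ℝ)} {t s : ι → ℝ} (h : INS f G t s) (i : ι) :
    (G (0, t i)).2 = f i (G (0, t i)).1 := by
  have h1 := h.up i (t i)
  have h2 := h.dn i (t i)
  simp only [sub_self, mul_zero, lt_irrefl, false_iff, not_lt] at h1 h2
  exact le_antisymm h1 h2

/-- the conclusion of the insertion step -/
def Inserted {ι : Type*} (f : ι → ℝ → ℝ) (L : Set (ℝ × ℝ)) : Prop :=
  ∃ (h : (ℝ × ℝ) ≃ₜ (ℝ × ℝ)) (g : ι → ℝ → ℝ) (g0 : ℝ → ℝ), (∀ i, Continuous (g i)) ∧ Continuous g0 ∧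
    (∀ i, h '' gr (f i) = gr (g i)) ∧ h '' L = gr g0

lemma ins_up {ι : Type*} [Fintype ι] [Nonempty ι] {f : ι → ℝ → ℝ} {G : (ℝ × ℝ) ≃ₜ (ℝ × ℝ)} {t s : ι → ℝ} (h : INS f G t s)
    (hs : ∀ i, s i = 1) : Inserted f {p | (G.symm p).1 = 0} := by
  obtain ⟨h', g, K, B, hK, h1, h2, h3, h4, h5⟩ := lemmaV h.ga G h.inj h.on
    (fun i r hr => (h.dn i r).1 (by rw [hs]; linarith)) (fun i r hr => (h.up i r).1 (by rw [hs]; linarith))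
  have hc : 0 < 1 / (K+1) := by positivity
  have hcK : 1 / (K+1) * K < 1 := by rw [div_mul_eq_mul_div, one_mul, div_lt_one (by linarith)]; linarith
  set c := 1 / (K+1) with hcd
  have h6 := fun i => tilt_pres (h1 i) hc hcK (h2 i)
  choose k hk1 hk2 hk3 using h6
  refine ⟨h'.trans (tiltH c), k, fun x => x / c, hk1, by fun_prop, fun i => ((h3 i).trans (hk3 i)).image, ?_⟩
  ext p
  constructor
  · rintro ⟨q, hq, rfl⟩
    have hq0 : (h' q).1 = 0 := (h4 q).1 hq
    show (tiltH c (h' q)).2 = (tiltH c (h' q)).1 / c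
    rw [tiltH_apply, hq0]; field_simp; ring
  · intro (hp : p.2 = p.1 / c)
    refine ⟨h'.symm ((tiltH c).symm p), (h4 _).2 ?_, by simp⟩
    show (h' (h'.symm ((tiltH c).symm p))).1 = 0
    rw [Homeomorph.apply_symm_apply]
    show p.1 - c * p.2 = 0
    rw [hp]; field_simp; ring

lemma ins_down {ι : Type*} [Fintype ι] [Nonempty ι] {f : ι → ℝ → ℝ} {G : (ℝ × ℝ) ≃ₜ (ℝ × ℝ)} {t s : ι → ℝ} (h : INS f G t s)
    (hs : ∀ i, s i = -1) : Inserted f {p | (G.symm p).1 = 0} := by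
  let N : (ℝ × ℝ) ≃ₜ (ℝ × ℝ) := (Homeomorph.refl ℝ).prodCongr (Homeomorph.neg ℝ)
  have hN : ∀ r, N (0, r) = (0, -r) := fun r => rfl
  have h' : INS f (N.trans G) (fun i => - t i) (fun _ => 1) := {
    ga := h.ga
    inj := fun i j hij => h.inj (neg_injective hij)
    sg := fun i => Or.inl rfl
    up := fun i r => by
      rw [Homeomorph.trans_apply, hN, ← h.up, hs]
      constructor <;> intro h <;> linarith
    dn := fun i r => by
      rw [Homeomorph.trans_apply, hN, ← h.dn, hs]
      constructor <;> intro h <;> linarith }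
  have := ins_up h' fun _ => rfl
  have e : {p | ((N.trans G).symm p).1 = 0} = {p | (G.symm p).1 = 0} := by
    ext p; rfl
  rwa [e] at this

lemma ins_empty {ι : Type*} [IsEmpty ι] (f : ι → ℝ → ℝ) (G : (ℝ × ℝ) ≃ₜ (ℝ × ℝ)) :
    Inserted f {p | (G.symm p).1 = 0} := by
  refine ⟨G.symm.trans (Homeomorph.prodComm ℝ ℝ), f, fun _ => 0, fun i => isEmptyElim i, continuous_const, fun i => isEmptyElim i, ?_⟩
  ext p
  constructor
  · rintro ⟨q, hq, rfl⟩; exact hq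
  · intro hp
    refine ⟨G p.swap, ?_, ?_⟩
    · show (G.symm (G p.swap)).1 = 0
      rw [Homeomorph.symm_apply_apply]; exact hp
    · show (G.symm (G p.swap)).swap = p
      simp

lemma ga_extreme {ι : Type*} [Fintype ι] [Nonempty ι] {f : ι → ℝ → ℝ} (h : GA f) :
    ∃ a b x0, (∀ i ≠ a, ∀ x ≤ x0, f i x < f a x) ∧ ∀ i ≠ b, ∀ x ≤ x0, f b x < f i x := by
  classical
  obtain ⟨ev, s, esym, ssym, sval, hev, hs⟩ := h.ev
  obtain ⟨x0, hx0⟩ : ∃ x0 : ℝ, ∀ p : ι × ι, x0 < ev p.1 p.2 := by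
    obtain ⟨m, hm⟩ := (Set.finite_range fun p : ι × ι => ev p.1 p.2).bddBelow
    exact ⟨m - 1, fun p => by have := hm ⟨p, rfl⟩; simp only at this; linarith⟩
  have key : ∀ i j, f i x0 < f j x0 → ∀ x ≤ x0, f i x < f j x := by
    intro i j hij x hx
    have hne : j ≠ i := by rintro rfl; exact lt_irrefl _ hij
    have h1 := (hs j i hne x0).2 hij
    have h2 := hx0 (j, i)
    simp only at h2
    rw [← hs j i hne x]
    rcases sval j i hne with h | h
    · rw [h] at h1; linarith
    · rw [h]; linarith
  have hne : ∀ i j, i ≠ j → f i x0 ≠ f j x0 := fun i j hij he => by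
    have := (hev i j hij x0).1 he
    have := hx0 (i, j)
    simp only at this; linarith
  obtain ⟨a, ha⟩ := Finite.exists_max fun i => f i x0
  obtain ⟨b, hb⟩ := Finite.exists_min fun i => f i x0
  exact ⟨a, b, x0, fun i hi => key i a (lt_of_le_of_ne (ha i) (hne i a hi)),
    fun i hi => key b i (lt_of_le_of_ne (hb i) (hne b i hi.symm))⟩

lemma ins_same {ι : Type*} {f : ι → ℝ → ℝ} {G : (ℝ × ℝ) ≃ₜ (ℝ × ℝ)} {t s : ι → ℝ} (h : INS f G t s)
    {a b : ι} {x0 : ℝ} (ha : ∀ i ≠ a, ∀ x ≤ x0, f i x < f a x) (hb : ∀ i ≠ b, ∀ x ≤ x0, f b x < f i x)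
    (hab : s a = s b) (i : ι) : s i = s b := by
  by_contra hi
  have hia : i ≠ a := by rintro rfl; exact hi hab
  have hib : i ≠ b := by rintro rfl; exact hi rfl
  have hsi : s i = - s b := by
    rcases h.sg i with h1 | h1 <;> rcases h.sg b with h2 | h2
    · exact absurd (h1.trans h2.symm) hi
    · rw [h1, h2]; norm_num
    · rw [h1, h2]
    · exact absurd (h1.trans h2.symm) hi
  obtain ⟨ea, hea⟩ := h.ga.ex i a hia
  -- the x-range is bounded
  have hx1 : ∀ x, f i x < f b x → x0 ≤ x := by
    intro x hx
    by_contra hn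
    have := hb i hib x (not_le.1 hn).le
    linarith
  have hx2 : ∀ x, f i x < f a x → x ≤ ea := by
    intro x hx
    by_contra hn
    push Not at hn
    have he0 : x0 < ea := by
      by_contra hn'
      have := ha i hia ea (not_lt.1 hn'); linarith
    -- f i < f a on both sides contradicts lt
    obtain ⟨y, hy⟩ := h.ga.lt a i hia.symm
    have hD : Continuous fun x => f i x - f a x := (h.ga.cont i).sub (h.ga.cont a)
    have huq : ∀ z, f i z - f a z = 0 → z = ea := fun z hz => h.ga.uniq i a hia _ _ (by linarith) hea
    rcases lt_or_ge y ea with hy1 | hy1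
    · obtain ⟨z, hz, hz0⟩ := ivt_zero hD (a := min x0 y) (b := y) (by have := ha i hia (min x0 y) (min_le_left _ _); linarith) (by linarith)
      rw [uIcc_of_le (min_le_right _ _)] at hz
      have := huq z hz0
      linarith [hz.2]
    · have hye : y ≠ ea := by rintro rfl; linarith
      have hy2 : ea < y := lt_of_le_of_ne hy1 hye.symm
      obtain ⟨z, hz, hz0⟩ := ivt_zero hD (a := x) (b := y) (by linarith) (by linarith)
      have := huq z hz0
      have h3 := hz.1
      have := lt_min hn hy2
      have h4 : min x y ≤ z := h3
      linarith
  -- compactness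
  have hca : Continuous fun x => |f i x| + |f a x| := (h.ga.cont i).abs.add (h.ga.cont a).abs
  obtain ⟨C, hC⟩ := (isCompact_Icc (a := x0) (b := ea)).bddAbove_image hca.continuousOn
  have hC' : ∀ x, x0 ≤ x → x ≤ ea → |f i x| + |f a x| ≤ C := fun x h1 h2 => hC ⟨x, ⟨h1, h2⟩, rfl⟩
  have hKc : IsCompact (Icc x0 ea ×ˢ Icc (-C) C) := isCompact_Icc.prod isCompact_Icc
  have hK2 := hKc.image G.symm.continuous
  obtain ⟨R, hR⟩ := (hK2.image continuous_snd.abs).bddAbove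
  set ρ : ℝ := |R| + |t a| + |t b| + |t i| + 1 with hρ
  have n1 := abs_nonneg R
  have n2 := abs_nonneg (t a)
  have n3 := abs_nonneg (t b)
  have n4 := abs_nonneg (t i)
  have hss : s b * s b = 1 := by rcases h.sg b with h | h <;> rw [h] <;> norm_num
  have hst : ∀ j, |s b * t j| = |t j| := fun j => by
    rw [abs_mul]; rcases h.sg b with h | h <;> rw [h] <;> norm_num
  have hcalc : ∀ j, s b * (-(s b * ρ) - t j) = -ρ - s b * t j := fun j => by
    linear_combination (-ρ) * hss
  have d1 := (h.dn a (-(s b * ρ))).1 (by rw [hab, hcalc]; have := abs_le.1 (hst a).le; linarith)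
  have d2 := (h.dn b (-(s b * ρ))).1 (by rw [hcalc]; have := abs_le.1 (hst b).le; linarith)
  have d3 := (h.up i (-(s b * ρ))).1 (by rw [hsi, neg_mul, hcalc]; have := abs_le.1 (hst i).le; linarith)
  set P := G (0, -(s b * ρ)) with hP
  have m1 := hx1 P.1 (by linarith)
  have m2 := hx2 P.1 (by linarith)
  have m3 := hC' _ m1 m2
  have hmem : P ∈ Icc x0 ea ×ˢ Icc (-C) C := by
    refine ⟨⟨m1, m2⟩, ?_, ?_⟩
    · have := neg_abs_le (f i P.1); have := abs_nonneg (f a P.1); linarith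
    · have := le_abs_self (f a P.1); have := abs_nonneg (f i P.1); linarith
  have := hR ⟨_, ⟨P, hmem, rfl⟩, rfl⟩
  rw [hP] at this
  simp only [Homeomorph.symm_apply_apply] at this
  have h1 : |s b| = 1 := by rcases h.sg b with h | h <;> rw [h] <;> norm_num
  rw [abs_neg, abs_mul, h1] at this
  have := le_abs_self R
  have := le_abs_self ρ
  linarith

end P9a

section P9b
open Set Filter Topology

lemma GA.sub {ι κ : Type*} {f : ι → ℝ → ℝ} (hf : GA f) (e : κ → ι) (he : Function.Injective e) : GA fun i => f (e i) where
    cont := fun i => hf.cont _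
    ex := fun i j hij => hf.ex _ _ (he.ne hij)
    uniq := fun i j hij => hf.uniq _ _ (he.ne hij)
    lt := fun i j hij => hf.lt _ _ (he.ne hij)
    tri := fun i j k x h1 h2 => by
      have := hf.tri _ _ _ x h1 h2
      simpa only [he.eq_iff] using this

lemma img_trans {X Y Z : Type*} [TopologicalSpace X] [TopologicalSpace Y] [TopologicalSpace Z] (Φ : X ≃ₜ Y) (Ψ : Y ≃ₜ Z)
    (S : Set X) : (Φ.trans Ψ) '' S = Ψ '' (Φ '' S) := by
  rw [← Set.image_comp]; rfl

/-- rotation: the top-left line becomes the bottom-left line -/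
lemma rotate {ι : Type*} [Fintype ι] {f : ι → ℝ → ℝ} (hf : GA f) {a : ι} {x0 : ℝ}
    (ha : ∀ i ≠ a, ∀ x ≤ x0, f i x < f a x) (hex : ∃ i, i ≠ a) :
    ∃ (h : (ℝ × ℝ) ≃ₜ (ℝ × ℝ)) (g : ι → ℝ → ℝ), (∀ i, Continuous (g i)) ∧ (∀ i ≠ a, Pres h (f i) (g i)) ∧
      Flip h (f a) (g a) ∧ ∃ x1, ∀ i ≠ a, ∀ x ≤ x1, g a x < g i x := by
  classical
  obtain ⟨i0, hi0⟩ := hex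
  obtain ⟨ev, s, esym, ssym, sval, hev, hs⟩ := hf.ev
  -- i vs a : f i < f a exactly for x < ev i a
  have hlt : ∀ i ≠ a, ∀ x, f i x < f a x ↔ x < ev i a := by
    intro i hi x
    have hsa : s a i = -1 := by
      rcases sval a i hi.symm with h | h
      · exfalso
        have h1 := (hs a i hi.symm (min x0 (ev a i - 1))).2 (ha i hi _ (min_le_left _ _))
        have := min_le_right x0 (ev a i - 1)
        rw [h] at h1; linarith
      · exact h
    rw [← hs a i hi.symm x, hsa, esym a i]
    constructor <;> intro h <;> linarith
  have hgt : ∀ i ≠ a, ∀ x, f a x < f i x ↔ ev i a < x := by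
    intro i hi x
    rw [← not_iff_not, not_lt, not_lt, le_iff_lt_or_eq, le_iff_lt_or_eq, hlt i hi, hev i a hi]
  have : Nonempty {i // i ≠ a} := ⟨⟨i0, hi0⟩⟩
  let G := grH (f a) (hf.cont a)
  have hG : ∀ r, G (0, r) = (-r, f a (-r)) := fun r => by
    show (-r, 0 + f a (-r)) = _
    rw [zero_add]
  obtain ⟨h, g, K, B, hK, h1, h2, h3, h4, h5⟩ := lemmaV (hf.sub (fun i : {i // i ≠ a} => i.1) Subtype.val_injective) G
    (t := fun i => - ev i.1 a) (by
      intro i j hij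
      simp only [neg_inj] at hij
      by_contra hne
      have e1 := (hev i.1 a i.2 (ev i.1 a)).2 rfl
      have e2 := (hev j.1 a j.2 (ev i.1 a)).2 hij
      rcases hf.tri a i.1 j.1 _ e1.symm e2.symm with h | h | h
      · exact i.2 h.symm
      · exact j.2 h.symm
      · exact hne (Subtype.ext h))
    (fun i => by rw [hG]; simp only [neg_neg]; exact ((hev i.1 a i.2 _).2 rfl).symm)
    (fun i r hr => by rw [hG]; exact (hgt i.1 i.2 _).2 (by linarith))
    (fun i r hr => by rw [hG]; exact (hlt i.1 i.2 _).2 (by linarith))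
  have hc : 0 < 1 / (K+1) := by positivity
  have hcK : 1 / (K+1) * K < 1 := by rw [div_mul_eq_mul_div, one_mul, div_lt_one (by linarith)]; linarith
  set c := 1 / (K+1) with hcd
  have h6 := fun i => tilt_pres (h1 i) hc hcK (h2 i)
  choose k hk1 hk2 hk3 using h6
  have hon : ∀ p : ℝ × ℝ, p.2 = f a p.1 ↔ (h p).1 = 0 := by
    intro p
    rw [← h4 p]
    show p.2 = f a p.1 ↔ p.2 - f a p.1 = 0
    rw [sub_eq_zero]
  let g' : ι → ℝ → ℝ := fun i => if hi : i ≠ a then k ⟨i, hi⟩ else fun x => x / c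
  have g'1 : ∀ i (hi : i ≠ a), g' i = k ⟨i, hi⟩ := fun i hi => dif_pos hi
  have g'2 : g' a = fun x => x / c := dif_neg (by simp)
  have hPi : ∀ i ≠ a, Pres (h.trans (tiltH c)) (f i) (g' i) := fun i hi => by
    rw [g'1 i hi]; exact (h3 ⟨i, hi⟩).trans (hk3 _)
  have hca : Continuous (g' a) := by rw [g'2]; fun_prop
  refine ⟨h.trans (tiltH c), g', ?_, hPi, ?_, ?_⟩
  · intro i
    by_cases hi : i = a
    · rw [hi]; exact hca
    · rw [g'1 i hi]; exact hk1 _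
  · have himg : (h.trans (tiltH c)) '' gr (f a) = gr (g' a) := by
      apply image_gr_of_on
      intro p
      rw [hon p, Homeomorph.trans_apply, tiltH_apply, g'2]
      simp only
      rw [eq_div_iff hc.ne']
      constructor <;> intro h <;> linarith
    rcases side_dich (hf.cont a) hca himg with hp | hp
    · exfalso
      -- test point
      have hx : ev i0 a - 1 < ev i0 a := by linarith
      have q1 := (hlt i0 hi0 _).2 hx
      have q2 := (h5 ⟨i0, hi0⟩ (ev i0 a - 1)).2 (by rw [hG]; simp only [neg_neg]; exact hx)
      have q3 := ((hp (ev i0 a - 1, f i0 (ev i0 a - 1))).2).1 q1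
      rw [Homeomorph.trans_apply, tiltH_apply, g'2] at q3
      simp only at q3 q2
      rw [lt_div_iff₀ hc] at q3
      linarith
    · exact hp
  · refine ⟨-(c * (B + 1)), fun i hi x hx => ?_⟩
    rw [g'2, g'1 i hi]
    have := abs_le.1 (hk2 ⟨i, hi⟩ x)
    have h7 : x / c ≤ -(B+1) := by rw [div_le_iff₀ hc]; linarith
    simp only
    linarith

theorem insertion {ι : Type*} [Fintype ι] (N : ℕ) : ∀ {f : ι → ℝ → ℝ} {G : (ℝ × ℝ) ≃ₜ (ℝ × ℝ)} {t s : ι → ℝ} (_ : INS f G t s)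
    {b : ι} {x1 : ℝ} (_ : ∀ i ≠ b, ∀ x ≤ x1, f b x < f i x) (_ : {i | s i ≠ s b}.ncard ≤ N),
    Inserted f {p | (G.symm p).1 = 0} := by
  classical
  induction N with
  | zero =>
    intro f G t s h b x1 hb hN
    have : Nonempty ι := ⟨b⟩
    have he : {i | s i ≠ s b} = ∅ := by
      rwa [Nat.le_zero, Set.ncard_eq_zero (Set.toFinite _)] at hN
    have hall : ∀ i, s i = s b := fun i => by
      by_contra hi
      have : i ∈ {i | s i ≠ s b} := hi
      rw [he] at this; exact this
    rcases h.sg b with h1 | h1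
    · exact ins_up h fun i => (hall i).trans h1
    · exact ins_down h fun i => (hall i).trans h1
  | succ N ih =>
    intro f G t s h b x1 hb hN
    have : Nonempty ι := ⟨b⟩
    by_cases hall : ∀ i, s i = s b
    · rcases h.sg b with h1 | h1
      · exact ins_up h fun i => (hall i).trans h1
      · exact ins_down h fun i => (hall i).trans h1
    obtain ⟨a, -, x0, ha, -⟩ := ga_extreme h.ga
    have hab : s a ≠ s b := by
      intro hab
      refine hall fun i => ins_same h (a := a) (b := b) (x0 := min x0 x1) ?_ ?_ hab i
      · intro i hi x hx; exact ha i hi x (hx.trans (min_le_left _ _))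
      · intro i hi x hx; exact hb i hi x (hx.trans (min_le_right _ _))
    have hba : b ≠ a := fun h => hab (by rw [h])
    have hsab : - s a = s b := by
      rcases h.sg a with h1 | h1 <;> rcases h.sg b with h2 | h2
      · exact absurd (h1.trans h2.symm) hab
      · rw [h1, h2]
      · rw [h1, h2]; norm_num
      · exact absurd (h1.trans h2.symm) hab
    obtain ⟨Φ, g, hg, hP, hF, x2, hx2⟩ := rotate h.ga ha ⟨b, hba⟩
    have himg : ∀ i, Φ '' gr (f i) = gr (g i) := fun i => by
      by_cases hi : i = a
      · rw [hi]; exact hF.image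
      · exact (hP i hi).image
    have hI : INS g (G.trans Φ) t (Function.update s a (- s a)) := {
      ga := h.ga.transport2 hg himg
      inj := h.inj
      sg := fun i => by
        by_cases hi : i = a
        · subst hi
          rw [Function.update_self]
          rcases h.sg i with h | h <;> rw [h] <;> norm_num
        · rw [Function.update_of_ne hi]; exact h.sg i
      up := fun i r => by
        by_cases hi : i = a
        · subst hi
          rw [Function.update_self, Homeomorph.trans_apply, ← (hF _).2, ← h.dn]
          constructor <;> intro h <;> linarith
        · rw [Function.update_of_ne hi, Homeomorph.trans_apply, ← (hP i hi _).1, ← h.up]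
      dn := fun i r => by
        by_cases hi : i = a
        · subst hi
          rw [Function.update_self, Homeomorph.trans_apply, ← (hF _).1, ← h.up]
          constructor <;> intro h <;> linarith
        · rw [Function.update_of_ne hi, Homeomorph.trans_apply, ← (hP i hi _).2, ← h.dn] }
    have hlt : {i | Function.update s a (- s a) i ≠ Function.update s a (- s a) a}.ncard < {i | s i ≠ s b}.ncard := by
      apply Set.ncard_lt_ncard _ (Set.toFinite _)
      constructor
      · intro i (hi : Function.update s a (- s a) i ≠ Function.update s a (- s a) a)
        have hia : i ≠ a := fun h => hi (by rw [h])
        rw [Function.update_self, Function.update_of_ne hia, hsab] at hi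
        exact hi
      · intro hsub
        exact hsub (show a ∈ {i | s i ≠ s b} from hab) rfl
    obtain ⟨h', g', g0, c1, c2, c3, c4⟩ := ih hI hx2 (by omega)
    refine ⟨Φ.trans h', g', g0, c1, c2, fun i => ?_, ?_⟩
    · rw [← c3 i, ← himg i, img_trans]
    · rw [← c4, img_trans]
      congr 1
      ext p
      constructor
      · rintro ⟨q, hq, rfl⟩
        show (G.symm (Φ.symm (Φ q))).1 = 0
        rw [Homeomorph.symm_apply_apply]; exact hq
      · intro hp
        exact ⟨Φ.symm p, hp, by simp⟩

end P9b

section P9c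
open Set Filter Topology

/-- arrangement of flat lines in `ℝ × ℝ` -/
structure PA {κ : Type*} (A : κ → Set (ℝ × ℝ)) : Prop where
  flat : ∀ i, ∃ G : (ℝ × ℝ) ≃ₜ (ℝ × ℝ), A i = {p | (G.symm p).1 = 0}
  ex : ∀ i j, i ≠ j → (A i ∩ A j).Nonempty
  uq : ∀ i j, i ≠ j → (A i ∩ A j).Subsingleton
  cross : ∀ i j, i ≠ j → ∀ G : (ℝ × ℝ) ≃ₜ (ℝ × ℝ), A i = {p | (G.symm p).1 = 0} →
    (∃ p ∈ A j, (G.symm p).1 < 0) ∧ ∃ p ∈ A j, 0 < (G.symm p).1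
  tri : ∀ p i j k, p ∈ A i → p ∈ A j → p ∈ A k → i = j ∨ i = k ∨ j = k

lemma img_flat (h G : (ℝ × ℝ) ≃ₜ (ℝ × ℝ)) : h '' {p | (G.symm p).1 = 0} = {p | ((G.trans h).symm p).1 = 0} := by
  ext p
  constructor
  · rintro ⟨q, hq, rfl⟩
    show (G.symm (h.symm (h q))).1 = 0
    rw [Homeomorph.symm_apply_apply]; exact hq
  · intro hp
    exact ⟨h.symm p, hp, by simp⟩

lemma PA.map {κ : Type*} {A : κ → Set (ℝ × ℝ)} (hA : PA A) (h : (ℝ × ℝ) ≃ₜ (ℝ × ℝ)) : PA fun i => h '' A i where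
  flat i := by
    obtain ⟨G, hG⟩ := hA.flat i
    exact ⟨G.trans h, by rw [hG, img_flat]⟩
  ex i j hij := by rw [← Set.image_inter h.injective]; exact (hA.ex i j hij).image _
  uq i j hij := by rw [← Set.image_inter h.injective]; exact (hA.uq i j hij).image _
  cross i j hij G hG := by
    have h1 : A i = {p | ((G.trans h.symm).symm p).1 = 0} := by
      rw [← img_flat, ← hG, ← Set.image_comp]; simp
    obtain ⟨⟨p, hp, hp'⟩, ⟨q, hq, hq'⟩⟩ := hA.cross i j hij _ h1
    exact ⟨⟨h p, ⟨p, hp, rfl⟩, hp'⟩, ⟨h q, ⟨q, hq, rfl⟩, hq'⟩⟩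
  tri p i j k := by
    rintro ⟨q, hq, rfl⟩ ⟨q2, hq2, h2⟩ ⟨q3, hq3, h3⟩
    have e2 := h.injective h2
    have e3 := h.injective h3
    subst e2 e3
    exact hA.tri _ i j k hq hq2 hq3

lemma gr_flat {f : ℝ → ℝ} (hf : Continuous f) : gr f = {p | ((grH f hf).symm p).1 = 0} := by
  ext p
  show p.2 = f p.1 ↔ p.2 - f p.1 = 0
  rw [sub_eq_zero]

lemma PA.toGA {κ ι : Type*} {A : κ → Set (ℝ × ℝ)} (hA : PA A) (e : ι → κ) (he : Function.Injective e) {f : ι → ℝ → ℝ}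
    (hf : ∀ i, Continuous (f i)) (h : ∀ i, A (e i) = gr (f i)) : GA f where
  cont := hf
  ex i j hij := by
    obtain ⟨p, hp1, hp2⟩ := hA.ex _ _ (he.ne hij)
    rw [h] at hp1 hp2
    have h1 : p.2 = f i p.1 := hp1
    have h2 : p.2 = f j p.1 := hp2
    exact ⟨p.1, h1.symm.trans h2⟩
  uniq i j hij x y hx hy := by
    have := hA.uq _ _ (he.ne hij) (x := (x, f i x)) ⟨by rw [h]; rfl, by rw [h]; exact hx⟩
      (y := (y, f i y)) ⟨by rw [h]; rfl, by rw [h]; exact hy⟩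
    exact congrArg Prod.fst this
  lt i j hij := by
    obtain ⟨⟨p, hp, hp'⟩, -⟩ := hA.cross (e j) (e i) (he.ne hij.symm) (grH (f j) (hf j)) (by rw [h, ← gr_flat])
    rw [h] at hp
    have h1 : p.2 = f i p.1 := hp
    have h2 : p.2 - f j p.1 < 0 := hp'
    exact ⟨p.1, by linarith⟩
  tri i j k x h1 h2 := by
    have := hA.tri (x, f i x) (e i) (e j) (e k) (by rw [h]; rfl) (by rw [h]; exact h1) (by rw [h]; exact h2)
    simpa only [he.eq_iff] using this

lemma pa_insert {κ : Type*} {A : κ → Set (ℝ × ℝ)} (hA : PA A) (s : Finset κ) (a : κ) (ha : a ∉ s)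
    {f : s → ℝ → ℝ} (hf : ∀ i, Continuous (f i)) (h : ∀ i, A i.1 = gr (f i)) : Inserted f (A a) := by
  have hGA := hA.toGA (fun i : s => i.1) Subtype.val_injective hf h
  obtain ⟨G, hG⟩ := hA.flat a
  have hne : ∀ i : s, a ≠ i.1 := fun i hi => ha (hi ▸ i.2)
  have hmem : ∀ r, G (0, r) ∈ A a := fun r => by
    rw [hG]; show (G.symm (G (0, r))).1 = 0; simp
  have hpar : ∀ p ∈ A a, p = G (0, (G.symm p).2) := fun p hp => by
    rw [hG] at hp
    have hp : (G.symm p).1 = 0 := hp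
    rw [← hp]; simp
  have key : ∀ i : s, ∃ t σ : ℝ, (σ = 1 ∨ σ = -1) ∧ (∀ r, (G (0, r)).2 = f i (G (0, r)).1 ↔ r = t) ∧
      ∀ r, 0 < σ * (r - t) ↔ f i (G (0, r)).1 < (G (0, r)).2 := by
    intro i
    have hD : Continuous fun r : ℝ => (G (0, r)).2 - f i (G (0, r)).1 := by
      have : Continuous fun r : ℝ => G (0, r) := by fun_prop
      exact (continuous_snd.comp this).sub ((hf i).comp (continuous_fst.comp this))
    obtain ⟨p, hp1, hp2⟩ := hA.ex _ _ (hne i)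
    have hp3 := hpar p hp1
    have hz : ∀ r, (G (0, r)).2 - f i (G (0, r)).1 = 0 ↔ r = (G.symm p).2 := by
      intro r
      constructor
      · intro hr
        have : G (0, r) = p := hA.uq _ _ (hne i) ⟨hmem r, by rw [h]; exact sub_eq_zero.1 hr⟩ ⟨hp1, hp2⟩
        rw [← this]; simp
      · rintro rfl
        rw [← hp3, sub_eq_zero]
        rw [h] at hp2; exact hp2
    obtain ⟨⟨q, hq, hq'⟩, ⟨q2, hq2, hq2'⟩⟩ := hA.cross i.1 a (hne i).symm (grH (f i) (hf i)) (by rw [h, ← gr_flat])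
    have e1 : q.2 - f i q.1 < 0 := hq'
    have e2 : 0 < q2.2 - f i q2.1 := hq2'
    rw [hpar q hq] at e1
    rw [hpar q2 hq2] at e2
    obtain ⟨σ, hσ, hσ'⟩ := sgn1 hD ((hz _).2 rfl) (fun r hr => (hz r).1 hr) e1 e2
    refine ⟨(G.symm p).2, σ, hσ, fun r => ?_, fun r => ?_⟩
    · rw [← hz r, sub_eq_zero]
    · rw [hσ' r, sub_pos]
  choose t σ h1 h2 h3 using key
  have hI : INS f G t σ := {
    ga := hGA
    inj := by
      intro i j hij
      have e1 := (h2 i (t i)).2 rfl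
      have e2 := (h2 j (t i)).2 hij
      rcases hA.tri (G (0, t i)) a i.1 j.1 (hmem _) (by rw [h]; exact e1) (by rw [h]; exact e2) with h | h | h
      · exact absurd h (hne i)
      · exact absurd h (hne j)
      · exact Subtype.ext h
    sg := h1
    up := h3
    dn := fun i r => by
      have a1 := h2 i r
      have a2 := h3 i r
      have a3 : σ i * (r - t i) = 0 ↔ r = t i := by
        have : σ i ≠ 0 := by rcases h1 i with h | h <;> rw [h] <;> norm_num
        rw [mul_eq_zero, sub_eq_zero]; simp [this]
      rcases lt_trichotomy (σ i * (r - t i)) 0 with h | h | h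
      · refine ⟨fun _ => ?_, fun _ => h⟩
        rcases lt_trichotomy (G (0, r)).2 (f i (G (0, r)).1) with h' | h' | h'
        · exact h'
        · have := a3.2 (a1.1 h'); linarith
        · have := a2.2 h'; linarith
      · have := a1.2 (a3.1 h)
        rw [h, this]; simp
      · have := a2.1 h
        constructor <;> intro h' <;> linarith }
  rw [hG]
  rcases isEmpty_or_nonempty s with hs | hs
  · exact ins_empty f G
  · obtain ⟨-, b, x0, -, hb⟩ := ga_extreme hGA
    exact insertion _ hI hb le_rfl

theorem pa_graphs {κ : Type*} [Fintype κ] {A : κ → Set (ℝ × ℝ)} (hA : PA A) :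
    ∃ (h : (ℝ × ℝ) ≃ₜ (ℝ × ℝ)) (f : κ → ℝ → ℝ), GA f ∧ ∀ i, h '' A i = gr (f i) := by
  classical
  suffices H : ∀ s : Finset κ, ∃ (h : (ℝ × ℝ) ≃ₜ (ℝ × ℝ)) (f : κ → ℝ → ℝ), (∀ i, Continuous (f i)) ∧
      ∀ i ∈ s, h '' A i = gr (f i) by
    obtain ⟨h, f, h1, h2⟩ := H Finset.univ
    refine ⟨h, f, (hA.map h).toGA id Function.injective_id h1 fun i => h2 i (Finset.mem_univ i), fun i => h2 i (Finset.mem_univ i)⟩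
  intro s
  induction s using Finset.induction_on with
  | empty => exact ⟨Homeomorph.refl _, fun _ _ => 0, fun _ => continuous_const, by simp⟩
  | insert a s ha ih =>
    obtain ⟨h, f, h1, h2⟩ := ih
    obtain ⟨h', g, g0, c1, c2, c3, c4⟩ := pa_insert (hA.map h) s a ha (f := fun i => f i.1) (fun i => h1 _) (fun i => h2 i.1 i.2)
    refine ⟨h.trans h', fun i => if hi : i ∈ s then g ⟨i, hi⟩ else g0, fun i => ?_, fun i hi => ?_⟩
    · by_cases hi : i ∈ s
      · simp only [hi, dif_pos]; exact c1 _
      · simp only [hi, dif_neg, not_false_eq_true]; exact c2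
    · rw [img_trans]
      rcases Finset.mem_insert.1 hi with hia | his
      · subst hia
        simp only [ha, dif_neg, not_false_eq_true]; exact c4
      · simp only [his, dif_pos]
        rw [h2 i his]; exact c3 ⟨i, his⟩

theorem pa_generic {κ : Type*} [Fintype κ] {A : κ → Set (ℝ × ℝ)} (hA : PA A) :
    ∃ (h : (ℝ × ℝ) ≃ₜ (ℝ × ℝ)) (f : κ → ℝ → ℝ), GA f ∧ (∀ i, h '' A i = gr (f i)) ∧
      ∀ i j k l x, i ≠ j → k ≠ l → f i x = f j x → f k x = f l x → (i = k ∧ j = l) ∨ (i = l ∧ j = k) := by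
  classical
  obtain ⟨h, f, hGA, hf⟩ := pa_graphs hA
  obtain ⟨f', K, hK, hlip, hB, hord, -⟩ := hGA.canon
  obtain ⟨Φ1, hΦx, hΦp⟩ := c2_homeo hGA.cont (fun i => lip_cont (hlip i)) hord
  have hGA' : GA f' := hGA.transport (fun i => lip_cont (hlip i)) hΦp
  obtain ⟨ev, s, esym, ssym, sval, hev, hs⟩ := hGA'.ev
  let bad : (κ × κ) × (κ × κ) → ℝ := fun q => 
    -(ev q.1.1 q.1.2 - ev q.2.1 q.2.2) / (f' q.1.1 (ev q.1.1 q.1.2) - f' q.2.1 (ev q.2.1 q.2.2))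
  obtain ⟨c, ⟨hc0, hc1⟩, hcb⟩ : ∃ c, c ∈ Ioo 0 (1/(K+1)) ∧ c ∉ range bad := by
    have hinf : (Ioo (0:ℝ) (1/(K+1))).Infinite := Ioo_infinite (by positivity)
    obtain ⟨c, h1, h2⟩ := (hinf.sdiff (Set.finite_range bad)).nonempty
    exact ⟨c, h1, h2⟩
  have hcK : c * K < 1 := by
    rw [lt_div_iff₀ (by linarith)] at hc1; linarith
  have h6 := fun i => tilt_pres (hlip i) hc0 hcK (hB i)
  choose g hg1 hg2 hg3 using h6
  have hP : ∀ i, Pres (Φ1.trans (tiltH c)) (f i) (g i) := fun i => (hΦp i).trans (hg3 i)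
  have hGAg : GA g := hGA.transport hg1 hP
  refine ⟨h.trans (Φ1.trans (tiltH c)), g, hGAg, fun i => ?_, ?_⟩
  · rw [img_trans, hf, (hP i).image]
  · intro i j k l x hij hkl e1 e2
    -- preimages
    have pre : ∀ i j, i ≠ j → g i x = g j x → x - c * g i x = ev i j ∧ g i x = f' i (x - c * g i x) := by
      intro i j hij e
      have t1 : (tiltH c) (x - c * g i x, g i x) = (x, g i x) := by rw [tiltH_apply]; simp
      have u1 := ((hg3 i).on (x - c * g i x, g i x)).2 (by rw [t1])
      have u2 := ((hg3 j).on (x - c * g i x, g i x)).2 (by rw [t1]; exact e)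
      simp only at u1 u2
      exact ⟨(hev i j hij _).1 (u1.symm.trans u2), u1⟩
    obtain ⟨p1, p2⟩ := pre i j hij e1
    obtain ⟨q1, q2⟩ := pre k l hkl e2
    rw [p1] at p2
    rw [q1] at q2
    have hy : g i x = g k x := by
      by_contra hne
      apply hcb
      refine ⟨((i, j), (k, l)), ?_⟩
      simp only [bad]
      rw [← p2, ← q2, ← p1, ← q1, div_eq_iff (sub_ne_zero.2 hne)]
      ring
    -- all four pass through the same point
    have hik := hGAg.tri i j k x e1 hy
    have hil := hGAg.tri i j l x e1 (hy.trans e2)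
    rcases hik with h | h | h
    · exact absurd h hij
    · rcases hil with h' | h' | h'
      · exact absurd h' hij
      · exact absurd (h.symm.trans h') hkl
      · exact Or.inl ⟨h, h'⟩
    · rcases hil with h' | h' | h'
      · exact absurd h' hij
      · exact Or.inr ⟨h', h⟩
      · exact absurd (h.symm.trans h') hkl

end P9c

section P10
open Set Filter Topology

lemma big_rpow {ι : Type*} [Finite ι] (e : ι → ℝ) (M : ℝ) :
    ∃ R : ℝ, 0 < R ∧ ∀ i j, e i < e j → M * R ^ (e i) < R ^ (e j) := by
  have h : ∀ q : ι × ι, ∀ᶠ R : ℝ in atTop, e q.1 < e q.2 → M * R ^ (e q.1) < R ^ (e q.2) := by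
    intro q
    by_cases hq : e q.1 < e q.2
    · filter_upwards [(tendsto_rpow_atTop (sub_pos.2 hq)).eventually_gt_atTop M, eventually_gt_atTop 0] with R h1 h2 _
      rw [Real.rpow_sub h2, lt_div_iff₀ (by positivity)] at h1
      exact h1
    · exact Eventually.of_forall fun R h => absurd h hq
  obtain ⟨R, h1, h2⟩ := ((eventually_all.2 h).and (eventually_gt_atTop 0)).exists
  exact ⟨R, h2, fun i j => h1 (i, j)⟩

structure SW (n N : ℕ) (F : ℕ → Fin n → ℝ) (I J : ℕ → Fin n) (m : Fin n → Fin n → ℕ) : Prop where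
  lt : ∀ k < N, I k < J k
  hm : ∀ p q, p < q → m p q < N ∧ I (m p q) = p ∧ J (m p q) = q
  hmk : ∀ k < N, m (I k) (J k) = k
  dn : ∀ k ≤ N, ∀ p q, p < q → (F k q < F k p ↔ k ≤ m p q)
  up : ∀ k ≤ N, ∀ p q, p < q → (F k p < F k q ↔ m p q < k)

lemma SW.inj {n N F I J m} (h : SW n N F I J m) {k} (hk : k ≤ N) {p q} (hpq : p ≠ q) : F k p < F k q ∨ F k q < F k p := by
  rcases lt_or_gt_of_ne hpq with hl | hl
  · rw [h.dn k hk _ _ hl, h.up k hk _ _ hl]; omega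
  · rw [h.dn k hk _ _ hl, h.up k hk _ _ hl]; omega

lemma SW.same {n N F I J m} (h : SW n N F I J m) {k} (hk : k < N) {p q} (h1 : ¬ (p = I k ∧ q = J k))
    (h2 : ¬ (q = I k ∧ p = J k)) : F k p < F k q ↔ F (k+1) p < F (k+1) q := by
  have key : ∀ p q, p < q → ¬ (p = I k ∧ q = J k) → m p q ≠ k := by
    rintro p q hpq hn rfl
    exact hn ⟨(h.hm p q hpq).2.1.symm, (h.hm p q hpq).2.2.symm⟩
  rcases lt_trichotomy p q with hl | hl | hl
  · have := key p q hl h1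
    rw [h.up k hk.le _ _ hl, h.up (k+1) hk _ _ hl]; omega
  · subst hl; simp
  · have := key q p hl h2
    rw [h.dn k hk.le _ _ hl, h.dn (k+1) hk _ _ hl]; omega

lemma SW.step {n N F I J m} (h : SW n N F I J m) {k} (hk : k < N) (e : Fin n → ℝ)
    (he : ∀ p q, e p < e q ↔ F k p < F k q) :
    ∃ e' : Fin n → ℝ, (∀ p q, e' p < e' q ↔ F (k+1) p < F (k+1) q) ∧ (∀ p, p ≠ J k → e' p = e p) ∧ e (J k) < e' (J k) := by
  classical
  have hIJ := h.lt k hk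
  have hmk := h.hmk k hk
  have ot : ∀ p q, p ≠ J k → q ≠ J k → (F k p < F k q ↔ F (k+1) p < F (k+1) q) := fun p q hp hq =>
    h.same hk (fun h' => hq h'.2) (fun h' => hp h'.2)
  obtain ⟨v, hv1, hv2⟩ := Order.exists_between_finsets
    (lo := (Finset.univ.filter fun q => q ≠ J k ∧ F (k+1) q < F (k+1) (J k)).image e)
    (hi := (Finset.univ.filter fun q => q ≠ J k ∧ F (k+1) (J k) < F (k+1) q).image e) (by
      intro x hx y hy
      simp only [Finset.mem_image, Finset.mem_filter, Finset.mem_univ, true_and] at hx hy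
      obtain ⟨p, ⟨hp, hp'⟩, rfl⟩ := hx
      obtain ⟨q, ⟨hq, hq'⟩, rfl⟩ := hy
      rw [he, ot p q hp hq]; exact hp'.trans hq')
  have hv1 : ∀ q, q ≠ J k → F (k+1) q < F (k+1) (J k) → e q < v := fun q h1 h2 => hv1 _ (by
    simp only [Finset.mem_image, Finset.mem_filter, Finset.mem_univ, true_and]; exact ⟨q, ⟨h1, h2⟩, rfl⟩)
  have hv2 : ∀ q, q ≠ J k → F (k+1) (J k) < F (k+1) q → v < e q := fun q h1 h2 => hv2 _ (by
    simp only [Finset.mem_image, Finset.mem_filter, Finset.mem_univ, true_and]; exact ⟨q, ⟨h1, h2⟩, rfl⟩)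
  refine ⟨Function.update e (J k) v, fun p q => ?_, fun p hp => Function.update_of_ne hp _ _, ?_⟩
  · by_cases hp : p = J k
    · by_cases hq : q = J k
      · subst hp; subst hq; simp
      · rw [hp, Function.update_self, Function.update_of_ne hq]
        refine ⟨fun h1 => ?_, hv2 q hq⟩
        rcases h.inj hk hq with h2 | h2
        · have := hv1 q hq h2; linarith
        · exact h2
    · by_cases hq : q = J k
      · rw [hq, Function.update_self, Function.update_of_ne hp]
        refine ⟨fun h1 => ?_, hv1 p hp⟩
        rcases h.inj hk hp with h2 | h2
        · exact h2
        · have := hv2 p hp h2; linarith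
      · rw [Function.update_of_ne hq, Function.update_of_ne hp, he, ot p q hp hq]
  · rw [Function.update_self]
    have h1 : e (J k) < e (I k) := by rw [he, h.dn k hk.le _ _ hIJ, hmk]
    have h2 : e (I k) < v := hv1 _ hIJ.ne (by rw [h.up (k+1) hk _ _ hIJ, hmk]; omega)
    linarith

lemma SW.exps {n N F I J m} (h : SW n N F I J m) : ∃ e : ℕ → Fin n → ℝ,
    (∀ k ≤ N, ∀ p q, e k p < e k q ↔ F k p < F k q) ∧ (∀ k < N, ∀ p, p ≠ J k → e (k+1) p = e k p) ∧
    ∀ k < N, e k (J k) < e (k+1) (J k) := by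
  suffices H : ∀ M ≤ N, ∃ e : ℕ → Fin n → ℝ,
    (∀ k ≤ M, ∀ p q, e k p < e k q ↔ F k p < F k q) ∧ (∀ k < M, ∀ p, p ≠ J k → e (k+1) p = e k p) ∧
    ∀ k < M, e k (J k) < e (k+1) (J k) from H N le_rfl
  intro M
  induction M with
  | zero => intro _; exact ⟨fun k => F k, fun k hk p q => Iff.rfl, by simp, by simp⟩
  | succ M ih =>
    intro hM
    obtain ⟨e, e1, e2, e3⟩ := ih (by omega)
    obtain ⟨e', f1, f2, f3⟩ := h.step (k := M) (by omega) (e M) (e1 M le_rfl)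
    refine ⟨Function.update e (M+1) e', fun k hk p q => ?_, fun k hk p hp => ?_, fun k hk => ?_⟩
    · rcases Nat.lt_or_ge k (M+1) with hk' | hk'
      · rw [Function.update_of_ne (by omega)]; exact e1 k (by omega) p q
      · obtain rfl : k = M+1 := by omega
        rw [Function.update_self]; exact f1 p q
    · rw [Function.update_of_ne (show k ≠ M+1 by omega)]
      rcases Nat.lt_or_ge k M with hk' | hk'
      · rw [Function.update_of_ne (by omega)]; exact e2 k hk' p hp
      · obtain rfl : k = M := by omega
        rw [Function.update_self]; exact f2 p hp
    · rw [Function.update_of_ne (show k ≠ M+1 by omega)]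
      rcases Nat.lt_or_ge k M with hk' | hk'
      · rw [Function.update_of_ne (by omega)]; exact e3 k hk'
      · obtain rfl : k = M := by omega
        rw [Function.update_self]; exact f3

/-- The convex piecewise linear chains. -/
noncomputable def gch {n : ℕ} (N : ℕ) (J : ℕ → Fin n) (A : Fin n → ℝ) (c u : ℕ → ℝ) (p : Fin n) (t : ℝ) : ℝ :=
  A p + ∑ k ∈ (Finset.range N).filter (fun k => J k = p), c k * max (t - u k) 0

lemma cell_ex (u : ℕ → ℝ) (N : ℕ) (t : ℝ) (h0 : u 0 ≤ t) (h1 : t < u N) : ∃ k < N, u k ≤ t ∧ t ≤ u (k+1) := by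
  induction N with
  | zero => linarith
  | succ N ih =>
    rcases lt_or_ge t (u N) with h | h
    · obtain ⟨k, hk, hk'⟩ := ih h
      exact ⟨k, by omega, hk'⟩
    · exact ⟨N, by omega, h, h1.le⟩

theorem SW.real {n N F I J m} (h : SW n N F I J m) : ∃ (A : Fin n → ℝ) (c u w : ℕ → ℝ),
    StrictMono u ∧ (∀ k < N, 0 < c k) ∧ (∀ k l, k < l → l < N → w k < w l) ∧
    ∀ p q, p < q → ∀ t, (gch N J A c u q t < gch N J A c u p t ↔ t < w (m p q)) ∧
      (gch N J A c u p t < gch N J A c u q t ↔ w (m p q) < t) := by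
  classical
  obtain ⟨e, e1, e2, e3⟩ := h.exps
  set δ : ℝ := 1 / (2 * N + 2) with hδ
  have hN0 : (0:ℝ) ≤ N := Nat.cast_nonneg N
  have hδ0 : 0 < δ := by positivity
  obtain ⟨R, hR0, hR⟩ := big_rpow (fun q : Fin (N+1) × Fin n => e q.1 q.2) (1 / δ + 4)
  obtain ⟨a, ha⟩ : ∃ a : ℕ → Fin n → ℝ, a = fun k p => R ^ (e k p) := ⟨_, rfl⟩
  have ha0 : ∀ k p, 0 < a k p := fun k p => by rw [ha]; positivity
  have hlt : ∀ k l p q, k ≤ N → l ≤ N → e k p < e l q → (1/δ + 4) * a k p < a l q := by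
    intro k l p q hk hl hh
    have := hR (⟨k, by omega⟩, p) (⟨l, by omega⟩, q) hh
    rw [ha]; exact this
  have hltδ : ∀ k l p q, k ≤ N → l ≤ N → e k p < e l q → a k p < δ * a l q := by
    intro k l p q hk hl hh
    have h1 := hlt k l p q hk hl hh
    have h2 := mul_lt_mul_of_pos_left h1 hδ0
    have h3 : δ * ((1/δ + 4) * a k p) = a k p + 4 * (δ * a k p) := by field_simp
    have h4 : 0 < δ * a k p := mul_pos hδ0 (ha0 _ _)
    linarith
  have hlt4 : ∀ k l p q, k ≤ N → l ≤ N → e k p < e l q → 4 * a k p < a l q := by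
    intro k l p q hk hl hh
    have h1 := hlt k l p q hk hl hh
    have h4 : 0 < (1/δ) * a k p := mul_pos (by positivity) (ha0 _ _)
    linarith
  obtain ⟨u, hu⟩ : ∃ u : ℕ → ℝ, u = fun k : ℕ => -1 + k * δ := ⟨_, rfl⟩
  have husub : ∀ k l, u k - u l = (k - l) * δ := fun k l => by rw [hu]; ring
  have hus : ∀ k, u (k+1) = u k + δ := fun k => by rw [hu]; push_cast; ring
  have hum : StrictMono u := strictMono_nat_of_lt_succ fun k => by rw [hus]; linarith
  have hu0 : u 0 = -1 := by rw [hu]; simp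
  have huge : ∀ k, -1 ≤ u k := fun k => by rw [← hu0]; exact hum.monotone (Nat.zero_le k)
  have huN : u N ≤ -1/2 := by
    have : (N:ℝ) * δ ≤ 1/2 := by
      rw [hδ, mul_one_div, div_le_iff₀ (by positivity)]; linarith
    rw [hu]; simp only; linarith
  have hule : ∀ k ≤ N, u k ≤ -1/2 := fun k hk => (hum.monotone hk).trans huN
  obtain ⟨Δ, hΔ⟩ : ∃ Δ : ℕ → ℝ, Δ = fun k => a (k+1) (J k) - a k (J k) := ⟨_, rfl⟩
  have hΔ0 : ∀ k < N, 0 < Δ k := fun k hk => by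
    have := hlt4 k (k+1) (J k) (J k) hk.le hk (e3 k hk)
    have := ha0 k (J k)
    rw [hΔ]; simp only; linarith
  obtain ⟨c, hc⟩ : ∃ c : ℕ → ℝ, c = fun k => Δ k / (-u k) := ⟨_, rfl⟩
  have hc0 : ∀ k < N, 0 < c k := fun k hk => by
    have := hule k hk.le
    rw [hc]; exact div_pos (hΔ0 k hk) (by linarith)
  have hcu : ∀ k < N, c k * (- u k) = Δ k := fun k hk => by
    have := hule k hk.le
    rw [hc]; exact div_mul_cancel₀ _ (by linarith)
  -- telescoping
  have tel : ∀ k ≤ N, ∀ p, a k p = a 0 p + ∑ l ∈ (Finset.range N).filter (fun l => J l = p), if l < k then Δ l else 0 := by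
    intro k
    induction k with
    | zero => intro _ p; simp
    | succ k ih =>
      intro hk p
      have e0 : ∀ l, (if l < k + 1 then Δ l else 0) = (if l < k then Δ l else 0) + if l = k then Δ l else 0 := by
        intro l
        rcases lt_trichotomy l k with hl | hl | hl
        · rw [if_pos (by omega), if_pos hl, if_neg (by omega)]; ring
        · rw [if_pos (by omega), if_neg (by omega), if_pos hl]; ring
        · rw [if_neg (by omega), if_neg (by omega), if_neg (by omega)]; ring
      simp only [e0]
      rw [Finset.sum_add_distrib, ← add_assoc, ← ih (by omega) p, Finset.sum_ite_eq']
      simp only [Finset.mem_filter, Finset.mem_range]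
      by_cases hp : J k = p
      · rw [if_pos ⟨by omega, hp⟩, hΔ]; simp only; rw [hp]; ring
      · rw [if_neg (fun h' => hp h'.2), ha]; simp only
        rw [e2 k (by omega) p (fun h' => hp h'.symm)]; ring
  obtain ⟨g, hg⟩ : ∃ g, g = gch N J (a 0) c u := ⟨_, rfl⟩
  have hgt : ∀ p t, g p t = a 0 p + ∑ l ∈ (Finset.range N).filter (fun l => J l = p), c l * max (t - u l) 0 := fun p t => by
    rw [hg]; rfl
  have hmem : ∀ {p l}, l ∈ (Finset.range N).filter (fun l => J l = p) → l < N := fun hl => by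
    simpa using (Finset.mem_filter.1 hl).1
  have ub : ∀ k ≤ N, ∀ p t, t ≤ u k → g p t ≤ a k p := by
    intro k hk p t ht
    rw [hgt, tel k hk p]
    refine add_le_add le_rfl (Finset.sum_le_sum fun l hl => ?_)
    have hl := hmem hl
    have := hc0 l hl
    split_ifs with hlk
    · rw [← hcu l hl]
      have h1 := hule k hk
      have h2 := hule l hl.le
      exact mul_le_mul_of_nonneg_left (max_le (by linarith) (by linarith)) this.le
    · have := hum.monotone (not_lt.1 hlk)
      rw [max_eq_right (by linarith)]; simp
  have lb : ∀ k ≤ N, ∀ p t, u k ≤ t → δ * a k p ≤ g p t := by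
    intro k hk p t ht
    have hδ1 : δ ≤ 1 := by rw [hδ, div_le_one (by positivity)]; linarith
    rw [hgt, tel k hk p, mul_add, Finset.mul_sum]
    refine add_le_add ?_ (Finset.sum_le_sum fun l hl => ?_)
    · have := ha0 0 p; nlinarith
    have hl := hmem hl
    have h0 := hc0 l hl
    split_ifs with hlk
    · rw [← hcu l hl]
      have h1 : u (l+1) ≤ u k := hum.monotone hlk
      rw [hus] at h1
      have h2 := huge l
      have h3 := hule l hl.le
      have h4 : δ * (-u l) ≤ δ * 1 := mul_le_mul_of_nonneg_left (by linarith) hδ0.le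
      calc δ * (c l * -u l) = c l * (δ * (-u l)) := by ring
        _ ≤ c l * max (t - u l) 0 := mul_le_mul_of_nonneg_left ((by linarith : δ * (-u l) ≤ t - u l).trans (le_max_left _ _)) h0.le
    · simp only [mul_zero]
      exact mul_nonneg h0.le (le_max_right _ _)
  -- order lemmas
  have S0 : ∀ k ≤ N, ∀ p q, e k p < e k q → g p (u k) < g q (u k) := fun k hk p q hh =>
    (ub k hk p _ le_rfl).trans_lt ((hltδ k k p q hk hk hh).trans_le (lb k hk q _ le_rfl))
  have S1 : ∀ k < N, ∀ p q t, u k ≤ t → t ≤ u (k+1) → e k p < e k q → e (k+1) p < e (k+1) q → g p t < g q t := by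
    intro k hk p q t h1 h2 h3 h4
    have h5 : e (k+1) p < e k q := by
      by_cases hq : q = J k
      · have hp : p ≠ J k := fun h' => by rw [h', hq] at h3; exact lt_irrefl _ h3
        rw [e2 k hk p hp]; exact h3
      · rw [← e2 k hk q hq]; exact h4
    exact (ub (k+1) hk p _ h2).trans_lt ((hltδ (k+1) k p q hk hk.le h5).trans_le (lb k hk.le q _ h1))
  have aff : ∀ k < N, ∀ p, ∃ α β : ℝ, ∀ t, u k ≤ t → t ≤ u (k+1) → g p t = α + β * t := by
    intro k hk p
    refine ⟨a 0 p + ∑ l ∈ (Finset.range N).filter (fun l => J l = p), (if l ≤ k then - (c l * u l) else 0),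
      ∑ l ∈ (Finset.range N).filter (fun l => J l = p), (if l ≤ k then c l else 0), fun t h1 h2 => ?_⟩
    rw [hgt, add_assoc, Finset.sum_mul, ← Finset.sum_add_distrib]
    congr 1
    refine Finset.sum_congr rfl fun l hl => ?_
    split_ifs with hlk
    · have := hum.monotone hlk
      rw [max_eq_left (by linarith)]; ring
    · have := hum.monotone (show k + 1 ≤ l by omega)
      rw [max_eq_right (by linarith)]; ring
  have S2 : ∀ k, ∃ w : ℝ, k < N → u k < w ∧ w < u (k+1) ∧ ∀ t, u k ≤ t → t ≤ u (k+1) →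
      (g (J k) t < g (I k) t ↔ t < w) ∧ (g (I k) t < g (J k) t ↔ w < t) := by
    intro k
    by_cases hk : k < N
    · obtain ⟨α, β, h1⟩ := aff k hk (I k)
      obtain ⟨α', β', h2⟩ := aff k hk (J k)
      have huk : u k ≤ u (k+1) := by rw [hus]; linarith
      have h3 := S0 k hk.le (J k) (I k) (by rw [e1 k hk.le, h.dn k hk.le _ _ (h.lt k hk), h.hmk k hk])
      have h4 := S0 (k+1) hk (I k) (J k) (by rw [e1 _ hk, h.up _ hk _ _ (h.lt k hk), h.hmk k hk]; omega)
      rw [h1 _ le_rfl huk, h2 _ le_rfl huk] at h3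
      rw [h1 _ huk le_rfl, h2 _ huk le_rfl] at h4
      have hβ : 0 < β' - β := by
        have h5 : 0 < (β' - β) * (u (k+1) - u k) := by nlinarith
        exact pos_of_mul_pos_left h5 (by linarith)
      refine ⟨(α - α') / (β' - β), fun _ => ⟨?_, ?_, fun t t1 t2 => ?_⟩⟩
      · rw [lt_div_iff₀ hβ]; nlinarith
      · rw [div_lt_iff₀ hβ]; nlinarith
      · rw [h1 t t1 t2, h2 t t1 t2, lt_div_iff₀ hβ, div_lt_iff₀ hβ]
        constructor <;> constructor <;> intro h' <;> nlinarith
    · exact ⟨0, fun h' => absurd h' hk⟩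
  choose w hw using S2
  refine ⟨a 0, c, u, w, hum, hc0, fun k l hkl hl => ?_, ?_⟩
  · have h1 := (hw k (by omega)).2.1
    have h2 := (hw l hl).1
    have := hum.monotone (show k+1 ≤ l by omega)
    linarith
  rw [← hg]
  intro p q hpq t
  obtain ⟨hmN, hmI, hmJ⟩ := h.hm p q hpq
  have hwm := hw _ hmN
  rw [hmI, hmJ] at hwm
  obtain ⟨w1, w2, w3⟩ := hwm
  have ordd : ∀ k ≤ N, k ≤ m p q → e k q < e k p := fun k hk hh => by rw [e1 k hk, h.dn k hk _ _ hpq]; exact hh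
  have ordu : ∀ k ≤ N, m p q < k → e k p < e k q := fun k hk hh => by rw [e1 k hk, h.up k hk _ _ hpq]; exact hh
  have fin1 : g q t < g p t → t < w (m p q) → 
    (g q t < g p t ↔ t < w (m p q)) ∧ (g p t < g q t ↔ w (m p q) < t) := fun h1 h2 =>
    ⟨iff_of_true h1 h2, iff_of_false h1.not_gt h2.not_gt⟩
  have fin2 : g p t < g q t → w (m p q) < t → 
    (g q t < g p t ↔ t < w (m p q)) ∧ (g p t < g q t ↔ w (m p q) < t) := fun h1 h2 =>
    ⟨iff_of_false h1.not_gt h2.not_gt, iff_of_true h1 h2⟩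
  rcases le_or_gt t (u 0) with ht0 | ht0
  · have gc : ∀ p, g p t = a 0 p := fun p => by
      rw [hgt, Finset.sum_eq_zero, add_zero]
      intro l hl
      have := hum.monotone (Nat.zero_le l)
      rw [max_eq_right (by linarith), mul_zero]
    apply fin1
    · rw [gc, gc]
      have := hlt4 0 0 q p (Nat.zero_le _) (Nat.zero_le _) (ordd 0 (Nat.zero_le _) (Nat.zero_le _))
      have := ha0 0 q
      linarith
    · have := hum.monotone (Nat.zero_le (m p q)); linarith
  rcases lt_or_ge t (u N) with htN | htN
  · obtain ⟨k, hk, k1, k2⟩ := cell_ex u N t ht0.le htN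
    rcases lt_trichotomy k (m p q) with hkm | hkm | hkm
    · apply fin1
      · exact S1 k hk q p t k1 k2 (ordd k hk.le hkm.le) (ordd (k+1) hk hkm)
      · have := hum.monotone (show k+1 ≤ m p q from hkm); linarith
    · subst hkm; exact w3 t k1 k2
    · apply fin2
      · exact S1 k hk p q t k1 k2 (ordu k hk.le hkm) (ordu (k+1) hk (by omega))
      · have := hum.monotone (show m p q + 1 ≤ k from hkm); linarith
  · apply fin2
    · have gl : ∀ p, g p t = g p (u N) + (∑ l ∈ (Finset.range N).filter (fun l => J l = p), c l) * (t - u N) := by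
        intro p
        rw [hgt, hgt, add_assoc, Finset.sum_mul, ← Finset.sum_add_distrib]
        congr 1
        refine Finset.sum_congr rfl fun l hl => ?_
        have := hum.monotone (hmem hl).le
        rw [max_eq_left (by linarith), max_eq_left (by linarith)]; ring
      rw [gl, gl]
      have s1 := S0 N le_rfl p q (ordu N le_rfl hmN)
      have telN : ∀ p, a N p = a 0 p + ∑ l ∈ (Finset.range N).filter (fun l => J l = p), Δ l := fun p => by
        rw [tel N le_rfl p]; congr 1
        exact Finset.sum_congr rfl fun l hl => if_pos (hmem hl)
      have s2 : ∑ l ∈ (Finset.range N).filter (fun l => J l = p), c l ≤ 2 * (a N p - a 0 p) := by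
        rw [telN, add_sub_cancel_left, Finset.mul_sum]
        refine Finset.sum_le_sum fun l hl => ?_
        have hl := hmem hl
        have := hule l hl.le
        have := hc0 l hl
        rw [← hcu l hl]; nlinarith
      have s3 : a N q - a 0 q ≤ ∑ l ∈ (Finset.range N).filter (fun l => J l = q), c l := by
        rw [telN, add_sub_cancel_left]
        refine Finset.sum_le_sum fun l hl => ?_
        have hl := hmem hl
        have := huge l
        have := hc0 l hl
        rw [← hcu l hl]; nlinarith
      have s4 := hlt4 N N p q le_rfl le_rfl (ordu N le_rfl hmN)
      have s5 : 4 * a 0 q < a N q := by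
        have emono : ∀ k ≤ N, e 0 q ≤ e k q ∧ (m p q < k → e 0 q < e k q) := by
          intro k
          induction k with
          | zero => intro _; exact ⟨le_rfl, fun h => by omega⟩
          | succ k ih =>
            intro hk
            obtain ⟨i1, i2⟩ := ih (by omega)
            by_cases hq : q = J k
            · have := e3 k hk
              rw [← hq] at this
              exact ⟨by linarith, fun _ => by linarith⟩
            · rw [e2 k hk q hq]
              refine ⟨i1, fun hmk => i2 ?_⟩
              rcases Nat.lt_or_ge (m p q) k with h' | h'
              · exact h'
              · exfalso
                have : m p q = k := by omega
                rw [this] at hmJ; exact hq hmJ.symm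
        exact hlt4 0 N q q (Nat.zero_le _) le_rfl ((emono N le_rfl).2 hmN)
      have s6 := ha0 0 p
      have s8 := ha0 N q
      have s7 : ∑ l ∈ (Finset.range N).filter (fun l => J l = p), c l ≤ ∑ l ∈ (Finset.range N).filter (fun l => J l = q), c l := by linarith
      have := mul_le_mul_of_nonneg_right s7 (sub_nonneg.2 htN)
      linarith
    · have := hum.monotone (show m p q + 1 ≤ N from hmN); linarith

end P10

section P10b
open Set Filter Topology

lemma SW.card {n N F I J m} (h : SW n N F I J m) (j : Fin n) :
    ((Finset.range N).filter (fun k => J k = j)).card = (j : ℕ) := by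
  classical
  have : (Finset.range N).filter (fun k => J k = j) = (Finset.Iio j).image (fun i => m i j) := by
    ext k
    simp only [Finset.mem_filter, Finset.mem_range, Finset.mem_image, Finset.mem_Iio]
    constructor
    · rintro ⟨hk, rfl⟩
      exact ⟨I k, h.lt k hk, h.hmk k hk⟩
    · rintro ⟨i, hi, rfl⟩
      exact ⟨(h.hm i j hi).1, (h.hm i j hi).2.2⟩
  rw [this, Finset.card_image_of_injOn, Fin.card_Iio]
  intro i hi i' hi' hii
  have hi : i < j := by simpa using hi
  have hi' : i' < j := by simpa using hi'
  have h1 := (h.hm i j hi).2.1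
  have h2 := (h.hm i' j hi').2.1
  simp only at hii
  rw [← h1, ← h2, hii]

lemma gch_cont {n : ℕ} (N : ℕ) (J : ℕ → Fin n) (A : Fin n → ℝ) (c u : ℕ → ℝ) (p : Fin n) :
    Continuous (gch N J A c u p) := by
  unfold gch
  fun_prop

theorem sorted_real {n : ℕ} [NeZero n] {f : Fin n → ℝ → ℝ} (hf : ∀ i, Continuous (f i)) (ev : Fin n → Fin n → ℝ)
    (hd : ∀ i j, i < j → ∀ x, f j x < f i x ↔ x < ev i j)
    (hu : ∀ i j, i < j → ∀ x, f i x < f j x ↔ ev i j < x)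
    (hinj : ∀ i j k l, i < j → k < l → ev i j = ev k l → i = k ∧ j = l) :
    ∃ (h : (ℝ × ℝ) ≃ₜ (ℝ × ℝ)) (N : ℕ) (J : ℕ → Fin n) (B : Fin n → ℝ) (c u : ℕ → ℝ),
      StrictMono u ∧ (∀ k < N, 0 < c k) ∧ (∀ j, ((Finset.range N).filter (fun k => J k = j)).card = (j : ℕ)) ∧
      ∀ i, h '' gr (f i) = gr (gch N J B c u i) := by
  classical
  let P := {p : Fin n × Fin n // p.1 < p.2}
  let t : P → ℝ := fun p => ev p.1.1 p.1.2
  have ht : Function.Injective t := by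
    rintro ⟨⟨i, j⟩, h1⟩ ⟨⟨k, l⟩, h2⟩ h3
    obtain ⟨rfl, rfl⟩ := hinj i j k l h1 h2 h3
    rfl
  obtain ⟨N, hN⟩ : ∃ N, Fintype.card P = N := ⟨_, rfl⟩
  obtain ⟨E, hE⟩ := sort_fin ht hN
  let I : ℕ → Fin n := fun k => if h : k < N then (E ⟨k, h⟩).1.1 else 0
  let J : ℕ → Fin n := fun k => if h : k < N then (E ⟨k, h⟩).1.2 else 0
  let m : Fin n → Fin n → ℕ := fun p q => if h : p < q then (E.symm ⟨(p, q), h⟩ : Fin N) else 0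
  have hs : ∀ k : ℕ, ∃ s : ℝ, ∀ l : Fin N, (k ≤ l → s < t (E l)) ∧ ((l:ℕ) < k → t (E l) < s) := by
    intro k
    obtain ⟨s, h1, h2⟩ := Order.exists_between_finsets
      (lo := (Finset.univ.filter fun l : Fin N => (l:ℕ) < k).image (fun l => t (E l)))
      (hi := (Finset.univ.filter fun l : Fin N => k ≤ (l:ℕ)).image (fun l => t (E l))) (by
        intro x hx y hy
        simp only [Finset.mem_image, Finset.mem_filter, Finset.mem_univ, true_and] at hx hy
        obtain ⟨a, ha, rfl⟩ := hx
        obtain ⟨b, hb, rfl⟩ := hy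
        exact hE (show a < b from Fin.lt_def.2 (lt_of_lt_of_le ha hb)))
    refine ⟨s, fun l => ⟨fun hl => h2 _ ?_, fun hl => h1 _ ?_⟩⟩
    · simp only [Finset.mem_image, Finset.mem_filter, Finset.mem_univ, true_and]; exact ⟨l, hl, rfl⟩
    · simp only [Finset.mem_image, Finset.mem_filter, Finset.mem_univ, true_and]; exact ⟨l, hl, rfl⟩
  choose s hs using hs
  have hmv : ∀ p q (h : p < q), m p q = (E.symm ⟨(p, q), h⟩ : Fin N) := fun p q h => dif_pos h
  have htE : ∀ p q (h : p < q), t (E (E.symm ⟨(p, q), h⟩)) = ev p q := fun p q h => by rw [E.apply_symm_apply]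
  have hSW : SW n N (fun k p => f p (s k)) I J m := {
    lt := fun k hk => by
      simp only [I, J, dif_pos hk]; exact (E ⟨k, hk⟩).2
    hm := fun p q h => by
      have h1 : m p q < N := by rw [hmv p q h]; exact Fin.is_lt _
      refine ⟨h1, ?_, ?_⟩
      · have h2 : (⟨m p q, h1⟩ : Fin N) = E.symm ⟨(p, q), h⟩ := Fin.ext (hmv p q h)
        simp only [I, dif_pos h1, h2, E.apply_symm_apply]
      · have h2 : (⟨m p q, h1⟩ : Fin N) = E.symm ⟨(p, q), h⟩ := Fin.ext (hmv p q h)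
        simp only [J, dif_pos h1, h2, E.apply_symm_apply]
    hmk := fun k hk => by
      have h1 : I k < J k := by simp only [I, J, dif_pos hk]; exact (E ⟨k, hk⟩).2
      rw [hmv _ _ h1]
      have : (⟨(I k, J k), h1⟩ : P) = E ⟨k, hk⟩ := by
        apply Subtype.ext; simp only [I, J, dif_pos hk]
      rw [this, E.symm_apply_apply]
    dn := fun k hk p q h => by
      rw [hd p q h, hmv p q h, ← htE p q h]
      refine ⟨fun h1 => ?_, (hs k _).1⟩
      by_contra h2
      have := (hs k _).2 (not_le.1 h2)
      linarith
    up := fun k hk p q h => by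
      rw [hu p q h, hmv p q h, ← htE p q h]
      refine ⟨fun h1 => ?_, (hs k _).2⟩
      by_contra h2
      have := (hs k _).1 (not_lt.1 h2)
      linarith }
  obtain ⟨A, c, u, w, hum, hc, hw, hg⟩ := hSW.real
  obtain ⟨φ, hφ⟩ := line_interp t (fun p : P => w (E.symm p)) (by
    have hsm : ∀ a b : Fin N, t (E a) < t (E b) ↔ w a < w b := by
      intro a b
      have h1 : t (E a) < t (E b) ↔ a < b := hE.lt_iff_lt
      rw [h1]
      refine ⟨fun h => hw _ _ h b.2, fun h => ?_⟩
      by_contra h2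
      rcases (not_lt.1 h2).lt_or_eq with h3 | h3
      · have := hw b a h3 a.2; linarith
      · rw [h3] at h; exact lt_irrefl _ h
    intro p q
    have := hsm (E.symm p) (E.symm q)
    simpa using this)
  let Ψ : (ℝ × ℝ) ≃ₜ (ℝ × ℝ) := φ.toHomeomorph.prodCongr (Homeomorph.refl ℝ)
  have hφw : ∀ p q, p < q → φ (ev p q) = w (m p q) := fun p q h => by
    rw [hmv p q h]; exact hφ ⟨(p, q), h⟩
  obtain ⟨Φ, -, hΦ⟩ := c2_homeo (f := fun i x => f i (φ.symm x)) (g := fun i => gch N J A c u i)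
    (fun i => (hf i).comp φ.symm.continuous) (fun i => gch_cont _ _ _ _ _ _) (by
      intro i j x
      rcases lt_trichotomy i j with h | h | h
      · rw [hu i j h, (hg i j h x).2, ← hφw i j h, φ.lt_symm_apply]
      · subst h; simp
      · rw [hd j i h, (hg j i h x).1, ← hφw j i h, φ.symm_apply_lt])
  refine ⟨Ψ.trans Φ, N, J, A, c, u, hum, hc, hSW.card, fun i => ?_⟩
  rw [img_trans, ← (hΦ i).image]
  congr 1
  ext p
  constructor
  · rintro ⟨q, hq, rfl⟩
    have hq : q.2 = f i q.1 := hq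
    show q.2 = f i (φ.symm (φ q.1))
    rw [hq]; simp
  · intro hp
    have hp : p.2 = f i (φ.symm p.1) := hp
    refine ⟨(φ.symm p.1, p.2), hp, ?_⟩
    show (φ (φ.symm p.1), p.2) = p
    simp

theorem pa_convex {n : ℕ} [NeZero n] {A : Fin n → Set (ℝ × ℝ)} (hA : PA A) :
    ∃ (σ : Equiv.Perm (Fin n)) (h : (ℝ × ℝ) ≃ₜ (ℝ × ℝ)) (N : ℕ) (J : ℕ → Fin n) (B : Fin n → ℝ) (c u : ℕ → ℝ),
      StrictMono u ∧ (∀ k < N, 0 < c k) ∧ (∀ j, ((Finset.range N).filter (fun k => J k = j)).card = (j : ℕ)) ∧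
      ∀ i, h '' A (σ i) = gr (gch N J B c u i) := by
  classical
  obtain ⟨h0, f, hGA, hf, hgen⟩ := pa_generic hA
  obtain ⟨ev, s, esym, ssym, sval, hev, hs⟩ := hGA.ev
  obtain ⟨x0, hx0⟩ : ∃ x0, ∀ i j, x0 < ev i j := by
    obtain ⟨x0, hx0⟩ := (Set.finite_range fun q : Fin n × Fin n => ev q.1 q.2).bddBelow
    refine ⟨x0 - 1, fun i j => ?_⟩
    have := hx0 ⟨(i, j), rfl⟩
    simp only at this
    linarith
  obtain ⟨σ, hσ⟩ := sort_fin (ι := Fin n) (m := n) (t := fun i => - f i x0) (by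
    intro i j hij
    by_contra hne
    have := (hev i j hne x0).1 (neg_injective hij)
    have := hx0 i j
    linarith) (Fintype.card_fin n)
  have hlt : ∀ i j, i < j → f (σ j) x0 < f (σ i) x0 := fun i j h => by
    have := hσ h
    simp only [Function.comp] at this
    linarith
  have hne : ∀ i j, i < j → σ i ≠ σ j := fun i j h h' => h.ne (σ.injective h')
  have hsv : ∀ i j, i < j → s (σ i) (σ j) = -1 := by
    intro i j h
    have h1 := (hs _ _ (hne i j h) x0).2 (hlt i j h)
    rcases sval _ _ (hne i j h) with h2 | h2
    · rw [h2] at h1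
      have := hx0 (σ i) (σ j)
      linarith
    · exact h2
  obtain ⟨h1, N, J, B, c, u, r1, r2, r3, r4⟩ := sorted_real (f := fun i => f (σ i)) (fun i => hGA.cont _) (fun i j => ev (σ i) (σ j))
    (by
      intro i j h x
      rw [← hs _ _ (hne i j h) x, hsv i j h]
      constructor <;> intro <;> linarith)
    (by
      intro i j h x
      rw [← hs _ _ (hne i j h).symm x, ssym _ _ (hne i j h), hsv i j h, esym (σ j)]
      constructor <;> intro <;> linarith)
    (by
      intro i j k l hij hkl he
      have e1 := (hev _ _ (hne i j hij) _).2 rfl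
      have e2 := (hev _ _ (hne k l hkl) _).2 he
      rcases hgen _ _ _ _ _ (hne i j hij) (hne k l hkl) e1 e2 with ⟨a, b⟩ | ⟨a, b⟩
      · exact ⟨σ.injective a, σ.injective b⟩
      · have a := σ.injective a
        have b := σ.injective b
        subst a; subst b
        exact absurd hij hkl.not_gt)
  exact ⟨σ, h0.trans h1, N, J, B, c, u, r1, r2, r3, fun i => by rw [img_trans, hf, r4]⟩

end P10b

section P11
open Set Filter Topology

lemma plane_ext {p q : Plane} (h0 : p 0 = q 0) (h1 : p 1 = q 1) : p = q := by
  ext i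
  fin_cases i
  · exact h0
  · exact h1

/-- Coordinates on the plane. -/
noncomputable def eP : Plane ≃ₜ (ℝ × ℝ) where
  toFun p := (p 0, p 1)
  invFun q := !₂[q.1, q.2]
  left_inv p := plane_ext (by simp) (by simp)
  right_inv q := by simp
  continuous_toFun := by fun_prop
  continuous_invFun := by
    refine (PiLp.continuous_toLp 2 _).comp (continuous_pi fun i => ?_)
    fin_cases i
    · exact continuous_fst
    · exact continuous_snd

lemma eP_apply (p : Plane) : eP p = (p 0, p 1) := rfl
lemma eP_symm_0 (q : ℝ × ℝ) : (eP.symm q) 0 = q.1 := by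
  have := congrArg Prod.fst (eP.apply_symm_apply q); exact this
lemma eP_symm_1 (q : ℝ × ℝ) : (eP.symm q) 1 = q.2 := by
  have := congrArg Prod.snd (eP.apply_symm_apply q); exact this

/-- graph in the plane -/
def grP (G : ℝ → ℝ) : Set Plane := {p | p 1 = G (p 0)}

lemma eP_gr (G : ℝ → ℝ) : eP.symm '' gr G = grP G := by
  ext p
  constructor
  · rintro ⟨q, hq, rfl⟩
    show (eP.symm q) 1 = G ((eP.symm q) 0)
    rw [eP_symm_0, eP_symm_1]; exact hq
  · intro hp
    exact ⟨eP p, hp, eP.symm_apply_apply p⟩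

/-- one convex chain -/
noncomputable def ch (K : Finset ℕ) (B : ℝ) (c u : ℕ → ℝ) (t : ℝ) : ℝ :=
  B + ∑ k ∈ K, c k * max (t - u k) 0

lemma ch_cont (K : Finset ℕ) (B : ℝ) (c u : ℕ → ℝ) : Continuous (ch K B c u) := by
  unfold ch
  fun_prop

lemma ch_conv {K : Finset ℕ} (B : ℝ) {c : ℕ → ℝ} (u : ℕ → ℝ) (hc : ∀ k ∈ K, 0 < c k) {a b : ℝ} (ha : 0 ≤ a) (hb : 0 ≤ b)
    (hab : a + b = 1) (x y : ℝ) : ch K B c u (a * x + b * y) ≤ a * ch K B c u x + b * ch K B c u y := by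
  unfold ch
  have e : a * (B + ∑ k ∈ K, c k * max (x - u k) 0) + b * (B + ∑ k ∈ K, c k * max (y - u k) 0)
    = B + ∑ k ∈ K, c k * (a * max (x - u k) 0 + b * max (y - u k) 0) := by
    have : B = a * B + b * B := by rw [← add_mul, hab, one_mul]
    conv_rhs => rw [this]
    rw [mul_add, mul_add, Finset.mul_sum, Finset.mul_sum]
    have : ∀ k, c k * (a * max (x - u k) 0 + b * max (y - u k) 0) = a * (c k * max (x - u k) 0) + b * (c k * max (y - u k) 0) := fun k => by ring
    simp only [this]
    rw [Finset.sum_add_distrib]; ring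
  rw [e]
  refine add_le_add le_rfl (Finset.sum_le_sum fun k hk => mul_le_mul_of_nonneg_left ?_ (hc k hk).le)
  have h1 := mul_le_mul_of_nonneg_left (le_max_left (x - u k) 0) ha
  have h2 := mul_le_mul_of_nonneg_left (le_max_left (y - u k) 0) hb
  have h3 := mul_nonneg ha (le_max_right (x - u k) 0)
  have h4 := mul_nonneg hb (le_max_right (y - u k) 0)
  refine max_le ?_ (by linarith)
  have : a * x + b * y - u k = a * (x - u k) + b * (y - u k) := by
    have : u k = a * u k + b * u k := by rw [← add_mul, hab, one_mul]
    linarith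
  linarith

lemma ch_boundary {K : Finset ℕ} (B : ℝ) {c : ℕ → ℝ} (u : ℕ → ℝ) (hc : ∀ k ∈ K, 0 < c k) :
    InConvexBoundary (grP (ch K B c u)) := by
  have hG := ch_cont K B c u
  have hG0 : Continuous fun p : Plane => ch K B c u (p 0) := hG.comp (by fun_prop)
  have h1 : Continuous fun p : Plane => p 1 := by fun_prop
  have hcl : IsClosed {p : Plane | ch K B c u (p 0) ≤ p 1} := isClosed_le hG0 h1
  refine ⟨{p | ch K B c u (p 0) ≤ p 1}, hcl, ?_, ?_, ?_⟩
  · intro p hp q hq a b ha hb hab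
    have hp : ch K B c u (p 0) ≤ p 1 := hp
    have hq : ch K B c u (q 0) ≤ q 1 := hq
    show ch K B c u ((a • p + b • q) 0) ≤ (a • p + b • q) 1
    have := ch_conv B u hc ha hb hab (p 0) (q 0)
    simp only [PiLp.add_apply, PiLp.smul_apply, smul_eq_mul]
    nlinarith
  · have ho : IsOpen {p : Plane | ch K B c u (p 0) < p 1} := isOpen_lt hG0 h1
    have hs : {p : Plane | ch K B c u (p 0) < p 1} ⊆ {p : Plane | ch K B c u (p 0) ≤ p 1} := fun p hp => by
      have hp : ch K B c u (p 0) < p 1 := hp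
      show ch K B c u (p 0) ≤ p 1
      exact hp.le
    refine ⟨eP.symm (0, ch K B c u 0 + 1), interior_maximal hs ho ?_⟩
    show ch K B c u ((eP.symm (0, ch K B c u 0 + 1)) 0) < (eP.symm (0, ch K B c u 0 + 1)) 1
    rw [eP_symm_0, eP_symm_1]; simp
  · intro p hp
    have hp : p 1 = ch K B c u (p 0) := hp
    rw [hcl.frontier_eq]
    refine ⟨le_of_eq hp.symm, fun hinn => ?_⟩
    have hcont : Continuous fun s : ℝ => eP.symm (p 0, p 1 - s) := eP.symm.continuous.comp (by fun_prop)
    have h0 : eP.symm (p 0, p 1 - 0) = p := by rw [sub_zero]; exact eP.symm_apply_apply p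
    have hev : ∀ᶠ s in 𝓝 (0:ℝ), eP.symm (p 0, p 1 - s) ∈ interior {p : Plane | ch K B c u (p 0) ≤ p 1} :=
      hcont.continuousAt.eventually_mem (isOpen_interior.mem_nhds (by rw [h0]; exact hinn))
    obtain ⟨s, hs, hs0⟩ := ((hev.filter_mono nhdsWithin_le_nhds).and (self_mem_nhdsWithin (a := (0:ℝ)) (s := Ioi 0))).exists
    have hs : ch K B c u ((eP.symm (p 0, p 1 - s)) 0) ≤ (eP.symm (p 0, p 1 - s)) 1 := by
      have hs' := interior_subset hs
      exact hs'
    have hs0 : 0 < s := hs0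
    rw [eP_symm_0, eP_symm_1] at hs
    simp only at hs
    linarith

lemma ch_bend {K : Finset ℕ} (B : ℝ) {c u : ℕ → ℝ} (hc : ∀ k ∈ K, 0 < c k) :
    {p | IsBendPoint (grP (ch K B c u)) p} = (fun k => eP.symm (u k, ch K B c u (u k))) '' (K : Set ℕ) := by
  have hG := ch_cont K B c u
  have hcont : Continuous fun t : ℝ => eP.symm (t, ch K B c u t) := eP.symm.continuous.comp (by fun_prop)
  have hmem : ∀ t, eP.symm (t, ch K B c u t) ∈ grP (ch K B c u) := fun t => by
    show (eP.symm (t, ch K B c u t)) 1 = ch K B c u ((eP.symm (t, ch K B c u t)) 0)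
    rw [eP_symm_0, eP_symm_1]
  apply Subset.antisymm
  · rintro p ⟨hp, hb⟩
    have hp : p 1 = ch K B c u (p 0) := hp
    by_contra hn
    have hne : ∀ k ∈ K, u k ≠ p 0 := by
      intro k hk he
      apply hn
      refine ⟨k, hk, plane_ext ?_ ?_⟩
      · simp only [eP_symm_0]; exact he
      · simp only [eP_symm_1]; rw [hp, he]
    have hloc : ∀ k ∈ K, ∀ᶠ x in 𝓝 (p 0), c k * max (x - u k) 0 = c k * max (p 0 - u k) 0 + (if u k < p 0 then c k else 0) * (x - p 0) := by
      intro k hk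
      rcases lt_or_gt_of_ne (hne k hk) with h | h
      · filter_upwards [lt_mem_nhds h] with x hx
        rw [if_pos h, max_eq_left (by linarith), max_eq_left (by linarith)]; ring
      · filter_upwards [gt_mem_nhds h] with x hx
        rw [if_neg h.not_gt, max_eq_right (by linarith), max_eq_right (by linarith)]; ring
    have hev := (Finset.eventually_all K).2 hloc
    have hU : {q : Plane | ∀ k ∈ K, c k * max (q 0 - u k) 0 = c k * max (p 0 - u k) 0 + (if u k < p 0 then c k else 0) * (q 0 - p 0)} ∈ 𝓝 p := by
      have : ContinuousAt (fun q : Plane => q 0) p := by fun_prop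
      exact this.eventually hev
    apply hb _ hU
    refine ⟨{q | ∃ t : ℝ, q = p + t • eP.symm (1, ∑ k ∈ K, if u k < p 0 then c k else 0)}, ⟨p, eP.symm (1, ∑ k ∈ K, if u k < p 0 then c k else 0), ?_, rfl⟩, ?_⟩
    · intro h0
      have := eP_symm_0 (1, ∑ k ∈ K, if u k < p 0 then c k else 0)
      rw [h0] at this
      simp at this
    · rintro q ⟨hq, hqU⟩
      have hq : q 1 = ch K B c u (q 0) := hq
      have hqU : ∀ k ∈ K, c k * max (q 0 - u k) 0 = c k * max (p 0 - u k) 0 + (if u k < p 0 then c k else 0) * (q 0 - p 0) := hqU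
      refine ⟨q 0 - p 0, plane_ext ?_ ?_⟩
      · simp only [PiLp.add_apply, PiLp.smul_apply, smul_eq_mul, eP_symm_0]; ring
      · simp only [PiLp.add_apply, PiLp.smul_apply, smul_eq_mul, eP_symm_1]
        rw [hq, hp]
        unfold ch
        rw [Finset.sum_congr rfl hqU, Finset.sum_add_distrib, ← Finset.sum_mul]; ring
  · rintro _ ⟨k, hk, rfl⟩
    have hk : k ∈ K := hk
    refine ⟨hmem _, fun U hU => ?_⟩
    rintro ⟨ℓ, ⟨a, v, hv, rfl⟩, hsub⟩
    have hev : ∀ᶠ t in 𝓝 (u k), eP.symm (t, ch K B c u t) ∈ U := hcont.continuousAt.eventually_mem hU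
    obtain ⟨ε, hε, hball⟩ := Metric.eventually_nhds_iff.1 hev
    have mem : ∀ t, |t - u k| < ε → ∃ r : ℝ, eP.symm (t, ch K B c u t) = a + r • v := fun t ht =>
      hsub ⟨hmem t, hball (by rwa [Real.dist_eq])⟩
    obtain ⟨r1, h1⟩ := mem (u k - ε / 2) (by rw [abs_lt]; constructor <;> linarith)
    obtain ⟨r2, h2⟩ := mem (u k) (by rw [abs_lt]; constructor <;> linarith)
    obtain ⟨r3, h3⟩ := mem (u k + ε / 2) (by rw [abs_lt]; constructor <;> linarith)
    have x1 := congrArg (fun p : Plane => p 0) h1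
    have x2 := congrArg (fun p : Plane => p 0) h2
    have x3 := congrArg (fun p : Plane => p 0) h3
    have y1 := congrArg (fun p : Plane => p 1) h1
    have y2 := congrArg (fun p : Plane => p 1) h2
    have y3 := congrArg (fun p : Plane => p 1) h3
    simp only [PiLp.add_apply, PiLp.smul_apply, smul_eq_mul, eP_symm_0, eP_symm_1] at x1 x2 x3 y1 y2 y3
    have hv0 : v 0 ≠ 0 := by
      intro h0
      rw [h0] at x1 x2
      linarith
    have hr : r1 + r3 - 2 * r2 = 0 := by
      have : (r1 + r3 - 2 * r2) * v 0 = 0 := by linarith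
      rcases mul_eq_zero.1 this with h | h
      · exact h
      · exact absurd h hv0
    have hy : ch K B c u (u k - ε/2) + ch K B c u (u k + ε/2) - 2 * ch K B c u (u k) = (r1 + r3 - 2 * r2) * v 1 := by
      rw [y1, y2, y3]; ring
    rw [hr, zero_mul] at hy
    have hsum : ch K B c u (u k - ε/2) + ch K B c u (u k + ε/2) - 2 * ch K B c u (u k) =
        ∑ l ∈ K, c l * (max (u k - ε/2 - u l) 0 + max (u k + ε/2 - u l) 0 - 2 * max (u k - u l) 0) := by
      unfold ch
      have : ∀ l, c l * (max (u k - ε/2 - u l) 0 + max (u k + ε/2 - u l) 0 - 2 * max (u k - u l) 0) =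
        c l * max (u k - ε/2 - u l) 0 + c l * max (u k + ε/2 - u l) 0 - 2 * (c l * max (u k - u l) 0) := fun l => by ring
      simp only [this]
      rw [Finset.sum_sub_distrib, Finset.sum_add_distrib, ← Finset.mul_sum]; ring
    have hpos : 0 < ∑ l ∈ K, c l * (max (u k - ε/2 - u l) 0 + max (u k + ε/2 - u l) 0 - 2 * max (u k - u l) 0) := by
      refine Finset.sum_pos' (fun l hl => mul_nonneg (hc l hl).le ?_) ⟨k, hk, mul_pos (hc k hk) ?_⟩
      · have a1 := le_max_left (u k - ε/2 - u l) 0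
        have a2 := le_max_right (u k - ε/2 - u l) 0
        have a3 := le_max_left (u k + ε/2 - u l) 0
        have a4 := le_max_right (u k + ε/2 - u l) 0
        rcases max_cases (u k - u l) 0 with ⟨h, _⟩ | ⟨h, _⟩ <;> rw [h] <;> linarith
      · rw [max_eq_right (by linarith), max_eq_left (by linarith), max_eq_right (by linarith)]; linarith
    linarith

lemma ch_ncard {K : Finset ℕ} (B : ℝ) {c u : ℕ → ℝ} (hc : ∀ k ∈ K, 0 < c k) (hu : StrictMono u) :
    {p | IsBendPoint (grP (ch K B c u)) p}.ncard = K.card := by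
  rw [ch_bend B hc, Set.ncard_image_of_injective, Set.ncard_coe_finset]
  intro k l h
  have := congrArg (fun p : Plane => p 0) h
  simp only [eP_symm_0] at this
  exact hu.injective this

lemma ch_poly {K : Finset ℕ} (B : ℝ) {c u : ℕ → ℝ} (hu : StrictMono u) (N : ℕ) (hK : ∀ k ∈ K, k < N) :
    ∃ (R₁ R₂ : Set Plane) (m : ℕ) (S : Fin m → Set Plane),
        IsRay R₁ ∧ IsRay R₂ ∧ (∀ k, IsSegment (S k)) ∧
        grP (ch K B c u) = R₁ ∪ R₂ ∪ ⋃ k, S k := by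
  obtain ⟨G, hG⟩ : ∃ G, G = ch K B c u := ⟨_, rfl⟩
  rw [← hG]
  have left : ∀ t ≤ u 0, G t = G (u 0) := by
    intro t ht
    rw [hG]; unfold ch
    congr 1
    refine Finset.sum_congr rfl fun k hk => ?_
    have := hu.monotone (Nat.zero_le k)
    rw [max_eq_right (by linarith), max_eq_right (by linarith)]
  have right : ∀ t, u N ≤ t → G t = G (u N) + (∑ k ∈ K, c k) * (t - u N) := by
    intro t ht
    rw [hG]; unfold ch
    rw [add_assoc, Finset.sum_mul, ← Finset.sum_add_distrib]
    congr 1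
    refine Finset.sum_congr rfl fun k hk => ?_
    have := hu.monotone (hK k hk).le
    rw [max_eq_left (by linarith), max_eq_left (by linarith)]; ring
  have mid : ∀ l, ∃ α β : ℝ, ∀ t, u l ≤ t → t ≤ u (l+1) → G t = α + β * t := by
    intro l
    refine ⟨B + ∑ k ∈ K, (if k ≤ l then - (c k * u k) else 0), ∑ k ∈ K, (if k ≤ l then c k else 0), fun t h1 h2 => ?_⟩
    rw [hG]; unfold ch
    rw [add_assoc, Finset.sum_mul, ← Finset.sum_add_distrib]
    congr 1
    refine Finset.sum_congr rfl fun k hk => ?_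
    split_ifs with h
    · have := hu.monotone h
      rw [max_eq_left (by linarith)]; ring
    · have := hu.monotone (show l + 1 ≤ k by omega)
      rw [max_eq_right (by linarith)]; ring
  refine ⟨{p | ∃ t : ℝ, 0 ≤ t ∧ p = eP.symm (u 0, G (u 0)) + t • eP.symm (-1, 0)},
    {p | ∃ t : ℝ, 0 ≤ t ∧ p = eP.symm (u N, G (u N)) + t • eP.symm (1, ∑ k ∈ K, c k)}, N,
    fun l => segment ℝ (eP.symm (u l, G (u l))) (eP.symm (u (l+1), G (u (l+1)))),
    ⟨_, _, ?_, rfl⟩, ⟨_, _, ?_, rfl⟩, fun l => ⟨_, _, rfl⟩, ?_⟩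
  · intro h0
    have := eP_symm_0 (-1, 0)
    rw [h0] at this
    simp at this
  · intro h0
    have := eP_symm_0 (1, ∑ k ∈ K, c k)
    rw [h0] at this
    simp at this
  apply Subset.antisymm
  · intro p hp
    have hp : p 1 = G (p 0) := hp
    rcases le_or_gt (p 0) (u 0) with h0 | h0
    · refine Or.inl (Or.inl ⟨u 0 - p 0, by linarith, plane_ext ?_ ?_⟩)
      · simp only [PiLp.add_apply, PiLp.smul_apply, smul_eq_mul, eP_symm_0]; ring
      · simp only [PiLp.add_apply, PiLp.smul_apply, smul_eq_mul, eP_symm_1]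
        rw [hp, left _ h0]; ring
    rcases lt_or_ge (p 0) (u N) with h1 | h1
    · obtain ⟨k, hk, k1, k2⟩ := cell_ex u N (p 0) h0.le h1
      refine Or.inr (mem_iUnion.2 ⟨⟨k, hk⟩, ?_⟩)
      obtain ⟨α, β, hab⟩ := mid k
      have hlt : u k < u (k+1) := hu (Nat.lt_succ_self k)
      have hpos : 0 < u (k+1) - u k := by linarith
      have hs : (u (k+1) - p 0) / (u (k+1) - u k) + (p 0 - u k) / (u (k+1) - u k) = 1 := by
        field_simp; ring
      refine ⟨(u (k+1) - p 0) / (u (k+1) - u k), (p 0 - u k) / (u (k+1) - u k), div_nonneg (by linarith) hpos.le,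
        div_nonneg (by linarith) hpos.le, hs, plane_ext ?_ ?_⟩
      · simp only [PiLp.add_apply, PiLp.smul_apply, smul_eq_mul, eP_symm_0]
        field_simp; ring
      · simp only [PiLp.add_apply, PiLp.smul_apply, smul_eq_mul, eP_symm_1]
        rw [hp, hab _ k1 k2, hab _ le_rfl hlt.le, hab _ hlt.le le_rfl]
        field_simp; ring
    · refine Or.inl (Or.inr ⟨p 0 - u N, by linarith, plane_ext ?_ ?_⟩)
      · simp only [PiLp.add_apply, PiLp.smul_apply, smul_eq_mul, eP_symm_0]; ring
      · simp only [PiLp.add_apply, PiLp.smul_apply, smul_eq_mul, eP_symm_1]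
        rw [hp, right _ h1]; ring
  · rintro p ((⟨t, ht, rfl⟩ | ⟨t, ht, rfl⟩) | hp)
    · show (_ : Plane) 1 = G ((_ : Plane) 0)
      simp only [PiLp.add_apply, PiLp.smul_apply, smul_eq_mul, eP_symm_0, eP_symm_1]
      rw [left (u 0 + t * -1) (by linarith)]; ring
    · show (_ : Plane) 1 = G ((_ : Plane) 0)
      simp only [PiLp.add_apply, PiLp.smul_apply, smul_eq_mul, eP_symm_0, eP_symm_1]
      rw [right (u N + t * 1) (by linarith)]; ring
    · obtain ⟨⟨k, hk⟩, a, b, ha, hb, hab, rfl⟩ := mem_iUnion.1 hp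
      obtain ⟨α, β, hm⟩ := mid k
      have hlt : u k < u (k+1) := hu (Nat.lt_succ_self k)
      show (_ : Plane) 1 = G ((_ : Plane) 0)
      simp only [PiLp.add_apply, PiLp.smul_apply, smul_eq_mul, eP_symm_0, eP_symm_1]
      obtain rfl : a = 1 - b := by linarith
      rw [hm (u k) le_rfl hlt.le, hm (u (k+1)) hlt.le le_rfl, hm _ (by nlinarith) (by nlinarith)]
      ring

end P11

section P12
open Set Filter Topology

/-- An affine homeomorphism taking the vertical axis to a given line. -/
noncomputable def lineH (a v : ℝ × ℝ) (hv : v.1 ^ 2 + v.2 ^ 2 ≠ 0) : (ℝ × ℝ) ≃ₜ (ℝ × ℝ) where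
  toFun q := (a.1 + q.2 * v.1 - q.1 * v.2, a.2 + q.2 * v.2 + q.1 * v.1)
  invFun p := (((p.2 - a.2) * v.1 - (p.1 - a.1) * v.2) / (v.1 ^ 2 + v.2 ^ 2),
    ((p.1 - a.1) * v.1 + (p.2 - a.2) * v.2) / (v.1 ^ 2 + v.2 ^ 2))
  left_inv q := by
    refine Prod.ext ?_ ?_
    · simp only; rw [div_eq_iff hv]; ring
    · simp only; rw [div_eq_iff hv]; ring
  right_inv p := by
    refine Prod.ext ?_ ?_
    · simp only; field_simp; ring
    · simp only; field_simp; ring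
  continuous_toFun := by fun_prop
  continuous_invFun := by fun_prop

lemma pseudoline_flat {L : Set Plane} (hL : IsPseudoline L) :
    ∃ G : (ℝ × ℝ) ≃ₜ (ℝ × ℝ), eP '' L = {p | (G.symm p).1 = 0} := by
  obtain ⟨h, ℓ, ⟨a, v, hv, rfl⟩, rfl⟩ := hL
  have hv' : (eP v).1 ^ 2 + (eP v).2 ^ 2 ≠ 0 := by
    intro h0
    apply hv
    have h1 : (v 0) ^ 2 + (v 1) ^ 2 = 0 := h0
    have h2 := sq_nonneg (v 0)
    have h3 := sq_nonneg (v 1)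
    exact plane_ext (by simpa using pow_eq_zero_iff (two_ne_zero) |>.1 (by linarith : (v 0)^2 = 0))
      (by simpa using pow_eq_zero_iff (two_ne_zero) |>.1 (by linarith : (v 1)^2 = 0))
  refine ⟨(lineH (eP a) (eP v) hv').trans (eP.symm.trans (h.trans eP)), ?_⟩
  have key : ∀ t : ℝ, (lineH (eP a) (eP v) hv') (0, t) = eP (a + t • v) := by
    intro t
    show ((eP a).1 + t * (eP v).1 - 0 * (eP v).2, (eP a).2 + t * (eP v).2 + 0 * (eP v).1) = eP (a + t • v)
    simp only [eP_apply, PiLp.add_apply, PiLp.smul_apply, smul_eq_mul]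
    refine Prod.ext ?_ ?_ <;> simp
  ext p
  constructor
  · rintro ⟨_, ⟨_, ⟨t, rfl⟩, rfl⟩, rfl⟩
    show ((lineH (eP a) (eP v) hv').symm (eP (h.symm (eP.symm (eP (h (a + t • v))))))).1 = 0
    rw [eP.symm_apply_apply, h.symm_apply_apply, ← key, Homeomorph.symm_apply_apply]
  · intro hp
    have hp : ((lineH (eP a) (eP v) hv').symm (eP (h.symm (eP.symm p)))).1 = 0 := hp
    set q := (lineH (eP a) (eP v) hv').symm (eP (h.symm (eP.symm p))) with hq
    have h1 : (lineH (eP a) (eP v) hv') (0, q.2) = eP (h.symm (eP.symm p)) := by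
      rw [← hp, Prod.mk.eta, hq, Homeomorph.apply_symm_apply]
    rw [key] at h1
    have h2 := eP.injective h1
    refine ⟨h (a + q.2 • v), ⟨_, ⟨q.2, rfl⟩, rfl⟩, ?_⟩
    rw [h2]; simp

lemma comp_side {M : Set Plane} {φ : Plane → ℝ} (hφ : Continuous φ) (hM : ∀ p, p ∈ M ↔ φ p = 0) {x y : Plane}
    (hy : y ∈ connectedComponentIn Mᶜ x) (hx : x ∈ Mᶜ) : (φ x < 0 → φ y < 0) ∧ (0 < φ x → 0 < φ y) := by
  have hpre : IsPreconnected (connectedComponentIn Mᶜ x) := isPreconnected_connectedComponentIn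
  have hxm := mem_connectedComponentIn hx
  have hnz : ∀ z ∈ connectedComponentIn Mᶜ x, φ z ≠ 0 := fun z hz h0 =>
    connectedComponentIn_subset _ _ hz ((hM z).2 h0)
  constructor
  · intro h
    by_contra hn
    obtain ⟨z, hz, hz0⟩ := hpre.intermediate_value hxm hy hφ.continuousOn ⟨h.le, not_lt.1 hn⟩
    exact hnz z hz hz0
  · intro h
    by_contra hn
    obtain ⟨z, hz, hz0⟩ := hpre.intermediate_value hy hxm hφ.continuousOn ⟨not_lt.1 hn, h.le⟩
    exact hnz z hz hz0

lemma arrangement_PA {n : ℕ} {L : Fin n → Set Plane} (hA : IsArrangement L) (hS : IsSimple L) :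
    PA (fun i => eP '' L i) := by
  obtain ⟨⟨-, hp, hss, hcr⟩, hne⟩ := hA
  have hmem : ∀ i p, p ∈ L i ↔ eP p ∈ eP '' L i := fun i p => (eP.injective.mem_set_image).symm
  exact {
    flat := fun i => pseudoline_flat (hp i)
    ex := fun i j hij => by
      obtain ⟨p, h1, h2⟩ := hne i j hij
      exact ⟨eP p, ⟨p, h1, rfl⟩, ⟨p, h2, rfl⟩⟩
    uq := fun i j hij => by
      rintro _ ⟨⟨p, hp, rfl⟩, hp'⟩ _ ⟨⟨q, hq, rfl⟩, hq'⟩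
      rw [hss i j hij ⟨hp, (hmem j p).2 hp'⟩ ⟨hq, (hmem j q).2 hq'⟩]
    cross := fun i j hij G hG => by
      obtain ⟨p, h1, h2⟩ := hne i j hij
      have hc := (hcr i j hij p ⟨h1, h2⟩).2.2
      have hφ : Continuous fun q : Plane => (G.symm (eP q)).1 := by fun_prop
      have hM : ∀ q, q ∈ L i ↔ (G.symm (eP q)).1 = 0 := fun q => by
        rw [hmem i q, hG]; rfl
      have side : ∀ s : ℝ, s ≠ 0 → ∃ q ∈ L j, (s < 0 → (G.symm (eP q)).1 < 0) ∧ (0 < s → 0 < (G.symm (eP q)).1) := by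
        intro s hs
        have hv : (G.symm (eP (eP.symm (G (s, 0))))).1 = s := by simp
        have hx : eP.symm (G (s, 0)) ∈ (L i)ᶜ := fun hx => hs (by rw [← hv]; exact (hM _).1 hx)
        obtain ⟨y, hy1, hy2⟩ := hc _ hx
        have := comp_side hφ hM hy2 hx
        simp only [hv] at this
        exact ⟨y, hy1, this⟩
      obtain ⟨q, hq, hq', -⟩ := side (-1) (by norm_num)
      obtain ⟨r, hr, -, hr'⟩ := side 1 (by norm_num)
      exact ⟨⟨eP q, ⟨q, hq, rfl⟩, hq' (by norm_num)⟩, ⟨eP r, ⟨r, hr, rfl⟩, hr' (by norm_num)⟩⟩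
    tri := fun p i j k h1 h2 h3 => by
      obtain ⟨q, rfl⟩ := eP.surjective p
      exact hS q i j k ((hmem i q).2 h1) ((hmem j q).2 h2) ((hmem k q).2 h3) }

end P12

theorem convex_polyline_exact_bends {n : ℕ} (L : Fin n → Set Plane)
    (hA : IsArrangement L) (hS : IsSimple L) :
    ∃ (σ : Equiv.Perm (Fin n)) (h : Plane ≃ₜ Plane) (C : Fin n → Set Plane),
      (∀ i, h '' L (σ i) = C i) ∧
      (∀ i, ∃ (R₁ R₂ : Set Plane) (m : ℕ) (S : Fin m → Set Plane),
        IsRay R₁ ∧ IsRay R₂ ∧ (∀ k, IsSegment (S k)) ∧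
        C i = R₁ ∪ R₂ ∪ ⋃ k, S k) ∧
      (∀ i, InConvexBoundary (C i)) ∧
      (∀ i : Fin n, {p | IsBendPoint (C i) p}.ncard = (i : ℕ)) ∧
      (∑ i : Fin n, {p | IsBendPoint (C i) p}.ncard) = n * (n - 1) / 2 := by
  rcases Nat.eq_zero_or_pos n with rfl | hn
  · exact ⟨Equiv.refl _, Homeomorph.refl _, L, fun i => i.elim0, fun i => i.elim0, fun i => i.elim0,
      fun i => i.elim0, by simp⟩
  have : NeZero n := ⟨hn.ne'⟩
  obtain ⟨σ, h, N, J, B, c, u, hu, hc, hcard, hg⟩ := pa_convex (arrangement_PA hA hS)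
  let K : Fin n → Finset ℕ := fun i => (Finset.range N).filter (fun k => J k = i)
  have hcK : ∀ i, ∀ k ∈ K i, 0 < c k := fun i k hk => hc k (by simpa using (Finset.mem_filter.1 hk).1)
  have hb : ∀ i : Fin n, {p | IsBendPoint (grP (ch (K i) (B i) c u)) p}.ncard = (i : ℕ) := fun i => by
    rw [ch_ncard (B i) (hcK i) hu]; exact hcard i
  refine ⟨σ, eP.trans (h.trans eP.symm), fun i => grP (ch (K i) (B i) c u), fun i => ?_, fun i => ?_, fun i => ?_, hb, ?_⟩
  · have h1 : (eP.trans (h.trans eP.symm)) '' L (σ i) = eP.symm '' (h '' (eP '' L (σ i))) := by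
      rw [Set.image_image, Set.image_image]; rfl
    have h2 := hg i
    rw [h1]
    rw [h2]
    exact eP_gr _
  · exact ch_poly (B i) hu N fun k hk => by simpa using (Finset.mem_filter.1 hk).1
  · exact ch_boundary (B i) u (hcK i)
  · simp only [hb]
    rw [Fin.sum_univ_eq_sum_range (fun i => i) n, Finset.sum_range_id]
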